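/- Assume μ_X is a Borel probability measure on X invariant under left translation by every element of G. Then the following are equivalent: (1) there exists a sequence t_i → ∞ such that ∫ f d(g_{t_i}λ_{a,b}) → ∫ f dμ_X as i → ∞ for every continuous compactly supported f : X → ℝ; (2) for Lebesgue-almost every s ∈ I, the forward orbit {g_tφ_{a,b}(s)·x₀ : t ≥ 0} is dense in X; (3) (a,b) ∉ ℚ². -/

import Mathlib

open MeasureTheory Matrix Filter Topology ENNReal

noncomputable section

/-- `G = SL(3,ℝ)`. -/
abbrev G : Type := Matrix.SpecialLinearGroup (Fin 3) ℝ

instance : TopologicalSpace G :=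
  TopologicalSpace.induced (fun g : G => (g : Matrix (Fin 3) (Fin 3) ℝ)) inferInstance

/-- `Γ = SL(3,ℤ)`, viewed as a (discrete) subgroup of `G`. -/
def Gamma : Subgroup G := (Matrix.SpecialLinearGroup.map (n := Fin 3) (Int.castRingHom ℝ)).range

/-- `X = G/Γ` with the quotient topology. -/
abbrev X : Type := G ⧸ Gamma

instance : MeasurableSpace X := borel X

/-- `x₀ = eΓ ∈ X`. -/
def x₀ : X := ↑(1 : G)

/-- `g_t = diag(e^{2t}, e^{-t}, e^{-t})`. -/
def gSL (t : ℝ) : G :=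
  ⟨Matrix.diagonal ![Real.exp (2*t), Real.exp (-t), Real.exp (-t)], by
    rw [Matrix.det_diagonal, Fin.prod_univ_three]
    simp [← Real.exp_add]
    ring_nf⟩

/-- `φ_{a,b}(s)`, the unipotent matrix with first row `(1, s, as+b)`. -/
def phiSL (a b s : ℝ) : G :=
  ⟨!![1, s, a*s+b; 0, 1, 0; 0, 0, 1], by
    simp [Matrix.det_fin_three, Matrix.vecHead, Matrix.vecTail]⟩

/-- `λ_{a,b}` : the push-forward of the normalized Lebesgue measure on `I = [s₁,s₂]`
under `s ↦ φ_{a,b}(s)·x₀`. -/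
def lambdaAB (a b s₁ s₂ : ℝ) : Measure X :=
  Measure.map (fun s => phiSL a b s • x₀)
    ((volume (Set.Icc s₁ s₂))⁻¹ • volume.restrict (Set.Icc s₁ s₂))

/-- `g_t λ_{a,b}` : the translate of `λ_{a,b}` by `g_t`. -/
def gtLambda (a b s₁ s₂ t : ℝ) : Measure X :=
  Measure.map (fun x => gSL t • x) (lambdaAB a b s₁ s₂)

section

open ProbabilityTheory (ae_cond_mem)
open DomMulAct (mk_smul_toLp norm_smul_Lp)
open ENNReal (ofReal)
open MeasureTheory.Measure (haar)
open Real (abs_exp closedBall_eq_Icc dist_eq exp exp_add exp_le_one_iff exp_pos norm_eq_abs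
  tendsto_exp_neg_atTop_nhds_zero volume_Icc)
open Set (Icc indicator_of_mem mk_mem_prod uIcc univ)
open intervalIntegral (integral_add_adjacent_intervals integral_comp_add_right integral_of_le)

local notation "M₃" => Matrix (Fin 3) (Fin 3) ℝ
local notation "ℝ³" => Fin 3 → ℝ
local notation "𝔪" => DomMulAct.mk

variable {μ : Measure X} [IsProbabilityMeasure μ] [SMulInvariantMeasure G X μ]
  {ν : Measure X} [IsProbabilityMeasure ν]

/-! ### Topology and measure theory on `G` and `X` -/

lemma coe_G_mul (g h : G) : ((g * h : G) : M₃) = g * h := Matrix.SpecialLinearGroup.coe_mul g h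

lemma coe_G_one : ((1 : G) : M₃) = 1 := Matrix.SpecialLinearGroup.coe_one

lemma isClosedEmbedding_coe_G : IsClosedEmbedding (fun g : G => (g : M₃)) :=
  Matrix.SpecialLinearGroup.isClosedEmbedding_val (n := Fin 3) (R := ℝ)

instance : IsTopologicalGroup G := Matrix.SpecialLinearGroup.topologicalGroup

instance : LocallyCompactSpace M₃ := inferInstanceAs (LocallyCompactSpace (Fin 3 → Fin 3 → ℝ))

instance : SecondCountableTopology M₃ :=
  inferInstanceAs (SecondCountableTopology (Fin 3 → Fin 3 → ℝ))

instance : LocallyCompactSpace G := isClosedEmbedding_coe_G.locallyCompactSpace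

instance : SecondCountableTopology G := isClosedEmbedding_coe_G.isEmbedding.secondCountableTopology

instance : T2Space G := isClosedEmbedding_coe_G.isEmbedding.t2Space

instance : IsClosed (Gamma : Set G) :=
  (Topology.IsClosedEmbedding.specialLinearGroup_map (n := Fin 3) (f := Int.castRingHom ℝ)
    Int.isClosedEmbedding_coe_real).isClosed_range

instance : BorelSpace X := ⟨rfl⟩

instance : MeasurableSpace G := borel G

instance : BorelSpace G := ⟨rfl⟩

lemma tendsto_G_iff {ι : Type*} {l : Filter ι} {f : ι → G} {g : G} :
    Tendsto f l (𝓝 g) ↔ ∀ i j, Tendsto (fun n => f n i j) l (𝓝 (g i j)) := by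
  exact isClosedEmbedding_coe_G.isEmbedding.tendsto_nhds_iff.trans
    (tendsto_pi_nhds.trans (forall_congr' fun i => tendsto_pi_nhds))

lemma continuous_entry (i j : Fin 3) : Continuous (fun g : G => g i j) :=
  continuous_iff_continuousAt.2 fun _ => (tendsto_G_iff.1 tendsto_id) i j

lemma continuous_G_iff {α : Type*} [TopologicalSpace α] {f : α → G} :
    Continuous f ↔ ∀ i j, Continuous (fun a => f a i j) := by
  simp only [continuous_iff_continuousAt, ContinuousAt, tendsto_G_iff]
  exact ⟨fun h i j a => h a i j, fun h a i j => h i j a⟩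

/-- The box of matrices whose entries are `ε`-close to those of the identity. -/
def nbox (ε : ℝ) : Set G := {g | ∀ i j, |g i j - (1 : M₃) i j| < ε}

lemma nbox_mem_nhds {ε : ℝ} (hε : 0 < ε) : nbox ε ∈ 𝓝 (1 : G) := by
  have h : ∀ i j, ∀ᶠ g : G in 𝓝 1, |g i j - (1 : M₃) i j| < ε := by
    intro i j
    have := (continuous_entry i j).tendsto (1 : G)
    have h2 := Metric.tendsto_nhds.1 this ε hε
    simpa [dist_eq] using h2
  have := eventually_all.2 fun i => eventually_all.2 fun j => h i j
  exact this

lemma exists_nbox_subset {O : Set G} (hO : O ∈ 𝓝 (1 : G)) : ∃ ε > 0, nbox ε ⊆ O := by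
  by_contra! hcon
  have h1 : ∀ n : ℕ, ∃ g : G, g ∈ nbox (1 / ((n : ℝ) + 1)) ∧ g ∉ O := fun n =>
    Set.not_subset.1 (hcon _ (by positivity))
  choose g hg hgO using h1
  have : Tendsto g atTop (𝓝 1) := by
    rw [tendsto_G_iff]
    intro i j
    have := tendsto_one_div_add_atTop_nhds_zero_nat (𝕜 := ℝ)
    rw [tendsto_iff_dist_tendsto_zero]
    refine squeeze_zero (fun _ => dist_nonneg) (fun n => ?_) this
    rw [dist_eq]
    exact (hg n i j).le
  obtain ⟨n, hn⟩ := (this.eventually hO).exists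
  exact hgO n hn

lemma isCompact_bounded_G (R : ℝ) : IsCompact {g : G | ∀ i j, |g i j| ≤ R} := by
  have h : IsCompact {M : M₃ | ∀ i j, M i j ∈ Icc (-R) R} := by
    have := isCompact_univ_pi (fun _ : Fin 3 => isCompact_univ_pi (fun _ : Fin 3 =>
      isCompact_Icc (a := -R) (b := R)))
    have h2 : {M : Fin 3 → Fin 3 → ℝ | ∀ i j, M i j ∈ Icc (-R) R} =
        univ.pi fun _ => univ.pi fun _ => Icc (-R) R := by
      ext M
      simp only [Set.mem_pi, Set.mem_univ, true_imp_iff]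
      exact Iff.rfl
    rw [← h2] at this
    exact this
  have h2 := isClosedEmbedding_coe_G.isCompact_preimage h
  convert h2 using 1
  ext g
  simp [abs_le]

lemma smul_x₀ (g : G) : g • x₀ = (g : X) := by
  change ((g * 1 : G) : X) = g
  rw [mul_one]

lemma exists_smul_x₀ (x : X) : ∃ g : G, x = g • x₀ := by
  obtain ⟨g, rfl⟩ := QuotientGroup.mk_surjective x
  exact ⟨g, (smul_x₀ g).symm⟩

lemma isOpenMap_smul_pt (x : X) : IsOpenMap (fun g : G => g • x) := by
  obtain ⟨h, rfl⟩ := exists_smul_x₀ x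
  have : (fun g : G => g • h • x₀) = (fun g : G => (g : X)) ∘ (fun g => g * h) := by
    funext g
    simp [smul_x₀]
  rw [this]
  exact QuotientGroup.isOpenMap_coe.comp (isOpenMap_mul_right h)

lemma smul_pt_mem_nhds {O : Set G} (hO : O ∈ 𝓝 (1 : G)) (x : X) :
    (fun g : G => g • x) '' O ∈ 𝓝 x := by
  have := (isOpenMap_smul_pt x).image_mem_nhds hO
  simpa using this

lemma discrete_Gamma : ∃ O ∈ 𝓝 (1 : G), ∀ g ∈ O, g ∈ Gamma → g = 1 := by
  refine ⟨nbox 1, nbox_mem_nhds one_pos, ?_⟩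
  rintro g hg ⟨γ, rfl⟩
  ext i j
  have := hg i j
  have h1 : (Matrix.SpecialLinearGroup.map (Int.castRingHom ℝ) γ) i j = ((γ i j : ℤ) : ℝ) := rfl
  rw [h1] at this ⊢
  have h2 : (1 : M₃) i j = (((1 : Matrix (Fin 3) (Fin 3) ℤ) i j : ℤ) : ℝ) := by
    by_cases hij : i = j
    · subst hij
      rw [one_apply_eq, one_apply_eq, Int.cast_one]
    · rw [one_apply_ne hij, one_apply_ne hij, Int.cast_zero]
  rw [h2, ← Int.cast_sub, ← Int.cast_abs] at this
  have h3 : |γ i j - (1 : Matrix (Fin 3) (Fin 3) ℤ) i j| < 1 := by exact_mod_cast this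
  have h4 : γ i j = (1 : Matrix (Fin 3) (Fin 3) ℤ) i j := by
    have := Int.abs_lt_one_iff.1 h3
    omega
  change ((γ i j : ℤ) : ℝ) = (1 : M₃) i j
  rw [h2, h4]

lemma smul_x₀_eq_iff (g h : G) : g • x₀ = h • x₀ ↔ g⁻¹ * h ∈ Gamma := by
  rw [smul_x₀, smul_x₀]
  exact QuotientGroup.eq

/-- Uniform injectivity radius on compact sets. -/
lemma injectivity {K : Set X} (hK : IsCompact K) :
    ∃ O ∈ 𝓝 (1 : G), ∀ y ∈ K, ∀ g ∈ O, g • y = y → g = 1 := by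
  obtain ⟨O₁, hO₁, hd⟩ := discrete_Gamma
  have key : ∀ x ∈ K, ∃ N ∈ 𝓝[K] x, ∃ O ∈ 𝓝 (1 : G), ∀ y ∈ N, ∀ g ∈ O, g • y = y → g = 1 := by
    intro x _
    obtain ⟨h, rfl⟩ := exists_smul_x₀ x
    have hc : Continuous (fun p : G × G => h⁻¹ * p.1⁻¹ * p.2 * p.1 * h) := by fun_prop
    have h1 : Tendsto (fun p : G × G => h⁻¹ * p.1⁻¹ * p.2 * p.1 * h) (𝓝 (1, 1)) (𝓝 1) := by
      simpa using hc.tendsto (1, 1)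
    have h2 : (fun p : G × G => h⁻¹ * p.1⁻¹ * p.2 * p.1 * h) ⁻¹' O₁ ∈ 𝓝 ((1, 1) : G × G) := h1 hO₁
    rw [nhds_prod_eq] at h2
    obtain ⟨s, hs, t, ht, hst⟩ := mem_prod_iff.1 h2
    refine ⟨_, mem_nhdsWithin_of_mem_nhds (smul_pt_mem_nhds hs (h • x₀)), t, ht, ?_⟩
    rintro _ ⟨b, hb, rfl⟩ g hg hgy
    have h3' : (b, g) ∈ (fun p : G × G => h⁻¹ * p.1⁻¹ * p.2 * p.1 * h) ⁻¹' O₁ :=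
      hst (mk_mem_prod hb hg)
    have h3 : h⁻¹ * b⁻¹ * g * b * h ∈ O₁ := Set.mem_preimage.1 h3'
    have h4 : h⁻¹ * b⁻¹ * g * b * h ∈ Gamma := by
      have h7 : (b * h) • x₀ = (g * (b * h)) • x₀ := by
        rw [mul_smul g, mul_smul b]
        exact hgy.symm
      rw [smul_x₀_eq_iff] at h7
      have h8 : h⁻¹ * b⁻¹ * g * b * h = (b * h)⁻¹ * (g * (b * h)) := by group
      rwa [h8]
    have h5 := hd _ h3 h4
    have h6 : g = (b * h) * (h⁻¹ * b⁻¹ * g * b * h) * (b * h)⁻¹ := by group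
    rw [h6, h5]
    simp
  refine hK.induction_on (p := fun S => ∃ O ∈ 𝓝 (1 : G), ∀ y ∈ S, ∀ g ∈ O, g • y = y → g = 1)
    ⟨univ, univ_mem, by simp⟩ ?_ ?_ key
  · rintro s t hst ⟨O, hO, h⟩
    exact ⟨O, hO, fun y hy => h y (hst hy)⟩
  · rintro s t ⟨O, hO, h⟩ ⟨O', hO', h'⟩
    refine ⟨O ∩ O', inter_mem hO hO', ?_⟩
    rintro y (hy | hy) g ⟨hg, hg'⟩
    · exact h y hy g hg
    · exact h' y hy g hg'

/-- Left translation of a continuous function. -/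
def tr (h : G) (f : C(X, ℝ)) : C(X, ℝ) := f.comp ⟨fun x => h • x, continuous_const_smul h⟩

@[simp] theorem tr_apply (h : G) (f : C(X, ℝ)) (x : X) : tr h f x = f (h • x) := rfl

lemma tr_tr (h k : G) (f : C(X, ℝ)) : tr h (tr k f) = tr (k * h) f := by ext x; simp [smul_smul]

lemma tr_one (f : C(X, ℝ)) : tr 1 f = f := by ext x; simp

lemma hasCompactSupport_tr {f : C(X, ℝ)} (hf : HasCompactSupport f) (h : G) :
    HasCompactSupport (tr h f) :=
  hf.comp_homeomorph (Homeomorph.smul h)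

lemma exists_bound {f : C(X, ℝ)} (hf : HasCompactSupport f) : ∃ M, 0 < M ∧ ∀ x, |f x| ≤ M := by
  obtain ⟨M, hM⟩ := hf.exists_bound_of_continuous f.continuous
  exact ⟨max M 1, by positivity, fun x => (hM x).trans (le_max_left _ _)⟩

/-- Compactly supported functions are uniformly continuous for the action. -/
lemma unif_cont {f : C(X, ℝ)} (hf : HasCompactSupport f) {ε : ℝ} (hε : 0 < ε) :
    ∀ᶠ g : G in 𝓝 1, ∀ x, |f (g • x) - f x| < ε := by
  have key : ∀ x ∈ tsupport f, ∃ N ∈ 𝓝[tsupport f] x, ∀ᶠ g : G in 𝓝 1, ∀ y ∈ N,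
      |f (g • y) - f y| < ε := by
    intro x _
    have hc : Continuous (fun p : G × X => f (p.1 • p.2) - f p.2) := by fun_prop
    have h1 := hc.tendsto (1, x)
    simp only [one_smul, sub_self] at h1
    have h2 := h1 (Metric.ball_mem_nhds 0 hε)
    rw [mem_map, nhds_prod_eq] at h2
    obtain ⟨s, hs, t, ht, hst⟩ := mem_prod_iff.1 h2
    refine ⟨t, mem_nhdsWithin_of_mem_nhds ht, ?_⟩
    filter_upwards [hs] with g hg y hy
    have := hst (mk_mem_prod hg hy)
    simpa [dist_eq] using this
  have h1 : ∀ᶠ g : G in 𝓝 1, ∀ y ∈ tsupport f, |f (g • y) - f y| < ε := by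
    refine hf.isCompact.induction_on
      (p := fun S => ∀ᶠ g : G in 𝓝 1, ∀ y ∈ S, |f (g • y) - f y| < ε) (by simp) ?_ ?_ key
    · intro s t hst h
      filter_upwards [h] with g hg y hy using hg y (hst hy)
    · intro s t hs ht
      filter_upwards [hs, ht] with g hg hg' y hy
      exact hy.elim (hg y) (hg' y)
  have hinv : Tendsto (fun g : G => g⁻¹) (𝓝 1) (𝓝 1) := by
    simpa using (continuous_inv (G := G)).tendsto 1
  filter_upwards [h1, hinv.eventually h1] with g hg hg' x
  by_cases hx : x ∈ tsupport f
  · exact hg x hx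
  by_cases hgx : g • x ∈ tsupport f
  · have := hg' _ hgx
    simp only [inv_smul_smul] at this
    rwa [abs_sub_comm]
  · rw [image_eq_zero_of_notMem_tsupport hx, image_eq_zero_of_notMem_tsupport hgx]
    simpa using hε

lemma unif_cont_tr {f : C(X, ℝ)} (hf : HasCompactSupport f) (h : G) {ε : ℝ} (hε : 0 < ε) :
    ∀ᶠ g : G in 𝓝 h, ∀ x, |f (g • x) - f (h • x)| < ε := by
  have h1 : Tendsto (fun g : G => g * h⁻¹) (𝓝 h) (𝓝 1) := by
    have : Continuous (fun g : G => g * h⁻¹) := by fun_prop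
    simpa using this.tendsto h
  filter_upwards [h1.eventually (unif_cont hf hε)] with g hg x
  simpa [smul_smul] using hg (h • x)

/-- A countable family of test functions, uniformly dense. -/
lemma exists_dense_family : ∃ F : ℕ → C(X, ℝ), (∀ n, HasCompactSupport (F n)) ∧
    ∀ f : C(X, ℝ), HasCompactSupport f → ∀ ε > 0, ∃ n, ∀ x, |f x - F n x| < ε := by
  let E := CompactExhaustion.choice X
  let S : ℕ → Set C(X, ℝ) := fun n => {f | ∀ x, x ∉ E n → f x = 0}
  have hne : ∀ n, Nonempty (S n) := fun n => ⟨⟨0, fun x _ => rfl⟩⟩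
  have hd : ∀ n, ∃ D : ℕ → S n, DenseRange D := fun n => TopologicalSpace.exists_dense_seq (S n)
  choose D hD using hd
  refine ⟨fun k => (D (Nat.unpair k).1 (Nat.unpair k).2 : C(X, ℝ)), fun k => ?_, fun f hf ε hε => ?_⟩
  · exact HasCompactSupport.intro (E.isCompact _) (fun x hx => (D _ _).2 x hx)
  · obtain ⟨n, hn⟩ := E.exists_superset_of_isCompact hf.isCompact
    have hfS : f ∈ S n := fun x hx => image_eq_zero_of_notMem_tsupport fun h => hx (hn h)
    have hopen : {g : S n | ∀ x ∈ E n, dist (f x) ((g : C(X, ℝ)) x) < ε} ∈ 𝓝 (⟨f, hfS⟩ : S n) := by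
      have h1 := (ContinuousMap.tendsto_iff_forall_isCompact_tendstoUniformlyOn
        (F := fun g : C(X, ℝ) => g) (p := 𝓝 f) (f := f)).1 tendsto_id (E n) (E.isCompact n)
      have h2 := Metric.tendstoUniformlyOn_iff.1 h1 ε hε
      exact (continuous_subtype_val.tendsto (⟨f, hfS⟩ : S n)).eventually h2
    obtain ⟨m, hm⟩ := (hD n).exists_mem_open isOpen_interior ⟨_, mem_interior_iff_mem_nhds.2 hopen⟩
    have hm := interior_subset hm
    refine ⟨Nat.pair n m, fun x => ?_⟩
    have he : (D (Nat.unpair (Nat.pair n m)).1 (Nat.unpair (Nat.pair n m)).2 : C(X, ℝ)) =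
        D n m := by rw [Nat.unpair_pair]
    simp only [he]
    by_cases hx : x ∈ E n
    · exact hm x hx
    · rw [hfS x hx, (D n m).2 x hx]
      simpa using hε

lemma measure_ext_of_test {μ ν : Measure X} [IsFiniteMeasure μ] [IsFiniteMeasure ν]
    (h : ∀ f : C(X, ℝ), HasCompactSupport f → ∫ x, f x ∂μ = ∫ x, f x ∂ν) : μ = ν :=
  Measure.ext_of_integral_eq_on_compactlySupported fun f => h f.toContinuousMap f.hasCompactSupport

/-- Invariance of a measure on `X` under left translation by `h`. -/
def MInv (ν : Measure X) (h : G) : Prop := Measure.map (fun x => h • x) ν = ν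

lemma measurable_smulX (h : G) : Measurable (fun x : X => h • x) :=
  (continuous_const_smul h).measurable

lemma MInv.mp {ν : Measure X} {h : G} (hi : MInv ν h) :
    MeasurePreserving (fun x : X => h • x) ν ν := ⟨measurable_smulX h, hi⟩

lemma MInv.inv {ν : Measure X} {h : G} (hi : MInv ν h) : MInv ν h⁻¹ := by
  unfold MInv
  conv_lhs => rw [← hi]
  rw [Measure.map_map (measurable_smulX _) (measurable_smulX _)]
  simp [Function.comp_def]

lemma MInv.mul {ν : Measure X} {h k : G} (hi : MInv ν h) (ki : MInv ν k) : MInv ν (h * k) := by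
  unfold MInv
  have : (fun x : X => (h * k) • x) = (fun x => h • x) ∘ (fun x => k • x) := by
    funext x; simp [smul_smul]
  rw [this, ← Measure.map_map (measurable_smulX _) (measurable_smulX _), ki, hi]

lemma MInv.integral {ν : Measure X} {h : G} (hi : MInv ν h) (f : X → ℝ) :
    ∫ x, f (h • x) ∂ν = ∫ x, f x ∂ν :=
  hi.mp.integral_comp (Homeomorph.smul h).toMeasurableEquiv.measurableEmbedding f

lemma MInv.preimage {ν : Measure X} {h : G} (hi : MInv ν h) {s : Set X} (hs : MeasurableSet s) :
    ν ((fun x => h • x) ⁻¹' s) = ν s := hi.mp.measure_preimage hs.nullMeasurableSet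

lemma MInv.of_integral {ν : Measure X} [IsFiniteMeasure ν] {h : G}
    (hi : ∀ f : C(X, ℝ), HasCompactSupport f → ∫ x, f (h • x) ∂ν = ∫ x, f x ∂ν) : MInv ν h := by
  refine measure_ext_of_test fun f hf => ?_
  rw [integral_map (measurable_smulX h).aemeasurable f.continuous.aestronglyMeasurable, hi f hf]

lemma iterate_smul (h : G) (n : ℕ) (x : X) : (fun x : X => h • x)^[n] x = h ^ n • x := by
  induction n with
  | zero => simp
  | succ n ih => rw [Function.iterate_succ_apply', ih, pow_succ', mul_smul]

lemma MInv.pow {ν : Measure X} {h : G} (hi : MInv ν h) (n : ℕ) : MInv ν (h ^ n) := by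
  induction n with
  | zero => simp [MInv]
  | succ n ih => rw [pow_succ]; exact ih.mul hi

/-- Poincaré recurrence for translations. -/
lemma MInv.recurrence {ν : Measure X} [IsFiniteMeasure ν] {h : G} (hi : MInv ν h) {s : Set X}
    (hs : MeasurableSet s) : ∀ᵐ x ∂ν, x ∈ s → ∃ᶠ n in atTop, h ^ n • x ∈ s := by
  filter_upwards [hi.mp.conservative.ae_mem_imp_frequently_image_mem hs.nullMeasurableSet]
    with x hx hxs
  simpa [iterate_smul] using hx hxs

lemma exists_isCompact_approx {ν : Measure X} [IsFiniteMeasure ν] {s : Set X} (hs : MeasurableSet s)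
    {ε : ℝ≥0∞} (hε : ε ≠ 0) : ∃ K ⊆ s, IsCompact K ∧ ν s < ν K + ε :=
  hs.exists_isCompact_lt_add (measure_ne_top _ _) hε

/-! ### Some elements of `G` -/

lemma G_mul_apply (g h : G) (i j : Fin 3) :
    (g * h) i j = g i 0 * h 0 j + g i 1 * h 1 j + g i 2 * h 2 j := by
  rw [coe_G_mul, Matrix.mul_apply, Fin.sum_univ_three]

lemma G_ext {g h : G} (H : ∀ i j, g i j = h i j) : g = h := by
  ext i j
  exact H i j

lemma G_det (g : G) : g 0 0 * g 1 1 * g 2 2 - g 0 0 * g 1 2 * g 2 1 - g 0 1 * g 1 0 * g 2 2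
    + g 0 1 * g 1 2 * g 2 0 + g 0 2 * g 1 0 * g 2 1 - g 0 2 * g 1 1 * g 2 0 = 1 := by
  have := g.det_coe
  rw [det_fin_three] at this
  exact this

/-- `1 + s E₁₃`. -/
def u (s : ℝ) : G := ⟨!![1, 0, s; 0, 1, 0; 0, 0, 1], by simp [det_fin_three]⟩

/-- `1 + p E₁₂`. -/
def e12 (p : ℝ) : G := ⟨!![1, p, 0; 0, 1, 0; 0, 0, 1], by simp [det_fin_three]⟩

/-- `1 + q E₂₃`. -/
def e23 (q : ℝ) : G := ⟨!![1, 0, 0; 0, 1, q; 0, 0, 1], by simp [det_fin_three]⟩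

/-- `1 + c E₃₁`. -/
def e31 (c : ℝ) : G := ⟨!![1, 0, 0; 0, 1, 0; c, 0, 1], by simp [det_fin_three]⟩

/-- `1 + c E₂₁`. -/
def e21 (c : ℝ) : G := ⟨!![1, 0, 0; c, 1, 0; 0, 0, 1], by simp [det_fin_three]⟩

/-- A diagonal element. -/
def dgn (x y z : ℝ) (h : x * y * z = 1) : G :=
  ⟨!![x, 0, 0; 0, y, 0; 0, 0, z], by simp [det_fin_three, h]⟩

/-- The diagonal one-parameter group with weights `w`. -/
def dT (w : ℝ³) (hw : w 0 + w 1 + w 2 = 0) (t : ℝ) : G :=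
  ⟨Matrix.diagonal fun i => exp (t * w i), by
    rw [det_diagonal, Fin.prod_univ_three, ← exp_add, ← exp_add, ← mul_add,
      ← mul_add, hw, mul_zero, Real.exp_zero]⟩

section
variable {w : ℝ³} {hw : w 0 + w 1 + w 2 = 0}

lemma dT_apply (t : ℝ) (i j : Fin 3) : dT w hw t i j = if i = j then exp (t * w i) else 0 := by
  change Matrix.diagonal _ i j = _
  rw [diagonal_apply]

lemma dT_mul_apply (t : ℝ) (g : G) (i j : Fin 3) : (dT w hw t * g) i j = exp (t * w i) * g i j := by
  change ((Matrix.diagonal (fun i => exp (t * w i)) : M₃) * (g : M₃)) i j = _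
  rw [diagonal_mul]

lemma mul_dT_apply (t : ℝ) (g : G) (i j : Fin 3) : (g * dT w hw t) i j = g i j * exp (t * w j) := by
  change ((g : M₃) * (Matrix.diagonal (fun i => exp (t * w i)) : M₃)) i j = _
  rw [mul_diagonal]

lemma dT_add (s t : ℝ) : dT w hw (s + t) = dT w hw s * dT w hw t := by
  refine G_ext fun i j => ?_
  rw [dT_mul_apply, dT_apply, dT_apply]
  split_ifs with h
  · rw [← exp_add, add_mul]
  · rw [mul_zero]

lemma dT_zero : dT w hw 0 = 1 := by
  refine G_ext fun i j => ?_
  rw [dT_apply, coe_G_one, Matrix.one_apply]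
  simp

lemma dT_inv (t : ℝ) : (dT w hw t)⁻¹ = dT w hw (-t) := by
  rw [inv_eq_iff_mul_eq_one, ← dT_add, add_neg_cancel, dT_zero]

lemma dT_conj_apply (t : ℝ) (g : G) (i j : Fin 3) :
    (dT w hw t * g * (dT w hw t)⁻¹) i j = exp (t * (w i - w j)) * g i j := by
  rw [dT_inv, mul_dT_apply, dT_mul_apply, mul_sub, sub_eq_add_neg, exp_add, neg_mul]
  ring

lemma dT_pow (n : ℕ) (t : ℝ) : dT w hw t ^ n = dT w hw (n * t) := by
  induction n with
  | zero => simp [dT_zero]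
  | succ n ih => rw [pow_succ, ih, ← dT_add]; congr 1; push_cast; ring

lemma continuous_dT : Continuous (dT w hw) := by
  rw [continuous_G_iff]
  intro i j
  simp only [dT_apply]
  split_ifs <;> fun_prop

end

lemma gSL_weights : (![2, -1, -1] : ℝ³) 0 + ![2, -1, -1] 1 + ![2, -1, -1] 2 = 0 := by simp; norm_num

lemma gSL_eq (t : ℝ) : gSL t = dT ![2, -1, -1] gSL_weights t := by
  refine G_ext fun i j => ?_
  rw [dT_apply]
  change Matrix.diagonal _ i j = _
  rw [diagonal_apply]
  fin_cases i <;> fin_cases j <;> simp [mul_comm]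

/-- `diag(e^τ, 1, e^{-τ})`. -/
def dd (τ : ℝ) : G := dT ![1, 0, -1] (by simp) τ

/-- `diag(e^τ, e^τ, e^{-2τ})`. -/
def ap (τ : ℝ) : G := dT ![1, 1, -2] (by simp; norm_num) τ

lemma continuous_gSL : Continuous gSL := by
  have : gSL = dT ![2, -1, -1] gSL_weights := funext gSL_eq
  rw [this]; exact continuous_dT

lemma gSL_add (s t : ℝ) : gSL (s + t) = gSL s * gSL t := by simp only [gSL_eq, dT_add]

lemma gSL_inv (t : ℝ) : (gSL t)⁻¹ = gSL (-t) := by simp only [gSL_eq, dT_inv]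

lemma gSL_conj_apply (t : ℝ) (g : G) (i j : Fin 3) : (gSL t * g * (gSL t)⁻¹) i j =
    exp (t * ((![2, -1, -1] : ℝ³) i - ![2, -1, -1] j)) * g i j := by
  rw [gSL_eq, dT_conj_apply]

lemma dd_conj_apply (t : ℝ) (g : G) (i j : Fin 3) : (dd t * g * (dd t)⁻¹) i j =
    exp (t * ((![1, 0, -1] : ℝ³) i - ![1, 0, -1] j)) * g i j := by
  rw [dd, dT_conj_apply]

lemma ap_conj_apply (t : ℝ) (g : G) (i j : Fin 3) : (ap t * g * (ap t)⁻¹) i j =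
    exp (t * ((![1, 1, -2] : ℝ³) i - ![1, 1, -2] j)) * g i j := by
  rw [ap, dT_conj_apply]

lemma u_add (s t : ℝ) : u (s + t) = u s * u t := by
  refine G_ext fun i j => ?_
  rw [G_mul_apply]
  fin_cases i <;> fin_cases j <;> simp [u, add_comm]

lemma u_zero : u 0 = 1 := by
  refine G_ext fun i j => ?_
  fin_cases i <;> fin_cases j <;> simp [u]

lemma u_inv (s : ℝ) : (u s)⁻¹ = u (-s) := by
  rw [inv_eq_iff_mul_eq_one, ← u_add, add_neg_cancel, u_zero]

lemma u_pow (n : ℕ) (s : ℝ) : u s ^ n = u (n * s) := by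
  induction n with
  | zero => simp [u_zero]
  | succ n ih => rw [pow_succ, ih, ← u_add]; congr 1; push_cast; ring

lemma e12_add (s t : ℝ) : e12 (s + t) = e12 s * e12 t := by
  refine G_ext fun i j => ?_
  rw [G_mul_apply]
  fin_cases i <;> fin_cases j <;> simp [e12, add_comm]

lemma e12_zero : e12 0 = 1 := by
  refine G_ext fun i j => ?_
  fin_cases i <;> fin_cases j <;> simp [e12]

lemma e23_add (s t : ℝ) : e23 (s + t) = e23 s * e23 t := by
  refine G_ext fun i j => ?_
  rw [G_mul_apply]
  fin_cases i <;> fin_cases j <;> simp [e23, add_comm]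

lemma e23_zero : e23 0 = 1 := by
  refine G_ext fun i j => ?_
  fin_cases i <;> fin_cases j <;> simp [e23]

lemma e31_add (s t : ℝ) : e31 (s + t) = e31 s * e31 t := by
  refine G_ext fun i j => ?_
  rw [G_mul_apply]
  fin_cases i <;> fin_cases j <;> simp [e31]

lemma e31_zero : e31 0 = 1 := by
  refine G_ext fun i j => ?_
  fin_cases i <;> fin_cases j <;> simp [e31]

lemma continuous_u : Continuous u := by
  rw [continuous_G_iff]
  intro i j
  fin_cases i <;> fin_cases j <;> simp [u] <;> fun_prop

lemma continuous_e12 : Continuous e12 := by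
  rw [continuous_G_iff]
  intro i j
  fin_cases i <;> fin_cases j <;> simp [e12] <;> fun_prop

lemma continuous_e23 : Continuous e23 := by
  rw [continuous_G_iff]
  intro i j
  fin_cases i <;> fin_cases j <;> simp [e23] <;> fun_prop

lemma continuous_e31 : Continuous e31 := by
  rw [continuous_G_iff]
  intro i j
  fin_cases i <;> fin_cases j <;> simp [e31] <;> fun_prop

lemma gSL_u (t s : ℝ) : gSL t * u s = u (exp (3 * t) * s) * gSL t := by
  refine eq_mul_of_mul_inv_eq (G_ext fun i j => ?_)
  rw [gSL_conj_apply]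
  fin_cases i <;> fin_cases j <;> simp [u]
  ring_nf
  simp

lemma dd_u (t s : ℝ) : dd t * u s = u (exp (2 * t) * s) * dd t := by
  refine eq_mul_of_mul_inv_eq (G_ext fun i j => ?_)
  rw [dd_conj_apply]
  fin_cases i <;> fin_cases j <;> simp [u]
  ring_nf
  simp

lemma ap_u (t s : ℝ) : ap t * u s = u (exp (3 * t) * s) * ap t := by
  refine eq_mul_of_mul_inv_eq (G_ext fun i j => ?_)
  rw [ap_conj_apply]
  fin_cases i <;> fin_cases j <;> simp [u]
  ring_nf
  simp

lemma dd_e31 (t c : ℝ) : dd t * e31 c = e31 (exp (-2 * t) * c) * dd t := by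
  refine eq_mul_of_mul_inv_eq (G_ext fun i j => ?_)
  rw [dd_conj_apply]
  fin_cases i <;> fin_cases j <;> simp [e31]
  ring_nf
  simp

lemma e23_u (p s : ℝ) : e23 p * u s = u s * e23 p := by
  refine G_ext fun i j => ?_
  rw [G_mul_apply, G_mul_apply]
  fin_cases i <;> fin_cases j <;> simp [e23, u]

lemma gSL_e23 (t p : ℝ) : gSL t * e23 p = e23 p * gSL t := by
  refine eq_mul_of_mul_inv_eq (G_ext fun i j => ?_)
  rw [gSL_conj_apply]
  fin_cases i <;> fin_cases j <;> simp [e23]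

lemma gSL_e12 (t p : ℝ) : gSL t * e12 p = e12 (exp (3 * t) * p) * gSL t := by
  refine eq_mul_of_mul_inv_eq (G_ext fun i j => ?_)
  rw [gSL_conj_apply]
  fin_cases i <;> fin_cases j <;> simp [e12]
  ring_nf
  simp

lemma dT_comm {w w' : ℝ³} {hw hw'} (s t : ℝ) :
    dT w hw s * dT w' hw' t = dT w' hw' t * dT w hw s := by
  refine G_ext fun i j => ?_
  rw [dT_mul_apply, mul_dT_apply, mul_comm, dT_apply]
  split_ifs with h
  · rw [h]
  · simp

/-! ### Ergodicity of unipotent subgroups and mixing -/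

section Mautner

set_option linter.unusedSectionVars false

lemma koop_mul (g h : G) (F : Lp ℝ 2 μ) : 𝔪 (g * h) • F = 𝔪 h • 𝔪 g • F := by
  rw [smul_smul, ← DomMulAct.mk_mul]

lemma continuous_koop (F : Lp ℝ 2 μ) : Continuous (fun g : G => 𝔪 g • F) := by
  have : Fact ((2 : ℝ≥0∞) ≠ ∞) := ⟨by simp⟩
  have := Lp.instContinuousSMulDomMulAct (M := G) (E := ℝ) (μ := μ) (p := 2)
  have : Continuous (fun g : G => 𝔪 g) := DomMulAct.continuous_mk
  exact this.smul continuous_const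

lemma koop_fix_mul {F : Lp ℝ 2 μ} {g h : G} (hg : 𝔪 g • F = F)
    (hh : 𝔪 h • F = F) : 𝔪 (g * h) • F = F := by
  rw [koop_mul, hg, hh]

lemma koop_fix_inv {F : Lp ℝ 2 μ} {g : G} (hg : 𝔪 g • F = F) : 𝔪 g⁻¹ • F = F := by
  conv_lhs => rw [← hg]
  rw [← koop_mul, mul_inv_cancel, DomMulAct.mk_one, one_smul]

lemma koop_fix_diag {F : Lp ℝ 2 μ} (hF : ∀ s, 𝔪 (u s) • F = F) (α : ℝ)
    (hα : α ≠ 0) (h1 : α * 1 * α⁻¹ = 1) : 𝔪 (dgn α 1 α⁻¹ h1) • F = F := by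
  let c : ℕ → ℝ := fun n => 1 / ((n : ℝ) + 1)
  have hc0 : ∀ n, c n ≠ 0 := fun n => by positivity
  have hc : Tendsto c atTop (𝓝 0) := tendsto_one_div_add_atTop_nhds_zero_nat
  let h : ℕ → G := fun n => u ((α - 1) / c n) * e31 (c n) * u (-((α - 1) / (c n * α)))
  have hh : Tendsto h atTop (𝓝 (dgn α 1 α⁻¹ h1)) := by
    rw [tendsto_G_iff]
    have hent : ∀ n i j, h n i j = (!![α, 0, 0; 0, 1, 0; c n, 0, α⁻¹] : Matrix _ _ ℝ) i j := by
      intro n i j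
      have := hc0 n
      simp only [h, G_mul_apply]
      fin_cases i <;> fin_cases j <;> simp [u, e31] <;> field_simp <;> ring
    intro i j
    simp only [hent]
    fin_cases i <;> fin_cases j <;> simp [dgn, hc]
  have e1 : Tendsto (fun n => 𝔪 (h n) • F) atTop
      (𝓝 (𝔪 (dgn α 1 α⁻¹ h1) • F)) := ((continuous_koop F).tendsto _).comp hh
  have e2 : Tendsto (fun n => 𝔪 (h n) • F) atTop (𝓝 F) := by
    rw [tendsto_iff_dist_tendsto_zero]
    have h3 : Tendsto (fun n => 𝔪 (e31 (c n)) • F) atTop (𝓝 F) := by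
      have := ((continuous_koop F).tendsto _).comp ((continuous_e31.tendsto 0).comp hc)
      simpa [e31_zero, Function.comp_def] using this
    rw [tendsto_iff_dist_tendsto_zero] at h3
    refine h3.congr fun n => ?_
    simp only [h]
    rw [koop_mul, koop_mul, hF]
    conv_rhs => rw [← hF (-((α - 1) / (c n * α)))]
    rw [DomMulAct.dist_smul_Lp, hF]
  exact tendsto_nhds_unique e1 e2

lemma koop_fix_contract {F : Lp ℝ 2 μ} {d : ℕ → G} (hd : ∀ n, 𝔪 (d n) • F = F)
    {e : G} (he : Tendsto (fun n => d n * e * (d n)⁻¹) atTop (𝓝 1)) :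
    𝔪 e • F = F := by
  have e1 := ((continuous_koop F).tendsto _).comp he
  rw [tendsto_iff_dist_tendsto_zero] at e1
  have e2 : ∀ n, dist (((fun g : G => 𝔪 g • F) ∘ fun n => d n * e * (d n)⁻¹) n)
      (𝔪 (1 : G) • F) = dist (𝔪 e • F) F := by
    intro n
    simp only [Function.comp]
    rw [DomMulAct.mk_one, one_smul, koop_mul, koop_mul, hd]
    conv_lhs => rw [← koop_fix_inv (hd n)]
    rw [DomMulAct.dist_smul_Lp, koop_fix_inv (hd n)]
  simp only [e2] at e1
  exact dist_eq_zero.1 (tendsto_nhds_unique tendsto_const_nhds e1)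

lemma koop_fix_all {F : Lp ℝ 2 μ} (hF : ∀ s, 𝔪 (u s) • F = F) (g : G) : 𝔪 g • F = F := by
  have hdd : ∀ τ, 𝔪 (dd τ) • F = F := by
    intro τ
    have h1 : exp τ * 1 * (exp τ)⁻¹ = 1 := by rw [mul_one, mul_inv_cancel₀ (Real.exp_ne_zero _)]
    have : dd τ = dgn (exp τ) 1 (exp τ)⁻¹ h1 := by
      refine G_ext fun i j => ?_
      rw [dd, dT_apply]
      fin_cases i <;> fin_cases j <;> simp [dgn, Real.exp_neg]
    rw [this]
    exact koop_fix_diag hF _ (Real.exp_ne_zero _) _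
  have hexp : ∀ c : ℝ, 0 < c → Tendsto (fun n : ℕ => exp (-(n : ℝ) * c)) atTop (𝓝 0) := by
    intro c hc
    refine Real.tendsto_exp_atBot.comp ?_
    simp only [neg_mul]
    exact tendsto_neg_atTop_atBot.comp (tendsto_natCast_atTop_atTop.atTop_mul_const hc)
  have htr : ∀ (i j : Fin 3) (hij : i ≠ j) (b : ℝ),
      𝔪 (Matrix.SpecialLinearGroup.transvection hij b : G) • F = F := by
    intro i j hij b
    let wt : ℝ³ := ![1, 0, -1]
    have hwt : wt i - wt j ≠ 0 := by fin_cases i <;> fin_cases j <;> simp [wt] at hij ⊢ <;> norm_num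
    let σ : ℝ := if 0 < wt i - wt j then -1 else 1
    have hσ : σ * (wt i - wt j) < 0 := by
      simp only [σ]; split_ifs with h
      · linarith
      · have := lt_of_le_of_ne (not_lt.1 h) hwt
        linarith
    refine koop_fix_contract (d := fun n : ℕ => dd (n * σ)) (fun n => hdd _) ?_
    rw [tendsto_G_iff]
    intro k l
    simp only [dd_conj_apply]
    change Tendsto (fun n : ℕ => exp (n * σ * (wt k - wt l)) *
      (transvection i j b : Matrix _ _ ℝ) k l) _ (𝓝 ((1 : M₃) k l))
    simp only [transvection, Matrix.add_apply, single_apply]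
    by_cases hkl : i = k ∧ j = l
    · obtain ⟨rfl, rfl⟩ := hkl
      have h2 := (hexp (-(σ * (wt i - wt j))) (by linarith)).mul_const b
      simp only [one_apply_ne hij, zero_add, and_self, if_true, zero_mul] at h2 ⊢
      refine h2.congr fun n => ?_
      congr 2; ring
    · simp only [if_neg hkl, add_zero]
      by_cases h3 : k = l
      · subst h3; simp
      · simp [one_apply_ne h3]
  have hdiag : ∀ (D : ℝ³) (h : det (diagonal D) = 1), 𝔪 (show G from ⟨diagonal D, h⟩) • F = F := by
    intro D h
    have h' := h
    rw [det_diagonal, Fin.prod_univ_three] at h'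
    have h0 : D 0 ≠ 0 := by rintro h0; simp [h0] at h'
    have h1 : D 1 ≠ 0 := by rintro h0; simp [h0] at h'
    have h2 : D 2 ≠ 0 := by rintro h0; simp [h0] at h'
    have h01 : (0 : Fin 3) ≠ 1 := by decide
    have hT1 : ∀ b, 𝔪 (e12 b) • F = F := by
      intro b
      have : e12 b = (Matrix.SpecialLinearGroup.transvection h01 b : G) := by
        refine G_ext fun i j => ?_
        change _ = (transvection 0 1 b : M₃) i j
        fin_cases i <;> fin_cases j <;> simp [e12, transvection]
      rw [this]; exact htr _ _ _ _
    have hT2 : ∀ b, 𝔪 (e21 b) • F = F := by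
      intro b
      have : e21 b = (Matrix.SpecialLinearGroup.transvection h01.symm b : G) := by
        refine G_ext fun i j => ?_
        change _ = (transvection 1 0 b : M₃) i j
        fin_cases i <;> fin_cases j <;> simp [e21, transvection]
      rw [this]; exact htr _ _ _ _
    have hd0 : (D 2)⁻¹ * 1 * (D 2)⁻¹⁻¹ = 1 := by field_simp
    have key : (show G from ⟨diagonal D, h⟩) = dgn (D 2)⁻¹ 1 (D 2)⁻¹⁻¹ hd0 *
        (e12 (D 1)⁻¹ * e21 (-(D 1)) * e12 (D 1)⁻¹ * (e12 (-1) * e21 1 * e12 (-1))) := by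
      refine G_ext fun i j => ?_
      change diagonal D i j = _
      have hD0 : D 0 = (D 2)⁻¹ * (D 1)⁻¹ := by field_simp; linarith
      simp only [G_mul_apply]
      fin_cases i <;> fin_cases j <;> simp [e12, e21, dgn, hD0] <;> field_simp <;> norm_num
    rw [key]
    exact koop_fix_mul (koop_fix_diag hF _ (inv_ne_zero h2) _) (koop_fix_mul (koop_fix_mul
      (koop_fix_mul (hT1 _) (hT2 _)) (hT1 _)) (koop_fix_mul
      (koop_fix_mul (hT1 _) (hT2 _)) (hT1 _)))
  obtain ⟨g', hg', h⟩ := diagonal_transvection_induction (fun M : M₃ => ∃ g' : G, (g' : M₃) = M ∧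
      𝔪 g' • F = F)
    (g : M₃) (fun D hD => ⟨⟨diagonal D, hD.trans g.det_coe⟩, rfl, hdiag D _⟩)
    (fun t => ⟨Matrix.SpecialLinearGroup.transvection t.hij t.c, rfl, htr t.i t.j t.hij t.c⟩) (by
      rintro A B ⟨a, rfl, ha⟩ ⟨b, rfl, hb⟩
      exact ⟨a * b, coe_G_mul a b, koop_fix_mul ha hb⟩)
  rwa [Subtype.ext hg'] at h

lemma koop_fix_all_of_e31 {F : Lp ℝ 2 μ} (hF : ∀ s, 𝔪 (e31 s) • F = F) (g : G) : 𝔪 g • F = F := by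
  let w : G := ⟨!![0, 0, 1; 0, 1, 0; -1, 0, 0], by simp [det_fin_three]⟩
  have hw : ∀ s, w * u s = e31 (-s) * w := by
    intro s
    refine G_ext fun i j => ?_
    rw [G_mul_apply, G_mul_apply]
    fin_cases i <;> fin_cases j <;> simp [w, u, e31]
  have h1 : ∀ g : G, 𝔪 g • 𝔪 w • F = 𝔪 w • F :=
    koop_fix_all fun s => by rw [← koop_mul, hw, koop_mul, hF]
  have h2 : F = 𝔪 w • F := by
    have := h1 w⁻¹
    rw [← koop_mul, mul_inv_cancel, DomMulAct.mk_one, one_smul] at this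
    exact this
  rw [h2]; exact h1 g

lemma ae_const_of_ae_inv {f : X → ℝ} (hf : Measurable f)
    (hinv : ∀ g : G, (fun x => f (g • x)) =ᵐ[μ] f) : ∃ c, f =ᵐ[μ] fun _ => c := by
  let m : Measure G := haar
  have hm1 : MeasurableSet {p : X × G | f (p.2 • p.1) = f p.1} := measurableSet_eq_fun (hf.comp (by
      have : Continuous (fun p : X × G => p.2 • p.1) := by fun_prop
      exact this.measurable)) (hf.comp measurable_fst)
  have h1 : ∀ᵐ x ∂μ, ∀ᵐ g ∂m, f (g • x) = f x := by
    rw [Measure.ae_ae_comm hm1]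
    exact ae_of_all _ hinv
  obtain ⟨x₁, hx₁⟩ := h1.exists
  refine ⟨f x₁, ?_⟩
  have h2 : ∀ x, ∀ᵐ g ∂m, f (g • x) = f x₁ := by
    intro x
    obtain ⟨h, rfl⟩ := MulAction.exists_smul_eq G x₁ x
    have := (quasiMeasurePreserving_mul_right m h).ae hx₁
    filter_upwards [this] with g hg
    rw [smul_smul]; exact hg
  have hm2 : MeasurableSet {p : X × G | f (p.2 • p.1) = f x₁} := measurableSet_eq_fun (hf.comp (by
      have : Continuous (fun p : X × G => p.2 • p.1) := by fun_prop
      exact this.measurable)) measurable_const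
  have h3 : ∀ᵐ g ∂m, ∀ᵐ x ∂μ, f (g • x) = f x₁ := by
    rw [← Measure.ae_ae_comm hm2]
    exact ae_of_all _ h2
  obtain ⟨g, hg⟩ := h3.exists
  filter_upwards [hinv g, hg] with x hx hx'
  rw [← hx, hx']

lemma koop_const {F : Lp ℝ 2 μ} (hF : ∀ g : G, 𝔪 g • F = F) : ∃ c, F =ᵐ[μ] fun _ => c := by
  refine ae_const_of_ae_inv (Lp.stronglyMeasurable F).measurable fun g => ?_
  have := DomMulAct.smul_Lp_ae_eq (𝔪 g) F
  rw [hF g] at this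
  simpa using this.symm

/-- A bounded measurable function invariant under `u` is constant. -/
lemma ae_const_of_u_inv {f : X → ℝ} (hf : Measurable f) {M : ℝ} (hM : ∀ x, |f x| ≤ M)
    (hinv : ∀ s, (fun x => f (u s • x)) =ᵐ[μ] f) : ∃ c, f =ᵐ[μ] fun _ => c := by
  have hL : MemLp f 2 μ := MemLp.of_bound hf.aestronglyMeasurable M (ae_of_all _ hM)
  have h1 : ∀ s, 𝔪 (u s) • hL.toLp f = hL.toLp f := by
    intro s
    rw [mk_smul_toLp]
    exact (MemLp.toLp_eq_toLp_iff _ _).2 (hinv s)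
  obtain ⟨c, hc⟩ := koop_const (koop_fix_all h1)
  exact ⟨c, hL.coeFn_toLp.symm.trans hc⟩

lemma inner_koop (g : G) (F H : Lp ℝ 2 μ) : inner ℝ (𝔪 g • F) (𝔪 g • H) = inner ℝ F H := by
  have h1 := norm_smul_Lp (𝔪 g) (F + H)
  have h2 := norm_smul_Lp (𝔪 g) F
  have h3 := norm_smul_Lp (𝔪 g) H
  rw [DomMulAct.smul_Lp_add] at h1
  have e1 := real_inner_eq_norm_add_mul_self_sub_norm_mul_self_sub_norm_mul_self_div_two
    (𝔪 g • F) (𝔪 g • H)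
  have e2 := real_inner_eq_norm_add_mul_self_sub_norm_mul_self_sub_norm_mul_self_div_two F H
  rw [e1, e2, h1, h2, h3]

/-- Mixing along a sequence contracting the lower root group `e31`. -/
lemma mixing {a : ℕ → G} (ha : ∀ c, Tendsto (fun k => a k * e31 c * (a k)⁻¹) atTop (𝓝 1))
    (F H : Lp ℝ 2 μ) : Tendsto (fun k => inner ℝ (𝔪 (a k) • F) H) atTop
      (𝓝 ((∫ x, F x ∂μ) * ∫ x, H x ∂μ)) := by
  rw [tendsto_iff_ultrafilter]
  intro 𝒰 h𝒰
  let φ : ℕ → WeakDual ℝ (Lp ℝ 2 μ) := fun k =>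
    StrongDual.toWeakDual (InnerProductSpace.toDual ℝ _ (𝔪 (a k) • F))
  have hball : ∀ k, φ k ∈ WeakDual.toStrongDual ⁻¹'
      Metric.closedBall (0 : StrongDual ℝ (Lp ℝ 2 μ)) ‖F‖ := by
    intro k
    simp [φ, norm_smul_Lp]
  obtain ⟨ψ, -, hψ⟩ := (WeakDual.isCompact_closedBall (𝕜 := ℝ) (0 : StrongDual ℝ (Lp ℝ 2 μ))
    ‖F‖).ultrafilter_le_nhds (𝒰.map φ) (by
      simp only [le_principal_iff]
      exact mem_map.2 (univ_mem' hball))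
  have hlim : ∀ H' : Lp ℝ 2 μ, Tendsto (fun k => inner ℝ (𝔪 (a k) • F) H') 𝒰 (𝓝 (ψ H')) := by
    intro H'
    have h1 : Tendsto φ 𝒰 (𝓝 ψ) := hψ
    exact ((WeakDual.eval_continuous H').tendsto ψ).comp h1
  obtain ⟨Ψ, hΨ⟩ : ∃ Ψ : Lp ℝ 2 μ, ∀ H', ψ H' = inner ℝ Ψ H' := by
    refine ⟨(InnerProductSpace.toDual ℝ _).symm (WeakDual.toStrongDual ψ), fun H' => ?_⟩
    rw [InnerProductSpace.toDual_symm_apply]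
    rfl
  have hfix : ∀ c, 𝔪 (e31 c) • Ψ = Ψ := by
    intro c
    refine ext_inner_right ℝ fun H' => ?_
    have h1 : inner ℝ (𝔪 (e31 c) • Ψ) H' = inner ℝ Ψ (𝔪 (e31 c)⁻¹ • H') := by
      rw [← inner_koop (e31 c) Ψ, ← koop_mul, inv_mul_cancel, DomMulAct.mk_one, one_smul]
    rw [h1, ← hΨ, ← hΨ]
    refine tendsto_nhds_unique (hlim _) ?_
    have h2 : ∀ k, inner ℝ (𝔪 (a k) • F) (𝔪 (e31 c)⁻¹ • H') =
        inner ℝ (𝔪 (a k) • F) H' + inner ℝ (𝔪 (a k) • (𝔪 (a k * e31 c * (a k)⁻¹) • F - F)) H' := by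
      intro k
      rw [DomMulAct.smul_Lp_sub, inner_sub_left, add_sub_cancel, ← koop_mul,
        inv_mul_cancel_right, koop_mul, ← inner_koop (e31 c)⁻¹ (𝔪 (e31 c) • _) H',
        ← koop_mul (e31 c), mul_inv_cancel, DomMulAct.mk_one, one_smul]
    simp only [h2]
    have h3 : Tendsto (fun k => inner ℝ (𝔪 (a k) •
          (𝔪 (a k * e31 c * (a k)⁻¹) • F - F)) H') atTop (𝓝 0) := by
      have h4 := ((continuous_koop F).tendsto _).comp (ha c)
      simp only [DomMulAct.mk_one, one_smul] at h4
      have h5 := (tendsto_iff_norm_sub_tendsto_zero.1 h4).mul_const ‖H'‖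
      rw [zero_mul] at h5
      refine squeeze_zero_norm (fun k => ?_) h5
      refine (norm_inner_le_norm _ _).trans ?_
      rw [norm_smul_Lp]
      rfl
    simpa using (hlim H').add (h3.mono_left h𝒰)
  obtain ⟨c, hc⟩ := koop_const (koop_fix_all_of_e31 hfix)
  have hψc : ∀ H' : Lp ℝ 2 μ, ψ H' = c * ∫ x, H' x ∂μ := by
    intro H'
    rw [hΨ, L2.inner_def, ← integral_const_mul]
    refine integral_congr_ae ?_
    filter_upwards [hc] with x hx
    rw [hx]
    simp [mul_comm]
  have hone : ∀ k, inner ℝ (𝔪 (a k) • F) (Lp.const 2 μ (1 : ℝ)) = ∫ x, F x ∂μ := by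
    intro k
    rw [← DomMulAct.smul_Lp_const (p := 2) (μ := μ) (𝔪 (a k)) (1 : ℝ), inner_koop, L2.inner_def]
    refine integral_congr_ae ?_
    filter_upwards [Lp.coeFn_const (p := 2) (μ := μ) (1 : ℝ)] with x hx
    rw [hx]
    simp
  have hc2 : c = ∫ x, F x ∂μ := by
    have h1 := hlim (Lp.const 2 μ (1 : ℝ))
    simp only [hone, hψc] at h1
    have h2 := tendsto_nhds_unique tendsto_const_nhds h1
    rw [h2, integral_congr_ae (Lp.coeFn_const (p := 2) (μ := μ) (1 : ℝ))]
    simp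
  have := hlim H
  rwa [hψc, hc2] at this

end Mautner

/-! ### Measures invariant under an expanded horospherical group -/

/-- An approximate identity on `G` that varies continuously in `L¹` under left translation. -/
lemma exists_haar_window {O : Set G} (hO : O ∈ 𝓝 (1 : G)) : ∃ θ : G → ℝ, Measurable θ ∧
    (∀ g, 0 ≤ θ g) ∧ Integrable θ haar ∧ ∫ g, θ g ∂haar = 1 ∧
    (∀ g, θ g ≠ 0 → g⁻¹ ∈ O) ∧ ∀ ε > 0, ∃ O' ∈ 𝓝 (1 : G), ∀ h ∈ O',
      ∫ g, |θ (h * g) - θ g| ∂haar < ε := by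
  let m : Measure G := haar
  have hO' : O⁻¹ ∈ 𝓝 (1 : G) := inv_mem_nhds_one G hO
  obtain ⟨V, hV, hVO, hVc⟩ := local_compact_nhds hO'
  have hVm : MeasurableSet V := hVc.isClosed.measurableSet
  have hpos : 0 < m V := Measure.measure_pos_of_mem_nhds m hV
  have hfin : m V < ∞ := hVc.measure_lt_top
  let c : ℝ := (m.real V)⁻¹
  have hr : 0 < m.real V := toReal_pos hpos.ne' hfin.ne
  let θ : G → ℝ := V.indicator fun _ => c
  have hθm1 : Integrable θ m := (integrable_indicator_iff hVm).2 (integrableOn_const hfin.ne)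
  refine ⟨θ, measurable_const.indicator hVm, fun g => Set.indicator_nonneg (fun _ _ => by positivity) g,
    hθm1, ?_, ?_, ?_⟩
  · rw [integral_indicator hVm, setIntegral_const, smul_eq_mul]
    exact mul_inv_cancel₀ hr.ne'
  · intro g hg
    exact hVO (Set.mem_of_indicator_ne_zero hg)
  · intro ε hε
    have hL : MemLp θ 1 m := memLp_one_iff_integrable.2 hθm1
    have : Fact ((1 : ℝ≥0∞) ≠ ∞) := ⟨by simp⟩
    have inst := Lp.instContinuousSMulDomMulAct (M := G) (X := G) (E := ℝ) (μ := m) (p := 1)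
    have hc : Continuous (fun g : G => 𝔪 g • hL.toLp θ) := by
      have : Continuous (fun g : G => 𝔪 g) := DomMulAct.continuous_mk
      exact this.smul continuous_const
    have h1 := (hc.tendsto 1).eventually (Metric.ball_mem_nhds _ hε)
    refine ⟨_, h1, fun h hh => ?_⟩
    have hh : dist (𝔪 h • hL.toLp θ) (𝔪 (1 : G) • hL.toLp θ) < ε := hh
    rw [DomMulAct.mk_one, one_smul, dist_eq_norm, L1.norm_eq_integral_norm] at hh
    refine lt_of_eq_of_lt (integral_congr_ae ?_) hh
    filter_upwards [Lp.coeFn_sub (𝔪 h • hL.toLp θ) (hL.toLp θ), hL.coeFn_toLp,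
      DomMulAct.smul_Lp_ae_eq (𝔪 h) (hL.toLp θ),
      (measurePreserving_mul_left m h).quasiMeasurePreserving.ae hL.coeFn_toLp] with g h1 h2 h3 h4
    rw [h1, Pi.sub_apply, h2, h3, norm_eq_abs]
    have : hL.toLp θ (h * g) = θ (h * g) := h4
    rw [← this]
    rfl

section Banana

lemma isOpen_pos_measure {B : Set X} (hB : IsOpen B) (hne : B.Nonempty) : 0 < μ B :=
  (measure_pos_iff_nonempty_of_smulInvariant G (NeZero.ne μ) hB).2 hne

lemma mixing_set {a : ℕ → G} (ha : ∀ c, Tendsto (fun k => a k * e31 c * (a k)⁻¹) atTop (𝓝 1))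
    {f : C(X, ℝ)} (hf : HasCompactSupport f) (g : G) {B : Set X} (hB : MeasurableSet B) :
    Tendsto (fun k => ∫ x in B, f (a k • g • x) ∂μ) atTop (𝓝 ((∫ x, f x ∂μ) * μ.real B)) := by
  obtain ⟨M, -, hM⟩ := exists_bound hf
  have hL : MemLp f 2 μ := MemLp.of_bound f.continuous.aestronglyMeasurable M (ae_of_all _ hM)
  have hH : MemLp (B.indicator fun _ => (1 : ℝ)) 2 μ := memLp_indicator_const 2 hB 1 (by simp)
  have h1 := mixing ha (hL.toLp f) (𝔪 g⁻¹ • hH.toLp _)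
  have e1 : ∫ x, (hL.toLp f) x ∂μ = ∫ x, f x ∂μ := integral_congr_ae hL.coeFn_toLp
  have hg : MInv μ g⁻¹ := (measurePreserving_smul g⁻¹ μ).map_eq
  have e2 : ∫ x, (𝔪 g⁻¹ • hH.toLp _ : Lp ℝ 2 μ) x ∂μ = μ.real B := by
    rw [mk_smul_toLp, integral_congr_ae (MemLp.coeFn_toLp _)]
    change ∫ x, B.indicator (fun _ => (1 : ℝ)) (g⁻¹ • x) ∂μ = _
    rw [hg.integral, integral_indicator hB]
    simp
  rw [e1, e2] at h1
  refine h1.congr fun k => ?_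
  have e3 : inner ℝ (𝔪 (a k) • hL.toLp f) (𝔪 g⁻¹ • hH.toLp _) =
      inner ℝ (𝔪 (a k * g) • hL.toLp f) (hH.toLp _) := by
    rw [← inner_koop g⁻¹ (𝔪 (a k * g) • hL.toLp f), ← koop_mul, mul_inv_cancel_right]
  rw [e3, L2.inner_def, ← integral_indicator hB]
  refine integral_congr_ae ?_
  rw [mk_smul_toLp]
  filter_upwards [MemLp.coeFn_toLp (hL.comp_measurePreserving (measurePreserving_smul (a k * g) μ)),
    hH.coeFn_toLp] with x h1 h2
  refine (congrArg₂ (inner ℝ) h1 h2).trans ?_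
  by_cases hx : x ∈ B <;> simp [hx, mul_smul]

/-- The average of `f ∘ a` over small displacements. -/
def smear (θ : G → ℝ) (f : C(X, ℝ)) (a : G) (x : X) : ℝ := ∫ g, f (a • g⁻¹ • x) * θ g ∂haar

lemma integrable_smear {θ : G → ℝ} (hθ : Integrable θ haar) {f : C(X, ℝ)}
    (hf : HasCompactSupport f) (a : G) (x : X) :
    Integrable (fun g => f (a • g⁻¹ • x) * θ g) haar := by
  obtain ⟨M, -, hM⟩ := exists_bound hf
  refine hθ.bdd_mul (c := M) ?_ (ae_of_all _ fun g => hM _)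
  have : Continuous (fun g : G => f (a • g⁻¹ • x)) := by fun_prop
  exact this.aestronglyMeasurable

lemma integrable_smear_prod {θ : G → ℝ} (hθ : Integrable θ haar) {f : C(X, ℝ)}
    (hf : HasCompactSupport f) (a b : G) (ν : Measure X) [IsFiniteMeasure ν] :
    Integrable (fun p : X × G => f (a • p.2⁻¹ • b • p.1) * θ p.2) (ν.prod haar) := by
  obtain ⟨M, -, hM⟩ := exists_bound hf
  refine (hθ.comp_snd ν).bdd_mul (c := M) ?_ (ae_of_all _ fun g => hM _)
  have : Continuous (fun p : X × G => f (a • p.2⁻¹ • b • p.1)) := by fun_prop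
  exact this.aestronglyMeasurable

lemma abs_smear_le {θ : G → ℝ} (h0 : ∀ g, 0 ≤ θ g) (hθ : Integrable θ haar)
    (h1 : ∫ g, θ g ∂haar = 1) {f : C(X, ℝ)} {M : ℝ} (hM : ∀ x, |f x| ≤ M) (a : G) (x : X) :
    |smear θ f a x| ≤ M := by
  rw [← norm_eq_abs]
  refine (norm_integral_le_of_norm_le (hθ.const_mul M) (ae_of_all _ fun g => ?_)).trans_eq ?_
  · rw [norm_mul, norm_eq_abs, norm_eq_abs, abs_of_nonneg (h0 g)]
    exact mul_le_mul_of_nonneg_right (hM _) (h0 g)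
  · rw [integral_const_mul, h1, mul_one]

lemma smear_equicont {θ : G → ℝ} (hθ : Integrable θ haar) {f : C(X, ℝ)}
    (hf : HasCompactSupport f) {M : ℝ} (hM : ∀ x, |f x| ≤ M) (a h : G) (x : X) :
    |smear θ f a (h • x) - smear θ f a x| ≤ M * ∫ g, |θ (h * g) - θ g| ∂haar := by
  have hθ' : Integrable (fun g => θ (h * g)) haar := hθ.comp_mul_left h
  have e1 : smear θ f a (h • x) = ∫ g, f (a • g⁻¹ • x) * θ (h * g) ∂haar := by
    rw [← integral_mul_left_eq_self (fun g => f (a • g⁻¹ • x) * θ (h * g)) h⁻¹]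
    refine integral_congr_ae (ae_of_all _ fun g => ?_)
    simp [smul_smul]
  rw [e1, smear, ← integral_sub (integrable_smear hθ' hf a x) (integrable_smear hθ hf a x),
    ← integral_const_mul, ← norm_eq_abs]
  refine norm_integral_le_of_norm_le ((hθ'.sub hθ).abs.const_mul M) (ae_of_all _ fun g => ?_)
  rw [← mul_sub, norm_mul]
  exact mul_le_mul_of_nonneg_right (hM _) (abs_nonneg _)

lemma smear_tendsto_set {a : ℕ → G} (ha : ∀ c, Tendsto (fun k => a k * e31 c * (a k)⁻¹) atTop (𝓝 1))
    {θ : G → ℝ} (hθ : Integrable θ haar) (h1 : ∫ g, θ g ∂haar = 1)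
    {f : C(X, ℝ)} (hf : HasCompactSupport f) {B : Set X} (hB : MeasurableSet B) :
    Tendsto (fun k => ∫ x in B, smear θ f (a k) x ∂μ) atTop (𝓝 ((∫ x, f x ∂μ) * μ.real B)) := by
  obtain ⟨M, hM0, hM⟩ := exists_bound hf
  have e1 : ∀ k, ∫ x in B, smear θ f (a k) x ∂μ =
      ∫ g, (∫ x in B, f (a k • g⁻¹ • x) ∂μ) * θ g ∂haar := by
    intro k
    unfold smear
    rw [integral_integral_swap]
    · simp_rw [integral_mul_const]
    · simpa [Function.uncurry_def] using integrable_smear_prod hθ hf (a k) 1 (μ.restrict B)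
  simp_rw [e1]
  have e2 : (∫ x, f x ∂μ) * μ.real B = ∫ g, ((∫ x, f x ∂μ) * μ.real B) * θ g ∂haar := by
    rw [integral_const_mul, h1, mul_one]
  rw [e2]
  refine tendsto_integral_of_dominated_convergence (fun g => M * |θ g|) ?_ (hθ.abs.const_mul M) ?_ ?_
  · intro k
    have := (integrable_smear_prod hθ hf (a k) 1 (μ.restrict B)).swap.integral_prod_left
    simp only [one_smul, Function.comp_apply, Prod.swap, integral_mul_const] at this
    exact this.aestronglyMeasurable
  · intro k
    refine ae_of_all _ fun g => ?_
    rw [norm_mul, norm_eq_abs (θ g)]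
    refine mul_le_mul_of_nonneg_right ?_ (abs_nonneg _)
    refine (norm_setIntegral_le_of_norm_le_const (measure_lt_top μ B) fun x _ => hM _).trans ?_
    exact mul_le_of_le_one_right hM0.le measureReal_le_one
  · exact ae_of_all _ fun g => (mixing_set ha hf g⁻¹ hB).mul_const _

lemma smear_tendsto_unif {a : ℕ → G}
    (ha : ∀ c, Tendsto (fun k => a k * e31 c * (a k)⁻¹) atTop (𝓝 1))
    {θ : G → ℝ} (hθ : Integrable θ haar) (h1 : ∫ g, θ g ∂haar = 1)
    (hc : ∀ ε > 0, ∃ O' ∈ 𝓝 (1 : G), ∀ h ∈ O', ∫ g, |θ (h * g) - θ g| ∂haar < ε)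
    {f : C(X, ℝ)} (hf : HasCompactSupport f) {C : Set X} (hC : IsCompact C) {ε : ℝ} (hε : 0 < ε) :
    ∀ᶠ k in atTop, ∀ x ∈ C, |smear θ f (a k) x - ∫ x, f x ∂μ| ≤ 3 * ε := by
  obtain ⟨M, hM0, hM⟩ := exists_bound hf
  obtain ⟨O, hO, hOe⟩ := hc (ε / M) (by positivity)
  have hcont : ∀ k x, ∀ h ∈ O, |smear θ f (a k) (h • x) - smear θ f (a k) x| ≤ ε := by
    intro k x h hh
    refine (smear_equicont hθ hf hM (a k) h x).trans ?_
    have := mul_le_mul_of_nonneg_left (hOe h hh).le hM0.le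
    rwa [mul_div_cancel₀ _ hM0.ne'] at this
  have hsm : ∀ k, Integrable (smear θ f (a k)) μ := by
    intro k
    have := (integrable_smear_prod hθ hf (a k) 1 μ).integral_prod_left
    simpa [← smear.eq_def] using this
  obtain ⟨O', hO'O, hO'o, hO'1⟩ := mem_nhds_iff.1 hO
  refine hC.induction_on (p := fun S => ∀ᶠ k in atTop, ∀ x ∈ S,
    |smear θ f (a k) x - ∫ x, f x ∂μ| ≤ 3 * ε) (by simp) ?_ ?_ ?_
  · intro s t hst h
    filter_upwards [h] with k hk x hx using hk x (hst hx)
  · intro s t hs ht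
    filter_upwards [hs, ht] with k hk hk' x hx
    exact hx.elim (hk x) (hk' x)
  · intro x _
    let B : Set X := (fun g : G => g • x) '' O'
    have hBo : IsOpen B := isOpenMap_smul_pt x O' hO'o
    have hBx : x ∈ B := ⟨1, hO'1, one_smul _ _⟩
    have hBpos : 0 < μ.real B :=
      toReal_pos (isOpen_pos_measure hBo ⟨x, hBx⟩).ne' (measure_ne_top _ _)
    refine ⟨B, mem_nhdsWithin_of_mem_nhds (hBo.mem_nhds hBx), ?_⟩
    have h2 := smear_tendsto_set (μ := μ) ha hθ h1 hf hBo.measurableSet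
    have h3 := (Metric.tendsto_nhds.1 h2) (ε * μ.real B) (by positivity)
    filter_upwards [h3] with k hk
    have h4 : |∫ y in B, (smear θ f (a k) y - smear θ f (a k) x) ∂μ| ≤ ε * μ.real B := by
      rw [← norm_eq_abs]
      refine norm_setIntegral_le_of_norm_le_const (measure_lt_top μ B) ?_
      rintro _ ⟨g, hg, rfl⟩
      exact hcont k x g (hO'O hg)
    rw [integral_sub (hsm k).integrableOn (integrable_const _), setIntegral_const, smul_eq_mul] at h4
    rw [dist_eq] at hk
    have h5 : |smear θ f (a k) x - ∫ x, f x ∂μ| ≤ 2 * ε := by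
      have h6 : |(smear θ f (a k) x - ∫ x, f x ∂μ) * μ.real B| ≤ 2 * ε * μ.real B := by
        rw [abs_le] at h4 ⊢
        rw [abs_lt] at hk
        constructor <;> nlinarith
      rw [abs_mul, abs_of_pos hBpos] at h6
      exact le_of_mul_le_mul_right h6 hBpos
    rintro _ ⟨g, hg, rfl⟩
    have h7 := hcont k x g (hO'O hg)
    calc _ = |(smear θ f (a k) (g • x) - smear θ f (a k) x) +
          (smear θ f (a k) x - ∫ x, f x ∂μ)| := by ring_nf
      _ ≤ _ := abs_add_le _ _
      _ ≤ 3 * ε := by linarith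

/-- A probability measure that is invariant under the directions expanded by `a`, and whose
translates by `(a k)⁻¹` are tight, is the invariant measure. -/
lemma eq_of_inv_expanding {a : ℕ → G}
    (ha : ∀ c, Tendsto (fun k => a k * e31 c * (a k)⁻¹) atTop (𝓝 1))
    (hdec : ∀ O ∈ 𝓝 (1 : G), ∃ O₁ ∈ 𝓝 (1 : G), ∀ g ∈ O₁, ∃ p n : G, g = p * n ∧
      ∀ k, MInv ν (a k * n * (a k)⁻¹) ∧ a k * p * (a k)⁻¹ ∈ O)
    (htight : ∀ η > 0, ∃ C : Set X, IsCompact C ∧ ∀ k, ν.real {x | (a k)⁻¹ • x ∉ C} ≤ η) :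
    ν = μ := by
  refine measure_ext_of_test fun f hf => ?_
  obtain ⟨M, hM0, hM⟩ := exists_bound hf
  refine eq_of_abs_sub_le_all fun ε₀ hε₀ => ?_
  let ε := ε₀ / (4 + 2 * M)
  have hε : 0 < ε := by positivity
  obtain ⟨O₁, hO₁, hO₁d⟩ := hdec _ (unif_cont hf hε)
  obtain ⟨θ, hθm, hθ0, hθi, hθ1, hθs, hθc⟩ := exists_haar_window hO₁
  obtain ⟨C, hC, hCk⟩ := htight ε hε
  obtain ⟨k, hk⟩ := (smear_tendsto_unif (μ := μ) ha hθi hθ1 hθc hf hC hε).exists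
  have hsi : Integrable (fun x => smear θ f (a k) ((a k)⁻¹ • x)) ν := by
    exact (integrable_smear_prod hθi hf (a k) (a k)⁻¹ ν).integral_prod_left
  have h1 : |∫ x, smear θ f (a k) ((a k)⁻¹ • x) ∂ν - ∫ x, f x ∂ν| ≤ ε := by
    have e1 : ∫ x, smear θ f (a k) ((a k)⁻¹ • x) ∂ν =
        ∫ g, (∫ x, f (a k • g⁻¹ • (a k)⁻¹ • x) ∂ν) * θ g ∂haar := by
      unfold smear
      rw [integral_integral_swap (integrable_smear_prod hθi hf (a k) (a k)⁻¹ ν)]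
      simp_rw [integral_mul_const]
    have e2 : ∫ x, f x ∂ν = ∫ g, (∫ x, f x ∂ν) * θ g ∂haar := by
      rw [integral_const_mul, hθ1, mul_one]
    have hi := (integrable_smear_prod hθi hf (a k) (a k)⁻¹ ν).swap.integral_prod_left
    simp only [Function.comp_apply, Prod.swap, integral_mul_const] at hi
    rw [e1, e2, ← integral_sub hi (hθi.const_mul _)]
    have e3 : ε = ∫ g, ε * θ g ∂haar := by rw [integral_const_mul, hθ1, mul_one]
    rw [e3, ← norm_eq_abs]
    refine norm_integral_le_of_norm_le (hθi.const_mul ε) (ae_of_all _ fun g => ?_)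
    rw [← sub_mul, norm_mul, norm_eq_abs (θ g), abs_of_nonneg (hθ0 g)]
    rcases eq_or_ne (θ g) 0 with h0 | h0
    · simp [h0]
    refine mul_le_mul_of_nonneg_right ?_ (hθ0 g)
    obtain ⟨p, n, hpn, hk2⟩ := hO₁d _ (hθs g h0)
    obtain ⟨hn, hp⟩ := hk2 k
    have e4 : ∫ x, f x ∂ν = ∫ x, f ((a k * n * (a k)⁻¹) • x) ∂ν := (hn.integral _).symm
    have hfi : ∀ h : G, Integrable (fun x => f (h • x)) ν := fun h =>
      Integrable.of_bound ((f.continuous.comp (continuous_const_smul h)).aestronglyMeasurable) M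
        (ae_of_all _ fun x => hM _)
    have hfi' : Integrable (fun x => f (a k • g⁻¹ • (a k)⁻¹ • x)) ν := by
      simpa only [smul_smul, mul_assoc] using hfi (a k * (g⁻¹ * (a k)⁻¹))
    rw [e4, ← integral_sub hfi' (hfi _)]
    refine (norm_integral_le_of_norm_le_const (C := ε) (ae_of_all _ fun x => ?_)).trans_eq (by simp)
    have := hp ((a k * n * (a k)⁻¹) • x)
    rw [smul_smul] at this
    have e5 : a k * p * (a k)⁻¹ * (a k * n * (a k)⁻¹) = a k * g⁻¹ * (a k)⁻¹ := by rw [hpn]; group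
    rw [e5] at this
    simp only [smul_smul, ← mul_assoc]
    exact this.le
  have hmC : MeasurableSet {x : X | (a k)⁻¹ • x ∉ C} :=
    (measurable_smulX _ hC.isClosed.measurableSet).compl
  have h2 : |∫ x, (smear θ f (a k) ((a k)⁻¹ • x) - ∫ x, f x ∂μ) ∂ν| ≤ 3 * ε + 2 * M * ε := by
    have hI : |∫ x, f x ∂μ| ≤ M := by
      rw [← norm_eq_abs]
      refine (norm_integral_le_of_norm_le_const (C := M) (ae_of_all _ hM)).trans_eq (by simp)
    have : 3 * ε + 2 * M * ν.real {x | (a k)⁻¹ • x ∉ C} =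
        ∫ x, (3 * ε + Set.indicator {x : X | (a k)⁻¹ • x ∉ C} (fun _ => 2 * M) x) ∂ν := by
      rw [integral_add (integrable_const _) ((integrable_const _).indicator hmC),
        integral_indicator hmC, setIntegral_const]
      simp [mul_comm]
    refine le_trans ?_ (add_le_add_right (mul_le_mul_of_nonneg_left (hCk k) (by positivity)) _)
    rw [this, ← norm_eq_abs]
    refine norm_integral_le_of_norm_le ((integrable_const _).add
      ((integrable_const _).indicator hmC)) (ae_of_all _ fun x => ?_)
    by_cases hx : (a k)⁻¹ • x ∈ C
    · have h3 := hk _ hx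
      have : x ∉ {x : X | (a k)⁻¹ • x ∉ C} := fun h => h hx
      simpa [this] using h3
    · have : x ∈ {x : X | (a k)⁻¹ • x ∉ C} := hx
      rw [indicator_of_mem this]
      have h4 := abs_smear_le hθ0 hθi hθ1 hM (a k) ((a k)⁻¹ • x)
      refine (abs_sub _ _).trans ?_
      linarith
  rw [integral_sub hsi (integrable_const _), integral_const] at h2
  simp only [probReal_univ, one_smul] at h2
  have : ε₀ = ε * (4 + 2 * M) := by simp only [ε]; field_simp
  rw [this]
  calc _ = |(∫ x, smear θ f (a k) ((a k)⁻¹ • x) ∂ν - ∫ x, f x ∂μ) -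
        (∫ x, smear θ f (a k) ((a k)⁻¹ • x) ∂ν - ∫ x, f x ∂ν)| := by ring_nf
    _ ≤ _ := abs_sub _ _
    _ ≤ _ := by linarith

end Banana

lemma dT_conj_mem_nbox_of {w : ℝ³} {hw : w 0 + w 1 + w 2 = 0} {p : G} {ε t : ℝ}
    (hp : p ∈ nbox ε) (h : ∀ i j, p i j = 0 ∨ t * (w i - w j) ≤ 0) :
    dT w hw t * p * (dT w hw t)⁻¹ ∈ nbox ε := by
  intro i j
  have hpi := hp i j
  rw [dT_conj_apply]
  by_cases hij : i = j
  · subst hij; simpa using hpi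
  · rw [one_apply_ne hij, sub_zero] at hpi ⊢
    rcases h i j with h0 | h0
    · rw [h0] at hpi ⊢; simpa using hpi
    · rw [abs_mul, abs_of_pos (exp_pos _)]
      refine lt_of_le_of_lt (mul_le_of_le_one_left (abs_nonneg _) ?_) hpi
      rwa [exp_le_one_iff]

lemma dT_conj_mem_nbox {w : ℝ³} {hw : w 0 + w 1 + w 2 = 0} {p : G} {ε t : ℝ}
    (hp : p ∈ nbox ε) (ht : 0 ≤ t) (h : ∀ i j, p i j = 0 ∨ w i ≤ w j) :
    dT w hw t * p * (dT w hw t)⁻¹ ∈ nbox ε :=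
  dT_conj_mem_nbox_of hp fun i j => (h i j).imp_right fun h =>
    mul_nonpos_of_nonneg_of_nonpos ht (by linarith)

lemma dT_conj_e31_tendsto {w : ℝ³} {hw : w 0 + w 1 + w 2 = 0} (h : w 2 < w 0) (c : ℝ) :
    Tendsto (fun k : ℕ => dT w hw k * e31 c * (dT w hw k)⁻¹) atTop (𝓝 1) := by
  rw [tendsto_G_iff]
  intro i j
  simp only [dT_conj_apply]
  by_cases hij : i = 2 ∧ j = 0
  · obtain ⟨rfl, rfl⟩ := hij
    have h1 : Tendsto (fun k : ℕ => (k : ℝ) * (w 2 - w 0)) atTop atBot :=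
      tendsto_natCast_atTop_atTop.atTop_mul_const_of_neg (by linarith)
    simpa [e31] using (Real.tendsto_exp_atBot.comp h1).mul_const c
  · have h1 : (e31 c : G) i j = (1 : G) i j := by
      fin_cases i <;> fin_cases j <;> simp [e31] at hij ⊢
    rw [h1]
    by_cases h2 : i = j
    · subst h2; simp
    · have : (1 : G) i j = 0 := one_apply_ne h2
      simp [this]

section


lemma eq_of_inv_e12 (hA : ∀ t, MInv ν (gSL t)) (hu : ∀ s, MInv ν (u s))
    (h12 : ∀ p, MInv ν (e12 p)) : ν = μ := by
  refine eq_of_inv_expanding (a := fun k => gSL k) (fun c => ?_) (fun O hO => ?_) (fun η hη => ?_)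
  · simp only [gSL_eq]
    exact dT_conj_e31_tendsto (by simp; norm_num) c
  · obtain ⟨ε, hε, hO⟩ := exists_nbox_subset hO
    let n : G → G := fun g => e12 (g 0 1 / g 0 0) * u (g 0 2 / g 0 0)
    have hn : ∀ g : G, g 0 0 ≠ 0 → ∀ j, n g 0 j = g 0 j / g 0 0 := by
      intro g hg j
      simp only [n, G_mul_apply]
      fin_cases j <;> simp [e12, u, hg]
    have hc : ContinuousAt (fun g : G => g * (n g)⁻¹) 1 := by
      have h0 : ∀ j, ContinuousAt (fun g : G => g 0 j / g 0 0) 1 := fun j =>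
        (continuous_entry 0 j).continuousAt.div (continuous_entry 0 0).continuousAt (by simp)
      exact continuousAt_id.mul ((continuous_e12.continuousAt.comp (h0 1)).mul
        (continuous_u.continuousAt.comp (h0 2))).inv
    have h1 : (1 : G) * (n 1)⁻¹ = 1 := by simp [n, e12_zero, u_zero]
    have hc' : ∀ᶠ g : G in 𝓝 1, g * (n g)⁻¹ ∈ nbox ε := by
      refine hc.eventually ?_
      beta_reduce; rw [h1]; exact nbox_mem_nhds hε
    have h00 : ∀ᶠ g : G in 𝓝 1, g 0 0 ≠ 0 :=
      (continuous_entry 0 0).continuousAt.eventually_ne (by simp)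
    refine ⟨_, hc'.and h00, fun g hg => ⟨g * (n g)⁻¹, n g, by group, fun k => ⟨?_, hO ?_⟩⟩⟩
    · exact ((hA _).mul ((h12 _).mul (hu _))).mul (hA _).inv
    · rw [gSL_eq]
      refine dT_conj_mem_nbox hg.1 (by positivity) fun i j => ?_
      by_cases hi : i = 0
      · subst hi
        by_cases hj : j = 0
        · right; rw [hj]
        · left
          have h2 : (g * (n g)⁻¹) 0 j * 1 = 0 := by
            have h3 : ∀ j, (g * (n g)⁻¹) 0 j = g 0 0 * (n g * (n g)⁻¹) 0 j := by
              intro j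
              rw [G_mul_apply, G_mul_apply, hn g hg.2, hn g hg.2, hn g hg.2]
              have := hg.2
              field_simp
            rw [h3, mul_inv_cancel]
            have : (1 : G) 0 j = 0 := one_apply_ne (Ne.symm hj)
            rw [this]; ring
          simpa using h2
      · right
        fin_cases i <;> fin_cases j <;> simp at hi ⊢ <;> norm_num
  · obtain ⟨C, -, hC, hlt⟩ := exists_isCompact_approx (ν := ν) MeasurableSet.univ
      (ofReal_pos.2 hη).ne'
    refine ⟨C, hC, fun k => ?_⟩
    have h1 : ν.real {x | (gSL k)⁻¹ • x ∉ C} = ν.real Cᶜ := by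
      rw [measureReal_def, measureReal_def,
        ← (hA (k : ℝ)).inv.preimage hC.isClosed.measurableSet.compl]
      rfl
    rw [h1, probReal_compl_eq_one_sub hC.isClosed.measurableSet]
    have h2 : (1 : ℝ) ≤ ν.real C + η := by
      rw [measure_univ] at hlt
      have := toReal_mono (by finiteness) hlt.le
      rwa [toReal_one, toReal_add (by finiteness) (by finiteness), toReal_ofReal hη.le] at this
    linarith

lemma eq_of_inv_e23 (hu : ∀ s, MInv ν (u s)) (h23 : ∀ p, MInv ν (e23 p))
    (htight : ∀ η > 0, ∃ C : Set X, IsCompact C ∧ ∀ k : ℕ, ν.real {x | (ap k)⁻¹ • x ∉ C} ≤ η) :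
    ν = μ := by
  refine eq_of_inv_expanding (a := fun k => ap k) (fun c => ?_) (fun O hO => ?_) htight
  · exact dT_conj_e31_tendsto (by simp; norm_num) c
  · obtain ⟨ε, hε, hO⟩ := exists_nbox_subset hO
    let D : G → ℝ := fun g => g 0 0 * g 1 1 - g 0 1 * g 1 0
    let s : G → ℝ := fun g => (g 0 2 * g 1 1 - g 0 1 * g 1 2) / D g
    let q : G → ℝ := fun g => (g 0 0 * g 1 2 - g 1 0 * g 0 2) / D g
    let n : G → G := fun g => u (s g) * e23 (q g)
    have hninv : ∀ g, (n g)⁻¹ = u (-s g) * e23 (-q g) := by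
      intro g
      rw [inv_eq_iff_mul_eq_one]
      simp only [n]
      rw [mul_assoc, ← mul_assoc (e23 _), e23_u, mul_assoc, ← mul_assoc, ← u_add, ← e23_add]
      simp [u_zero, e23_zero]
    have hent : ∀ i j, Continuous (fun g : G => g i j) := continuous_entry
    have hD : Continuous D := by
      have h00 := hent 0 0; have h01 := hent 0 1; have h10 := hent 1 0; have h11 := hent 1 1
      fun_prop
    have hD1 : D 1 ≠ 0 := by simp [D]
    have hs : ContinuousAt s 1 := by
      refine ContinuousAt.div ?_ hD.continuousAt hD1
      exact (((hent 0 2).mul (hent 1 1)).sub ((hent 0 1).mul (hent 1 2))).continuousAt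
    have hq : ContinuousAt q 1 := by
      refine ContinuousAt.div ?_ hD.continuousAt hD1
      exact (((hent 0 0).mul (hent 1 2)).sub ((hent 1 0).mul (hent 0 2))).continuousAt
    have hc : ContinuousAt (fun g : G => g * (n g)⁻¹) 1 :=
      continuousAt_id.mul ((continuous_u.continuousAt.comp hs).mul
        (continuous_e23.continuousAt.comp hq)).inv
    have h1 : (1 : G) * (n 1)⁻¹ = 1 := by simp [n, s, q, e23_zero, u_zero]
    have hc' : ∀ᶠ g : G in 𝓝 1, g * (n g)⁻¹ ∈ nbox ε := by
      refine hc.eventually ?_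
      beta_reduce; rw [h1]; exact nbox_mem_nhds hε
    have h00 : ∀ᶠ g : G in 𝓝 1, D g ≠ 0 := hD.continuousAt.eventually_ne hD1
    refine ⟨_, hc'.and h00, fun g hg => ⟨g * (n g)⁻¹, n g, by group, fun k => ⟨?_, hO ?_⟩⟩⟩
    · have h2 : ap k * n g * (ap k)⁻¹ = u (exp (3 * k) * s g) * e23 (exp (3 * k) * q g) := by
        refine G_ext fun i j => ?_
        rw [ap_conj_apply]
        simp only [n, G_mul_apply]
        fin_cases i <;> fin_cases j <;> simp [u, e23] <;> ring_nf <;> simp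
      rw [h2]
      exact (hu _).mul (h23 _)
    · refine dT_conj_mem_nbox hg.1 (by positivity) fun i j => ?_
      by_cases hij : i ≠ 2 ∧ j = 2
      · left
        obtain ⟨hi, rfl⟩ := hij
        have hg2 : D g ≠ 0 := hg.2
        rw [hninv, G_mul_apply]
        simp only [G_mul_apply]
        fin_cases i
        · simp [u, e23, s, q]; field_simp; simp only [D]; ring
        · simp [u, e23, s, q]; field_simp; simp only [D]; ring
        · simp at hi
      · right
        fin_cases i <;> fin_cases j <;> simp at hij ⊢ <;> norm_num
end

/-! ### The pointwise ergodic theorem for bounded functions -/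

section Birkhoff

set_option linter.unusedSectionVars false

variable {Ω : Type*} [MeasurableSpace Ω] {μ : Measure Ω} [IsFiniteMeasure μ] {T : Ω → Ω}

/-- The running maximum of Birkhoff sums. -/
def maxSum (T : Ω → Ω) (f : Ω → ℝ) : ℕ → Ω → ℝ
  | 0, _ => 0
  | n + 1, x => max 0 (f x + maxSum T f n (T x))

lemma maxSum_nonneg (f : Ω → ℝ) (n : ℕ) (x : Ω) : 0 ≤ maxSum T f n x := by
  cases n with
  | zero => exact le_rfl
  | succ n => exact le_max_left _ _

lemma maxSum_mono (f : Ω → ℝ) (n : ℕ) (x : Ω) : maxSum T f n x ≤ maxSum T f (n + 1) x := by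
  induction n generalizing x with
  | zero => exact maxSum_nonneg f 1 x
  | succ n ih =>
    change max 0 _ ≤ max 0 _
    gcongr
    exact ih _

lemma birkhoffSum_le_maxSum (f : Ω → ℝ) (n : ℕ) (x : Ω) : birkhoffSum T f n x ≤ maxSum T f n x := by
  induction n generalizing x with
  | zero => simp [maxSum]
  | succ n ih =>
    rw [birkhoffSum_succ']
    exact (add_le_add_right (ih _) _).trans (le_max_right _ _)

lemma measurable_maxSum (hT : Measurable T) {f : Ω → ℝ} (hf : Measurable f) (n : ℕ) :
    Measurable (maxSum T f n) := by
  induction n with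
  | zero => exact measurable_const
  | succ n ih => exact measurable_const.max (hf.add (ih.comp hT))

lemma maxSum_le {f : Ω → ℝ} {M : ℝ} (hM : ∀ x, |f x| ≤ M) (n : ℕ) (x : Ω) :
    maxSum T f n x ≤ n * M := by
  induction n generalizing x with
  | zero => simp [maxSum]
  | succ n ih =>
    have h0 : 0 ≤ M := (abs_nonneg _).trans (hM x)
    refine max_le (by positivity) ?_
    have := ih (T x)
    have := (abs_le.1 (hM x)).2
    push_cast
    linarith

lemma integrable_maxSum (hT : Measurable T) {f : Ω → ℝ} (hf : Measurable f) {M : ℝ}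
    (hM : ∀ x, |f x| ≤ M) (n : ℕ) : Integrable (maxSum T f n) μ :=
  Integrable.of_bound (measurable_maxSum hT hf n).aestronglyMeasurable (n * M)
    (ae_of_all _ fun x => by
      rw [norm_eq_abs, abs_of_nonneg (maxSum_nonneg f n x)]
      exact maxSum_le hM n x)

/-- Maximal ergodic lemma. -/
lemma maximal_ergodic (hT : MeasurePreserving T μ μ) {f : Ω → ℝ} (hf : Measurable f) {M : ℝ}
    (hM : ∀ x, |f x| ≤ M) (h : ∀ᵐ x ∂μ, ∃ n, 0 < birkhoffSum T f n x) : 0 ≤ ∫ x, f x ∂μ := by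
  let A : ℕ → Set Ω := fun n => {x | 0 < maxSum T f n x}
  have hAm : ∀ n, MeasurableSet (A n) := fun n =>
    measurableSet_lt measurable_const (measurable_maxSum hT.measurable hf n)
  have hAmono : Monotone A := monotone_nat_of_le_succ fun n x hx =>
    lt_of_lt_of_le hx (maxSum_mono f n x)
  have hfi : Integrable f μ := Integrable.of_bound hf.aestronglyMeasurable M (ae_of_all _ hM)
  have h1 : ∀ n, 0 ≤ ∫ x in A (n + 1), f x ∂μ := by
    intro n
    have hi := integrable_maxSum (μ := μ) hT.measurable hf hM
    have hTi : Integrable (fun x => maxSum T f n (T x)) μ := hT.integrable_comp_of_integrable (hi n)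
    have e1 : ∫ x in A (n + 1), f x ∂μ =
        ∫ x in A (n + 1), (maxSum T f (n + 1) x - maxSum T f n (T x)) ∂μ := by
      refine setIntegral_congr_fun (hAm _) fun x hx => ?_
      have hx : 0 < max 0 (f x + maxSum T f n (T x)) := hx
      have : maxSum T f (n + 1) x = f x + maxSum T f n (T x) := by
        change max 0 _ = _
        rcases lt_max_iff.1 hx with h | h
        · exact absurd h (lt_irrefl _)
        · exact max_eq_right h.le
      simp only [this]; ring
    rw [e1, integral_sub (hi _).integrableOn hTi.integrableOn]
    have e2 : ∫ x in A (n + 1), maxSum T f (n + 1) x ∂μ = ∫ x, maxSum T f (n + 1) x ∂μ := by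
      refine setIntegral_eq_integral_of_forall_compl_eq_zero fun x hx => ?_
      exact le_antisymm (not_lt.1 hx) (maxSum_nonneg f _ x)
    have e3 : ∫ x in A (n + 1), maxSum T f n (T x) ∂μ ≤ ∫ x, maxSum T f n (T x) ∂μ :=
      setIntegral_le_integral hTi (ae_of_all _ fun x => maxSum_nonneg f n _)
    have e4 : ∫ x, maxSum T f n (T x) ∂μ = ∫ x, maxSum T f n x ∂μ := by
      have := integral_map hT.measurable.aemeasurable (μ := μ)
        (measurable_maxSum hT.measurable hf n).aestronglyMeasurable
      rw [hT.map_eq] at this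
      exact this.symm
    have e5 := integral_mono (hi n) (hi (n + 1)) (maxSum_mono f n)
    linarith
  have h2 := tendsto_setIntegral_of_monotone hAm hAmono hfi.integrableOn (μ := μ)
  have h3 : ∫ x in ⋃ n, A n, f x ∂μ = ∫ x, f x ∂μ := by
    rw [setIntegral_congr_set (t := univ), setIntegral_univ]
    rw [eventuallyEq_univ]
    filter_upwards [h] with x ⟨n, hn⟩
    exact Set.mem_iUnion.2 ⟨n, hn.trans_le (birkhoffSum_le_maxSum f n x)⟩
  rw [h3] at h2
  exact ge_of_tendsto' ((tendsto_add_atTop_iff_nat 1).2 h2) h1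

lemma measurable_birkhoffAverage (hT : Measurable T) {f : Ω → ℝ} (hf : Measurable f) (n : ℕ) :
    Measurable (birkhoffAverage ℝ T f n) := by
  unfold birkhoffAverage birkhoffSum
  exact (Finset.measurable_fun_sum _ fun k _ => hf.comp (hT.iterate k)).const_mul ((n : ℝ)⁻¹)

lemma abs_birkhoffAverage_le {f : Ω → ℝ} {M : ℝ} (hM : ∀ x, |f x| ≤ M) (n : ℕ) (x : Ω) :
    |birkhoffAverage ℝ T f n x| ≤ M := by
  have hM0 : 0 ≤ M := (abs_nonneg _).trans (hM x)
  unfold birkhoffAverage birkhoffSum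
  rcases n.eq_zero_or_pos with rfl | hn
  · simpa using hM0
  rw [smul_eq_mul, abs_mul, abs_of_nonneg (by positivity), inv_mul_le_iff₀ (by positivity)]
  refine (Finset.abs_sum_le_sum_abs _ _).trans ?_
  refine (Finset.sum_le_sum fun k _ => hM _).trans ?_
  simp

lemma tendsto_birkhoffAverage_sub {f : Ω → ℝ} {M : ℝ} (hM : ∀ x, |f x| ≤ M) (x : Ω) :
    Tendsto (fun n => birkhoffAverage ℝ T f n (T x) - birkhoffAverage ℝ T f n x) atTop (𝓝 0) := by
  refine tendsto_birkhoffAverage_apply_sub_birkhoffAverage ℝ ?_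
  rw [isBounded_iff_forall_norm_le]
  exact ⟨M, by rintro _ ⟨n, rfl⟩; exact hM _⟩

/-- Averages exceeding `β` by a definite amount infinitely often. -/
def overshoot (T : Ω → Ω) (f : Ω → ℝ) (β : ℝ) : Set Ω :=
  {x | ∃ m : ℕ, ∃ᶠ n in atTop, β + 1 / ((m : ℝ) + 1) < birkhoffAverage ℝ T f n x}

lemma overshoot_of {u v : ℕ → ℝ} {β : ℝ} (h : Tendsto (fun n => u n - v n) atTop (𝓝 0))
    (hv : ∃ m : ℕ, ∃ᶠ n in atTop, β + 1 / ((m : ℝ) + 1) < v n) :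
    ∃ m : ℕ, ∃ᶠ n in atTop, β + 1 / ((m : ℝ) + 1) < u n := by
  obtain ⟨m, hm⟩ := hv
  have hpos : 0 < 1 / ((m : ℝ) + 1) := by positivity
  obtain ⟨k, hk⟩ := exists_nat_one_div_lt (half_pos hpos)
  have h1 : ∀ᶠ n in atTop, |u n - v n| < 1 / ((m : ℝ) + 1) / 2 := by
    have := (Metric.tendsto_nhds.1 h) _ (half_pos hpos)
    simpa [dist_eq] using this
  refine ⟨k, (hm.and_eventually h1).mono fun n hn => ?_⟩
  have := (abs_lt.1 hn.2).1
  linarith [hn.1]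

lemma overshoot_inv {f : Ω → ℝ} {M : ℝ} (hM : ∀ x, |f x| ≤ M) (β : ℝ) :
    T ⁻¹' overshoot T f β = overshoot T f β := by
  ext x
  have h1 := tendsto_birkhoffAverage_sub (T := T) hM x
  have h2 : Tendsto (fun n => birkhoffAverage ℝ T f n x - birkhoffAverage ℝ T f n (T x)) atTop
      (𝓝 0) := by simpa using h1.neg
  exact ⟨fun h => overshoot_of h2 h, fun h => overshoot_of h1 h⟩

lemma measurableSet_overshoot (hT : Measurable T) {f : Ω → ℝ} (hf : Measurable f) (β : ℝ) :
    MeasurableSet (overshoot T f β) := by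
  have : overshoot T f β = ⋃ m : ℕ, {x | ∃ᶠ n in atTop,
      x ∈ {x | β + 1 / ((m : ℝ) + 1) < birkhoffAverage ℝ T f n x}} := by
    ext x; simp [overshoot]
  rw [this]
  refine MeasurableSet.iUnion fun m => ?_
  simp only [← mem_limsup_iff_frequently_mem, Set.ofPred_mem_eq]
  exact MeasurableSet.measurableSet_limsup fun n =>
    measurableSet_lt measurable_const (measurable_birkhoffAverage hT hf n)

lemma le_integral_of_overshoot (hT : MeasurePreserving T μ μ) {f : Ω → ℝ} (hf : Measurable f)
    {M : ℝ} (hM : ∀ x, |f x| ≤ M) (β : ℝ) (h : ∀ᵐ x ∂μ, x ∈ overshoot T f β) :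
    β * μ.real univ ≤ ∫ x, f x ∂μ := by
  have hfi : Integrable f μ := Integrable.of_bound hf.aestronglyMeasurable M (ae_of_all _ hM)
  have h1 := maximal_ergodic hT (f := fun x => f x - β) (hf.sub_const β) (M := M + |β|)
    (fun x => (abs_sub _ _).trans (add_le_add_left (hM x) _)) (by
      filter_upwards [h] with x ⟨m, hm⟩
      obtain ⟨n, hn, hn0⟩ := (hm.and_eventually (eventually_gt_atTop 0)).exists
      refine ⟨n, ?_⟩
      have e1 : birkhoffSum T (fun x => f x - β) n x = birkhoffSum T f n x - n * β := by
        simp [birkhoffSum]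
      rw [e1]
      unfold birkhoffAverage at hn
      have hn' : (0 : ℝ) < n := by exact_mod_cast hn0
      have h2 : β < (n : ℝ)⁻¹ * birkhoffSum T f n x := lt_trans (by
        have : 0 < 1 / ((m : ℝ) + 1) := by positivity
        linarith) hn
      rw [lt_inv_mul_iff₀ hn'] at h2
      linarith)
  rw [integral_sub hfi (integrable_const _), integral_const, smul_eq_mul] at h1
  linarith

lemma measure_overshoot_inter (hT : MeasurePreserving T μ μ) {f : Ω → ℝ} (hf : Measurable f)
    {M : ℝ} (hM : ∀ x, |f x| ≤ M) {α β : ℝ} (hαβ : α < β) :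
    μ (overshoot T f β ∩ overshoot T (-f) (-α)) = 0 := by
  have hM' : ∀ x, |(-f) x| ≤ M := fun x => by simpa using hM x
  set E := overshoot T f β ∩ overshoot T (-f) (-α) with hE
  have hEm : MeasurableSet E := (measurableSet_overshoot hT.measurable hf β).inter
    (measurableSet_overshoot hT.measurable hf.neg _)
  have hEi : T ⁻¹' E = E := by rw [hE, Set.preimage_inter, overshoot_inv hM, overshoot_inv hM']
  have hTE : MeasurePreserving T (μ.restrict E) (μ.restrict E) := by
    have := hT.restrict_preimage hEm
    rwa [hEi] at this
  have h1 := le_integral_of_overshoot hTE hf hM β ((ae_restrict_iff' hEm).2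
    (ae_of_all _ fun x hx => hx.1))
  have h2 := le_integral_of_overshoot hTE hf.neg hM' (-α) ((ae_restrict_iff' hEm).2
    (ae_of_all _ fun x hx => hx.2))
  simp only [Pi.neg_apply, integral_neg] at h2
  have h3 : (μ.restrict E).real univ ≤ 0 := by
    have h4 : 0 ≤ (μ.restrict E).real univ := measureReal_nonneg
    nlinarith
  have h5 : μ.real E = 0 := by
    have : (μ.restrict E).real univ = μ.real E := by simp
    exact le_antisymm (this ▸ h3) measureReal_nonneg
  exact (measureReal_eq_zero_iff).1 h5

/-- Birkhoff's theorem. -/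
lemma birkhoff_ae (hT : MeasurePreserving T μ μ) {f : Ω → ℝ} (hf : Measurable f)
    {M : ℝ} (hM : ∀ x, |f x| ≤ M) :
    ∀ᵐ x ∂μ, ∃ c, Tendsto (fun n => birkhoffAverage ℝ T f n x) atTop (𝓝 c) := by
  have h1 : ∀ᵐ x ∂μ, ∀ p q : ℚ, p < q → x ∉ overshoot T f q ∩ overshoot T (-f) (-(p : ℝ)) := by
    rw [ae_all_iff]; intro p
    rw [ae_all_iff]; intro q
    by_cases hpq : p < q
    · have := measure_overshoot_inter hT hf hM (α := p) (β := q) (by exact_mod_cast hpq)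
      filter_upwards [measure_eq_zero_iff_ae_notMem.1 this] with x hx _ using hx
    · exact ae_of_all _ fun x h => absurd h hpq
  filter_upwards [h1] with x hx
  have hover : ∀ (F : Ω → ℝ) (a b : ℝ), a < b → (∃ᶠ n in atTop, b < birkhoffAverage ℝ T F n x) →
      x ∈ overshoot T F a := by
    intro F a b hab h
    obtain ⟨m, hm⟩ := exists_nat_one_div_lt (sub_pos.2 hab)
    exact ⟨m, h.mono fun n hn => by linarith⟩
  refine tendsto_of_no_upcrossings (s := univ) dense_univ ?_ ?_ ?_
  · rintro a - b - hab ⟨ha, hb⟩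
    obtain ⟨p, hp1, hp2⟩ := exists_rat_btwn hab
    obtain ⟨q, hq1, hq2⟩ := exists_rat_btwn hp2
    refine hx p q (by exact_mod_cast hq1) ⟨hover _ _ _ hq2 hb, hover _ _ (-a) (by linarith) ?_⟩
    exact ha.mono fun n hn => by rw [birkhoffAverage_neg]; simpa using hn
  · exact ⟨M, eventually_map.2 (Eventually.of_forall fun n =>
      (abs_le.1 (abs_birkhoffAverage_le hM n x)).2)⟩
  · exact ⟨-M, eventually_map.2 (Eventually.of_forall fun n =>
      (abs_le.1 (abs_birkhoffAverage_le hM n x)).1)⟩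

end Birkhoff

/-! ### Generic points for the one-parameter group `u` -/

/-- Average of `f` over a segment of the `u`-orbit of `x`. -/
def avg (S : ℝ) (f : C(X, ℝ)) (x : X) : ℝ := S⁻¹ * ∫ r in (0 : ℝ)..S, f (u r • x)

lemma continuous_orbit (f : C(X, ℝ)) (x : X) : Continuous (fun r : ℝ => f (u r • x)) :=
  f.continuous.comp (continuous_u.smul continuous_const)

lemma orbit_intervalIntegrable (f : C(X, ℝ)) (x : X) (a b : ℝ) :
    IntervalIntegrable (fun r : ℝ => f (u r • x)) volume a b :=
  (continuous_orbit f x).intervalIntegrable a b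

lemma abs_orbit_integral_le {f : C(X, ℝ)} {M : ℝ} (hM : ∀ x, |f x| ≤ M) (x : X) (a b : ℝ) :
    |∫ r in a..b, f (u r • x)| ≤ M * |b - a| := by
  rw [← norm_eq_abs]
  exact intervalIntegral.norm_integral_le_of_norm_le_const fun r _ => hM _

lemma abs_avg_le {f : C(X, ℝ)} {M : ℝ} (hM : ∀ x, |f x| ≤ M) (S : ℝ) (x : X) :
    |avg S f x| ≤ M := by
  have hM0 : 0 ≤ M := (abs_nonneg _).trans (hM x)
  rcases eq_or_ne S 0 with rfl | hS
  · simpa [avg] using hM0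
  unfold avg
  rw [abs_mul, abs_inv, inv_mul_le_iff₀ (abs_pos.2 hS), mul_comm]
  simpa using abs_orbit_integral_le hM x 0 S

lemma avg_sub (S : ℝ) (f g : C(X, ℝ)) (x : X) : avg S f x - avg S g x = avg S (f - g) x := by
  unfold avg
  rw [← mul_sub, ← intervalIntegral.integral_sub (orbit_intervalIntegrable f x 0 S)
    (orbit_intervalIntegrable g x 0 S)]
  rfl

lemma abs_avg_sub_le {f g : C(X, ℝ)} {ε : ℝ} (h : ∀ x, |f x - g x| ≤ ε) (S : ℝ) (x : X) :
    |avg S f x - avg S g x| ≤ ε := by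
  rw [avg_sub]; exact abs_avg_le (f := f - g) h S x

lemma continuous_avg (S : ℝ) (f : C(X, ℝ)) : Continuous (avg S f) := by
  refine continuous_const.mul ?_
  refine intervalIntegral.continuous_parametric_intervalIntegral_of_continuous' ?_ 0 S
  have : Continuous (fun p : X × ℝ => f (u p.2 • p.1)) :=
    f.continuous.comp ((continuous_u.comp continuous_snd).smul continuous_fst)
  exact this

lemma avg_floor_sub_le {f : C(X, ℝ)} {M : ℝ} (hM : ∀ x, |f x| ≤ M) {S : ℝ} (hS : 1 ≤ S) (x : X) :
    |avg S f x - avg (⌊S⌋₊ : ℝ) f x| ≤ 2 * M / S := by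
  have hM0 : 0 ≤ M := (abs_nonneg _).trans (hM x)
  have hS0 : 0 < S := by linarith
  set n : ℝ := (⌊S⌋₊ : ℝ) with hn
  have hn1 : n ≤ S := Nat.floor_le hS0.le
  have hn2 : S < n + 1 := Nat.lt_floor_add_one S
  have hn0 : 0 < n := by rw [hn]; exact_mod_cast Nat.floor_pos.2 hS
  have h1 : ∫ r in (0 : ℝ)..S, f (u r • x) =
      (∫ r in (0 : ℝ)..n, f (u r • x)) + ∫ r in n..S, f (u r • x) :=
    (integral_add_adjacent_intervals (orbit_intervalIntegrable f x _ _)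
      (orbit_intervalIntegrable f x _ _)).symm
  have h2 := abs_orbit_integral_le hM x n S
  have h3 : ∫ r in (0 : ℝ)..n, f (u r • x) = n * avg n f x := by unfold avg; field_simp
  have h4 : avg S f x - avg n f x = ((∫ r in n..S, f (u r • x)) - (S - n) * avg n f x) / S := by
    conv_lhs => rw [avg, h1, h3]
    field_simp; ring
  rw [h4, abs_div, abs_of_pos hS0]
  gcongr
  refine (abs_sub _ _).trans ?_
  rw [abs_mul, abs_of_nonneg (by linarith : 0 ≤ S - n)]
  rw [abs_of_nonneg (by linarith : 0 ≤ S - n)] at h2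
  have h5 := abs_avg_le hM n x
  nlinarith

lemma tendsto_avg_of_nat {f : C(X, ℝ)} {M : ℝ} (hM : ∀ x, |f x| ≤ M) {x : X} {c : ℝ}
    (h : Tendsto (fun n : ℕ => avg n f x) atTop (𝓝 c)) :
    Tendsto (fun S : ℝ => avg S f x) atTop (𝓝 c) := by
  have h1 : Tendsto (fun S : ℝ => avg (⌊S⌋₊ : ℝ) f x) atTop (𝓝 c) := h.comp tendsto_nat_floor_atTop
  have h2 : Tendsto (fun S : ℝ => avg S f x - avg (⌊S⌋₊ : ℝ) f x) atTop (𝓝 0) := by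
    refine squeeze_zero_norm' (a := fun S => 2 * M / S) ?_ (tendsto_const_nhds.div_atTop tendsto_id)
    filter_upwards [eventually_ge_atTop 1] with S hS using avg_floor_sub_le hM hS x
  simpa using h2.add h1

/-- Points with convergent `u`-averages for every test function. -/
def Gen : Set X := {x | ∀ f : C(X, ℝ), HasCompactSupport f →
  ∃ c, Tendsto (fun S : ℝ => avg S f x) atTop (𝓝 c)}

/-- Limit of the `u`-averages. -/
def Lm (f : C(X, ℝ)) (x : X) : ℝ := limsup (fun n : ℕ => avg n f x) atTop

lemma tendsto_avg {x : X} (hx : x ∈ Gen) {f : C(X, ℝ)} (hf : HasCompactSupport f) :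
    Tendsto (fun S : ℝ => avg S f x) atTop (𝓝 (Lm f x)) := by
  obtain ⟨c, hc⟩ := hx f hf
  have : Lm f x = c := (hc.comp tendsto_natCast_atTop_atTop).limsup_eq
  rwa [this]

lemma Lm_eq {x : X} {f : C(X, ℝ)} {c : ℝ}
    (h : Tendsto (fun S : ℝ => avg S f x) atTop (𝓝 c)) : Lm f x = c :=
  (h.comp tendsto_natCast_atTop_atTop).limsup_eq

lemma measurable_Lm (f : C(X, ℝ)) : Measurable (Lm f) :=
  Measurable.limsup fun n => (continuous_avg n f).measurable

lemma abs_Lm_sub_le {x : X} (hx : x ∈ Gen) {f g : C(X, ℝ)} (hf : HasCompactSupport f)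
    (hg : HasCompactSupport g) {ε : ℝ} (h : ∀ x, |f x - g x| ≤ ε) : |Lm f x - Lm g x| ≤ ε :=
  le_of_tendsto ((tendsto_avg hx hf).sub (tendsto_avg hx hg)).abs
    (Eventually.of_forall fun S => abs_avg_sub_le h S x)

lemma abs_Lm_le {x : X} (hx : x ∈ Gen) {f : C(X, ℝ)} (hf : HasCompactSupport f)
    {M : ℝ} (hM : ∀ x, |f x| ≤ M) : |Lm f x| ≤ M :=
  le_of_tendsto (tendsto_avg hx hf).abs (Eventually.of_forall fun S => abs_avg_le hM S x)

/-- A fixed uniformly dense sequence of test functions. -/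
def tst : ℕ → C(X, ℝ) := exists_dense_family.choose

lemma hasCompactSupport_tst (n : ℕ) : HasCompactSupport (tst n) :=
  exists_dense_family.choose_spec.1 n

lemma tst_dense {f : C(X, ℝ)} (hf : HasCompactSupport f) {ε : ℝ} (hε : 0 < ε) :
    ∃ n, ∀ x, |f x - tst n x| ≤ ε := by
  obtain ⟨n, hn⟩ := exists_dense_family.choose_spec.2 f hf ε hε
  exact ⟨n, fun x => (hn x).le⟩

lemma mem_Gen_iff (x : X) :
    x ∈ Gen ↔ ∀ k, ∃ c, Tendsto (fun n : ℕ => avg n (tst k) x) atTop (𝓝 c) := by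
  constructor
  · intro h k
    obtain ⟨c, hc⟩ := h _ (hasCompactSupport_tst k)
    exact ⟨c, hc.comp tendsto_natCast_atTop_atTop⟩
  · intro h f hf
    refine cauchy_map_iff_exists_tendsto.1 (Metric.cauchy_iff.2 ⟨inferInstance, fun ε hε => ?_⟩)
    obtain ⟨k, hk⟩ := tst_dense hf (ε := ε / 4) (by positivity)
    obtain ⟨c, hc⟩ := h k
    obtain ⟨M, -, hM⟩ := exists_bound (hasCompactSupport_tst k)
    have h1 := (Metric.tendsto_nhds.1 (tendsto_avg_of_nat hM hc)) (ε / 4) (by positivity)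
    refine ⟨Metric.ball c (ε / 2), ?_, ?_⟩
    · rw [mem_map]
      filter_upwards [h1] with S hS
      have h2 := abs_avg_sub_le hk S x
      rw [Set.mem_preimage, Metric.mem_ball]
      rw [dist_eq] at hS ⊢
      calc _ = |(avg S f x - avg S (tst k) x) + (avg S (tst k) x - c)| := by ring_nf
        _ ≤ _ := abs_add_le _ _
        _ < ε / 2 := by linarith
    · intro y hy z hz
      have := dist_triangle_right y z c
      rw [Metric.mem_ball] at hy hz
      linarith

lemma measurableSet_Gen : MeasurableSet Gen := by
  have : Gen = ⋂ k, {x | ∃ c, Tendsto (fun n : ℕ => avg n (tst k) x) atTop (𝓝 c)} := by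
    ext x; simp [mem_Gen_iff]
  rw [this]
  exact MeasurableSet.iInter fun k => measurableSet_exists_tendsto
    fun n => (continuous_avg n (tst k)).measurable

lemma avg_nat_eq_birkhoff (f : C(X, ℝ)) (n : ℕ) (x : X) :
    avg n f x = birkhoffAverage ℝ (fun x : X => u 1 • x) (avg 1 f) n x := by
  have h : ∀ n : ℕ, ∫ r in (0 : ℝ)..n, f (u r • x) =
      birkhoffSum (fun x : X => u 1 • x) (avg 1 f) n x := by
    intro n
    induction n with
    | zero => simp
    | succ n ih =>
      rw [birkhoffSum_succ, ← ih, iterate_smul, u_pow]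
      push_cast
      rw [← integral_add_adjacent_intervals (orbit_intervalIntegrable f x 0 n)
        (orbit_intervalIntegrable f x n (n + 1))]
      congr 1
      simp only [avg, inv_one, one_mul, smul_smul, ← u_add, mul_one]
      rw [integral_comp_add_right (fun r => f (u r • x))]
      simp [add_comm]
  rw [avg, h, birkhoffAverage, smul_eq_mul]

section
variable {ν : Measure X} [IsFiniteMeasure ν]

lemma ae_mem_Gen (hu : ∀ s, MInv ν (u s)) : ∀ᵐ x ∂ν, x ∈ Gen := by
  simp only [mem_Gen_iff]
  rw [ae_all_iff]
  intro k
  obtain ⟨M, -, hM⟩ := exists_bound (hasCompactSupport_tst k)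
  filter_upwards [birkhoff_ae (hu 1).mp (continuous_avg 1 (tst k)).measurable
    (fun x => abs_avg_le hM 1 x)] with x hx
  simpa only [avg_nat_eq_birkhoff] using hx

lemma integral_avg (hu : ∀ s, MInv ν (u s)) {f : C(X, ℝ)} (hf : HasCompactSupport f) {S : ℝ}
    (hS : S ≠ 0) : ∫ x, avg S f x ∂ν = ∫ x, f x ∂ν := by
  obtain ⟨M, -, hM⟩ := exists_bound hf
  unfold avg
  rw [integral_const_mul]
  have h1 : ∫ x, (∫ r in (0 : ℝ)..S, f (u r • x)) ∂ν = ∫ r in (0 : ℝ)..S, ∫ x, f (u r • x) ∂ν := by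
    rw [intervalIntegral_integral_swap]
    have hc : Continuous (fun p : ℝ × X => f (u p.1 • p.2)) :=
      f.continuous.comp ((continuous_u.comp continuous_fst).smul continuous_snd)
    have : IsFiniteMeasure (volume.restrict (Set.uIoc 0 S)) := ⟨by simp [Set.uIoc]⟩
    exact Integrable.of_bound hc.aestronglyMeasurable M (ae_of_all _ fun p => hM _)
  rw [h1]
  simp only [(hu _).integral]
  simp [hS]

lemma integral_Lm (hu : ∀ s, MInv ν (u s)) {f : C(X, ℝ)} (hf : HasCompactSupport f) :
    ∫ x, Lm f x ∂ν = ∫ x, f x ∂ν := by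
  obtain ⟨M, -, hM⟩ := exists_bound hf
  have h1 : Tendsto (fun n : ℕ => ∫ x, avg n f x ∂ν) atTop (𝓝 (∫ x, Lm f x ∂ν)) := by
    refine tendsto_integral_of_dominated_convergence (fun _ => M)
      (fun n => (continuous_avg n f).aestronglyMeasurable) (integrable_const _)
      (fun n => ae_of_all _ fun x => abs_avg_le hM n x) ?_
    filter_upwards [ae_mem_Gen hu] with x hx
    exact (tendsto_avg hx hf).comp tendsto_natCast_atTop_atTop
  refine tendsto_nhds_unique h1 (tendsto_const_nhds.congr' ?_)
  filter_upwards [eventually_ne_atTop 0] with n hn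
  rw [integral_avg hu hf (by exact_mod_cast hn)]

end

/-- `b` normalizes the group `u`, rescaling it by `c`. -/
def Nrm (b : G) (c : ℝ) : Prop := 0 < c ∧ ∀ s, u s * b = b * u (c * s)

lemma Nrm.avg {b : G} {c : ℝ} (hb : Nrm b c) (S : ℝ) (f : C(X, ℝ)) (x : X) :
    avg S f (b • x) = avg (c * S) (tr b f) x := by
  unfold _root_.avg
  have : ∀ r, f (u r • b • x) = tr b f (u (c * r) • x) := by
    intro r; rw [smul_smul, hb.2, mul_smul, tr_apply]
  simp only [this]
  rw [intervalIntegral.integral_comp_mul_left (fun r => tr b f (u r • x)) hb.1.ne']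
  simp [mul_assoc, mul_left_comm]

lemma Nrm.inv {b : G} {c : ℝ} (hb : Nrm b c) : Nrm b⁻¹ c⁻¹ := by
  refine ⟨inv_pos.2 hb.1, fun s => ?_⟩
  have := hb.2 (c⁻¹ * s)
  rw [mul_inv_cancel_left₀ hb.1.ne'] at this
  rw [mul_inv_eq_iff_eq_mul, mul_assoc, this, inv_mul_cancel_left]

lemma nrm_u (s : ℝ) : Nrm (u s) 1 := ⟨one_pos, fun t => by rw [one_mul, ← u_add, ← u_add, add_comm]⟩

lemma nrm_gSL (t : ℝ) : Nrm (gSL t) (exp (-(3 * t))) := ⟨exp_pos _, fun s => by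
    rw [gSL_u, ← mul_assoc, ← exp_add]; simp⟩

lemma nrm_e23 (q : ℝ) : Nrm (e23 q) 1 := ⟨one_pos, fun s => by rw [one_mul, e23_u]⟩

lemma Nrm.tendsto {b : G} {c : ℝ} (hb : Nrm b c) {f : C(X, ℝ)} {x : X} {l : ℝ}
    (h : Tendsto (fun S : ℝ => _root_.avg S (tr b f) x) atTop (𝓝 l)) :
    Tendsto (fun S : ℝ => _root_.avg S f (b • x)) atTop (𝓝 l) := by
  simp only [hb.avg]
  exact h.comp (tendsto_id.const_mul_atTop hb.1)

lemma Nrm.mem_Gen {b : G} {c : ℝ} (hb : Nrm b c) {x : X} (hx : x ∈ Gen) : b • x ∈ Gen := by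
  intro f hf
  obtain ⟨l, hl⟩ := hx (tr b f) (hasCompactSupport_tr hf b)
  exact ⟨l, hb.tendsto hl⟩

lemma Nrm.mem_Gen_iff {b : G} {c : ℝ} (hb : Nrm b c) {x : X} : b • x ∈ Gen ↔ x ∈ Gen :=
  ⟨fun h => by simpa using hb.inv.mem_Gen h, hb.mem_Gen⟩

lemma Nrm.Lm {b : G} {c : ℝ} (hb : Nrm b c) {x : X} (hx : x ∈ Gen) {f : C(X, ℝ)}
    (hf : HasCompactSupport f) : Lm f (b • x) = Lm (tr b f) x :=
  Lm_eq (hb.tendsto (tendsto_avg hx (hasCompactSupport_tr hf b)))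

lemma tr_u_tendsto {x : X} {f : C(X, ℝ)} (hf : HasCompactSupport f) (s : ℝ) {l : ℝ}
    (h : Tendsto (fun S : ℝ => avg S f x) atTop (𝓝 l)) :
    Tendsto (fun S : ℝ => avg S (tr (u s) f) x) atTop (𝓝 l) := by
  obtain ⟨M, -, hM⟩ := exists_bound hf
  have h2 : Tendsto (fun S : ℝ => avg S (tr (u s) f) x - avg S f x) atTop (𝓝 0) := by
    refine squeeze_zero_norm' (a := fun S => 2 * (M * |s|) / S) ?_
      (tendsto_const_nhds.div_atTop tendsto_id)
    filter_upwards [eventually_gt_atTop 0] with S hS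
    have e1 : ∫ r in (0 : ℝ)..S, tr (u s) f (u r • x) = ∫ r in s..(S + s), f (u r • x) := by
      simp only [tr_apply, smul_smul, ← u_add, add_comm s]
      rw [integral_comp_add_right (fun r => f (u r • x)), zero_add]
    have e2 := intervalIntegral.integral_interval_sub_interval_comm
      (orbit_intervalIntegrable f x s (S + s)) (orbit_intervalIntegrable f x 0 S)
      (orbit_intervalIntegrable f x s 0)
    rw [avg, avg, e1, ← mul_sub, e2, norm_mul, norm_eq_abs, norm_eq_abs,
      abs_of_pos (inv_pos.2 hS), inv_mul_eq_div]
    gcongr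
    refine (abs_sub _ _).trans ?_
    have e3 := abs_orbit_integral_le hM x s 0
    have e4 := abs_orbit_integral_le hM x (S + s) S
    rw [zero_sub, abs_neg] at e3
    rw [show S - (S + s) = -s by ring, abs_neg] at e4
    linarith
  simpa using h2.add h

lemma Lm_tr_u {x : X} (hx : x ∈ Gen) {f : C(X, ℝ)} (hf : HasCompactSupport f) (s : ℝ) :
    Lm (tr (u s) f) x = Lm f x :=
  Lm_eq (tr_u_tendsto hf s (tendsto_avg hx hf))

lemma Lm_u {x : X} (hx : x ∈ Gen) {f : C(X, ℝ)} (hf : HasCompactSupport f) (s : ℝ) :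
    Lm f (u s • x) = Lm f x := by
  rw [(nrm_u s).Lm hx hf, Lm_tr_u hx hf]

/-- The limiting distribution of the `u`-orbit of `x` is invariant under `h`. -/
def LInv (h : G) (x : X) : Prop := ∀ f : C(X, ℝ), HasCompactSupport f → Lm (tr h f) x = Lm f x

lemma LInv.mul {h k : G} {x : X} (hh : LInv h x) (hk : LInv k x) : LInv (h * k) x := by
  intro f hf
  rw [← tr_tr, hk _ (hasCompactSupport_tr hf h), hh f hf]

lemma LInv.inv {h : G} {x : X} (hh : LInv h x) : LInv h⁻¹ x := by
  intro f hf
  rw [← hh _ (hasCompactSupport_tr hf h⁻¹), tr_tr, inv_mul_cancel, tr_one]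

lemma inv_u {x : X} (hx : x ∈ Gen) (s : ℝ) : LInv (u s) x := fun _ hf => Lm_tr_u hx hf s

lemma LInv.conj {h b : G} {c : ℝ} (hb : Nrm b c) {x : X} (hx : x ∈ Gen) (hh : LInv h x) :
    LInv (b * h * b⁻¹) (b • x) := by
  intro f hf
  rw [hb.Lm hx hf, hb.Lm hx (hasCompactSupport_tr hf _), tr_tr, inv_mul_cancel_right, ← tr_tr,
    hh _ (hasCompactSupport_tr hf b)]

lemma inv_u_smul_iff {h : G} {x : X} (hx : x ∈ Gen) (s : ℝ) : LInv h (u s • x) ↔ LInv h x := by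
  refine forall₂_congr fun f hf => ?_
  rw [Lm_u hx hf, Lm_u hx (hasCompactSupport_tr hf h)]

lemma inv_of_tst {h : G} {x : X} (hx : x ∈ Gen)
    (H : ∀ n, Lm (tr h (tst n)) x = Lm (tst n) x) : LInv h x := by
  intro f hf
  refine eq_of_abs_sub_le_all fun ε hε => ?_
  obtain ⟨n, hn⟩ := tst_dense hf (half_pos hε)
  have h1 := abs_Lm_sub_le hx hf (hasCompactSupport_tst n) hn
  have h2 := abs_Lm_sub_le hx (hasCompactSupport_tr hf h)
    (hasCompactSupport_tr (hasCompactSupport_tst n) h) (fun y => hn (h • y))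
  rw [H n] at h2
  calc _ = |(Lm (tr h f) x - Lm (tst n) x) - (Lm f x - Lm (tst n) x)| := by ring_nf
    _ ≤ _ := abs_sub _ _
    _ ≤ ε := by linarith

lemma inv_of_tendsto {x : X} (hx : x ∈ Gen) {ι : Type*} {l : Filter ι} [l.NeBot] {h : ι → G}
    {h₀ : G} (ht : Tendsto h l (𝓝 h₀)) (hi : ∀ᶠ i in l, LInv (h i) x) : LInv h₀ x := by
  intro f hf
  refine eq_of_abs_sub_le_all fun ε hε => ?_
  obtain ⟨i, h1, h2⟩ := ((ht.eventually (unif_cont_tr hf h₀ hε)).and hi).exists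
  have h3 := abs_Lm_sub_le hx (hasCompactSupport_tr hf (h i)) (hasCompactSupport_tr hf h₀)
    (fun y => (h1 y).le)
  rw [h2 f hf, abs_sub_comm] at h3
  exact h3

lemma measurableSet_inv (h : G) : MeasurableSet {x | x ∈ Gen ∧ LInv h x} := by
  have : {x | x ∈ Gen ∧ LInv h x} = Gen ∩ ⋂ n, {x | Lm (tr h (tst n)) x = Lm (tst n) x} := by
    ext x
    simp only [Set.mem_ofPred_eq, Set.mem_inter_iff, Set.mem_iInter]
    exact ⟨fun h => ⟨h.1, fun n => h.2 _ (hasCompactSupport_tst n)⟩,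
      fun h => ⟨h.1, inv_of_tst h.1 h.2⟩⟩
  rw [this]
  exact measurableSet_Gen.inter (MeasurableSet.iInter fun n =>
    measurableSet_eq_fun (measurable_Lm _) (measurable_Lm _))

lemma mInv_of_ae_inv {ν : Measure X} [IsFiniteMeasure ν] (hu : ∀ s, MInv ν (u s)) {h : G}
    (H : ∀ᵐ x ∂ν, LInv h x) : MInv ν h := by
  refine MInv.of_integral fun f hf => ?_
  have h1 := integral_Lm hu (hasCompactSupport_tr hf h)
  rw [integral_congr_ae (by filter_upwards [H] with x hx using hx f hf), integral_Lm hu hf] at h1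
  exact h1.symm

/-! ### Sets of uniform convergence -/

/-- The `u`-averages converge uniformly on `K`. -/
def UConv (K : Set X) : Prop := K ⊆ Gen ∧ ∀ f : C(X, ℝ), HasCompactSupport f → ∀ ε > 0,
  ∃ S₀ : ℝ, ∀ S ≥ S₀, ∀ x ∈ K, |avg S f x - Lm f x| ≤ ε

lemma uconv_of_tst {K : Set X} (hK : K ⊆ Gen) (h : ∀ k, TendstoUniformlyOn
    (fun n : ℕ => avg n (tst k)) (Lm (tst k)) atTop K) : UConv K := by
  refine ⟨hK, fun f hf ε hε => ?_⟩
  obtain ⟨k, hk⟩ := tst_dense hf (ε := ε / 4) (by positivity)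
  obtain ⟨M, hM0, hM⟩ := exists_bound (hasCompactSupport_tst k)
  have h1 := (Metric.tendstoUniformlyOn_iff.1 (h k)) (ε / 4) (by positivity)
  have h2 : ∀ᶠ S : ℝ in atTop, ∀ x ∈ K, dist (Lm (tst k) x) (avg (⌊S⌋₊ : ℝ) (tst k) x) < ε / 4 :=
    tendsto_nat_floor_atTop.eventually h1
  obtain ⟨S₀, hS₀⟩ := eventually_atTop.1 (h2.and (eventually_ge_atTop (max 1 (8 * M / ε))))
  refine ⟨S₀, fun S hS x hx => ?_⟩
  obtain ⟨h3, h4⟩ := hS₀ S hS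
  have hS1 : 1 ≤ S := (le_max_left _ _).trans h4
  have e1 := abs_avg_sub_le hk S x
  have e2 := avg_floor_sub_le hM hS1 x
  have e3 : 2 * M / S ≤ ε / 4 := by
    have h5 := (le_max_right _ _).trans h4
    rw [div_le_iff₀ hε] at h5
    rw [div_le_iff₀ (by linarith)]
    linarith
  have e4 := h3 x hx
  rw [dist_eq, abs_sub_comm] at e4
  have e5 := abs_Lm_sub_le (hK hx) hf (hasCompactSupport_tst k) hk
  rw [abs_sub_comm] at e5
  calc _ = |(avg S f x - avg S (tst k) x) + (avg S (tst k) x - avg (⌊S⌋₊ : ℝ) (tst k) x) +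
        (avg (⌊S⌋₊ : ℝ) (tst k) x - Lm (tst k) x) + (Lm (tst k) x - Lm f x)| := by ring_nf
    _ ≤ _ := (abs_add_le _ _).trans (add_le_add_left (abs_add_three _ _ _) _)
    _ ≤ ε := by linarith

lemma exists_uconv {ν : Measure X} [IsFiniteMeasure ν] (hu : ∀ s, MInv ν (u s)) {E : Set X}
    (hE : MeasurableSet E) {ε : ℝ≥0∞} (hε : ε ≠ 0) :
    ∃ K ⊆ E, IsCompact K ∧ UConv K ∧ ν E < ν K + ε := by
  have hE' : MeasurableSet (E ∩ Gen) := hE.inter measurableSet_Gen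
  obtain ⟨δ, hδ, hsum⟩ := exists_pos_sum_of_countable (ε := ε / 2) (ENNReal.half_pos hε).ne' ℕ
  have hk : ∀ k, ∃ t ⊆ E ∩ Gen, MeasurableSet t ∧ ν t ≤ ofReal (δ k) ∧
      TendstoUniformlyOn (fun n : ℕ => avg n (tst k)) (Lm (tst k)) atTop ((E ∩ Gen) \ t) := by
    intro k
    refine tendstoUniformlyOn_of_ae_tendsto (f := fun n : ℕ => avg n (tst k))
      (fun n => (continuous_avg n (tst k)).measurable.stronglyMeasurable)
      (measurable_Lm _).stronglyMeasurable hE' (measure_ne_top _ _) ?_ (hδ k)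
    exact ae_of_all _ fun x hx =>
      (tendsto_avg hx.2 (hasCompactSupport_tst k)).comp tendsto_natCast_atTop_atTop
  choose t ht htm htν htu using hk
  have hm : MeasurableSet ((E ∩ Gen) \ ⋃ k, t k) := hE'.diff (MeasurableSet.iUnion htm)
  obtain ⟨K, hKE, hK, hlt⟩ := exists_isCompact_approx (ν := ν) hm (ENNReal.half_pos hε).ne'
  refine ⟨K, fun x hx => (hKE hx).1.1, hK, ?_, ?_⟩
  · refine uconv_of_tst (fun x hx => (hKE hx).1.2) fun k => (htu k).mono ?_
    exact fun x hx => ⟨(hKE hx).1, fun h => (hKE hx).2 (Set.mem_iUnion.2 ⟨k, h⟩)⟩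
  · have h1 : ν E = ν (E ∩ Gen) := (measure_inter_conull (mem_ae_iff.1 (ae_mem_Gen hu))).symm
    have h2 : ν (⋃ k, t k) ≤ ε / 2 := by
      refine (measure_iUnion_le _).trans ((ENNReal.tsum_le_tsum htν).trans ?_)
      simp only [ofReal_coe_nnreal]
      exact hsum.le
    have h3 : ν (E ∩ Gen) ≤ ν ((E ∩ Gen) \ ⋃ k, t k) + ν (⋃ k, t k) := (measure_mono (fun x hx => by
        by_cases h : x ∈ ⋃ k, t k
        · exact Or.inr h
        · exact Or.inl ⟨hx, h⟩)).trans (measure_union_le _ _)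
    rcases eq_or_ne ε ∞ with h5 | h5
    · simp [h5]
    calc ν E ≤ ν ((E ∩ Gen) \ ⋃ k, t k) + ε / 2 := by
          rw [h1]; exact h3.trans (add_le_add_right h2 _)
      _ < ν K + ε / 2 + ε / 2 := by
          exact ENNReal.add_lt_add_right (div_ne_top h5 (by simp)) hlt
      _ = ν K + ε := by rw [add_assoc, ENNReal.add_halves]

lemma UConv.continuousOn {K : Set X} (hK : UConv K) {f : C(X, ℝ)} (hf : HasCompactSupport f) :
    ContinuousOn (Lm f) K := by
  have h : TendstoUniformlyOn (fun n : ℕ => avg n f) (Lm f) atTop K := by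
    refine Metric.tendstoUniformlyOn_iff.2 fun ε hε => ?_
    obtain ⟨S₀, hS₀⟩ := hK.2 f hf (ε / 2) (by positivity)
    filter_upwards [tendsto_natCast_atTop_atTop.eventually (eventually_ge_atTop S₀)] with n hn x hx
    rw [dist_eq, abs_sub_comm]
    exact (hS₀ n hn x hx).trans_lt (by linarith)
  exact h.continuousOn (Frequently.of_forall fun n => (continuous_avg n f).continuousOn)

lemma UConv.tendsto {K : Set X} (hK : UConv K) {f : C(X, ℝ)} (hf : HasCompactSupport f)
    {ι : Type*} {l : Filter ι} {x : ι → X} {x' : X} (hx : ∀ n, x n ∈ K) (hx' : x' ∈ K)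
    (h : Tendsto x l (𝓝 x')) : Tendsto (fun n => Lm f (x n)) l (𝓝 (Lm f x')) :=
  ((hK.continuousOn hf) x' hx').tendsto.comp
    (tendsto_nhdsWithin_of_tendsto_nhds_of_eventually_within _ h (Eventually.of_forall hx))

lemma UConv.linv_of_tendsto {K : Set X} (hK : UConv K) {x : ℕ → X} {x' : X}
    (hx : ∀ n, x n ∈ K) (hx' : x' ∈ K) (h : Tendsto x atTop (𝓝 x')) {k : ℕ → G} {k' : G}
    (hk : Tendsto k atTop (𝓝 k')) (hi : ∀ᶠ n in atTop, LInv (k n) (x n)) : LInv k' x' := by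
  intro f hf
  refine eq_of_abs_sub_le_all fun ε hε => ?_
  have h1 := (hK.tendsto (hasCompactSupport_tr hf k') hx hx' h).sub (hK.tendsto hf hx hx' h)
  refine le_of_tendsto h1.abs ?_
  filter_upwards [hk.eventually (unif_cont_tr hf k' hε), hi] with n hn hin
  have := abs_Lm_sub_le (hK.1 (hx n)) (hasCompactSupport_tr hf (k n)) (hasCompactSupport_tr hf k')
    (fun y => (hn y).le)
  rwa [hin f hf, abs_sub_comm] at this

/-! ### The polynomial divergence of nearby orbits -/

lemma window_bound {f : C(X, ℝ)} {x : X} {a b e l : ℝ} (ha : 0 < a) (hb : 0 < b)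
    (h1 : |avg a f x - l| ≤ e) (h2 : |avg b f x - l| ≤ e) :
    |(∫ r in a..b, f (u r • x)) - (b - a) * l| ≤ (a + b) * e := by
  have e1 : ∫ r in a..b, f (u r • x) = b * avg b f x - a * avg a f x := by
    rw [eq_sub_iff_add_eq', avg, avg, mul_inv_cancel_left₀ ha.ne', mul_inv_cancel_left₀ hb.ne']
    exact integral_add_adjacent_intervals (orbit_intervalIntegrable f x _ _)
      (orbit_intervalIntegrable f x _ _)
  rw [e1]
  rw [abs_le] at *
  constructor <;> nlinarith

/-- The limiting displacement of two diverging `u`-orbits. -/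
def hmat (κ σ ρ : ℝ) (h : 1 + κ ≠ 0) : G :=
  ⟨!![1 + κ, σ, 0; 0, 1, -ρ / (1 + κ); 0, 0, 1 / (1 + κ)], by simp [det_fin_three, h]⟩

/-- The time change for diverging orbits. -/
def phi (g : G) (s : ℝ) : ℝ := (g 0 2 + s * g 2 2) / (g 0 0 + s * g 2 0)

def disp (g : G) (s : ℝ) : G := u s * g * u (-phi g s)

lemma disp_mul (g : G) (s : ℝ) : disp g s * u (phi g s) = u s * g := by
  rw [disp, mul_assoc, ← u_add, neg_add_cancel, u_zero, mul_one]

lemma disp_apply {g : G} {s : ℝ} (h : g 0 0 + s * g 2 0 ≠ 0) (i j : Fin 3) :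
    disp g s i j = !![g 0 0 + s * g 2 0, g 0 1 + s * g 2 1, 0;
      g 1 0, g 1 1, g 1 2 - phi g s * g 1 0; g 2 0, g 2 1, g 2 2 - phi g s * g 2 0] i j := by
  have h1 : phi g s * (g 0 0 + s * g 2 0) = g 0 2 + s * g 2 2 := div_mul_cancel₀ _ h
  simp only [disp, G_mul_apply]
  fin_cases i <;> fin_cases j <;> simp [u] <;> linarith

lemma hasDerivAt_phi {g : G} {s : ℝ} (h : g 0 0 + s * g 2 0 ≠ 0) :
    HasDerivAt (phi g) ((g 0 0 * g 2 2 - g 0 2 * g 2 0) / (g 0 0 + s * g 2 0) ^ 2) s := by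
  have h1 : HasDerivAt (fun s => g 0 2 + s * g 2 2) (g 2 2) s := by
    simpa using ((hasDerivAt_id s).mul_const (g 2 2)).const_add (g 0 2)
  have h2 : HasDerivAt (fun s => g 0 0 + s * g 2 0) (g 2 0) s := by
    simpa using ((hasDerivAt_id s).mul_const (g 2 0)).const_add (g 0 0)
  refine (h1.div h2 h).congr_deriv ?_
  congr 1
  ring

lemma tendsto_entry {ι : Type*} {l : Filter ι} {g : ι → G} (hg : Tendsto g l (𝓝 1)) (i j : Fin 3) :
    Tendsto (fun n => g n i j) l (𝓝 ((1 : M₃) i j)) :=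
  tendsto_G_iff.1 hg i j

lemma abs_sub_chain {a b c d e f p q r s t : ℝ} (h1 : |b - a| ≤ p) (h2 : |b - c| ≤ q)
    (h3 : |c - d| ≤ r) (h4 : |d - e| ≤ s) (h5 : |e - f| ≤ t) : |a - f| ≤ p + q + r + s + t := by
  rw [abs_le] at *
  constructor <;> linarith

section HP

variable {x : ℕ → X} {g : ℕ → G} {x' : X} {r : ℕ → ℝ} {κ σ ρ θ : ℝ}

lemma tendsto_denom (hg : Tendsto g atTop (𝓝 1))
    (h20 : Tendsto (fun n => g n 2 0 / r n) atTop (𝓝 κ)) :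
    Tendsto (fun p : ℕ × ℝ => g p.1 0 0 + p.2 / r p.1 * g p.1 2 0) (atTop ×ˢ 𝓝 θ)
      (𝓝 (1 + θ * κ)) := by
  have hfst : Tendsto (Prod.fst : ℕ × ℝ → ℕ) (atTop ×ˢ 𝓝 θ) atTop := tendsto_fst
  have hsnd : Tendsto (Prod.snd : ℕ × ℝ → ℝ) (atTop ×ˢ 𝓝 θ) (𝓝 θ) := tendsto_snd
  have h0 : Tendsto (fun p : ℕ × ℝ => g p.1 0 0) (atTop ×ˢ 𝓝 θ) (𝓝 1) := by
    simpa using tendsto_entry (hg.comp hfst) 0 0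
  have h1 : Tendsto (fun p : ℕ × ℝ => g p.1 2 0 / r p.1) (atTop ×ˢ 𝓝 θ) (𝓝 κ) := h20.comp hfst
  refine (h0.add (hsnd.mul h1)).congr fun p => ?_
  ring

lemma tendsto_phi (hg : Tendsto g atTop (𝓝 1)) (hr : ∀ n, 0 < r n)
    (hr0 : Tendsto r atTop (𝓝 0)) (h20 : Tendsto (fun n => g n 2 0 / r n) atTop (𝓝 κ))
    (h1 : 0 < 1 + θ * κ) :
    Tendsto (fun p : ℕ × ℝ => r p.1 * phi (g p.1) (p.2 / r p.1)) (atTop ×ˢ 𝓝 θ)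
      (𝓝 (θ / (1 + θ * κ))) := by
  have hfst : Tendsto (Prod.fst : ℕ × ℝ → ℕ) (atTop ×ˢ 𝓝 θ) atTop := tendsto_fst
  have hsnd : Tendsto (Prod.snd : ℕ × ℝ → ℝ) (atTop ×ˢ 𝓝 θ) (𝓝 θ) := tendsto_snd
  have h02 : Tendsto (fun p : ℕ × ℝ => g p.1 0 2) (atTop ×ˢ 𝓝 θ) (𝓝 0) := by
    simpa using tendsto_entry (hg.comp hfst) 0 2
  have h22 : Tendsto (fun p : ℕ × ℝ => g p.1 2 2) (atTop ×ˢ 𝓝 θ) (𝓝 1) := by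
    simpa using tendsto_entry (hg.comp hfst) 2 2
  have hr1 : Tendsto (fun p : ℕ × ℝ => r p.1) (atTop ×ˢ 𝓝 θ) (𝓝 0) := hr0.comp hfst
  have h2 := ((hr1.mul h02).add (hsnd.mul h22)).div (tendsto_denom (θ := θ) hg h20) h1.ne'
  simp only [mul_zero, zero_add, mul_one] at h2
  refine h2.congr fun p => ?_
  have := (hr p.1).ne'
  simp only [phi, Pi.div_apply]
  field_simp

lemma tendsto_disp (hg : Tendsto g atTop (𝓝 1)) (hr : ∀ n, 0 < r n)
    (hr0 : Tendsto r atTop (𝓝 0)) (h20 : Tendsto (fun n => g n 2 0 / r n) atTop (𝓝 κ))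
    (h21 : Tendsto (fun n => g n 2 1 / r n) atTop (𝓝 σ))
    (h10 : Tendsto (fun n => g n 1 0 / r n) atTop (𝓝 ρ)) (h1 : 0 < 1 + θ * κ) :
    Tendsto (fun p : ℕ × ℝ => disp (g p.1) (p.2 / r p.1)) (atTop ×ˢ 𝓝 θ)
      (𝓝 (hmat (θ * κ) (θ * σ) (θ * ρ) h1.ne')) := by
  have hfst : Tendsto (Prod.fst : ℕ × ℝ → ℕ) (atTop ×ˢ 𝓝 θ) atTop := tendsto_fst
  have hsnd : Tendsto (Prod.snd : ℕ × ℝ → ℝ) (atTop ×ˢ 𝓝 θ) (𝓝 θ) := tendsto_snd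
  have hD := tendsto_denom (θ := θ) hg h20
  have hphi := tendsto_phi (θ := θ) hg hr hr0 h20 h1
  have hG : ∀ i j, Tendsto (fun p : ℕ × ℝ => g p.1 i j) (atTop ×ˢ 𝓝 θ)
      (𝓝 ((1 : M₃) i j)) := fun i j => tendsto_entry (hg.comp hfst) i j
  have hσ : Tendsto (fun p : ℕ × ℝ => g p.1 2 1 / r p.1) (atTop ×ˢ 𝓝 θ) (𝓝 σ) := h21.comp hfst
  have hρ : Tendsto (fun p : ℕ × ℝ => g p.1 1 0 / r p.1) (atTop ×ˢ 𝓝 θ) (𝓝 ρ) := h10.comp hfst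
  have hκ : Tendsto (fun p : ℕ × ℝ => g p.1 2 0 / r p.1) (atTop ×ˢ 𝓝 θ) (𝓝 κ) := h20.comp hfst
  have hne : ∀ᶠ p : ℕ × ℝ in atTop ×ˢ 𝓝 θ, g p.1 0 0 + p.2 / r p.1 * g p.1 2 0 ≠ 0 :=
    hD.eventually_ne h1.ne'
  rw [tendsto_G_iff]
  intro i j
  have key : Tendsto (fun p : ℕ × ℝ => !![g p.1 0 0 + p.2 / r p.1 * g p.1 2 0,
      g p.1 0 1 + p.2 / r p.1 * g p.1 2 1, 0; g p.1 1 0, g p.1 1 1,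
      g p.1 1 2 - phi (g p.1) (p.2 / r p.1) * g p.1 1 0; g p.1 2 0, g p.1 2 1,
      g p.1 2 2 - phi (g p.1) (p.2 / r p.1) * g p.1 2 0] i j) (atTop ×ˢ 𝓝 θ)
      (𝓝 (hmat (θ * κ) (θ * σ) (θ * ρ) h1.ne' i j)) := by
    have h01 := (hG 0 1).add (hsnd.mul hσ)
    have h12 := (hG 1 2).sub (hphi.mul hρ)
    have h22 := (hG 2 2).sub (hphi.mul hκ)
    fin_cases i <;> fin_cases j
    · simpa [hmat] using hD
    · simp [hmat] at h01 ⊢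
      refine h01.congr fun p => ?_
      ring
    · simp [hmat]
    · simpa [hmat, Function.comp_def] using hG 1 0
    · simpa [hmat, Function.comp_def] using hG 1 1
    · simp [hmat] at h12 ⊢
      have e : -(θ * ρ) / (1 + θ * κ) = -(θ / (1 + θ * κ) * ρ) := by ring
      rw [e]
      refine h12.congr fun p => ?_
      have := (hr p.1).ne'
      field_simp
    · simpa [hmat, Function.comp_def] using hG 2 0
    · simpa [hmat, Function.comp_def] using hG 2 1
    · simp [hmat] at h22 ⊢
      have e : (1 + θ * κ)⁻¹ = 1 - θ / (1 + θ * κ) * κ := by field_simp; ring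
      rw [e]
      refine h22.congr fun p => ?_
      have := (hr p.1).ne'
      field_simp
  refine key.congr' ?_
  filter_upwards [hne] with p hp
  rw [disp_apply hp]

set_option maxHeartbeats 400000 in
/-- If points of a set of uniform convergence approach each other transversally, then the limiting
distribution is invariant under the limiting displacement. -/
lemma h_principle {K : Set X} (hK : UConv K) (hx : ∀ n, x n ∈ K) (hy : ∀ n, g n • x n ∈ K)
    (hx' : x' ∈ K) (hlim : Tendsto x atTop (𝓝 x')) (hg : Tendsto g atTop (𝓝 1))
    (hr : ∀ n, 0 < r n) (hr0 : Tendsto r atTop (𝓝 0))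
    (h20 : Tendsto (fun n => g n 2 0 / r n) atTop (𝓝 κ))
    (h21 : Tendsto (fun n => g n 2 1 / r n) atTop (𝓝 σ))
    (h10 : Tendsto (fun n => g n 1 0 / r n) atTop (𝓝 ρ)) (hθ : 0 < θ) (h1 : 0 < 1 + θ * κ) :
    LInv (hmat (θ * κ) (θ * σ) (θ * ρ) h1.ne') x' := by
  intro f hf
  set h := hmat (θ * κ) (θ * σ) (θ * ρ) h1.ne'
  have hF := hasCompactSupport_tr hf h
  obtain ⟨M, hM0, hM⟩ := exists_bound hf
  have hylim : Tendsto (fun n => g n • x n) atTop (𝓝 x') := by simpa using hg.smul hlim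
  refine eq_of_abs_sub_le_all fun ε₀ hε₀ => ?_
  set ε := ε₀ / (2 + 2 * M)
  have hε : 0 < ε := by positivity
  set ℓ := θ / (1 + θ * κ)
  have hℓ : 0 < ℓ := by positivity
  set C := (1 + θ * κ) ^ 2
  have hC : 0 < C := by positivity
  have hD := tendsto_denom (θ := θ) hg h20
  have hfst : Tendsto (Prod.fst : ℕ × ℝ → ℕ) (atTop ×ˢ 𝓝 θ) atTop := tendsto_fst
  have hder : Tendsto (fun p : ℕ × ℝ => C * ((g p.1 0 0 * g p.1 2 2 - g p.1 0 2 * g p.1 2 0) /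
      (g p.1 0 0 + p.2 / r p.1 * g p.1 2 0) ^ 2)) (atTop ×ˢ 𝓝 θ) (𝓝 1) := by
    have hG : ∀ i j, Tendsto (fun p : ℕ × ℝ => g p.1 i j) (atTop ×ˢ 𝓝 θ)
      (𝓝 ((1 : M₃) i j)) := fun i j => tendsto_entry (hg.comp hfst) i j
    have h2 := ((((hG 0 0).mul (hG 2 2)).sub ((hG 0 2).mul (hG 2 0))).div (hD.pow 2)
      (pow_ne_zero 2 h1.ne')).const_mul C
    have e : C * (((1 : M₃) 0 0 * (1 : M₃) 2 2 - (1 : M₃) 0 2 * (1 : M₃) 2 0) /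
        (1 + θ * κ) ^ 2) = 1 := by
      simp [C]; field_simp
    rw [e] at h2
    exact h2
  have hev : ∀ᶠ p : ℕ × ℝ in atTop ×ˢ 𝓝 θ,
      (∀ y, |f (disp (g p.1) (p.2 / r p.1) • y) - f (h • y)| < ε) ∧
      0 < g p.1 0 0 + p.2 / r p.1 * g p.1 2 0 ∧
      |C * ((g p.1 0 0 * g p.1 2 2 - g p.1 0 2 * g p.1 2 0) /
        (g p.1 0 0 + p.2 / r p.1 * g p.1 2 0) ^ 2) - 1| < ε ∧
      ℓ / 2 < r p.1 * phi (g p.1) (p.2 / r p.1) ∧ r p.1 * phi (g p.1) (p.2 / r p.1) < 2 * ℓ := by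
    have e1 := (tendsto_disp (θ := θ) hg hr hr0 h20 h21 h10 h1).eventually (unif_cont_tr hf h hε)
    have e2 := hD.eventually (eventually_gt_nhds h1)
    have e3 := (Metric.tendsto_nhds.1 hder) ε hε
    have e4 := (tendsto_phi (θ := θ) hg hr hr0 h20 h1).eventually
      (eventually_gt_nhds (show ℓ / 2 < ℓ by linarith))
    have e5 := (tendsto_phi (θ := θ) hg hr hr0 h20 h1).eventually
      (eventually_lt_nhds (show ℓ < 2 * ℓ by linarith))
    filter_upwards [e1, e2, e3, e4, e5] with p h1 h2 h3 h4 h5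
    exact ⟨h1, h2, by simpa [dist_eq] using h3, h4, h5⟩
  obtain ⟨pa, hpa, pb, hpb, hab⟩ := eventually_prod_iff.1 hev
  obtain ⟨δ₀, hδ₀, hball⟩ := Metric.eventually_nhds_iff.1 hpb
  set δ := δ₀ / 2
  have hδ : 0 < δ := by positivity
  have hwin : ∀ τ ∈ Icc θ (θ + δ), pb τ := by
    intro τ hτ
    refine hball ?_
    rw [dist_eq, abs_of_nonneg (by linarith [hτ.1])]
    have : δ₀ = 2 * δ := by simp only [δ]; ring
    linarith [hτ.2]
  set e := ε * δ / (2 * θ + δ + 4 * C * ℓ)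
  have he : 0 < e := by positivity
  obtain ⟨S₁, hS₁⟩ := hK.2 f hf e he
  obtain ⟨S₂, hS₂⟩ := hK.2 _ hF e he
  have hrinv : Tendsto (fun n => (r n)⁻¹) atTop atTop :=
    tendsto_inv_nhdsGT_zero.comp (tendsto_nhdsWithin_of_tendsto_nhds_of_eventually_within _ hr0
      (Eventually.of_forall hr))
  have main : ∀ᶠ n in atTop, |Lm f (g n • x n) - Lm (tr h f) (x n)| ≤ ε₀ := by
    filter_upwards [hpa, (hrinv.const_mul_atTop hθ).eventually_ge_atTop S₁,
      (hrinv.const_mul_atTop (half_pos hℓ)).eventually_ge_atTop S₂] with n hn hn1 hn2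
    have hrn := hr n
    set a := θ / r n with ha
    set b := (θ + δ) / r n with hb
    have ha0 : 0 < a := by positivity
    have hb0 : 0 < b := by positivity
    have hba : b - a = δ / r n := by simp only [a, b]; ring
    have habpos : a < b := by
      have : 0 < δ / r n := by positivity
      linarith
    have hwin' : ∀ s ∈ Icc a b, (∀ y, |f (disp (g n) s • y) - f (h • y)| < ε) ∧
        0 < g n 0 0 + s * g n 2 0 ∧
        |C * ((g n 0 0 * g n 2 2 - g n 0 2 * g n 2 0) / (g n 0 0 + s * g n 2 0) ^ 2) - 1| < ε ∧
        ℓ / 2 < r n * phi (g n) s ∧ r n * phi (g n) s < 2 * ℓ := by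
      intro s hs
      have := hab hn (hwin (s * r n) ⟨?_, ?_⟩)
      · simpa [hrn.ne'] using this
      · exact (div_le_iff₀ hrn).1 hs.1
      · exact (le_div_iff₀ hrn).1 hs.2
    let φ' : ℝ → ℝ := fun s => (g n 0 0 * g n 2 2 - g n 0 2 * g n 2 0) / (g n 0 0 + s * g n 2 0) ^ 2
    let Fx : ℝ → ℝ := fun s => tr h f (u s • x n)
    have hFx : Continuous Fx := continuous_orbit _ _
    have huIcc : uIcc a b = Icc a b := Set.uIcc_of_le habpos.le
    have hφ : ∀ s ∈ uIcc a b, HasDerivAt (phi (g n)) (φ' s) s := by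
      intro s hs
      rw [huIcc] at hs
      exact hasDerivAt_phi (hwin' s hs).2.1.ne'
    have hφc : ContinuousOn (phi (g n)) (uIcc a b) := fun s hs =>
      (hφ s hs).continuousAt.continuousWithinAt
    have hφ'c : ContinuousOn φ' (uIcc a b) := by
      refine ContinuousOn.div continuousOn_const (by fun_prop) ?_
      intro s hs
      rw [huIcc] at hs
      exact pow_ne_zero 2 (hwin' s hs).2.1.ne'
    have hcomp : ContinuousOn (fun s => Fx (phi (g n) s)) (uIcc a b) := hFx.comp_continuousOn hφc
    have hJ : |b - a| = b - a := abs_of_pos (by linarith)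
    have hmem : ∀ s, s ∈ Set.uIoc a b → s ∈ Icc a b := by
      intro s hs
      rw [Set.uIoc_of_le habpos.le] at hs
      exact ⟨hs.1.le, hs.2⟩
    have i1 : |(∫ s in a..b, f (u s • g n • x n)) - (b - a) * Lm f (g n • x n)| ≤ (a + b) * e := by
      have haS : S₁ ≤ a := by rw [ha, div_eq_mul_inv]; exact hn1
      exact window_bound ha0 hb0 (hS₁ a haS _ (hy n)) (hS₁ b (haS.trans habpos.le) _ (hy n))
    have i2 : |(∫ s in a..b, f (u s • g n • x n)) - ∫ s in a..b, Fx (phi (g n) s)| ≤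
        ε * (b - a) := by
      rw [← intervalIntegral.integral_sub (orbit_intervalIntegrable f _ a b)
        hcomp.intervalIntegrable, ← hJ, ← norm_eq_abs]
      refine intervalIntegral.norm_integral_le_of_norm_le_const fun s hs => ?_
      have := (hwin' s (hmem s hs)).1 (u (phi (g n) s) • x n)
      rw [smul_smul, disp_mul, mul_smul] at this
      exact this.le
    have hCi1 : IntervalIntegrable (fun s => C * (Fx (phi (g n) s) * φ' s)) volume a b :=
      (continuousOn_const.mul (hcomp.mul hφ'c)).intervalIntegrable
    have hCi2 : IntervalIntegrable (fun s => C * φ' s) volume a b :=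
      (continuousOn_const.mul hφ'c).intervalIntegrable
    have i3 : |(∫ s in a..b, Fx (phi (g n) s)) - C * ∫ s in a..b, Fx (phi (g n) s) * φ' s| ≤
        M * ε * (b - a) := by
      rw [← intervalIntegral.integral_const_mul, ← intervalIntegral.integral_sub
        hcomp.intervalIntegrable hCi1, ← hJ,
        ← norm_eq_abs]
      refine intervalIntegral.norm_integral_le_of_norm_le_const fun s hs => ?_
      have h3 := (hwin' s (hmem s hs)).2.2.1
      have : Fx (phi (g n) s) - C * (Fx (phi (g n) s) * φ' s) =
          - (Fx (phi (g n) s) * (C * φ' s - 1)) := by ring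
      rw [this, norm_neg, norm_mul]
      exact mul_le_mul (hM _) h3.le (abs_nonneg _) hM0.le
    have i4 : ∫ s in a..b, Fx (phi (g n) s) * φ' s = ∫ s in (phi (g n) a)..(phi (g n) b), Fx s :=
      intervalIntegral.integral_comp_mul_deriv hφ hφ'c hFx
    have i5 : |C * (phi (g n) b - phi (g n) a) - (b - a)| ≤ ε * (b - a) := by
      have e1 : ∫ s in a..b, φ' s = phi (g n) b - phi (g n) a :=
        intervalIntegral.integral_eq_sub_of_hasDerivAt hφ hφ'c.intervalIntegrable
      have e2 : ∫ _ in a..b, (1 : ℝ) = b - a := by simp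
      rw [← e1, ← e2, ← intervalIntegral.integral_const_mul, ← intervalIntegral.integral_sub
        hCi2 (by simp), e2]
      conv_rhs => rw [← hJ]
      rw [← norm_eq_abs]
      refine intervalIntegral.norm_integral_le_of_norm_le_const fun s hs => ?_
      exact (hwin' s (hmem s hs)).2.2.1.le
    have hra := hwin' a ⟨le_rfl, habpos.le⟩
    have hrb := hwin' b ⟨habpos.le, le_rfl⟩
    have hφlow : ∀ s, ℓ / 2 < r n * phi (g n) s → S₂ ≤ phi (g n) s ∧ 0 < phi (g n) s := by
      intro s hs
      have : ℓ / 2 * (r n)⁻¹ < phi (g n) s := by rw [← div_eq_mul_inv, div_lt_iff₀ hrn]; linarith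
      exact ⟨hn2.trans this.le, lt_trans (by positivity) this⟩
    have i6 := window_bound (f := tr h f) (x := x n) (e := e) (l := Lm (tr h f) (x n))
      (hφlow a hra.2.2.2.1).2 (hφlow b hrb.2.2.2.1).2 (hS₂ _ (hφlow a hra.2.2.2.1).1 _ (hx n))
      (hS₂ _ (hφlow b hrb.2.2.2.1).1 _ (hx n))
    have hLF : |Lm (tr h f) (x n)| ≤ M := abs_Lm_le (hK.1 (hx n)) hF fun y => hM _
    have hphi : phi (g n) a + phi (g n) b ≤ 4 * ℓ / r n := by
      rw [le_div_iff₀ hrn]; linarith [hra.2.2.2.2, hrb.2.2.2.2]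
    have hJpos : 0 < b - a := by linarith
    have hfin : (b - a) * |Lm f (g n • x n) - Lm (tr h f) (x n)| ≤ (b - a) * ε₀ := by
      rw [i4] at i3
      have i6' : |C * (∫ s in (phi (g n) a)..(phi (g n) b), Fx s) -
          C * (phi (g n) b - phi (g n) a) * Lm (tr h f) (x n)| ≤ C * (4 * ℓ / r n * e) := by
        rw [mul_assoc, ← mul_sub, abs_mul, abs_of_pos hC]
        refine mul_le_mul_of_nonneg_left (i6.trans ?_) hC.le
        exact mul_le_mul_of_nonneg_right hphi he.le
      have i5' : |C * (phi (g n) b - phi (g n) a) * Lm (tr h f) (x n) -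
          (b - a) * Lm (tr h f) (x n)| ≤ ε * (b - a) * M := by
        rw [← sub_mul, abs_mul]
        exact mul_le_mul i5 hLF (abs_nonneg _) (by positivity)
      have etot : (a + b) * e + C * (4 * ℓ / r n * e) = ε * (b - a) := by
        rw [hba]
        simp only [a, b, e]
        have : 2 * θ + δ + 4 * C * ℓ ≠ 0 := by positivity
        field_simp
        ring
      have eε : ε₀ = ε * (2 + 2 * M) := by simp only [ε]; field_simp
      have hch := abs_sub_chain i1 i2 i3 i6' i5'
      have hsum : (a + b) * e + ε * (b - a) + M * ε * (b - a) + C * (4 * ℓ / r n * e) +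
          ε * (b - a) * M = (b - a) * ε₀ := by
        rw [eε]; linear_combination etot
      calc (b - a) * |Lm f (g n • x n) - Lm (tr h f) (x n)| =
          |(b - a) * Lm f (g n • x n) - (b - a) * Lm (tr h f) (x n)| := by
            rw [← mul_sub, abs_mul, abs_of_pos hJpos]
        _ ≤ _ := hch
        _ = _ := hsum
    exact le_of_mul_le_mul_left hfin hJpos
  have hT := (hK.tendsto hf hy hx' hylim).sub (hK.tendsto hF hx hx' hlim)
  rw [abs_sub_comm]
  exact le_of_tendsto hT.abs main

end HP

/-! ### Points with extra invariance -/

/-- Generic points whose limiting distribution is invariant under all `e p`. -/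
def Om (e : ℝ → G) : Set X := {x | x ∈ Gen ∧ ∀ p, LInv (e p) x}

lemma measurableSet_Om {e : ℝ → G} (he : Continuous e) : MeasurableSet (Om e) := by
  have : Om e = ⋂ q : ℚ, {x | x ∈ Gen ∧ LInv (e q) x} := by
    ext x
    simp only [Om, Set.mem_iInter, Set.mem_ofPred_eq]
    refine ⟨fun h q => ⟨h.1, h.2 q⟩, fun h => ⟨(h 0).1, fun p => ?_⟩⟩
    have := Rat.isDenseEmbedding_coe_real.isDenseInducing.comap_nhds_neBot p
    exact inv_of_tendsto (h 0).1 ((he.tendsto p).comp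
      (tendsto_comap (f := ((↑) : ℚ → ℝ)))) (Eventually.of_forall fun q => (h q).2)
  rw [this]
  exact MeasurableSet.iInter fun q => measurableSet_inv _

lemma linv_pow {g : G} {x : X} (h : LInv g x) (n : ℕ) : LInv (g ^ n) x := by
  induction n with
  | zero => rw [pow_zero]; exact fun f _ => by rw [tr_one]
  | succ n ih => rw [pow_succ]; exact ih.mul h

lemma linv_all_of_small {e : ℝ → G} (hadd : ∀ s t, e (s + t) = e s * e t) (h0 : e 0 = 1) {x : X}
    {η : ℝ} (hη : 0 < η) (h : ∀ p, 0 < p → p < η → LInv (e p) x) (p : ℝ) : LInv (e p) x := by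
  have hpow : ∀ (n : ℕ) (p : ℝ), e (n * p) = e p ^ n := by
    intro n p
    induction n with
    | zero => simp [h0]
    | succ n ih => rw [pow_succ, ← ih, ← hadd]; push_cast; ring_nf
  have hpos : ∀ p, 0 < p → LInv (e p) x := by
    intro p hp
    obtain ⟨n, hn⟩ := exists_nat_gt (p / η)
    have hn0 : (0 : ℝ) < n := lt_trans (by positivity) hn
    have : e p = e (p / n) ^ n := by rw [← hpow]; congr 1; field_simp
    rw [this]
    refine linv_pow (h _ (by positivity) ?_) n
    rw [div_lt_iff₀ hη] at hn
    rw [div_lt_iff₀ hn0]; linarith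
  have hneg : ∀ p, e (-p) = (e p)⁻¹ := fun p => by rw [eq_inv_iff_mul_eq_one, ← hadd]; simp [h0]
  rcases lt_trichotomy p 0 with hp | rfl | hp
  · have := (hpos (-p) (by linarith)).inv
    rwa [← hneg, neg_neg] at this
  · rw [h0]; exact fun f _ => by rw [tr_one]
  · exact hpos p hp

lemma Om_smul {e : ℝ → G} {b : G} {c α : ℝ} (hb : Nrm b c) (hα : α ≠ 0)
    (hbe : ∀ p, b * e p * b⁻¹ = e (α * p)) {x : X} (hx : x ∈ Om e) : b • x ∈ Om e := by
  refine ⟨hb.mem_Gen hx.1, fun p => ?_⟩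
  have := (hx.2 (α⁻¹ * p)).conj hb hx.1
  rwa [hbe, mul_inv_cancel_left₀ hα] at this

lemma Om_u_iff {e : ℝ → G} (s : ℝ) {x : X} : u s • x ∈ Om e ↔ x ∈ Om e := by
  by_cases hx : x ∈ Gen
  · simp only [Om, Set.mem_ofPred_eq, (nrm_u s).mem_Gen_iff, inv_u_smul_iff hx]
  · exact ⟨fun h => absurd ((nrm_u s).mem_Gen_iff.1 h.1) hx, fun h => absurd h.1 hx⟩

lemma Om_e12_gSL_iff (t : ℝ) {x : X} : gSL t • x ∈ Om e12 ↔ x ∈ Om e12 := by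
  have h : ∀ t : ℝ, ∀ x : X, x ∈ Om e12 → gSL t • x ∈ Om e12 := fun t x hx =>
    Om_smul (nrm_gSL t) (Real.exp_ne_zero (3 * t)) (fun p => by
      rw [gSL_e12, mul_inv_cancel_right]) hx
  refine ⟨fun hx => ?_, h t x⟩
  have := h (-t) _ hx
  rwa [← gSL_inv, inv_smul_smul] at this

lemma Om_e23_gSL_iff (t : ℝ) {x : X} : gSL t • x ∈ Om e23 ↔ x ∈ Om e23 := by
  have h : ∀ t : ℝ, ∀ x : X, x ∈ Om e23 → gSL t • x ∈ Om e23 := fun t x hx =>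
    Om_smul (nrm_gSL t) one_ne_zero (fun p => by rw [gSL_e23, mul_inv_cancel_right, one_mul]) hx
  refine ⟨fun hx => ?_, h t x⟩
  have := h (-t) _ hx
  rwa [← gSL_inv, inv_smul_smul] at this

/-- A compact set of recurrent points inside a compact set of uniform convergence avoiding the
points of larger invariance. -/
structure GoodPair (K K' : Set X) : Prop where
  sub : K ⊆ K'
  isCompact : IsCompact K
  isCompact' : IsCompact K'
  uconv : UConv K'
  not12 : ∀ x ∈ K', x ∉ Om e12
  not23 : ∀ x ∈ K', x ∉ Om e23
  recur : ∀ x ∈ K, ∃ᶠ n : ℕ in atTop, gSL n • x ∈ K'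

lemma gSL_pow (n : ℕ) (t : ℝ) : gSL t ^ n = gSL (n * t) := by simp only [gSL_eq, dT_pow]

lemma exists_goodPair {ν : Measure X} [IsFiniteMeasure ν] (hu : ∀ s, MInv ν (u s))
    (hA : ∀ t, MInv ν (gSL t)) (h12 : ν (Om e12) = 0) (h23 : ν (Om e23) = 0) {E : Set X}
    (hE : MeasurableSet E) {ε : ℝ≥0∞} (hε : ε ≠ 0) :
    ∃ K K', GoodPair K K' ∧ K' ⊆ E ∧ ν E ≤ ν K + ε := by
  have hm12 : MeasurableSet (Om e12) := measurableSet_Om continuous_e12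
  have hm23 : MeasurableSet (Om e23) := measurableSet_Om continuous_e23
  obtain ⟨K', hK'E, hK', hU, hlt⟩ := exists_uconv hu ((hE.diff hm12).diff hm23)
    (ENNReal.half_pos hε).ne'
  have hrm : MeasurableSet {x : X | ∃ᶠ n : ℕ in atTop, gSL n • x ∈ K'} := by
    have := MeasurableSet.measurableSet_limsup (s := fun n : ℕ => (fun x : X => gSL n • x) ⁻¹' K')
      fun n => measurable_smulX _ hK'.isClosed.measurableSet
    convert this using 1
    ext x
    rw [mem_limsup_iff_frequently_mem]
    rfl
  obtain ⟨K, hKK', hK, hlt'⟩ := exists_isCompact_approx (ν := ν)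
    (hK'.isClosed.measurableSet.inter hrm) (ENNReal.half_pos hε).ne'
  refine ⟨K, K', ⟨fun x hx => (hKK' hx).1, hK, hK', hU, fun x hx => (hK'E hx).1.2,
    fun x hx => (hK'E hx).2, fun x hx => (hKK' hx).2⟩, fun x hx => (hK'E hx).1.1, ?_⟩
  have h1 : ν ((E \ Om e12) \ Om e23) = ν E := by
    rw [measure_sdiff_null h23, measure_sdiff_null h12]
  have h2 : ν (K' ∩ {x : X | ∃ᶠ n : ℕ in atTop, gSL n • x ∈ K'}) = ν K' := by
    refine measure_congr ?_
    filter_upwards [(hA 1).recurrence hK'.isClosed.measurableSet] with x hx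
    refine propext ⟨fun h => h.1, fun h => ⟨h, ?_⟩⟩
    simpa [gSL_pow] using hx h
  rw [h1] at hlt
  rw [h2] at hlt'
  calc ν E ≤ ν K' + ε / 2 := hlt.le
    _ ≤ ν K + ε / 2 + ε / 2 := by gcongr
    _ = ν K + ε := by rw [add_assoc, ENNReal.add_halves]

/-- Conjugates of the diagonal group `dd`. -/
def cj (m τ : ℝ) : G := e23 m * dd τ * e23 (-m)

lemma dd_add (s t : ℝ) : dd (s + t) = dd s * dd t := dT_add s t

lemma dd_zero : dd 0 = 1 := dT_zero

lemma continuous_dd : Continuous dd := continuous_dT (hw := by simp)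

lemma e23_neg_mul (m : ℝ) : e23 (-m) * e23 m = 1 := by rw [← e23_add]; simp [e23_zero]

lemma e23_inv (m : ℝ) : (e23 m)⁻¹ = e23 (-m) := inv_eq_of_mul_eq_one_left (e23_neg_mul m)

lemma cj_add (m s t : ℝ) : cj m (s + t) = cj m s * cj m t := by
  simp only [cj, dd_add, ← e23_inv]; group

lemma cj_zero (m : ℝ) : cj m 0 = 1 := by simp [cj, dd_zero, ← e23_inv]

lemma cj_apply (m τ : ℝ) (i j : Fin 3) : cj m τ i j =
    !![exp τ, 0, 0; 0, 1, m * exp (-τ) - m; 0, 0, exp (-τ)] i j := by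
  simp only [cj, G_mul_apply, dd, dT_apply]
  fin_cases i <;> fin_cases j <;> simp [e23]; ring

lemma hmat_eq_cj {κ ρ m : ℝ} (h : 0 < 1 + κ) (hm : m * κ = ρ) :
    hmat κ 0 ρ h.ne' = cj m (Real.log (1 + κ)) := by
  refine G_ext fun i j => ?_
  rw [cj_apply, Real.exp_neg, Real.exp_log h, ← hm]
  fin_cases i <;> fin_cases j <;> simp [hmat]
  field_simp; ring

lemma hmat_eq_e23 (ρ : ℝ) (h : (1 : ℝ) + 0 ≠ 0) : hmat 0 0 ρ h = e23 (-ρ) := by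
  refine G_ext fun i j => ?_
  fin_cases i <;> fin_cases j <;> simp [hmat, e23]

/-- Transversal approach in a good pair produces invariance under a conjugate of `dd`. -/
lemma transversal_limit {K K' : Set X} (hG : GoodPair K K') {x : ℕ → X} {g : ℕ → G}
    (hx : ∀ n, x n ∈ K) (hy : ∀ n, g n • x n ∈ K) (hg : Tendsto g atTop (𝓝 1))
    (hne : ∀ n, ¬ (g n 2 0 = 0 ∧ g n 2 1 = 0 ∧ g n 1 0 = 0)) :
    ∃ x' ∈ K, ∃ (ψ : ℕ → ℕ) (r : ℕ → ℝ) (κ ρ : ℝ), StrictMono ψ ∧ (∀ n, 0 < r n) ∧ κ ≠ 0 ∧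
      Tendsto (fun n => g (ψ n) 2 0 / r n) atTop (𝓝 κ) ∧
      Tendsto (fun n => g (ψ n) 2 1 / r n) atTop (𝓝 0) ∧
      Tendsto (fun n => g (ψ n) 1 0 / r n) atTop (𝓝 ρ) ∧ ∀ τ, LInv (cj (ρ / κ) τ) x' := by
  let R : ℕ → ℝ := fun n => max |g n 2 0| (max |g n 2 1| |g n 1 0|)
  have hR : ∀ n, 0 < R n := by
    intro n
    by_contra! h
    have h1 : |g n 2 0| ≤ R n := le_max_left _ _
    have h2 : |g n 2 1| ≤ R n := (le_max_left _ _).trans (le_max_right _ _)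
    have h3 : |g n 1 0| ≤ R n := (le_max_right _ _).trans (le_max_right _ _)
    exact hne n ⟨abs_nonpos_iff.1 (h1.trans h), abs_nonpos_iff.1 (h2.trans h),
      abs_nonpos_iff.1 (h3.trans h)⟩
  have hR0 : Tendsto R atTop (𝓝 0) := by
    have h1 := (tendsto_entry hg 2 0).abs.max ((tendsto_entry hg 2 1).abs.max
      (tendsto_entry hg 1 0).abs)
    simpa using h1
  have hIcc : ∀ (v : ℝ) n, |v| ≤ R n → v / R n ∈ Icc (-1 : ℝ) 1 := by
    intro v n h
    rw [Set.mem_Icc, ← abs_le, abs_div, abs_of_pos (hR n)]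
    exact (div_le_one (hR n)).2 h
  let Y : ℕ → X × ℝ × ℝ × ℝ := fun n => (x n, g n 2 0 / R n, g n 2 1 / R n, g n 1 0 / R n)
  have hcpt : IsCompact (K ×ˢ Icc (-1 : ℝ) 1 ×ˢ Icc (-1 : ℝ) 1 ×ˢ Icc (-1 : ℝ) 1) :=
    hG.isCompact.prod (isCompact_Icc.prod (isCompact_Icc.prod isCompact_Icc))
  obtain ⟨⟨x', κ, σ, ρ⟩, hmem, ψ, hψ, hlim⟩ := hcpt.tendsto_subseq (x := Y) fun n =>
    ⟨hx n, hIcc _ n (le_max_left _ _), hIcc _ n ((le_max_left _ _).trans (le_max_right _ _)),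
      hIcc _ n ((le_max_right _ _).trans (le_max_right _ _))⟩
  obtain ⟨hx', hκ1, hσ1, hρ1⟩ := hmem
  have l1 : Tendsto (fun n => x (ψ n)) atTop (𝓝 x') := (continuous_fst.tendsto _).comp hlim
  have l2 : Tendsto (fun n => g (ψ n) 2 0 / R (ψ n)) atTop (𝓝 κ) :=
    ((continuous_fst.comp continuous_snd).tendsto _).comp hlim
  have l3 : Tendsto (fun n => g (ψ n) 2 1 / R (ψ n)) atTop (𝓝 σ) :=
    ((continuous_fst.comp (continuous_snd.comp continuous_snd)).tendsto _).comp hlim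
  have l4 : Tendsto (fun n => g (ψ n) 1 0 / R (ψ n)) atTop (𝓝 ρ) :=
    ((continuous_snd.comp (continuous_snd.comp continuous_snd)).tendsto _).comp hlim
  have hmax : max |κ| (max |σ| |ρ|) = 1 := by
    refine tendsto_nhds_unique (l2.abs.max (l3.abs.max l4.abs)) ?_
    refine tendsto_const_nhds.congr fun n => ?_
    simp only [abs_div, abs_of_pos (hR (ψ n))]
    rw [max_div_div_right (hR _).le, max_div_div_right (hR _).le]
    exact (div_self (hR _).ne').symm
  have hpos : ∀ θ : ℝ, 0 < θ → θ < 1 / 2 → 0 < 1 + θ * κ := by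
    intro θ h0 h1
    have := hκ1.1
    nlinarith
  have hHP : ∀ θ (h0 : 0 < θ) (h1 : θ < 1 / 2),
      LInv (hmat (θ * κ) (θ * σ) (θ * ρ) (hpos θ h0 h1).ne') x' := fun θ h0 h1 =>
    h_principle hG.uconv (fun n => hG.sub (hx (ψ n))) (fun n => hG.sub (hy (ψ n))) (hG.sub hx') l1
      (hg.comp hψ.tendsto_atTop) (fun n => hR (ψ n)) (hR0.comp hψ.tendsto_atTop) l2 l3 l4 h0 (hpos θ h0 h1)
  have hσ : σ = 0 := by
    by_contra hσ
    obtain ⟨N, hN, hNK⟩ := extraction_of_frequently_atTop (hG.recur x' hx')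
    obtain ⟨x'', hx'', χ, hχ, hlim'⟩ := hG.isCompact'.tendsto_subseq hNK
    have hx'G : x' ∈ Gen := hG.uconv.1 (hG.sub hx')
    have hNlim : Tendsto (fun n => (N (χ n) : ℝ)) atTop atTop :=
      tendsto_natCast_atTop_atTop.comp (hN.comp hχ).tendsto_atTop
    have hexp : Tendsto (fun n => exp (-(3 * (N (χ n) : ℝ)))) atTop (𝓝 0) :=
      tendsto_exp_neg_atTop_nhds_zero.comp (hNlim.const_mul_atTop (by norm_num))
    have key : ∀ θ' : ℝ, 0 < θ' → LInv (e12 (θ' * σ)) x'' := by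
      intro θ' hθ'
      have hth : Tendsto (fun n => θ' * exp (-(3 * (N (χ n) : ℝ)))) atTop (𝓝 0) := by
        simpa using hexp.const_mul θ'
      have hsmall : ∀ᶠ n in atTop, θ' * exp (-(3 * (N (χ n) : ℝ))) < 1 / 2 :=
        hth.eventually (eventually_lt_nhds (by norm_num))
      have hD : ∀ κ : ℝ, Tendsto (fun n => 1 + θ' * exp (-(3 * (N (χ n) : ℝ))) * κ) atTop
          (𝓝 1) := by
        intro κ
        simpa using (hth.mul_const κ).const_add 1
      obtain ⟨n₀, hn₀⟩ := eventually_atTop.1 hsmall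
      have hpos' : ∀ n, 0 < θ' * exp (-(3 * (N (χ (n + n₀)) : ℝ))) := fun n => by positivity
      have hsm' : ∀ n, θ' * exp (-(3 * (N (χ (n + n₀)) : ℝ))) < 1 / 2 := fun n => hn₀ _ (by omega)
      refine hG.uconv.linv_of_tendsto (x := fun n => gSL (N (χ (n + n₀))) • x')
        (fun n => hNK _) hx'' ((tendsto_add_atTop_iff_nat n₀).2 hlim')
        (k := fun n => gSL (N (χ (n + n₀))) * hmat _ _ _ (hpos _ (hpos' n) (hsm' n)).ne' *
          (gSL (N (χ (n + n₀))))⁻¹) ?_ (Eventually.of_forall fun n =>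
          (hHP _ (hpos' n) (hsm' n)).conj (nrm_gSL _) hx'G)
      rw [tendsto_G_iff]
      intro i j
      simp only [gSL_conj_apply]
      have hD' := (tendsto_add_atTop_iff_nat n₀).2 (hD κ)
      have hth' := (tendsto_add_atTop_iff_nat n₀).2 hth
      have hρ' : Tendsto (fun n => -(θ' * exp (-(3 * (N (χ (n + n₀)) : ℝ))) * ρ) /
          (1 + θ' * exp (-(3 * (N (χ (n + n₀)) : ℝ))) * κ)) atTop (𝓝 0) := by
        have h := (hth'.mul_const ρ).neg.div hD' one_ne_zero
        simp only [zero_mul, neg_zero, zero_div] at h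
        exact h
      fin_cases i <;> fin_cases j
      · simpa [hmat, e12] using hD'
      · simp [hmat, e12]
        refine tendsto_const_nhds.congr fun n => ?_
        have : exp (N (χ (n + n₀)) * (2 + 1)) * exp (-(3 * (N (χ (n + n₀)) : ℝ))) = 1 := by
          rw [← exp_add]; ring_nf; simp
        linear_combination (-θ' * σ) * this
      · simp [hmat, e12]
      · simp [hmat, e12]
      · simp [hmat, e12]
      · simpa [hmat, e12] using hρ'
      · simp [hmat, e12]
      · simp [hmat, e12]
      · simpa [hmat, e12] using hD'.inv₀ one_ne_zero
    refine hG.not12 x'' hx'' ⟨hG.uconv.1 hx'', fun p => ?_⟩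
    have h1 := linv_all_of_small (e := fun θ => e12 (θ * σ)) (x := x'')
      (fun s t => by rw [add_mul, e12_add]) (by simp [e12_zero]) one_pos
      (fun θ h0 _ => key θ h0) (p / σ)
    simpa [hσ] using h1
  subst hσ
  have hκ : κ ≠ 0 := by
    rintro rfl
    have hρ : |ρ| = 1 := by simpa using hmax
    refine hG.not23 x' (hG.sub hx') ⟨hG.uconv.1 (hG.sub hx'), fun p => ?_⟩
    have hρ0 : ρ ≠ 0 := by rintro rfl; simp at hρ
    have h1 := linv_all_of_small (e := fun θ => e23 (-(θ * ρ))) (x := x')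
      (fun s t => by rw [← e23_add]; congr 1; ring) (by simp [e23_zero])
      (show (0 : ℝ) < 1 / 2 by norm_num) (fun θ h0 h1 => by
        have := hHP θ h0 h1
        simpa only [mul_zero, hmat_eq_e23] using this) (-p / ρ)
    simpa [hρ0] using h1
  refine ⟨x', hx', ψ, fun n => R (ψ n), κ, ρ, hψ, fun n => hR _, hκ, l2, l3, l4, ?_⟩
  have hcjθ : ∀ θ, 0 < θ → θ < 1 / 2 → LInv (cj (ρ / κ) (Real.log (1 + θ * κ))) x' := by
    intro θ h0 h1
    have := hHP θ h0 h1
    simp only [mul_zero] at this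
    rwa [hmat_eq_cj (m := ρ / κ) (hpos θ h0 h1) (by field_simp)] at this
  rcases lt_or_gt_of_ne hκ with hneg | hpos'
  · have h3 := linv_all_of_small (e := fun p => cj (ρ / κ) (-p)) (x := x')
      (fun s t => by rw [neg_add, cj_add]) (by simp [cj_zero])
      (show 0 < -Real.log (1 + 1 / 2 * κ) by
        have := Real.log_neg (show 0 < 1 + 1 / 2 * κ by linarith [hκ1.1]) (by linarith)
        linarith) (fun p h0 h1 => by
        have e1 : exp (-p) < 1 := Real.exp_lt_one_iff.2 (by linarith)
        have e2 : 1 + 1 / 2 * κ < exp (-p) := by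
          rw [← Real.log_lt_iff_lt_exp (by linarith [hκ1.1])]; linarith
        have := hcjθ ((1 - exp (-p)) / (-κ)) (div_pos (by linarith) (by linarith)) (by
          rw [div_lt_iff₀ (by linarith)]; linarith)
        have e3 : 1 + (1 - exp (-p)) / (-κ) * κ = exp (-p) := by field_simp; ring
        rwa [e3, Real.log_exp] at this)
    intro τ
    simpa using h3 (-τ)
  · exact linv_all_of_small (e := fun p => cj (ρ / κ) p) (x := x') (cj_add _) (cj_zero _)
      (Real.log_pos (show 1 < 1 + 1 / 2 * κ by linarith)) (fun p h0 h1 => by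
        have e1 : 1 < exp p := Real.one_lt_exp_iff.2 h0
        have e2 : exp p < 1 + 1 / 2 * κ := by rw [← Real.lt_log_iff_exp_lt (by linarith)]; exact h1
        have := hcjθ ((exp p - 1) / κ) (div_pos (by linarith) hpos') (by
          rw [div_lt_iff₀ hpos']; linarith)
        have e3 : 1 + (exp p - 1) / κ * κ = exp p := by field_simp; ring
        rwa [e3, Real.log_exp] at this)

/-! ### Transversal pairs -/

lemma measure_le_of_disjoint_translates
    (hu : ∀ s, MInv ν (u s)) {a : G} {lam r : ℝ} (hlam : 0 < lam) (hr : 0 < r)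
    (ha : ∀ j, a * u (lam * j) = u j * a) {z₀ : X} {O₂ O₄ : Set G}
    (hinj : ∀ g ∈ O₂, g • a • z₀ = a • z₀ → g = 1)
    (hO₄ : ∀ p ∈ O₄, ∀ q ∈ O₄, ∀ j, |j| ≤ r → p⁻¹ * u j * q ∈ O₂) {H : Set G}
    (hH : ∀ h ∈ H, a * h * a⁻¹ ∈ O₄) (hH2 : ∀ h ∈ H, ∀ h' ∈ H, |(h' * h⁻¹) 0 2| < 1)
    {Z : Set X} (hZm : MeasurableSet Z) (hZ : ∀ z ∈ Z, ∃ h ∈ H, z = h • z₀) :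
    ν.real Z * (r * lam) ≤ 1 := by
  let N := ⌊r * lam⌋₊
  let A : ℕ → Set X := fun i => (fun x => u (-(i : ℝ)) • x) ⁻¹' Z
  have hAm : ∀ i, MeasurableSet (A i) := fun i => measurable_smulX _ hZm
  have hAν : ∀ i, ν (A i) = ν Z := fun i => (hu _).preimage hZm
  have hdis : ∀ i ≤ N, ∀ k ≤ N, i ≠ k → Disjoint (A i) (A k) := by
    intro i hi k hk hik
    rw [Set.disjoint_left]
    intro x hxi hxk
    obtain ⟨h, hh, e1⟩ := hZ _ hxi
    obtain ⟨h', hh', e2⟩ := hZ _ hxk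
    let j : ℝ := ((i : ℝ) - k) / lam
    have hlj : lam * j = (i : ℝ) - k := by simp only [j]; field_simp
    have e3 : u (lam * j) • h • z₀ = h' • z₀ := by
      rw [← e1, ← e2]
      simp only [smul_smul, ← u_add, hlj]
      congr 2; ring
    have hj : |j| ≤ r := by
      have hN : (N : ℝ) ≤ r * lam := Nat.floor_le (by positivity)
      have hi' : (i : ℝ) ≤ N := by exact_mod_cast hi
      have hk' : (k : ℝ) ≤ N := by exact_mod_cast hk
      have h0 : (0 : ℝ) ≤ i := by positivity
      have h1 : (0 : ℝ) ≤ k := by positivity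
      rw [abs_div, abs_of_pos hlam, div_le_iff₀ hlam, abs_le]
      constructor <;> linarith
    have e4 : ((a * h' * a⁻¹)⁻¹ * u j * (a * h * a⁻¹)) • a • z₀ = a • z₀ := by
      have : (a * h' * a⁻¹)⁻¹ * u j * (a * h * a⁻¹) = a * h'⁻¹ * (a⁻¹ * (u j * a)) * h * a⁻¹ := by
        group
      rw [this, ← ha, inv_mul_cancel_left]
      have e5 : (a * h'⁻¹ * u (lam * j) * h * a⁻¹) • a • z₀ = a • h'⁻¹ • u (lam * j) • h • z₀ := by
        simp only [smul_smul]; congr 1; group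
      rw [e5, e3, inv_smul_smul]
    have e6 := hinj _ (hO₄ _ (hH h' hh') _ (hH h hh) j hj) e4
    have e7 : h' * h⁻¹ = u (lam * j) := by
      have : u j * a * h * a⁻¹ = a * h' * a⁻¹ := by
        rw [mul_assoc, inv_mul_eq_one] at e6
        rw [e6]; simp only [mul_assoc]
      rw [← ha, mul_left_inj, mul_assoc, mul_right_inj] at this
      rw [← this, mul_inv_cancel_right]
    have e8 := hH2 h hh h' hh'
    rw [e7, hlj] at e8
    have e9 : |((i : ℝ) - k)| < 1 := by simpa [u] using e8
    have e10 : |(i : ℤ) - k| < 1 := by exact_mod_cast e9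
    rw [Int.abs_lt_one_iff] at e10
    omega
  have hsum := sum_measure_le_measure_univ (μ := ν) (s := Finset.range (N + 1)) (t := A)
    (fun i _ => (hAm i).nullMeasurableSet) (fun i hi k hk hik => (hdis i (by simpa [Nat.lt_succ_iff]
      using hi) k (by simpa [Nat.lt_succ_iff] using hk) hik).aedisjoint)
  simp only [hAν, Finset.sum_const, Finset.card_range, measure_univ, nsmul_eq_mul] at hsum
  have h2 := toReal_mono one_ne_top hsum
  rw [toReal_mul, toReal_one, toReal_natCast] at h2
  have h3 : r * lam ≤ (N + 1 : ℕ) := by push_cast; exact (Nat.lt_floor_add_one _).le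
  have h4 : 0 ≤ ν.real Z := measureReal_nonneg
  calc ν.real Z * (r * lam) ≤ ν.real Z * (N + 1 : ℕ) := by gcongr
    _ ≤ 1 := by rw [mul_comm]; exact h2

/-- Neighbourhoods adapted to `measure_le_of_disjoint_translates`. -/
lemma exists_conj_window {O₂ : Set G} (hO₂ : O₂ ∈ 𝓝 (1 : G)) : ∃ ε > 0, ∃ r > 0,
    (∀ p ∈ nbox ε, ∀ q ∈ nbox ε, ∀ j, |j| ≤ r → p⁻¹ * u j * q ∈ O₂) ∧
    ∀ p ∈ nbox ε, ∀ q ∈ nbox ε, |(q * p⁻¹) 0 2| < 1 := by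
  have hc : Continuous (fun p : (G × G) × ℝ => p.1.1⁻¹ * u p.2 * p.1.2) :=
    (continuous_fst.fst.inv.mul (continuous_u.comp continuous_snd)).mul continuous_fst.snd
  have h1 := hc.tendsto ((1, 1), 0)
  simp only [inv_one, u_zero, mul_one] at h1
  have h2 := h1.eventually hO₂
  have hc' : Continuous (fun p : (G × G) × ℝ => |(p.1.2 * p.1.1⁻¹) 0 2|) :=
    ((continuous_entry 0 2).comp (continuous_fst.snd.mul continuous_fst.fst.inv)).abs
  have h3 : ∀ᶠ p : (G × G) × ℝ in 𝓝 ((1, 1), 0), |(p.1.2 * p.1.1⁻¹) 0 2| < 1 :=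
    (hc'.tendsto ((1, 1), 0)).eventually (eventually_lt_nhds (by simp))
  have h4 := h2.and h3
  rw [nhds_prod_eq, nhds_prod_eq] at h4
  obtain ⟨s, hs, t, ht, hst⟩ := mem_prod_iff.1 h4
  obtain ⟨s1, hs1, s2, hs2, hss⟩ := mem_prod_iff.1 hs
  obtain ⟨ε, hε, hε'⟩ := exists_nbox_subset (inter_mem hs1 hs2)
  obtain ⟨r, hr, hr'⟩ := Metric.mem_nhds_iff.1 ht
  refine ⟨ε, hε, r / 2, half_pos hr, fun p hp q hq j hj => ?_, fun p hp q hq => ?_⟩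
  · have : j ∈ t := hr' (by rw [mem_ball_zero_iff, norm_eq_abs]; linarith)
    exact (hst (mk_mem_prod (hss (mk_mem_prod (hε' hp).1 (hε' hq).2)) this)).1
  · have : (0 : ℝ) ∈ t := hr' (Metric.mem_ball_self hr)
    exact (hst (mk_mem_prod (hss (mk_mem_prod (hε' hp).1 (hε' hq).2)) this)).2

lemma exists_open_div_subset {O : Set G} (hO : O ∈ 𝓝 (1 : G)) : ∃ V : Set G, IsOpen V ∧
    (1 : G) ∈ V ∧ ∀ p ∈ V, ∀ q ∈ V, p * q⁻¹ ∈ O := by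
  have hc : Continuous (fun p : G × G => p.1 * p.2⁻¹) := by fun_prop
  have h1 := hc.tendsto (1, 1)
  simp only [inv_one, mul_one] at h1
  have h2 := h1 hO
  rw [mem_map, nhds_prod_eq] at h2
  obtain ⟨s, hs, t, ht, hst⟩ := mem_prod_iff.1 h2
  obtain ⟨V, hV, hVo, hV1⟩ := mem_nhds_iff.1 (inter_mem hs ht)
  exact ⟨V, hVo, hV1, fun p hp q hq => hst (mk_mem_prod (hV hp).1 (hV hq).2)⟩

/-- A compact set of positive measure contains arbitrarily close transversal pairs. -/
lemma exists_transversal (hu : ∀ s, MInv ν (u s))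
    (hA : ∀ t, MInv ν (gSL t)) {K : Set X} (hK : IsCompact K) (hKν : ν K ≠ 0) {O : Set G}
    (hO : O ∈ 𝓝 (1 : G)) : ∃ x ∈ K, ∃ g ∈ O, g • x ∈ K ∧ ¬ (g 2 0 = 0 ∧ g 1 0 = 0) := by
  by_contra! hcon
  obtain ⟨O₂, hO₂, hinj⟩ := injectivity hK
  obtain ⟨ε, hε, r, hr, hw1, hw2⟩ := exists_conj_window hO₂
  obtain ⟨V, hVo, hV1, hV⟩ := exists_open_div_subset (inter_mem hO (nbox_mem_nhds hε))
  obtain ⟨xs, hxs, hpos⟩ := exists_mem_forall_mem_nhdsWithin_pos_measure hKν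
  let W : Set X := (fun g : G => g • xs) '' V
  have hWo : IsOpen W := isOpenMap_smul_pt xs V hVo
  let Z := K ∩ W
  have hZm : MeasurableSet Z := hK.isClosed.measurableSet.inter hWo.measurableSet
  have hZpos : 0 < ν Z := hpos _ (inter_mem self_mem_nhdsWithin
    (mem_nhdsWithin_of_mem_nhds (hWo.mem_nhds ⟨1, hV1, one_smul _ _⟩)))
  obtain ⟨z₀, hz₀Z, hz₀⟩ : ∃ z₀ ∈ Z, ∃ᶠ n : ℕ in atTop, gSL (-1) ^ n • z₀ ∈ K := by
    by_contra! h
    have := (hA (-1)).recurrence hK.isClosed.measurableSet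
    refine hZpos.ne' (measure_mono_null (fun z hz => ?_) (ae_iff.1 this))
    intro h'
    exact h' hz.1 (h z hz)
  have hbound : ∀ n : ℕ, gSL (-1) ^ n • z₀ ∈ K → ν.real Z * (r * exp (3 * n)) ≤ 1 := by
    intro n hn
    rw [gSL_pow] at hn
    have hneg : (n : ℝ) * (-1) = -n := by ring
    rw [hneg] at hn
    refine measure_le_of_disjoint_translates hu (a := gSL (-n)) (exp_pos _) hr (fun j => ?_)
      (z₀ := z₀) (hinj _ hn) hw1 (H := {h | h ∈ nbox ε ∧ h 2 0 = 0 ∧ h 1 0 = 0}) ?_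
      (fun h hh h' hh' => hw2 h hh.1 h' hh'.1) hZm ?_
    · rw [gSL_u, ← mul_assoc, ← exp_add]; simp
    · rintro h ⟨h1, h2, h3⟩
      rw [gSL_eq]
      refine dT_conj_mem_nbox_of h1 fun i j => ?_
      have hn0 : (0 : ℝ) ≤ n := by positivity
      fin_cases i <;> fin_cases j <;> simp [h2, h3] <;> right <;> linarith
    · rintro z ⟨hzK, p, hp, rfl⟩
      obtain ⟨q, hq, hqz⟩ := hz₀Z.2
      have hz : p • xs = (p * q⁻¹) • z₀ := by rw [← hqz]; simp [smul_smul]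
      have hm := hV p hp q hq
      refine ⟨p * q⁻¹, ⟨hm.2, ?_⟩, hz⟩
      have := hcon z₀ hz₀Z.1 (p * q⁻¹) hm.1 (by rw [← hz]; exact hzK)
      exact this
  have hZr : 0 < ν.real Z := toReal_pos hZpos.ne' (measure_ne_top _ _)
  have hlim : Tendsto (fun n : ℕ => ν.real Z * (r * exp (3 * n))) atTop atTop := by
    refine Tendsto.const_mul_atTop hZr (Tendsto.const_mul_atTop hr (Real.tendsto_exp_atTop.comp ?_))
    exact tendsto_natCast_atTop_atTop.const_mul_atTop (by norm_num)
  obtain ⟨n, hn1, hn2⟩ := (hz₀.and_eventually (hlim.eventually_gt_atTop 1)).exists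
  exact absurd (hbound n hn1) (not_le.2 hn2)

/-! ### Reduction to measures invariant under `dd` -/

lemma cj_mul_cj (m m' τ : ℝ) : cj m τ * cj m' (-τ) = e23 ((m' - m) * (exp τ - 1)) := by
  refine G_ext fun i j => ?_
  have h : exp (-τ) * exp τ = 1 := by rw [← exp_add]; simp
  have h' : exp τ * exp (-τ) = 1 := by rw [mul_comm]; exact h
  simp only [G_mul_apply, cj_apply]
  fin_cases i <;> fin_cases j <;> simp [e23, h, h']
  linear_combination m * h

lemma cj_unique {x : X} (hx : x ∈ Gen) (h23 : x ∉ Om e23) {m m' : ℝ}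
    (h : ∀ τ, LInv (cj m τ) x) (h' : ∀ τ, LInv (cj m' τ) x) : m = m' := by
  by_contra hne
  have hne' : m' - m ≠ 0 := sub_ne_zero.2 (Ne.symm hne)
  refine h23 ⟨hx, fun p => ?_⟩
  have h1 := linv_all_of_small (e := fun θ => e23 ((m' - m) * θ)) (x := x)
    (fun s t => by rw [mul_add, e23_add]) (by simp [e23_zero]) one_pos (fun θ h0 _ => by
      have := (h (Real.log (1 + θ))).mul (h' (-Real.log (1 + θ)))
      rw [cj_mul_cj, Real.exp_log (by linarith)] at this
      simpa using this) (p / (m' - m))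
  simpa [mul_div_cancel₀ _ hne'] using h1

lemma continuous_cj (τ : ℝ) : Continuous (fun m => cj m τ) :=
  (continuous_e23.mul continuous_const).mul (continuous_e23.comp continuous_neg)

/-- The parameter of the conjugate of `dd` preserving the limiting distribution at `x`. -/
def mpar (x : X) : ℝ := Classical.epsilon fun m => ∀ τ, LInv (cj m τ) x

lemma mpar_spec {x : X} {m : ℝ} (h : ∀ τ, LInv (cj m τ) x) : ∀ τ, LInv (cj (mpar x) τ) x :=
  Classical.epsilon_spec (p := fun m => ∀ τ, LInv (cj m τ) x) ⟨m, h⟩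

lemma mpar_u {x : X} (hx : x ∈ Gen) (s : ℝ) : mpar (u s • x) = mpar x := by
  unfold mpar
  simp only [inv_u_smul_iff hx]

lemma gSL_cj (t m τ : ℝ) : gSL t * cj m τ * (gSL t)⁻¹ = cj m τ := by
  have h : gSL t * dd τ = dd τ * gSL t := by rw [gSL_eq]; exact dT_comm _ _
  rw [mul_inv_eq_iff_eq_mul, cj, ← mul_assoc, ← mul_assoc, gSL_e23, mul_assoc (e23 m) (gSL t), h,
    mul_assoc _ _ (gSL t), ← gSL_e23]
  simp only [mul_assoc]

lemma linv_cj_gSL {x : X} (hx : x ∈ Gen) (t m τ : ℝ) :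
    LInv (cj m τ) (gSL t • x) ↔ LInv (cj m τ) x := by
  constructor
  · intro h
    have := h.conj (nrm_gSL (-t)) ((nrm_gSL t).mem_Gen hx)
    rwa [gSL_cj, ← gSL_inv, inv_smul_smul] at this
  · intro h
    have := h.conj (nrm_gSL t) hx
    rwa [gSL_cj] at this

lemma mpar_gSL {x : X} (hx : x ∈ Gen) (t : ℝ) : mpar (gSL t • x) = mpar x := by
  unfold mpar
  simp only [linv_cj_gSL hx]

/-- Points of `K` with parameter bounded by `R`. -/
def starSet (K : Set X) (R : ℝ) : Set X := {x | x ∈ K ∧ ∃ m ∈ Icc (-R) R, ∀ τ, LInv (cj m τ) x}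

lemma isClosed_starSet {K : Set X} (hK : IsCompact K) (hU : UConv K) (R : ℝ) :
    IsClosed (starSet K R) := by
  refine IsSeqClosed.isClosed ?_
  intro x x' hx hlim
  have hx' : x' ∈ K := hK.isClosed.mem_of_tendsto hlim (Eventually.of_forall fun n => (hx n).1)
  choose hxK m hm hmi using hx
  obtain ⟨m', hm', ψ, hψ, hmlim⟩ := isCompact_Icc.tendsto_subseq hm
  refine ⟨hx', m', hm', fun τ => ?_⟩
  exact hU.linv_of_tendsto (fun n => hxK (ψ n)) hx' (hlim.comp hψ.tendsto_atTop)
    (((continuous_cj τ).tendsto m').comp hmlim) (Eventually.of_forall fun n => hmi (ψ n) τ)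

lemma continuousOn_mpar {K : Set X} (hU : UConv K) (h23 : ∀ x ∈ K, x ∉ Om e23) (R : ℝ) :
    ContinuousOn mpar (starSet K R) := by
  have hsp : ∀ x ∈ starSet K R, (∀ τ, LInv (cj (mpar x) τ) x) ∧ mpar x ∈ Icc (-R) R := by
    rintro x ⟨hxK, m, hm, hmi⟩
    have h1 := mpar_spec hmi
    exact ⟨h1, by rwa [cj_unique (hU.1 hxK) (h23 x hxK) h1 hmi]⟩
  rw [continuousOn_iff_continuous_domRestrict, continuous_iff_seqContinuous]
  intro x x' hlim
  have hlim' : Tendsto (fun n => (x n : X)) atTop (𝓝 (x' : X)) :=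
    (continuous_subtype_val.tendsto _).comp hlim
  refine tendsto_of_subseq_tendsto fun ns hns => ?_
  obtain ⟨m', hm', ψ, hψ, hmlim⟩ := isCompact_Icc.tendsto_subseq
    (x := fun n => mpar (x (ns n))) fun n => (hsp _ (x (ns n)).2).2
  refine ⟨ψ, ?_⟩
  have : m' = mpar x' := by
    refine cj_unique (hU.1 x'.2.1) (h23 _ x'.2.1) (fun τ => ?_) (hsp _ x'.2).1
    exact hU.linv_of_tendsto (fun n => (x (ns (ψ n))).2.1) x'.2.1
      (hlim'.comp (hns.comp hψ.tendsto_atTop)) (((continuous_cj τ).tendsto m').comp hmlim)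
      (Eventually.of_forall fun n => (hsp _ (x (ns (ψ n))).2).1 τ)
  rw [this] at hmlim
  exact hmlim

section
lemma exists_star_cover (hu : ∀ s, MInv ν (u s)) (hA : ∀ t, MInv ν (gSL t))
    (h12 : ν (Om e12) = 0) (h23 : ν (Om e23) = 0) : ∃ K : ℕ → Set X, (∀ n, IsCompact (K n)) ∧
      (∀ n, UConv (K n)) ∧ (∀ n, ∀ x ∈ K n, x ∉ Om e23) ∧
      ∀ᵐ x ∂ν, x ∈ ⋃ p : ℕ × ℕ, starSet (K p.1) p.2 := by
  have hm23 : MeasurableSet (Om e23) := measurableSet_Om continuous_e23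
  have hex : ∀ n : ℕ, ∃ K ⊆ (Om e23)ᶜ, IsCompact K ∧ UConv K ∧
      ν (Om e23)ᶜ < ν K + ((n + 1 : ℕ) : ℝ≥0∞)⁻¹ := fun n =>
    exists_uconv hu hm23.compl (by simp)
  choose K hK23 hKc hKU hKν using hex
  refine ⟨K, hKc, hKU, fun n x hx => hK23 n hx, ?_⟩
  have hKae : ∀ᵐ x ∂ν, x ∈ ⋃ n, K n := by
    have h1 : ν (Om e23)ᶜ = 1 := by rw [prob_compl_eq_one_iff hm23, h23]
    have h2 : (1 : ℝ≥0∞) ≤ ν (⋃ n, K n) + 0 := by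
      refine ge_of_tendsto' (tendsto_const_nhds.add ((tendsto_add_atTop_iff_nat 1).2
        ENNReal.tendsto_inv_nat_nhds_zero)) fun n => ?_
      rw [← h1]
      exact (hKν n).le.trans (add_le_add_left (measure_mono (Set.subset_iUnion K n)) _)
    rw [add_zero] at h2
    exact mem_ae_iff.2 ((prob_compl_eq_zero_iff (MeasurableSet.iUnion fun n =>
      (hKc n).isClosed.measurableSet)).2 (le_antisymm prob_le_one h2))
  have hSm : MeasurableSet (⋃ p : ℕ × ℕ, starSet (K p.1) p.2) :=
    MeasurableSet.iUnion fun p => (isClosed_starSet (hKc _) (hKU _) _).measurableSet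
  have hKm : MeasurableSet (⋃ n, K n) := MeasurableSet.iUnion fun n => (hKc n).isClosed.measurableSet
  by_contra hcon
  have hpos : ν ((⋃ n, K n) \ ⋃ p : ℕ × ℕ, starSet (K p.1) p.2) ≠ 0 := by
    intro h0
    apply hcon
    filter_upwards [hKae, measure_eq_zero_iff_ae_notMem.1 h0] with x hx1 hx2
    by_contra hx3
    exact hx2 ⟨hx1, hx3⟩
  obtain ⟨Q, Q', hQ, hQE, hQν⟩ := exists_goodPair hu hA h12 h23 (hKm.diff hSm)
    (ENNReal.half_pos hpos).ne'
  have hQ0 : ν Q ≠ 0 := by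
    intro h0
    rw [h0, zero_add] at hQν
    exact absurd (ENNReal.half_lt_self hpos (measure_ne_top _ _)) (not_lt.2 hQν)
  have hseq : ∀ n : ℕ, ∃ x ∈ Q, ∃ g ∈ nbox (1 / ((n : ℝ) + 1)), g • x ∈ Q ∧
      ¬ (g 2 0 = 0 ∧ g 1 0 = 0) := fun n =>
    exists_transversal hu hA hQ.isCompact hQ0 (nbox_mem_nhds (by positivity))
  choose x hxQ g hg hgx hne using hseq
  have hg1 : Tendsto g atTop (𝓝 1) := by
    rw [tendsto_G_iff]
    intro i j
    rw [tendsto_iff_norm_sub_tendsto_zero]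
    exact squeeze_zero (fun n => norm_nonneg _) (fun n => (hg n i j).le)
      tendsto_one_div_add_atTop_nhds_zero_nat
  obtain ⟨x', hx', -, -, κ, ρ, -, -, -, -, -, -, hinv⟩ := transversal_limit hQ hxQ hgx hg1
    fun n h => hne n ⟨h.1, h.2.2⟩
  have hx'E := hQE (hQ.sub hx')
  obtain ⟨n, hn⟩ := Set.mem_iUnion.1 hx'E.1
  obtain ⟨R, hR⟩ := exists_nat_ge |ρ / κ|
  exact hx'E.2 (Set.mem_iUnion.2 ⟨(n, R), hn, ρ / κ, abs_le.1 hR, hinv⟩)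

lemma exists_dd_inv (hu : ∀ s, MInv ν (u s)) (hA : ∀ t, MInv ν (gSL t))
    (h12 : ν (Om e12) = 0) (h23 : ν (Om e23) = 0) : ∃ ν' : Measure X, IsProbabilityMeasure ν' ∧
      (∀ s, MInv ν' (u s)) ∧ (∀ t, MInv ν' (gSL t)) ∧ (∀ t, MInv ν' (dd t)) ∧
      ν' (Om e12) = 0 ∧ ν' (Om e23) = 0 ∧ ν' (Om dd)ᶜ = 0 := by
  obtain ⟨K, hKc, hKU, hK23, hKae⟩ := exists_star_cover hu hA h12 h23
  have hmm : AEMeasurable mpar ν := by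
    rw [← Measure.restrict_eq_self_of_ae_mem hKae, aemeasurable_iUnion_iff]
    intro p
    exact (continuousOn_mpar (hKU _) (hK23 _) _).aemeasurable
      (isClosed_starSet (hKc _) (hKU _) _).measurableSet
  let Φ : X → X := fun x => e23 (-mpar x) • x
  have hΦ : AEMeasurable Φ ν := by
    have hc : Continuous (fun p : ℝ × X => e23 (-p.1) • p.2) :=
      (continuous_e23.comp continuous_fst.neg).smul continuous_snd
    have hp : AEMeasurable (fun x : X => (mpar x, x)) ν := hmm.prodMk aemeasurable_id
    have h := Measurable.comp_aemeasurable (g := fun p : ℝ × X => e23 (-p.1) • p.2) hc.measurable hp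
    exact h
  have hGen := ae_mem_Gen hu
  have hstar : ∀ᵐ x ∂ν, ∀ τ, LInv (cj (mpar x) τ) x := by
    filter_upwards [hKae] with x hx
    obtain ⟨p, -, m, -, hm⟩ := Set.mem_iUnion.1 hx
    exact mpar_spec hm
  let ν' := Measure.map Φ ν
  have hprob : IsProbabilityMeasure ν' := Measure.isProbabilityMeasure_map hΦ
  have hinv : ∀ b : G, MInv ν b → (∀ x ∈ Gen, Φ (b • x) = b • Φ x) → MInv ν' b := by
    intro b hb hcomm
    refine MInv.of_integral fun f hf => ?_
    have e : ∫ x, f (b • x) ∂ν' = ∫ x, f (b • Φ x) ∂ν :=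
      integral_map hΦ (tr b f).continuous.aestronglyMeasurable
    rw [e, integral_map hΦ f.continuous.aestronglyMeasurable, ← hb.integral (fun x => f (Φ x))]
    refine integral_congr_ae ?_
    filter_upwards [hGen] with x hx
    rw [hcomm x hx]
  have hu' : ∀ s, MInv ν' (u s) := fun s => hinv _ (hu s) fun x hx => by
    simp only [Φ, mpar_u hx, smul_smul, e23_u]
  have hA' : ∀ t, MInv ν' (gSL t) := fun t => hinv _ (hA t) fun x hx => by
    simp only [Φ, mpar_gSL hx, smul_smul, gSL_e23]
  have hback : ∀ x, e23 (mpar x) • Φ x = x := fun x => by simp only [Φ, ← e23_inv, smul_inv_smul]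
  have hdd : ∀ᵐ y ∂ν', y ∈ Om dd := by
    refine (ae_map_iff (p := fun y => y ∈ Om dd) hΦ (measurableSet_Om continuous_dd)).2 ?_
    filter_upwards [hGen, hstar] with x hx hsx
    refine ⟨(nrm_e23 _).mem_Gen hx, fun τ => ?_⟩
    have := (hsx τ).conj (nrm_e23 (-mpar x)) hx
    have e : e23 (-mpar x) * cj (mpar x) τ * (e23 (-mpar x))⁻¹ = dd τ := by
      rw [cj, ← e23_inv]; group
    rwa [e] at this
  refine ⟨ν', hprob, hu', hA', fun t => mInv_of_ae_inv hu' ?_, ?_, ?_, mem_ae_iff.1 hdd⟩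
  · filter_upwards [hdd] with y hy using hy.2 t
  · rw [Measure.map_apply_of_aemeasurable hΦ (measurableSet_Om continuous_e12)]
    refine measure_mono_null (fun x hx => ?_) h12
    have hx : Φ x ∈ Om e12 := hx
    rw [← hback x]
    refine ⟨(nrm_e23 _).mem_Gen hx.1, fun p => ?_⟩
    have h1 := ((hx.2 p).mul (inv_u hx.1 (mpar x * p))).conj (nrm_e23 (mpar x)) hx.1
    have e : e23 (mpar x) * (e12 p * u (mpar x * p)) * (e23 (mpar x))⁻¹ = e12 p := by
      rw [mul_inv_eq_iff_eq_mul]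
      refine G_ext fun i j => ?_
      simp only [G_mul_apply]
      fin_cases i <;> fin_cases j <;> simp [e23, e12, u]; ring
    rwa [e] at h1
  · rw [Measure.map_apply_of_aemeasurable hΦ (measurableSet_Om continuous_e23)]
    refine measure_mono_null (fun x hx => ?_) h23
    have hx : Φ x ∈ Om e23 := hx
    rw [← hback x]
    exact Om_smul (nrm_e23 _) one_ne_zero (fun p => by
      rw [← e23_add, add_comm, e23_add, mul_inv_cancel_right, one_mul]) hx
end

/-! ### Transverse coordinates for measures invariant under `dd` -/

lemma isOpen_nbox (ε : ℝ) : IsOpen (nbox ε) := by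
  have : nbox ε = ⋂ i, ⋂ j, {g : G | |g i j - (1 : M₃) i j| < ε} := by ext g; simp [nbox]
  rw [this]
  refine isOpen_iInter_of_finite fun i => isOpen_iInter_of_finite fun j => ?_
  exact isOpen_lt ((continuous_entry i j).sub continuous_const).abs continuous_const

lemma cj_zero_left (τ : ℝ) : cj 0 τ = dd τ := by simp [cj, e23_zero]

/-- Nearby points of a good set are displaced mainly in the direction `e31`. -/
lemma exists_cone {K K' : Set X} (hG : GoodPair K K') (hdd : K ⊆ Om dd) {ε : ℝ} (hε : 0 < ε) :
    ∃ O ∈ 𝓝 (1 : G), ∀ x ∈ K, ∀ g ∈ O, g • x ∈ K → |g 2 1| + |g 1 0| ≤ ε * |g 2 0| := by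
  by_contra! hcon
  have hseq := fun n : ℕ => hcon (nbox (1 / ((n : ℝ) + 1))) (nbox_mem_nhds (by positivity))
  choose x hxK g hg hgx hlt using hseq
  have hg1 : Tendsto g atTop (𝓝 1) := by
    rw [tendsto_G_iff]
    intro i j
    rw [tendsto_iff_norm_sub_tendsto_zero]
    exact squeeze_zero (fun n => norm_nonneg _) (fun n => (hg n i j).le)
      tendsto_one_div_add_atTop_nhds_zero_nat
  obtain ⟨x', hx', ψ, r, κ, ρ, hψ, hr, hκ, l1, l2, l3, hinv⟩ := transversal_limit hG hxK hgx hg1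
    (fun n h => by have := hlt n; rw [h.1, h.2.1, h.2.2] at this; simp at this)
  have hm : ρ / κ = 0 := cj_unique (hG.uconv.1 (hG.sub hx')) (hG.not23 _ (hG.sub hx')) hinv
    (fun τ => by rw [cj_zero_left]; exact (hdd hx').2 τ)
  have hρ : ρ = 0 := by simpa [hκ] using hm
  subst hρ
  have h1 := l2.abs.add l3.abs
  have h2 := l1.abs.const_mul ε
  simp only [abs_zero, add_zero] at h1
  have h3 : ε * |κ| ≤ 0 := by
    refine le_of_tendsto_of_tendsto' h2 h1 fun n => ?_
    simp only [abs_div, abs_of_pos (hr n)]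
    rw [← add_div, ← mul_div_assoc]
    exact (div_le_div_iff_of_pos_right (hr n)).2 (hlt (ψ n)).le
  have : 0 < ε * |κ| := by positivity
  linarith

/-- A function whose distribution on small balls is controlled infinitely often has bounded
density. -/
lemma measure_le_of_frequently_ball {α : Type*} [MeasurableSpace α] {m : Measure α}
    [IsFiniteMeasure m] {χ : α → ℝ} (hχ : AEMeasurable χ m) {c : ℝ≥0∞}
    (h : ∀ᵐ z ∂m, ∃ᶠ r in 𝓝[>] (0 : ℝ), c * m.map χ (Metric.closedBall (χ z) r) ≤
      volume (Metric.closedBall (χ z) r)) {B : Set ℝ} (hB : MeasurableSet B) :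
    c * m.map χ B ≤ volume B := by
  set ρ := m.map χ
  have h0 : ∀ᵐ z ∂m, c ≤ (volume : Measure ℝ).rnDeriv ρ (χ z) := by
    filter_upwards [h, ae_of_ae_map hχ
      (Besicovitch.ae_tendsto_rnDeriv (volume : Measure ℝ) ρ)] with z ht hlim
    by_contra! hlt
    have h2 := hlim.eventually (eventually_lt_nhds hlt)
    obtain ⟨r, ⟨hr1, hr2⟩, hr3⟩ := ((ht.and_eventually h2).and_eventually
      self_mem_nhdsWithin).exists
    have hr3 : 0 < r := hr3
    rcases eq_or_ne (ρ (Metric.closedBall (χ z) r)) 0 with h0 | h0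
    · rw [h0] at hr2
      rw [ENNReal.div_zero (by simp [hr3])] at hr2
      exact not_top_lt hr2
    · rw [ENNReal.div_lt_iff (Or.inl h0) (Or.inl (measure_ne_top _ _))] at hr2
      exact absurd hr1 (not_le.2 hr2)
  have h1 : ∀ᵐ t ∂ρ, c ≤ (volume : Measure ℝ).rnDeriv ρ t :=
    (ae_map_iff hχ (measurableSet_le measurable_const (Measure.measurable_rnDeriv _ _))).2 h0
  calc c * ρ B = ∫⁻ _ in B, c ∂ρ := by rw [setLIntegral_const]
    _ ≤ ∫⁻ t in B, (volume : Measure ℝ).rnDeriv ρ t ∂ρ :=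
      setLIntegral_mono_ae' hB (h1.mono fun t ht _ => ht)
    _ ≤ volume B := Measure.setLIntegral_rnDeriv_le B

/-- Displacement from `w` to `z`. -/
def gam (ε : ℝ) (w z : X) : G := Classical.epsilon fun g => g ∈ nbox ε ∧ z = g • w

lemma gam_spec {ε : ℝ} {w z : X} (h : ∃ g ∈ nbox ε, z = g • w) :
    gam ε w z ∈ nbox ε ∧ z = gam ε w z • w :=
  Classical.epsilon_spec (p := fun g => g ∈ nbox ε ∧ z = g • w) h

/-- A patch: a set of positive measure on which displacements are unique, small, continuous and
mainly in the direction `e31`. -/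
structure Patch (ν : Measure X) (K P : Set X) (ε η r : ℝ) : Prop where
  sub : P ⊆ K
  meas : MeasurableSet P
  pos : ν P ≠ 0
  eps : ε ≤ 1 / 10
  η_pos : 0 < η
  r_pos : 0 < r
  mem : ∀ w ∈ P, ∀ z ∈ P, gam ε w z ∈ nbox ε ∧ z = gam ε w z • w
  uniq : ∀ w ∈ P, ∀ g ∈ nbox ε, g • w ∈ P → g = gam ε w (g • w)
  cocycle : ∀ w ∈ P, ∀ z ∈ P, ∀ y ∈ P, gam ε w y = gam ε z y * gam ε w z
  cont : ∀ w ∈ P, ContinuousOn (gam ε w) P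
  cone : ∀ w ∈ P, ∀ z ∈ P, |gam ε w z 2 1| + |gam ε w z 1 0| ≤ 1 / 10 * |gam ε w z 2 0|
  bound : ∀ w ∈ P, ∀ n : ℕ, dd (-n) • w ∈ K →
    ν.real {z | z ∈ P ∧ |gam ε w z 2 0| ≤ η * exp (-(2 * n))} * (r * exp (2 * n)) ≤ 1

open scoped Pointwise in
lemma exists_nbox_triple {O : Set G} (hO : O ∈ 𝓝 (1 : G)) :
    ∃ ε > 0, ∀ p ∈ nbox ε, ∀ q ∈ nbox ε, ∀ k ∈ nbox ε, p⁻¹ * q * k ∈ O := by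
  obtain ⟨V, hVo, hV1, hV⟩ := exists_open_div_subset hO
  obtain ⟨W, hWo, hW1, hW⟩ := exists_open_div_subset (hVo.mem_nhds hV1)
  have hVi : V⁻¹ ∈ 𝓝 (1 : G) := hVo.inv.mem_nhds (by simpa using hV1)
  have hWi : W⁻¹ ∈ 𝓝 (1 : G) := hWo.inv.mem_nhds (by simpa using hW1)
  obtain ⟨ε, hε, hεs⟩ := exists_nbox_subset (inter_mem hVi hWi)
  refine ⟨ε, hε, fun p hp q hq k hk => ?_⟩
  have h1 := hW _ (hεs hp).2 _ (hεs hq).2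
  have h2 := hV _ h1 _ (hεs hk).1
  simpa using h2

lemma dd_conj_mem_nbox {ε ε₁ : ℝ} (hε : ε ≤ ε₁) {h : G} (h1 : h ∈ nbox ε)
    (h2 : |h 2 1| + |h 1 0| ≤ 1 / 10 * |h 2 0|) (n : ℕ)
    (h3 : |h 2 0| ≤ ε₁ / 2 * exp (-(2 * n))) : dd (-n) * h * (dd (-n))⁻¹ ∈ nbox ε₁ := by
  have hε0 : 0 < ε₁ := ((abs_nonneg _).trans_lt (h1 0 0)).trans_le hε
  have hn : (0 : ℝ) ≤ n := n.cast_nonneg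
  have hsc : ∀ c x y : ℝ, c ≤ 1 → 0 ≤ c → |x| < ε → c * |x| < ε₁ := by
    intro c x _ hc hc0 hx
    calc c * |x| ≤ 1 * |x| := by gcongr
      _ < ε₁ := by linarith
  have hlow : ∀ c x : ℝ, c ≤ 2 * n → |x| ≤ |h 2 0| → exp c * |x| < ε₁ := by
    intro c x hc hx
    calc exp c * |x| ≤ exp (2 * n) * (ε₁ / 2 * exp (-(2 * n))) := by
          gcongr; exact hx.trans h3
      _ = ε₁ / 2 := by rw [mul_left_comm, ← exp_add]; simp
      _ < ε₁ := by linarith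
  have a0 := abs_nonneg (h 2 1)
  have a1 := abs_nonneg (h 1 0)
  have a2 := abs_nonneg (h 2 0)
  have hd := fun i j => h1 i j
  intro i j
  rw [dd_conj_apply]
  fin_cases i <;> fin_cases j <;> simp
  · have := hd 0 0; simp at this; linarith
  · have := hd 0 1; simp at this
    refine hsc _ _ 0 (exp_le_one_iff.2 ?_) (exp_pos _).le this
    linarith
  · have := hd 0 2; simp at this
    refine hsc _ _ 0 (exp_le_one_iff.2 ?_) (exp_pos _).le this
    linarith
  · refine hlow _ _ ?_ ?_ <;> linarith
  · have := hd 1 1; simp at this; linarith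
  · have := hd 1 2; simp at this
    refine hsc _ _ 0 (exp_le_one_iff.2 ?_) (exp_pos _).le this
    linarith
  · refine hlow _ _ ?_ le_rfl; linarith
  · refine hlow _ _ ?_ ?_ <;> linarith
  · have := hd 2 2; simp at this; linarith

lemma exists_patch (hu : ∀ s, MInv ν (u s))
    {K K' : Set X} (hG : GoodPair K K') (hdd : K ⊆ Om dd) (hKν : ν K ≠ 0) :
    ∃ P ε η r, Patch ν K P ε η r := by
  obtain ⟨O₂, hO₂, hinj⟩ := injectivity hG.isCompact
  obtain ⟨ε₁, hε₁, r, hr, hw1, hw2⟩ := exists_conj_window hO₂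
  obtain ⟨O, hO, hcone⟩ := exists_cone hG hdd (ε := 1 / 10) (by norm_num)
  obtain ⟨ε₂, hε₂, hε₂O⟩ := exists_nbox_subset hO
  obtain ⟨ε₃, hε₃, htriple₃⟩ := exists_nbox_triple hO₂
  obtain ⟨ε, hε, hε1, hε2, hε3, hε4⟩ : ∃ ε > 0, ε ≤ ε₁ ∧ ε ≤ ε₂ ∧ ε ≤ ε₃ ∧ ε ≤ 1 / 10 :=
    ⟨min (min ε₁ ε₂) (min ε₃ (1 / 10)), lt_min (lt_min hε₁ hε₂) (lt_min hε₃ (by norm_num)),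
      (min_le_left _ _).trans (min_le_left _ _), (min_le_left _ _).trans (min_le_right _ _),
      (min_le_right _ _).trans (min_le_left _ _), (min_le_right _ _).trans (min_le_right _ _)⟩
  have hmono : ∀ {a b : ℝ}, a ≤ b → nbox a ⊆ nbox b := fun hab g hg i j => (hg i j).trans_le hab
  have hεε₁ : nbox ε ⊆ nbox ε₁ := hmono hε1
  have hεO : nbox ε ⊆ O := (hmono hε2).trans hε₂O
  have hεε₃ : nbox ε ⊆ nbox ε₃ := hmono hε3
  have htriple : ∀ p ∈ nbox ε, ∀ q ∈ nbox ε, ∀ k ∈ nbox ε, p⁻¹ * q * k ∈ O₂ := by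
    exact fun p hp q hq k hk => htriple₃ p (hεε₃ hp) q (hεε₃ hq) k (hεε₃ hk)
  obtain ⟨V, hVo, hV1, hV⟩ := exists_open_div_subset (nbox_mem_nhds hε)
  obtain ⟨xs, hxs, hpos⟩ := exists_mem_forall_mem_nhdsWithin_pos_measure hKν
  let W : Set X := (fun g : G => g • xs) '' V
  have hWo : IsOpen W := isOpenMap_smul_pt xs V hVo
  let P := K ∩ W
  have hPm : MeasurableSet P := hG.isCompact.isClosed.measurableSet.inter hWo.measurableSet
  have hPpos : 0 < ν P := hpos _ (inter_mem self_mem_nhdsWithin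
    (mem_nhdsWithin_of_mem_nhds (hWo.mem_nhds ⟨1, hV1, one_smul _ _⟩)))
  have hex : ∀ w ∈ P, ∀ z ∈ P, ∃ g ∈ nbox ε, z = g • w := by
    rintro w ⟨-, q, hq, rfl⟩ z ⟨-, p, hp, rfl⟩
    exact ⟨p * q⁻¹, hV p hp q hq, by simp [smul_smul]⟩
  have hmem : ∀ w ∈ P, ∀ z ∈ P, gam ε w z ∈ nbox ε ∧ z = gam ε w z • w := fun w hw z hz =>
    gam_spec (hex w hw z hz)
  have h1ε : (1 : G) ∈ nbox ε := by intro i j; simpa using hε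
  have huniq : ∀ w ∈ P, ∀ g ∈ nbox ε, g • w ∈ P → g = gam ε w (g • w) := by
    intro w hw g hg hgw
    obtain ⟨h3, h4⟩ := hmem w hw _ hgw
    have := hinj w hw.1 (g⁻¹ * gam ε w (g • w)) (by simpa using htriple g hg _ h3 1 h1ε)
      (by rw [mul_smul, ← h4, inv_smul_smul])
    exact (inv_mul_eq_one.1 this)
  have hcontg : ∀ w ∈ P, ContinuousOn (gam ε w) P := by
    intro w hw z hz
    obtain ⟨a1, a2⟩ := hmem w hw z hz
    intro N hN
    have hN' : N ∩ nbox ε ∈ 𝓝 (gam ε w z) := inter_mem hN ((isOpen_nbox ε).mem_nhds a1)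
    have h5 := (isOpenMap_smul_pt w).image_mem_nhds hN'
    rw [← a2] at h5
    have h6 : (fun g : G => g • w) '' (N ∩ nbox ε) ∩ P ∈ 𝓝[P] z :=
      inter_mem (mem_nhdsWithin_of_mem_nhds h5) self_mem_nhdsWithin
    rw [mem_map]
    refine mem_of_superset h6 ?_
    rintro _ ⟨⟨g, ⟨hgN, hgε⟩, rfl⟩, hP⟩
    have := huniq w hw g hgε hP
    change gam ε w (g • w) ∈ N
    rwa [← this]
  refine ⟨P, ε, ε₁ / 2, r, ⟨fun x hx => hx.1, hPm, hPpos.ne', hε4, half_pos hε₁, hr, hmem, huniq, ?_, ?_, ?_, ?_⟩⟩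
  · intro w hw z hz y hy
    obtain ⟨a1, a2⟩ := hmem w hw y hy
    obtain ⟨b1, b2⟩ := hmem z hz y hy
    obtain ⟨c1, c2⟩ := hmem w hw z hz
    have := hinj w hw.1 ((gam ε w y)⁻¹ * gam ε z y * gam ε w z) (htriple _ a1 _ b1 _ c1)
      (by rw [mul_smul, mul_smul, ← c2, ← b2, inv_smul_eq_iff]; exact a2)
    rw [mul_assoc] at this
    exact inv_mul_eq_one.1 this
  · exact hcontg
  · intro w hw z hz
    obtain ⟨a1, a2⟩ := hmem w hw z hz
    exact hcone w hw.1 _ (hεO a1) (by rw [← a2]; exact hz.1)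
  · intro w hw n hn
    have hcont : ContinuousOn (fun z => |gam ε w z 2 0|) P := by
      have hcg := hcontg w hw
      have h7 : ContinuousOn (fun z => gam ε w z 2 0) P := (continuous_entry 2 0).comp_continuousOn hcg
      exact h7.abs
    refine measure_le_of_disjoint_translates hu (a := dd (-n)) (exp_pos _) hr (fun j => ?_)
      (z₀ := w) (hinj _ hn) hw1 (H := {h | h ∈ nbox ε ∧ |h 2 1| + |h 1 0| ≤ 1 / 10 * |h 2 0| ∧
        |h 2 0| ≤ ε₁ / 2 * exp (-(2 * n))}) ?_
      (fun h hh h' hh' => hw2 h (hεε₁ hh.1) h' (hεε₁ hh'.1)) ?_ ?_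
    · rw [dd_u, ← mul_assoc, ← exp_add]; simp
    · rintro h ⟨h3, h4, h5⟩
      exact dd_conj_mem_nbox hε1 h3 h4 n h5
    · obtain ⟨F, hF, hFP⟩ := (continuousOn_iff_isClosed.1 hcont)
        (Set.Iic (ε₁ / 2 * exp (-(2 * n)))) isClosed_Iic
      have : {z | z ∈ P ∧ |gam ε w z 2 0| ≤ ε₁ / 2 * exp (-(2 * n))} = F ∩ P := by
        rw [← hFP]; ext z; simp [and_comm]
      rw [this]
      exact hF.measurableSet.inter hPm
    · rintro z ⟨hz, hz2⟩
      obtain ⟨a1, a2⟩ := hmem w hw z hz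
      exact ⟨gam ε w z, ⟨a1, hcone w hw.1 _ (hεO a1) (by rw [← a2]; exact hz.1), hz2⟩, a2⟩

/-! ### The transverse direction is charged -/

/-- Transverse coordinate on a patch. -/
def chi (ε : ℝ) (w z : X) : ℝ := gam ε w z 2 0 / gam ε w z 2 2

lemma nbox_diag {ε : ℝ} {g : G} (hg : g ∈ nbox ε) (i : Fin 3) : |g i i - 1| < ε := by
  simpa using hg i i

lemma nbox_off {ε : ℝ} {g : G} (hg : g ∈ nbox ε) {i j : Fin 3} (h : i ≠ j) : |g i j| < ε := by
  simpa [one_apply_ne h] using hg i j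

section
variable {K P : Set X} {ε η r : ℝ}

lemma Patch.diag (hP : Patch ν K P ε η r) {w z : X} (hw : w ∈ P) (hz : z ∈ P) (i : Fin 3) :
    9 / 10 < gam ε w z i i ∧ gam ε w z i i < 11 / 10 := by
  have h1 := abs_lt.1 (nbox_diag (hP.mem w hw z hz).1 i)
  have h2 := hP.eps
  constructor <;> linarith [h1.1, h1.2]

lemma Patch.off (hP : Patch ν K P ε η r) {w z : X} (hw : w ∈ P) (hz : z ∈ P) {i j : Fin 3}
    (h : i ≠ j) : |gam ε w z i j| < 1 / 10 :=
  (nbox_off (hP.mem w hw z hz).1 h).trans_le hP.eps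

lemma Patch.abs_chi_le (hP : Patch ν K P ε η r) {w z : X} (hw : w ∈ P) (hz : z ∈ P) :
    |chi ε w z| ≤ 1 := by
  have h1 := (hP.diag hw hz 2).1
  have h2 := hP.off hw hz (i := 2) (j := 0) (by decide)
  rw [chi, abs_div, abs_of_pos (by linarith : 0 < gam ε w z 2 2), div_le_one (by linarith)]
  linarith

lemma Patch.abs_gam_le (hP : Patch ν K P ε η r) {w z₀ z : X} (hw : w ∈ P) (hz₀ : z₀ ∈ P)
    (hz : z ∈ P) : |gam ε z₀ z 2 0| ≤ 2 * |chi ε w z - chi ε w z₀| := by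
  have hc := hP.cocycle w hw z₀ hz₀ z hz
  have hcone := hP.cone z₀ hz₀ z hz
  obtain ⟨a1, a2⟩ := hP.diag hw hz₀ 0
  obtain ⟨b1, b2⟩ := hP.diag hw hz₀ 2
  obtain ⟨c1, c2⟩ := hP.diag hw hz 2
  have d1 := abs_lt.1 (hP.off hw hz₀ (i := 0) (j := 2) (by decide))
  have d2 := abs_lt.1 (hP.off hw hz₀ (i := 2) (j := 0) (by decide))
  have d3 := abs_lt.1 (hP.off hw hz₀ (i := 1) (j := 0) (by decide))
  have d4 := abs_lt.1 (hP.off hw hz₀ (i := 1) (j := 2) (by decide))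
  unfold chi
  have e0 : gam ε w z 2 0 = gam ε z₀ z 2 0 * gam ε w z₀ 0 0 + gam ε z₀ z 2 1 * gam ε w z₀ 1 0 +
      gam ε z₀ z 2 2 * gam ε w z₀ 2 0 := by rw [hc, G_mul_apply]
  have e2 : gam ε w z 2 2 = gam ε z₀ z 2 0 * gam ε w z₀ 0 2 + gam ε z₀ z 2 1 * gam ε w z₀ 1 2 +
      gam ε z₀ z 2 2 * gam ε w z₀ 2 2 := by rw [hc, G_mul_apply]
  generalize gam ε w z 2 0 = h0 at *
  generalize gam ε w z 2 2 = h2 at *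
  generalize gam ε z₀ z 2 0 = g0 at *
  generalize gam ε z₀ z 2 1 = g1 at *
  generalize gam ε z₀ z 2 2 = g2 at *
  generalize gam ε z₀ z 1 0 = g3 at *
  generalize gam ε w z₀ 0 0 = k00 at *
  generalize gam ε w z₀ 2 2 = k22 at *
  generalize gam ε w z₀ 0 2 = k02 at *
  generalize gam ε w z₀ 2 0 = k20 at *
  generalize gam ε w z₀ 1 0 = k10 at *
  generalize gam ε w z₀ 1 2 = k12 at *
  have key : h0 / h2 - k20 / k22 = (g0 * (k00 * k22 - k02 * k20) + g1 * (k10 * k22 - k12 * k20)) /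
      (h2 * k22) := by
    rw [div_sub_div _ _ (by linarith) (by linarith), e0, e2]
    congr 1; ring
  have hpos : 0 < h2 * k22 := mul_pos (by linarith) (by linarith)
  have hle : h2 * k22 ≤ 121 / 100 := by nlinarith
  rw [key, abs_div, abs_of_pos hpos, ← mul_div_assoc, le_div_iff₀ hpos]
  have q1 : 79 / 100 ≤ k00 * k22 - k02 * k20 := by nlinarith
  have q2 : |k10 * k22 - k12 * k20| ≤ 13 / 100 := by rw [abs_le]; constructor <;> nlinarith
  have q3 : |g1| ≤ 1 / 10 * |g0| := by linarith [abs_nonneg g3]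
  have q4 := abs_sub_abs_le_abs_sub (g0 * (k00 * k22 - k02 * k20)) (-(g1 * (k10 * k22 - k12 * k20)))
  rw [sub_neg_eq_add, abs_neg, abs_mul, abs_mul g1, abs_of_pos (by linarith : 0 <
    k00 * k22 - k02 * k20)] at q4
  have q5 : |g1| * |k10 * k22 - k12 * k20| ≤ 1 / 10 * |g0| * (13 / 100) := by gcongr
  have q6 := abs_nonneg g0
  have q7 : |g0| * (79 / 100) ≤ |g0| * (k00 * k22 - k02 * k20) := by gcongr
  have q8 : |g0| * (h2 * k22) ≤ |g0| * (121 / 100) := by gcongr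
  linarith

lemma Patch.aemeasurable_chi (hP : Patch ν K P ε η r) {w : X} (hw : w ∈ P) :
    AEMeasurable (chi ε w) (ν.restrict P) := by
  refine ContinuousOn.aemeasurable (fun z hz => ?_) hP.meas
  have h := hP.cont w hw z hz
  have h1 : ContinuousWithinAt (fun z => gam ε w z 2 0) P z :=
    (continuous_entry 2 0).continuousAt.comp_continuousWithinAt h
  have h2 : ContinuousWithinAt (fun z => gam ε w z 2 2) P z :=
    (continuous_entry 2 2).continuousAt.comp_continuousWithinAt h
  exact h1.div h2 (by linarith [(hP.diag hw hz 2).1])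

lemma dd_pow (t : ℝ) (n : ℕ) : dd t ^ n = dd (n * t) := by
  induction n with
  | zero => simp [dd_zero]
  | succ n ih => rw [pow_succ, ih, ← dd_add]; congr 1; push_cast; ring

lemma Patch.measure_chi_le (hP : Patch ν K P ε η r) (hd : ∀ t, MInv ν (dd t)) {w : X}
    (hw : w ∈ P) {B : Set ℝ} (hB : MeasurableSet B) :
    ofReal (η * r) * ν.restrict P (chi ε w ⁻¹' B) ≤ volume B := by
  rw [← Measure.map_apply_of_aemeasurable (hP.aemeasurable_chi hw) hB]
  refine measure_le_of_frequently_ball (hP.aemeasurable_chi hw) ?_ hB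
  rw [ae_restrict_iff' hP.meas]
  filter_upwards [(hd (-1)).recurrence hP.meas] with z hz hzP
  have h1 := hz hzP
  have hη := hP.η_pos
  have hr := hP.r_pos
  have ht : Tendsto (fun n : ℕ => η / 2 * exp (-(2 * n))) atTop (𝓝[>] 0) := by
    rw [tendsto_nhdsWithin_iff]
    refine ⟨?_, Eventually.of_forall fun n => by simp only [Set.mem_Ioi]; positivity⟩
    have : Tendsto (fun n : ℕ => exp (-(2 * (n : ℝ)))) atTop (𝓝 0) :=
      tendsto_exp_neg_atTop_nhds_zero.comp (tendsto_natCast_atTop_atTop.const_mul_atTop two_pos)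
    simpa using this.const_mul (η / 2)
  refine ht.frequently (h1.mono fun n hn => ?_)
  rw [dd_pow, mul_neg_one] at hn
  have h2 := hP.bound z hzP n (hP.sub hn)
  rw [Measure.map_apply_of_aemeasurable (hP.aemeasurable_chi hw) Metric.isClosed_closedBall.measurableSet,
    Measure.restrict_apply' hP.meas, Real.volume_closedBall]
  have h3 : ν (chi ε w ⁻¹' Metric.closedBall (chi ε w z) (η / 2 * exp (-(2 * n))) ∩ P) ≤
      ofReal (ν.real {y | y ∈ P ∧ |gam ε z y 2 0| ≤ η * exp (-(2 * n))}) := by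
    rw [ofReal_measureReal]
    refine measure_mono fun y hy => ⟨hy.2, ?_⟩
    have h4 := hP.abs_gam_le hw hzP hy.2
    have h5 : |chi ε w y - chi ε w z| ≤ η / 2 * exp (-(2 * n)) := by
      have := hy.1; rwa [Set.mem_preimage, Metric.mem_closedBall, dist_eq] at this
    linarith
  refine (mul_le_mul_right h3 _).trans ?_
  rw [← ofReal_mul (by positivity)]
  refine ofReal_le_ofReal ?_
  have he : exp (-(2 * (n : ℝ))) * exp (2 * n) = 1 := by rw [← exp_add]; simp
  have := mul_le_mul_of_nonneg_left h2 (by positivity : 0 ≤ η * exp (-(2 * (n : ℝ))))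
  calc _ = η * exp (-(2 * n)) * (ν.real {y | y ∈ P ∧ |gam ε z y 2 0| ≤
        η * exp (-(2 * n))} * (r * exp (2 * n))) := by
        linear_combination (-η * r * ν.real {y | y ∈ P ∧ |gam ε z y 2 0| ≤ η * exp (-(2 * n))}) * he
    _ ≤ _ := this.trans (le_of_eq (by ring))

end

/-- Quantitative recurrence. -/
lemma MInv.exists_return {h : G} (hi : MInv ν h)
    {P : Set X} (hPm : MeasurableSet P) (hP : ν P ≠ 0) : ∃ δ > 0, ∃ᶠ n in atTop,
      δ ≤ ν.real (P ∩ (fun x => h ^ n • x) ⁻¹' P) := by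
  have hp : 0 < ν.real P := by rw [measureReal_def]; exact toReal_pos hP (measure_ne_top _ _)
  obtain ⟨N, hN⟩ := exists_nat_gt (2 / ν.real P)
  have hN0 : (0 : ℝ) < N := (by positivity : 0 < 2 / ν.real P).trans hN
  rw [div_lt_iff₀ hp] at hN
  refine ⟨ν.real P / (2 * N), by positivity, ?_⟩
  rw [frequently_atTop]
  intro a
  by_contra! hcon
  let E : ℕ → Set X := fun i => (fun x => h ^ (i * (a + 1)) • x) ⁻¹' P
  have hEm : ∀ i, MeasurableSet (E i) := fun i => measurable_smulX _ hPm
  have hItg : ∀ i j, j < i → ν.real (E i ∩ E j) ≤ ν.real P / (2 * N) := by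
    intro i j hji
    have e : E i ∩ E j = (fun x => h ^ (j * (a + 1)) • x) ⁻¹'
        (P ∩ (fun x => h ^ ((i - j) * (a + 1)) • x) ⁻¹' P) := by
      ext x
      simp only [E, Set.mem_inter_iff, Set.mem_preimage, smul_smul, ← pow_add, ← add_mul,
        Nat.sub_add_cancel hji.le]
      exact and_comm
    rw [e, measureReal_def, (hi.pow _).preimage (hPm.inter (measurable_smulX _ hPm)),
      ← measureReal_def]
    refine (hcon _ ?_).le
    have : 1 ≤ i - j := by omega
    nlinarith
  have hEν : ∀ i, ν.real (E i) = ν.real P := fun i => by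
    rw [measureReal_def, (hi.pow _).preimage hPm, ← measureReal_def]
  let D : ℕ → Set X := fun i => E i \ ⋃ j ∈ Finset.range i, E j
  have hDm : ∀ i, MeasurableSet (D i) := fun i =>
    (hEm i).diff (Finset.measurableSet_biUnion _ fun j _ => hEm j)
  have hD : ∀ i < N, ν.real P / 2 ≤ ν.real (D i) := by
    intro i hiN
    have h1 : E i ⊆ D i ∪ ⋃ j ∈ Finset.range i, (E i ∩ E j) := by
      intro x hx
      by_cases hx' : x ∈ ⋃ j ∈ Finset.range i, E j
      · right
        simp only [Set.mem_iUnion] at hx' ⊢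
        obtain ⟨j, hj, hxj⟩ := hx'
        exact ⟨j, hj, hx, hxj⟩
      · exact Or.inl ⟨hx, hx'⟩
    have h2 := (measureReal_mono (μ := ν) h1).trans (measureReal_union_le _ _)
    have h3 : ν.real (⋃ j ∈ Finset.range i, (E i ∩ E j)) ≤ i * (ν.real P / (2 * N)) := by
      refine (measureReal_biUnion_finset_le _ _).trans ?_
      calc _ ≤ ∑ j ∈ Finset.range i, ν.real P / (2 * N) :=
            Finset.sum_le_sum fun j hj => hItg i j (Finset.mem_range.1 hj)
        _ = _ := by simp
    have h4 : (i : ℝ) * (ν.real P / (2 * N)) ≤ N * (ν.real P / (2 * N)) := by gcongr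
    have h5 : N * (ν.real P / (2 * N)) = ν.real P / 2 := by field_simp
    rw [hEν] at h2
    linarith
  have hdis : ∀ i j, i < j → Disjoint (D i) (D j) := by
    intro i j hij
    rw [Set.disjoint_left]
    rintro x hx hx'
    exact hx'.2 (Set.mem_biUnion (Finset.mem_coe.2 (Finset.mem_range.2 hij)) hx.1)
  have hsum : ∑ i ∈ Finset.range N, ν.real (D i) ≤ 1 := by
    rw [← measureReal_biUnion_finset (fun i _ j _ hij => by
      rcases lt_or_gt_of_ne hij with h | h
      · exact hdis _ _ h
      · exact (hdis _ _ h).symm) fun i _ => hDm i]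
    exact measureReal_le_one
  have : ∑ i ∈ Finset.range N, ν.real P / 2 ≤ ∑ i ∈ Finset.range N, ν.real (D i) :=
    Finset.sum_le_sum fun i hi => hD i (Finset.mem_range.1 hi)
  simp at this
  linarith

section
variable {K P : Set X} {ε η r : ℝ}

lemma Patch.conj_bounds (hP : Patch ν K P ε η r) {z y : X} (hz : z ∈ P) (hy : y ∈ P) (n : ℕ)
    (h : |gam ε z y 2 0| ≤ 2 * exp (-(2 * n))) {g : G}
    (hg : g = dd (-n) * gam ε z y * (dd (-n))⁻¹) :
    (∀ i, |g i i - 1| ≤ 1 / 10) ∧ |g 2 0| ≤ 2 ∧ g 2 0 / g 2 2 = exp (2 * n) * chi ε z y ∧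
      ∀ i j, i ≠ j → (i, j) ≠ (2, 0) → |g i j| ≤ exp (-n) := by
  have hn : (0 : ℝ) ≤ n := n.cast_nonneg
  have hcone := hP.cone z hz y hy
  have hE : ∀ i j, g i j = exp (-n * ((![1, 0, -1] : ℝ³) i - ![1, 0, -1] j)) * gam ε z y i j :=
    fun i j => by rw [hg, dd_conj_apply]
  have h20 : g 2 0 = exp (2 * n) * gam ε z y 2 0 := by rw [hE]; congr 2; simp; ring
  have h22 : g 2 2 = gam ε z y 2 2 := by rw [hE]; simp
  have he : exp (2 * n) * exp (-(2 * (n : ℝ))) = 1 := by rw [← exp_add]; simp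
  have hlow : ∀ x, |x| ≤ 1 / 10 * |gam ε z y 2 0| → exp n * |x| ≤ exp (-n) := by
    intro x hx
    have : exp (n : ℝ) * exp (-(2 * (n : ℝ))) = exp (-n) := by rw [← exp_add]; ring_nf
    calc _ ≤ exp (n : ℝ) * (1 * exp (-(2 * (n : ℝ)))) := by
          gcongr
          have := exp_pos (-(2 * (n : ℝ)))
          linarith
      _ = _ := by rw [one_mul, this]
  have hup : ∀ {i j : Fin 3}, i ≠ j → ∀ c : ℝ, c ≤ -n → exp c * |gam ε z y i j| ≤ exp (-n) := by
    intro i j hij c hc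
    have := hP.off hz hy hij
    calc _ ≤ exp (-n) * 1 := by gcongr; linarith
      _ = _ := mul_one _
  refine ⟨fun i => ?_, ?_, ?_, fun i j hij hne => ?_⟩
  · have h1 : g i i = gam ε z y i i := by rw [hE]; simp
    rw [h1]
    exact (nbox_diag (hP.mem z hz y hy).1 i).le.trans hP.eps
  · rw [h20, abs_mul, abs_of_pos (exp_pos _)]
    calc _ ≤ exp (2 * n) * (2 * exp (-(2 * (n : ℝ)))) := by gcongr
      _ = 2 := by linear_combination 2 * he
  · rw [h20, h22, chi, mul_div_assoc]
  · rw [hE, abs_mul, abs_of_pos (exp_pos _)]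
    have a1 := abs_nonneg (gam ε z y 2 1)
    have a2 := abs_nonneg (gam ε z y 1 0)
    fin_cases i <;> fin_cases j <;> simp at hij hne ⊢
    · simpa using hup (i := 0) (j := 1) (by decide) (-n) le_rfl
    · refine hup (i := 0) (j := 2) (by decide) _ ?_; linarith
    · exact hlow _ (by linarith)
    · simpa using hup (i := 1) (j := 2) (by decide) (-n) le_rfl
    · exact hlow _ (by linarith)

lemma Patch.zoom_step (hP : Patch ν K P ε η r) {δ : ℝ} (hδ : 0 < δ) (n : ℕ)
    (hn : δ ≤ ν.real (P ∩ (fun x => dd (-n) • x) ⁻¹' P)) :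
    ∃ z ∈ P, dd (-n) • z ∈ P ∧ ∃ Q ⊆ P ∩ (fun x => dd (-n) • x) ⁻¹' P,
      (∀ y ∈ Q, |gam ε z y 2 0| ≤ 2 * exp (-(2 * n))) ∧
      δ / 5 * exp (-(2 * n)) ≤ ν.real Q := by
  set A := P ∩ (fun x => dd (-n) • x) ⁻¹' P
  obtain ⟨w, hw⟩ := nonempty_of_measure_ne_zero hP.pos
  let m : ℕ := ⌈exp (2 * n)⌉₊
  let Q : ℤ → Set X := fun k => {z | z ∈ A ∧ ⌊exp (2 * n) * chi ε w z⌋ = k}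
  have hcov : A ⊆ ⋃ k ∈ Finset.Icc (-m : ℤ) m, Q k := by
    intro z hz
    simp only [Set.mem_iUnion]
    refine ⟨_, ?_, hz, rfl⟩
    have h1 := abs_le.1 (hP.abs_chi_le hw hz.1)
    have h2 : exp (2 * n) ≤ m := Nat.le_ceil _
    have h3 := exp_pos (2 * (n : ℝ))
    rw [Finset.mem_Icc]
    constructor
    · rw [Int.le_floor]; push_cast; nlinarith
    · have : ⌊exp (2 * n) * chi ε w z⌋ ≤ ⌊(m : ℝ)⌋ := Int.floor_le_floor (by nlinarith)
      simpa using this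
  have hm : (m : ℝ) ≤ exp (2 * n) + 1 := (Nat.ceil_lt_add_one (exp_pos _).le).le
  have h1e : 1 ≤ exp (2 * (n : ℝ)) := Real.one_le_exp (by positivity)
  have hex : ∃ k, δ / 5 * exp (-(2 * n)) ≤ ν.real (Q k) := by
    by_contra! hcon
    have h1 := (measureReal_mono (μ := ν) hcov (measure_ne_top _ _)).trans
      (measureReal_biUnion_finset_le _ _)
    have h2 : ∑ k ∈ Finset.Icc (-m : ℤ) m, ν.real (Q k) <
        ∑ k ∈ Finset.Icc (-m : ℤ) m, δ / 5 * exp (-(2 * n)) :=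
      Finset.sum_lt_sum_of_nonempty ⟨0, by simp⟩ fun k _ => hcon k
    rw [Finset.sum_const, Int.card_Icc, nsmul_eq_mul] at h2
    have h3 : (((m : ℤ) + 1 - -(m : ℤ)).toNat : ℝ) = 2 * m + 1 := by
      have : ((m : ℤ) + 1 - -(m : ℤ)).toNat = 2 * m + 1 := by omega
      rw [this]; push_cast; ring
    rw [h3] at h2
    have he : exp (2 * n) * exp (-(2 * (n : ℝ))) = 1 := by rw [← exp_add]; simp
    have h4 : (2 * (m : ℝ) + 1) * (δ / 5 * exp (-(2 * n))) ≤
        (5 * exp (2 * n)) * (δ / 5 * exp (-(2 * n))) := by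
      gcongr; linarith
    have h5 : (5 * exp (2 * n)) * (δ / 5 * exp (-(2 * n))) = δ := by linear_combination δ * he
    linarith
  obtain ⟨k, hk⟩ := hex
  have hpos : 0 < ν.real (Q k) := lt_of_lt_of_le (by positivity) hk
  obtain ⟨z, hz⟩ : (Q k).Nonempty := by
    rw [Set.nonempty_iff_ne_empty]; intro h; rw [h] at hpos; simp at hpos
  refine ⟨z, hz.1.1, hz.1.2, Q k, fun y hy => hy.1, fun y hy => ?_, hk⟩
  have h1 := hP.abs_gam_le hw hz.1.1 hy.1.1
  have h2 := Int.abs_sub_lt_one_of_floor_eq_floor (hy.2.trans hz.2.symm)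
  rw [← mul_sub, abs_mul, abs_of_pos (exp_pos _)] at h2
  have : |chi ε w y - chi ε w z| ≤ exp (-(2 * n)) := by
    rw [Real.exp_neg, ← one_div, le_div_iff₀ (exp_pos _)]; linarith
  linarith

lemma Patch.exists_zoom (hP : Patch ν K P ε η r) (hK : IsCompact K) (hd : ∀ t, MInv ν (dd t)) :
    ∃ x ∈ K, volume {c : ℝ | ∃ t : G, (∀ i j, i ≠ j → t i j = 0) ∧ (t * e31 c) • x ∈ K} ≠ 0 := by
  obtain ⟨δ, hδ, hfr⟩ := (hd (-1)).exists_return hP.meas hP.pos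
  simp only [dd_pow, mul_neg_one] at hfr
  obtain ⟨φ, hφ, hφδ⟩ := extraction_of_frequently_atTop hfr
  choose z hzP hzP' Q hQA hQ hQν using fun n => hP.zoom_step hδ (φ n) (hφδ n)
  obtain ⟨x, hx, ψ, hψ, hlim⟩ := hK.tendsto_subseq (fun n => hP.sub (hzP' n))
  refine ⟨x, hx, fun h0 => ?_⟩
  set Cs := {c : ℝ | ∃ t : G, (∀ i j, i ≠ j → t i j = 0) ∧ (t * e31 c) • x ∈ K}
  have hη := hP.η_pos
  have hr := hP.r_pos
  obtain ⟨O, hCO, hO, hOlt⟩ := Set.exists_isOpen_lt_of_lt Cs (μ := volume)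
    (ofReal (η * r * (δ / 5))) (by rw [h0]; exact ofReal_pos.2 (by positivity))
  have hex : ∀ n, ∃ y ∈ Q n, exp (2 * φ n) * chi ε (z n) y ∉ O := by
    intro n
    by_contra! hcon
    have h1 := hP.measure_chi_le hd (hzP n) (B := (fun c => exp (2 * φ n) * c) ⁻¹' O)
      (hO.measurableSet.preimage (measurable_const_mul _))
    rw [Real.volume_preimage_mul_left (exp_pos _).ne', abs_of_pos (by positivity),
      Measure.restrict_apply' hP.meas] at h1
    have h2 : ν (Q n) ≤ ν (chi ε (z n) ⁻¹' ((fun c => exp (2 * φ n) * c) ⁻¹' O) ∩ P) :=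
      measure_mono fun y hy => ⟨hcon y hy, (hQA n hy).1⟩
    have h3 : ofReal (δ / 5 * exp (-(2 * φ n))) ≤ ν (Q n) := by
      rw [← ofReal_measureReal]; exact ofReal_le_ofReal (hQν n)
    have h4 := (mul_le_mul_right (h3.trans h2) (ofReal (η * r))).trans h1
    rw [← ofReal_mul (by positivity), ← mul_assoc, mul_comm, Real.exp_neg,
      ofReal_mul (by positivity)] at h4
    rw [ENNReal.mul_le_mul_iff_right (ofReal_pos.2 (by positivity)).ne' ofReal_ne_top] at h4
    exact absurd hOlt (not_lt.2 h4)
  choose y hyQ hyO using hex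
  let h : ℕ → G := fun n => dd (-(φ n)) * gam ε (z n) (y n) * (dd (-(φ n)))⁻¹
  have hyP : ∀ n, y n ∈ P := fun n => (hQA n (hyQ n)).1
  have hb := fun n => hP.conj_bounds (hzP n) (hyP n) (φ n) (hQ n _ (hyQ n)) (g := h n) rfl
  have hbd : ∀ n, h n ∈ {g : G | ∀ i j, |g i j| ≤ 3} := by
    intro n i j
    obtain ⟨b1, b2, -, b4⟩ := hb n
    by_cases hij : i = j
    · subst hij
      have := abs_le.1 (b1 i)
      rw [abs_le]; constructor <;> linarith [this.1, this.2]
    by_cases hne : (i, j) = (2, 0)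
    · obtain ⟨rfl, rfl⟩ := Prod.mk.inj hne; linarith
    · have : exp (-(φ n : ℝ)) ≤ 1 := exp_le_one_iff.2 (by simp)
      linarith [b4 i j hij hne]
  obtain ⟨g, -, θ, hθ, hg⟩ := (isCompact_bounded_G 3).tendsto_subseq (fun n => hbd (ψ n))
  have hgij : ∀ i j, Tendsto (fun n => h (ψ (θ n)) i j) atTop (𝓝 (g i j)) := fun i j =>
    tendsto_G_iff.1 hg i j
  have hxlim : Tendsto (fun n => dd (-(φ (ψ (θ n)) : ℝ)) • z (ψ (θ n))) atTop (𝓝 x) :=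
    hlim.comp hθ.tendsto_atTop
  have hgx : g • x ∈ K := by
    have h1 : Tendsto (fun n => h (ψ (θ n)) • dd (-(φ (ψ (θ n)) : ℝ)) • z (ψ (θ n))) atTop
        (𝓝 (g • x)) := Tendsto.smul hg hxlim
    refine hK.isClosed.mem_of_tendsto h1 (Eventually.of_forall fun n => ?_)
    have e : h (ψ (θ n)) • dd (-(φ (ψ (θ n)) : ℝ)) • z (ψ (θ n)) =
        dd (-(φ (ψ (θ n)) : ℝ)) • y (ψ (θ n)) := by
      simp only [h]
      rw [smul_smul, inv_mul_cancel_right, mul_smul, ← (hP.mem _ (hzP _) _ (hyP _)).2]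
    rw [e]
    exact hP.sub (hQA _ (hyQ _)).2
  have hoff : ∀ i j, i ≠ j → (i, j) ≠ (2, 0) → g i j = 0 := by
    intro i j hij hne
    refine tendsto_nhds_unique (hgij i j) (squeeze_zero_norm (fun n => (hb _).2.2.2 i j hij hne) ?_)
    exact tendsto_exp_neg_atTop_nhds_zero.comp (tendsto_natCast_atTop_atTop.comp
      ((hφ.comp (hψ.comp hθ)).tendsto_atTop))
  have hg22 : 9 / 10 ≤ g 2 2 := by
    refine ge_of_tendsto' (hgij 2 2) fun n => ?_
    linarith [(abs_le.1 ((hb (ψ (θ n))).1 2)).1]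
  have hc : Tendsto (fun n => exp (2 * φ (ψ (θ n))) * chi ε (z (ψ (θ n))) (y (ψ (θ n)))) atTop
      (𝓝 (g 2 0 / g 2 2)) := by
    have h1 := (hgij 2 0).div (hgij 2 2) (by linarith)
    refine h1.congr fun n => ?_
    rw [← (hb (ψ (θ n))).2.2.1]; rfl
  have hcO : g 2 0 / g 2 2 ∉ O := by
    have : g 2 0 / g 2 2 ∈ Oᶜ := hO.isClosed_compl.mem_of_tendsto hc
      (Eventually.of_forall fun n => hyO _)
    exact this
  refine hcO (hCO ⟨g * (e31 (g 2 0 / g 2 2))⁻¹, fun i j hij => ?_, by rwa [inv_mul_cancel_right]⟩)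
  have e : (e31 (g 2 0 / g 2 2))⁻¹ = e31 (-(g 2 0 / g 2 2)) := by
    rw [inv_eq_iff_mul_eq_one, ← e31_add]; simp [e31_zero]
  rw [e, G_mul_apply]
  have z01 := hoff 0 1 (by decide) (by decide)
  have z02 := hoff 0 2 (by decide) (by decide)
  have z10 := hoff 1 0 (by decide) (by decide)
  have z12 := hoff 1 2 (by decide) (by decide)
  have z21 := hoff 2 1 (by decide) (by decide)
  have hne : g 2 2 ≠ 0 := by linarith
  fin_cases i <;> fin_cases j <;> simp [e31, z01, z02, z10, z12, z21] at hij ⊢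
  field_simp; ring
end

/-! ### Forward and backward averages along `dd` -/

section
variable {Ω : Type*} [MeasurableSpace Ω] {μ : Measure Ω} [IsFiniteMeasure μ] {T S : Ω → Ω}

lemma integral_mul_comp_of_ae_inv (hT : MeasurePreserving T μ μ) {D F : Ω → ℝ}
    (hD : Measurable D) (hF : Measurable F) (hDT : ∀ᵐ x ∂μ, D (T x) = D x) :
    ∫ x, D x * F (T x) ∂μ = ∫ x, D x * F x ∂μ := by
  calc ∫ x, D x * F (T x) ∂μ = ∫ x, D (T x) * F (T x) ∂μ := by
        refine integral_congr_ae ?_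
        filter_upwards [hDT] with x hx
        rw [hx]
    _ = ∫ y, D y * F y ∂(μ.map T) :=
        (integral_map hT.aemeasurable (hD.mul hF).aestronglyMeasurable).symm
    _ = _ := by rw [hT.map_eq]

lemma integral_mul_birkhoffAverage (hT : MeasurePreserving T μ μ) {D F : Ω → ℝ}
    (hD : Measurable D) (hF : Measurable F) (hDT : ∀ᵐ x ∂μ, D (T x) = D x) {M M' : ℝ}
    (hDM : ∀ᵐ x ∂μ, |D x| ≤ M') (hM : ∀ x, |F x| ≤ M) {n : ℕ} (hn : n ≠ 0) :
    ∫ x, D x * birkhoffAverage ℝ T F n x ∂μ = ∫ x, D x * F x ∂μ := by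
  have h1 : ∀ i, ∫ x, D x * F (T^[i] x) ∂μ = ∫ x, D x * F x ∂μ := by
    intro i
    induction i with
    | zero => rfl
    | succ i ih =>
      rw [← ih]
      exact integral_mul_comp_of_ae_inv hT hD (hF.comp (hT.measurable.iterate i)) hDT
  have hI : ∀ i, Integrable (fun x => D x * F (T^[i] x)) μ := fun i =>
    Integrable.of_bound (hD.mul (hF.comp (hT.measurable.iterate i))).aestronglyMeasurable (M' * M)
      (by filter_upwards [hDM] with x hx
          rw [norm_mul]
          exact mul_le_mul hx (hM _) (norm_nonneg _) ((abs_nonneg _).trans hx))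
  simp only [birkhoffAverage, birkhoffSum, smul_eq_mul, mul_left_comm (D _), Finset.mul_sum]
  rw [integral_finsetSum _ fun i _ => (hI i).const_mul _]
  simp only [integral_const_mul, h1, Finset.sum_const, Finset.card_range, nsmul_eq_mul]
  field_simp

lemma ae_tendsto_fwd_sub_bwd (hT : MeasurePreserving T μ μ) (hS : MeasurePreserving S μ μ)
    (hST : ∀ x, S (T x) = x) (hTS : ∀ x, T (S x) = x) {f : Ω → ℝ} (hf : Measurable f) {M : ℝ}
    (hM : ∀ x, |f x| ≤ M) : ∀ᵐ x ∂μ, Tendsto (fun n => birkhoffAverage ℝ T f n x -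
      birkhoffAverage ℝ S f n x) atTop (𝓝 0) := by
  let A : ℕ → Ω → ℝ := fun n x => birkhoffAverage ℝ T f n x - birkhoffAverage ℝ S f n x
  have hA : ∀ n, Measurable (A n) := fun n => (measurable_birkhoffAverage hT.measurable hf n).sub
    (measurable_birkhoffAverage hS.measurable hf n)
  let D : Ω → ℝ := fun x => limsup (fun n => A n x) atTop
  have hD : Measurable D := Measurable.limsup hA
  have hAM : ∀ n x, |A n x| ≤ 2 * M := fun n x => (abs_sub _ _).trans (by
    linarith [abs_birkhoffAverage_le (T := T) hM n x, abs_birkhoffAverage_le (T := S) hM n x])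
  have hconv : ∀ᵐ x ∂μ, Tendsto (fun n => A n x) atTop (𝓝 (D x)) := by
    filter_upwards [birkhoff_ae hT hf hM, birkhoff_ae hS hf hM] with x ⟨c, hc⟩ ⟨c', hc'⟩
    have := hc.sub hc'
    rwa [← this.limsup_eq] at this
  have hDM : ∀ᵐ x ∂μ, |D x| ≤ 2 * M := by
    filter_upwards [hconv] with x hx
    exact le_of_tendsto hx.abs (Eventually.of_forall fun n => hAM n x)
  have hAT : ∀ x, Tendsto (fun n => A n (T x) - A n x) atTop (𝓝 0) := by
    intro x
    have h1 := tendsto_birkhoffAverage_sub (T := T) hM x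
    have h2 := tendsto_birkhoffAverage_sub (T := S) hM (T x)
    rw [hST] at h2
    have := h1.add h2
    rw [add_zero] at this
    exact this.congr fun n => by simp only [A]; ring
  have hDT : ∀ᵐ x ∂μ, D (T x) = D x := by
    filter_upwards [hconv] with x hx
    have := (hAT x).add hx
    simp only [sub_add_cancel, zero_add] at this
    exact this.limsup_eq
  have hDS : ∀ᵐ x ∂μ, D (S x) = D x := by
    filter_upwards [hS.quasiMeasurePreserving.ae hDT] with x hx
    rw [hTS] at hx; exact hx.symm
  have h1 : Tendsto (fun n => ∫ x, D x * A n x ∂μ) atTop (𝓝 (∫ x, D x * D x ∂μ)) := by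
    refine tendsto_integral_of_dominated_convergence (fun _ => 2 * M * (2 * M))
      (fun n => (hD.mul (hA n)).aestronglyMeasurable) (integrable_const _) (fun n => ?_) ?_
    · filter_upwards [hDM] with x hx
      rw [norm_mul]
      exact mul_le_mul hx (hAM n x) (norm_nonneg _) ((abs_nonneg _).trans hx)
    · filter_upwards [hconv] with x hx using hx.const_mul _
  have hI : ∀ {R : Ω → Ω}, MeasurePreserving R μ μ → ∀ n,
      Integrable (fun x => D x * birkhoffAverage ℝ R f n x) μ := fun hR n =>
    Integrable.of_bound (hD.mul (measurable_birkhoffAverage hR.measurable hf n)).aestronglyMeasurable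
      (2 * M * M) (by
        filter_upwards [hDM] with x hx
        rw [norm_mul]
        exact mul_le_mul hx (abs_birkhoffAverage_le hM n x) (norm_nonneg _)
          ((abs_nonneg _).trans hx))
  have h2 : ∀ n ≠ 0, ∫ x, D x * A n x ∂μ = 0 := by
    intro n hn
    simp only [A, mul_sub]
    rw [integral_sub (hI hT n) (hI hS n), integral_mul_birkhoffAverage hT hD hf hDT hDM hM hn,
      integral_mul_birkhoffAverage hS hD hf hDS hDM hM hn, sub_self]
  have h3 : ∫ x, D x * D x ∂μ = 0 := by
    refine tendsto_nhds_unique h1 (tendsto_const_nhds.congr' ?_)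
    filter_upwards [eventually_ne_atTop 0] with n hn
    rw [h2 n hn]
  rw [integral_eq_zero_iff_of_nonneg (fun x => mul_self_nonneg _)
    (Integrable.of_bound (hD.mul hD).aestronglyMeasurable (2 * M * (2 * M)) (by
      filter_upwards [hDM] with x hx
      rw [norm_mul]
      exact mul_le_mul hx hx (norm_nonneg _) ((abs_nonneg _).trans hx)))] at h3
  filter_upwards [h3, hconv] with x hx hc
  have : D x = 0 := by simpa using hx
  rwa [this] at hc

end

lemma tendsto_zero_of_approx {F : ℕ → ℝ} (h : ∀ ε > 0, ∃ F' : ℕ → ℝ, Tendsto F' atTop (𝓝 0) ∧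
    ∀ n, |F n - F' n| ≤ ε) : Tendsto F atTop (𝓝 0) := by
  rw [Metric.tendsto_atTop]
  intro ε hε
  obtain ⟨F', hF', hFF'⟩ := h (ε / 2) (by positivity)
  obtain ⟨N, hN⟩ := Metric.tendsto_atTop.1 hF' (ε / 2) (by positivity)
  refine ⟨N, fun n hn => ?_⟩
  have h1 := hN n hn
  have h2 := hFF' n
  rw [dist_eq, sub_zero] at h1 ⊢
  have := abs_sub_abs_le_abs_sub (F n) (F' n)
  linarith

lemma exists_tendsto_of_approx {F : ℕ → ℝ} (h : ∀ ε > 0, ∃ F' : ℕ → ℝ, ∃ c,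
    Tendsto F' atTop (𝓝 c) ∧ ∀ n, |F n - F' n| ≤ ε) : ∃ c, Tendsto F atTop (𝓝 c) := by
  refine cauchySeq_tendsto_of_complete (Metric.cauchySeq_iff.2 fun ε hε => ?_)
  obtain ⟨F', c, hF', hFF'⟩ := h (ε / 4) (by positivity)
  obtain ⟨N, hN⟩ := Metric.tendsto_atTop.1 hF' (ε / 4) (by positivity)
  refine ⟨N, fun m hm n hn => ?_⟩
  have h1 := hN m hm
  have h2 := hN n hn
  have h3 := hFF' m
  have h4 := hFF' n
  rw [dist_eq, abs_lt] at *
  rw [abs_le] at h3 h4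
  constructor <;> linarith [h1.1, h1.2, h2.1, h2.2, h3.1, h3.2, h4.1, h4.2]

/-- Averages along the orbit of `dd t`. -/
def bav (t : ℝ) (f : X → ℝ) (n : ℕ) (x : X) : ℝ := birkhoffAverage ℝ (fun x : X => dd t • x) f n x

lemma bav_eq (t : ℝ) (f : X → ℝ) (n : ℕ) (x : X) :
    bav t f n x = (n : ℝ)⁻¹ * ∑ i ∈ Finset.range n, f (dd (i * t) • x) := by
  simp only [bav, birkhoffAverage, birkhoffSum, iterate_smul, dd_pow, smul_eq_mul]

lemma bav_sub (t : ℝ) (f g : X → ℝ) (n : ℕ) (x : X) :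
    bav t f n x - bav t g n x = bav t (fun y => f y - g y) n x := by
  simp only [bav_eq, ← mul_sub, ← Finset.sum_sub_distrib]

lemma abs_bav_le {t : ℝ} {f : X → ℝ} {M : ℝ} (hM : ∀ x, |f x| ≤ M) (n : ℕ) (x : X) :
    |bav t f n x| ≤ M := abs_birkhoffAverage_le hM n x

lemma abs_bav_sub_le {t : ℝ} {f g : X → ℝ} {M : ℝ} (hM : ∀ x, |f x - g x| ≤ M) (n : ℕ) (x : X) :
    |bav t f n x - bav t g n x| ≤ M := by
  rw [bav_sub]; exact abs_bav_le hM n x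

lemma continuous_bav (t : ℝ) (f : C(X, ℝ)) (n : ℕ) : Continuous (bav t f n) := by
  have : bav t f n = fun x => (n : ℝ)⁻¹ * ∑ i ∈ Finset.range n, f (dd (i * t) • x) :=
    funext fun x => bav_eq _ _ _ _
  rw [this]
  exact continuous_const.mul (continuous_finset_sum _ fun i _ =>
    f.continuous.comp (continuous_const_smul _))

/-- Points with equal forward and backward averages along `dd`. -/
def OmD : Set X := {x | ∀ f : C(X, ℝ), HasCompactSupport f →
  (∃ c, Tendsto (fun n => bav 1 f n x) atTop (𝓝 c)) ∧
    Tendsto (fun n => bav 1 f n x - bav (-1) f n x) atTop (𝓝 0)}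

lemma mem_OmD_iff (x : X) : x ∈ OmD ↔ ∀ k, (∃ c, Tendsto (fun n => bav 1 (tst k) n x) atTop (𝓝 c)) ∧
      Tendsto (fun n => bav 1 (tst k) n x - bav (-1) (tst k) n x) atTop (𝓝 0) := by
  refine ⟨fun h k => h _ (hasCompactSupport_tst k), fun h f hf => ⟨?_, ?_⟩⟩
  · refine exists_tendsto_of_approx fun ε hε => ?_
    obtain ⟨k, hk⟩ := tst_dense hf hε
    obtain ⟨c, hc⟩ := (h k).1
    exact ⟨_, c, hc, fun n => abs_bav_sub_le hk n x⟩
  · refine tendsto_zero_of_approx fun ε hε => ?_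
    obtain ⟨k, hk⟩ := tst_dense hf (half_pos hε)
    refine ⟨_, (h k).2, fun n => ?_⟩
    have h1 := abs_le.1 (abs_bav_sub_le (t := 1) hk n x)
    have h2 := abs_le.1 (abs_bav_sub_le (t := -1) hk n x)
    rw [abs_le]; constructor <;> linarith [h1.1, h1.2, h2.1, h2.2]

lemma measurableSet_OmD : MeasurableSet OmD := by
  have : OmD = ⋂ k, ({x | ∃ c, Tendsto (fun n => bav 1 (tst k) n x) atTop (𝓝 c)} ∩
      {x | Tendsto (fun n => bav 1 (tst k) n x - bav (-1) (tst k) n x) atTop (𝓝 0)}) := by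
    ext x; simp [mem_OmD_iff]
  rw [this]
  exact MeasurableSet.iInter fun k => (measurableSet_exists_tendsto
    fun n => (continuous_bav 1 (tst k) n).measurable).inter (measurableSet_tendsto _
      fun n => ((continuous_bav 1 (tst k) n).sub (continuous_bav (-1) (tst k) n)).measurable)

lemma ae_mem_OmD {ν : Measure X} [IsFiniteMeasure ν] (hd : ∀ t, MInv ν (dd t)) :
    ∀ᵐ x ∂ν, x ∈ OmD := by
  simp only [mem_OmD_iff]
  rw [ae_all_iff]
  intro k
  obtain ⟨M, -, hM⟩ := exists_bound (hasCompactSupport_tst k)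
  filter_upwards [birkhoff_ae (hd 1).mp (tst k).continuous.measurable hM,
    ae_tendsto_fwd_sub_bwd (hd 1).mp (hd (-1)).mp
      (fun x => by rw [smul_smul, ← dd_add]; simp [dd_zero])
      (fun x => by rw [smul_smul, ← dd_add]; simp [dd_zero]) (tst k).continuous.measurable hM]
    with x h1 h2 using ⟨h1, h2⟩

lemma dd_comm_diag {t : G} (ht : ∀ i j, i ≠ j → t i j = 0) (s : ℝ) : dd s * t = t * dd s := by
  refine G_ext fun i j => ?_
  have e : ∀ i j, i ≠ j → dd s i j = 0 := fun i j hij => by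
    rw [dd, dT]; simp [diagonal_apply_ne _ hij]
  simp only [G_mul_apply]
  fin_cases i <;> fin_cases j <;> simp [ht, e, mul_comm]

lemma OmD_diag {t : G} (ht : ∀ i j, i ≠ j → t i j = 0) {x : X} (hx : t • x ∈ OmD) : x ∈ OmD := by
  have key : ∀ s (f : C(X, ℝ)) n, bav s f n x = bav s (tr t⁻¹ f) n (t • x) := by
    intro s f n
    simp only [bav_eq, tr_apply, smul_smul, mul_assoc, dd_comm_diag ht, inv_mul_cancel_left]
  intro f hf
  have := hx _ (hasCompactSupport_tr hf t⁻¹)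
  simpa only [← key] using this

open scoped Pointwise in
lemma tendsto_setIntegral_translate {C : Set ℝ} (hC : IsCompact C) {F : ℕ → ℝ → ℝ} {M : ℝ}
    (hF : ∀ n, Continuous (F n)) (hM : ∀ n c, |F n c| ≤ M) {δ : ℕ → ℝ}
    (hδ : Tendsto δ atTop (𝓝 0)) :
    Tendsto (fun n => (∫ c in C, F n (c + δ n)) - ∫ c in C, F n c) atTop (𝓝 0) := by
  have hfin : ∀ d : ℝ, volume ((d +ᵥ C) \ C) ≠ ∞ := fun d =>
    ne_top_of_le_ne_top (by rw [measure_vadd]; exact hC.measure_lt_top.ne)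
      (measure_mono Set.sdiff_subset)
  have ht : Tendsto (fun d : ℝ => volume.real ((d +ᵥ C) \ C)) (𝓝 0) (𝓝 0) := by
    have := (tendsto_toReal zero_ne_top).comp
      (tendsto_measure_vadd_sdiff_isCompact_isClosed (μ := (volume : Measure ℝ)) hC hC.isClosed)
    rw [toReal_zero] at this
    exact this
  have h1 := (ht.comp hδ).add (ht.comp (by simpa using hδ.neg : Tendsto (fun n => -δ n) atTop (𝓝 0)))
  have h2 := h1.const_mul M
  rw [add_zero, mul_zero] at h2
  refine squeeze_zero_norm (fun n => ?_) h2
  set A := δ n +ᵥ C with hA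
  have hAc : IsCompact A := hC.vadd (δ n)
  have e1 : ∫ c in C, F n (c + δ n) = ∫ c in A, F n c := by
    have hmp : MeasurePreserving (fun c : ℝ => c + δ n) volume volume :=
      measurePreserving_add_right volume (δ n)
    rw [← hmp.setIntegral_preimage_emb (measurableEmbedding_addRight (δ n)) (F n) A]
    congr 2
    ext c
    simp [hA, Set.mem_vadd_set_iff_neg_vadd_mem]
  have hi1 : IntegrableOn (F n) A := (hF n).continuousOn.integrableOn_compact hAc
  have hi2 : IntegrableOn (F n) C := (hF n).continuousOn.integrableOn_compact hC
  rw [e1, ← integral_inter_add_sdiff hC.isClosed.measurableSet hi1,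
    ← integral_inter_add_sdiff hAc.isClosed.measurableSet hi2, Set.inter_comm C A,
    add_sub_add_left_eq_sub]
  have b1 := norm_setIntegral_le_of_norm_le_const (μ := volume) (f := F n) (s := A \ C)
    (hfin _).lt_top (fun c _ => hM n c)
  have e2 : volume (C \ A) = volume ((-δ n +ᵥ C) \ C) := by
    rw [← measure_vadd volume (-δ n) (C \ A), Set.vadd_set_sdiff, hA, neg_vadd_vadd]
  have b2 := norm_setIntegral_le_of_norm_le_const (μ := volume) (f := F n) (s := C \ A)
    (by rw [e2]; exact (hfin _).lt_top) (fun c _ => hM n c)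
  have e3 : volume.real (C \ A) = volume.real ((-δ n +ᵥ C) \ C) := by
    rw [measureReal_def, e2, ← measureReal_def]
  rw [e3] at b2
  refine (norm_sub_le _ _).trans ?_
  simp only [Function.comp_apply]
  linarith

lemma tendsto_bav_e31 {x : X} (hx : x ∈ OmD) (hC : volume {c | e31 c • x ∈ OmD} ≠ 0) (b : ℝ)
    {f : C(X, ℝ)} (hf : HasCompactSupport f) :
    Tendsto (fun n => bav 1 (tr (e31 b) f) n x - bav 1 f n x) atTop (𝓝 0) := by
  have hce : Continuous (fun c => e31 c • x) := continuous_e31.smul continuous_const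
  obtain ⟨C, hCs, hCc, hC0⟩ := (measurableSet_OmD.preimage hce.measurable).exists_lt_isCompact
    (pos_iff_ne_zero.2 hC)
  have hfinC : IsFiniteMeasure (volume.restrict C) := ⟨by simpa using hCc.measure_lt_top⟩
  have hexp : Tendsto (fun n : ℕ => exp (-2 * (n : ℝ))) atTop (𝓝 0) := by
    have := tendsto_exp_neg_atTop_nhds_zero.comp
        (tendsto_natCast_atTop_atTop (R := ℝ).const_mul_atTop two_pos)
    refine this.congr fun n => ?_
    simp
  have hpt : ∀ g : C(X, ℝ), HasCompactSupport g → ∀ ℓ, Tendsto (fun n => bav 1 g n x) atTop (𝓝 ℓ) →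
      ∀ c ∈ C, Tendsto (fun n => bav (-1) g n (e31 c • x)) atTop (𝓝 ℓ) := by
    intro g hg ℓ hℓ c hc
    have h1 : Tendsto (fun i : ℕ => g (dd (i * 1) • e31 c • x) - g (dd (i * 1) • x)) atTop (𝓝 0) := by
      rw [Metric.tendsto_nhds]
      intro ε hε
      have h2 : Tendsto (fun i : ℕ => e31 (exp (-2 * (i : ℝ)) * c)) atTop (𝓝 1) := by
        have := (continuous_e31.tendsto 0).comp (by simpa using hexp.mul_const c :
          Tendsto (fun i : ℕ => exp (-2 * (i : ℝ)) * c) atTop (𝓝 0))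
        rwa [e31_zero] at this
      filter_upwards [h2.eventually (unif_cont hg hε)] with i hi
      have := hi (dd i • x)
      rw [smul_smul, ← dd_e31, mul_smul] at this
      simpa [dist_eq] using this
    have h3 : Tendsto (fun n => bav 1 g n (e31 c • x) - bav 1 g n x) atTop (𝓝 0) := by
      refine h1.cesaro.congr fun n => ?_
      rw [bav_eq, bav_eq, ← mul_sub, ← Finset.sum_sub_distrib]
    have h4 := (hCs hc g hg).2
    have h5 := (h3.add hℓ).sub h4
    simp only [zero_add, sub_zero] at h5
    exact h5.congr fun n => by ring
  have hItg : ∀ g : C(X, ℝ), HasCompactSupport g → ∀ ℓ, Tendsto (fun n => bav 1 g n x) atTop (𝓝 ℓ) →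
      Tendsto (fun n => ∫ c in C, bav (-1) g n (e31 c • x)) atTop (𝓝 (volume.real C * ℓ)) := by
    intro g hg ℓ hℓ
    obtain ⟨M, -, hM⟩ := exists_bound hg
    have e : volume.real C * ℓ = ∫ c in C, ℓ := by simp
    rw [e]
    refine tendsto_integral_of_dominated_convergence (fun _ => M)
      (fun n => ((continuous_bav _ g n).comp hce).aestronglyMeasurable) (integrable_const _)
      (fun n => ae_of_all _ fun c => abs_bav_le hM n _) ?_
    exact (ae_restrict_iff' hCc.isClosed.measurableSet).2 (ae_of_all _ fun c hc => hpt g hg ℓ hℓ c hc)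
  obtain ⟨ℓ, hℓ⟩ := (hx f hf).1
  obtain ⟨ℓ', hℓ'⟩ := (hx _ (hasCompactSupport_tr hf (e31 b))).1
  obtain ⟨M, -, hM⟩ := exists_bound hf
  let F : ℕ → ℝ → ℝ := fun i c => f (dd (-i) • e31 c • x)
  have hFc : ∀ i, Continuous (F i) := fun i =>
    f.continuous.comp ((continuous_const_smul _).comp hce)
  have hδ : Tendsto (fun n : ℕ => exp (-2 * (n : ℝ)) * b) atTop (𝓝 0) := by
    simpa using hexp.mul_const b
  have htr := (tendsto_setIntegral_translate hCc hFc (fun n c => hM _) hδ).cesaro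
  have hI : ∀ (F' : ℕ → ℝ → ℝ), (∀ i, Continuous (F' i)) → ∀ n : ℕ,
      ∫ c in C, (n : ℝ)⁻¹ * ∑ i ∈ Finset.range n, F' i c =
        (n : ℝ)⁻¹ * ∑ i ∈ Finset.range n, ∫ c in C, F' i c := by
    intro F' hF' n
    rw [integral_const_mul, integral_finsetSum _ fun i _ =>
      (hF' i).continuousOn.integrableOn_compact hCc]
  have e1 : ∀ n, ∫ c in C, bav (-1) f n (e31 c • x) =
      (n : ℝ)⁻¹ * ∑ i ∈ Finset.range n, ∫ c in C, F i c := by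
    intro n
    rw [← hI F hFc]
    simp only [bav_eq, mul_neg_one, F]
  have e2 : ∀ n, ∫ c in C, bav (-1) (tr (e31 b) f) n (e31 c • x) =
      (n : ℝ)⁻¹ * ∑ i ∈ Finset.range n, ∫ c in C, F i (c + exp (-2 * (i : ℝ)) * b) := by
    intro n
    rw [← hI (fun i c => F i (c + exp (-2 * (i : ℝ)) * b))
      (fun i => (hFc i).comp (continuous_add_const _))]
    simp only [bav_eq, mul_neg_one, F, tr_apply]
    have : ∀ (i : ℕ) c, e31 b • dd (-i) • e31 c • x =
        dd (-i) • e31 (c + exp (-2 * (i : ℝ)) * b) • x := by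
      intro i c
      rw [add_comm, e31_add, mul_smul, smul_smul (dd _) (e31 _) (e31 c • x), dd_e31, ← mul_assoc,
        ← exp_add, mul_smul]
      simp
    simp only [this]
  have h6 := (hItg _ (hasCompactSupport_tr hf (e31 b)) ℓ' hℓ').sub (hItg f hf ℓ hℓ)
  simp only [e1, e2] at h6
  simp only [Finset.sum_sub_distrib, mul_sub] at htr
  have h7 := tendsto_nhds_unique h6 htr
  have hCpos : volume.real C ≠ 0 := by
    rw [measureReal_def]; exact (toReal_pos hC0.ne' hCc.measure_lt_top.ne).ne'
  have h8 : ℓ' = ℓ := by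
    rw [← mul_sub] at h7
    exact sub_eq_zero.1 ((mul_eq_zero.1 h7).resolve_left hCpos)
  have := hℓ'.sub hℓ
  rwa [h8, sub_self] at this

/-! ### Invariance in the direction `e31` -/

lemma MInv.of_tendsto {ν : Measure X} [IsFiniteMeasure ν] {ι : Type*} {l : Filter ι} [l.NeBot]
    {h : ι → G} {h₀ : G} (ht : Tendsto h l (𝓝 h₀)) (hi : ∀ i, MInv ν (h i)) : MInv ν h₀ := by
  refine MInv.of_integral fun f hf => ?_
  obtain ⟨M, -, hM⟩ := exists_bound hf
  have hI : ∀ g : G, Integrable (fun x => f (g • x)) ν := fun g => Integrable.of_bound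
    (tr g f).continuous.aestronglyMeasurable M (ae_of_all _ fun x => hM _)
  have h1 : Tendsto (fun i => ∫ x, f (h i • x) ∂ν) l (𝓝 (∫ x, f (h₀ • x) ∂ν)) := by
    rw [Metric.tendsto_nhds]
    intro ε hε
    have hc : 0 < ν.real univ + 1 := by positivity
    filter_upwards [ht.eventually (unif_cont_tr hf h₀ (ε := ε / (ν.real univ + 1))
      (by positivity))] with i hi
    rw [dist_eq_norm, ← integral_sub (hI _) (hI _)]
    refine (norm_integral_le_of_norm_le_const (C := ε / (ν.real univ + 1))
      (ae_of_all _ fun x => (hi x).le)).trans_lt ?_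
    rw [div_mul_eq_mul_div, div_lt_iff₀ hc]
    nlinarith
  refine tendsto_nhds_unique h1 (tendsto_const_nhds.congr fun i => ((hi i).integral f).symm)

lemma MInv.of_tst {ν : Measure X} [IsFiniteMeasure ν] {h : G}
    (hi : ∀ k, ∫ x, tst k (h • x) ∂ν = ∫ x, tst k x ∂ν) : MInv ν h := by
  refine MInv.of_integral fun f hf => eq_of_abs_sub_le_all fun ε hε => ?_
  have hc : 0 < ν.real univ + 1 := by positivity
  obtain ⟨k, hk⟩ := tst_dense hf (ε := ε / (2 * (ν.real univ + 1))) (by positivity)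
  have hI : ∀ (f : C(X, ℝ)), HasCompactSupport f → ∀ g : G,
      Integrable (fun x => f (g • x)) ν := fun f hf g => by
    obtain ⟨M, -, hM⟩ := exists_bound hf
    exact Integrable.of_bound (tr g f).continuous.aestronglyMeasurable M (ae_of_all _ fun x => hM _)
  have key : ∀ g : G, |(∫ x, f (g • x) ∂ν) - ∫ x, tst k (g • x) ∂ν| ≤ ε / 2 := by
    intro g
    rw [← integral_sub (hI f hf g) (hI _ (hasCompactSupport_tst k) g), ← norm_eq_abs]
    refine (norm_integral_le_of_norm_le_const (C := ε / (2 * (ν.real univ + 1)))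
      (ae_of_all _ fun x => hk _)).trans ?_
    rw [div_mul_eq_mul_div, div_le_div_iff₀ (by positivity) two_pos]
    nlinarith
  have h1 := abs_le.1 (key h)
  have h2 := key 1
  simp only [one_smul] at h2
  have h2 := abs_le.1 h2
  rw [hi k] at h1
  rw [abs_le]; constructor <;> linarith [h1.1, h1.2, h2.1, h2.2]

/-- Points whose `dd`-averages are invariant under `e31`. -/
def GE : Set X := {x | ∀ (q : ℚ) (k : ℕ),
  Tendsto (fun n => bav 1 (tr (e31 q) (tst k)) n x - bav 1 (tst k) n x) atTop (𝓝 0)}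

lemma measurableSet_GE : MeasurableSet GE := by
  have : GE = ⋂ q : ℚ, ⋂ k : ℕ, {x | Tendsto (fun n => bav 1 (tr (e31 q) (tst k)) n x -
      bav 1 (tst k) n x) atTop (𝓝 0)} := by
    ext x; simp [GE]
  rw [this]
  exact MeasurableSet.iInter fun q => MeasurableSet.iInter fun k => measurableSet_tendsto _
    fun n => ((continuous_bav _ _ _).sub (continuous_bav _ _ _)).measurable

lemma mInv_e31_of_ae_GE {ν : Measure X} [IsFiniteMeasure ν] (hd : ∀ t, MInv ν (dd t))
    (h : ∀ᵐ x ∂ν, x ∈ GE) (c : ℝ) : MInv ν (e31 c) := by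
  have hq : ∀ q : ℚ, MInv ν (e31 q) := by
    intro q
    refine MInv.of_tst fun k => ?_
    obtain ⟨M, -, hM⟩ := exists_bound (hasCompactSupport_tst k)
    have hItg : ∀ f : C(X, ℝ), (∀ x, |f x| ≤ M) → ∀ n ≠ 0, ∫ x, bav 1 f n x ∂ν = ∫ x, f x ∂ν := by
      intro f hf n hn
      have := integral_mul_birkhoffAverage (hd 1).mp (D := fun _ => 1) measurable_const
        f.continuous.measurable (ae_of_all _ fun _ => rfl) (M' := 1) (ae_of_all _ fun _ => by simp)
        hf hn
      simp only [one_mul] at this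
      exact this
    have hI : ∀ f : C(X, ℝ), (∀ x, |f x| ≤ M) → ∀ n, Integrable (bav 1 f n) ν := fun f hf n =>
      Integrable.of_bound (continuous_bav 1 f n).aestronglyMeasurable M
        (ae_of_all _ fun x => abs_bav_le hf n x)
    have hM' : ∀ x, |tr (e31 q) (tst k) x| ≤ M := fun x => hM _
    have h1 : Tendsto (fun n => ∫ x, (bav 1 (tr (e31 q) (tst k)) n x - bav 1 (tst k) n x) ∂ν) atTop
        (𝓝 (∫ x, (0 : ℝ) ∂ν)) := by
      refine tendsto_integral_of_dominated_convergence (fun _ => 2 * M)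
        (fun n => ((continuous_bav _ _ _).sub (continuous_bav _ _ _)).aestronglyMeasurable)
        (integrable_const _) (fun n => ae_of_all _ fun x => ?_) ?_
      · refine (norm_sub_le _ _).trans ?_
        have a1 := abs_bav_le (t := 1) hM' n x
        have a2 := abs_bav_le (t := 1) hM n x
        rw [norm_eq_abs, norm_eq_abs]; linarith
      · filter_upwards [h] with x hx using hx q k
    rw [integral_zero] at h1
    have h2 : (∫ x, tst k (e31 q • x) ∂ν) - ∫ x, tst k x ∂ν = 0 := by
      refine tendsto_nhds_unique (tendsto_const_nhds.congr' ?_) h1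
      filter_upwards [eventually_ne_atTop 0] with n hn
      rw [integral_sub (hI _ hM' n) (hI _ hM n), hItg _ hM' n hn, hItg _ hM n hn]
      rfl
    exact sub_eq_zero.1 h2
  obtain ⟨qs, hqs⟩ : ∃ qs : ℕ → ℚ, Tendsto (fun n => (qs n : ℝ)) atTop (𝓝 c) := by
    have hdense := Rat.isDenseEmbedding_coe_real.dense
    obtain ⟨y, hy, hyl⟩ := mem_closure_iff_seq_limit.1 (hdense.closure_eq ▸ Set.mem_univ c)
    choose qs hqs using hy
    exact ⟨qs, by simpa only [hqs] using hyl⟩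
  exact MInv.of_tendsto ((continuous_e31.tendsto c).comp hqs) fun n => hq _

lemma mInv_e31 (hu : ∀ s, MInv ν (u s))
    (hA : ∀ t, MInv ν (gSL t)) (hd : ∀ t, MInv ν (dd t)) (h12 : ν (Om e12) = 0)
    (h23 : ν (Om e23) = 0) (hdd : ν (Om dd)ᶜ = 0) (c : ℝ) : MInv ν (e31 c) := by
  refine mInv_e31_of_ae_GE hd ?_ c
  by_contra hcon
  let E := (OmD ∩ Om dd) ∩ GEᶜ
  have hEm : MeasurableSet E := (measurableSet_OmD.inter (measurableSet_Om continuous_dd)).inter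
    measurableSet_GE.compl
  have hE0 : ν E ≠ 0 := by
    intro h0
    refine hcon ?_
    have h1 : ∀ᵐ x ∂ν, x ∈ Om dd := mem_ae_iff.2 hdd
    have h2 : ∀ᵐ x ∂ν, x ∉ E := measure_eq_zero_iff_ae_notMem.1 h0
    filter_upwards [ae_mem_OmD hd, h1, h2] with x a1 a2 a3
    by_contra hx
    exact a3 ⟨⟨a1, a2⟩, hx⟩
  obtain ⟨K, K', hG, hK'E, hle⟩ := exists_goodPair hu hA h12 h23 hEm (ENNReal.half_pos hE0).ne'
  have hKE : K ⊆ E := hG.sub.trans hK'E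
  have hK0 : ν K ≠ 0 := by
    intro h0
    rw [h0, zero_add] at hle
    exact absurd hle (not_le.2 (ENNReal.half_lt_self hE0 (measure_ne_top _ _)))
  obtain ⟨P, ε, η, r, hP⟩ := exists_patch hu hG (fun x hx => (hKE hx).1.2) hK0
  obtain ⟨x, hx, hvol⟩ := hP.exists_zoom hG.isCompact hd
  refine (hKE hx).2 fun q k => tendsto_bav_e31 (hKE hx).1.1 (fun h0 => hvol ?_) q
    (hasCompactSupport_tst k)
  refine measure_mono_null ?_ h0
  rintro c ⟨t, ht, htK⟩
  rw [mul_smul] at htK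
  exact OmD_diag ht (hKE htK).1.1

/-! ### The block subgroup and its plaques -/

lemma G_inv_apply (g : G) (i j : Fin 3) : g⁻¹ i j = (g : M₃).adjugate i j := by
  rw [Matrix.SpecialLinearGroup.coe_inv]

/-- Matrices preserving the middle axis and the complementary coordinate plane. -/
def Lg : Subgroup G where
  carrier := {g | g 0 1 = 0 ∧ g 2 1 = 0 ∧ g 1 0 = 0 ∧ g 1 2 = 0}
  mul_mem' := by
    rintro g h ⟨a1, a2, a3, a4⟩ ⟨b1, b2, b3, b4⟩
    refine ⟨?_, ?_, ?_, ?_⟩ <;> rw [G_mul_apply] <;> simp [*]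
  one_mem' := by simp
  inv_mem' := by
    rintro g ⟨a1, a2, a3, a4⟩
    refine ⟨?_, ?_, ?_, ?_⟩ <;> rw [G_inv_apply, adjugate_fin_three] <;> simp [*]

lemma mem_Lg {g : G} : g ∈ Lg ↔ g 0 1 = 0 ∧ g 2 1 = 0 ∧ g 1 0 = 0 ∧ g 1 2 = 0 := Iff.rfl

lemma isClosed_Lg : IsClosed (Lg : Set G) := by
  have : (Lg : Set G) = {g : G | g 0 1 = 0} ∩ {g | g 2 1 = 0} ∩ {g | g 1 0 = 0} ∩ {g | g 1 2 = 0} := by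
    ext g; simp [mem_Lg, and_assoc]
  rw [this]
  exact (((isClosed_eq (continuous_entry _ _) continuous_const).inter
    (isClosed_eq (continuous_entry _ _) continuous_const)).inter
    (isClosed_eq (continuous_entry _ _) continuous_const)).inter
    (isClosed_eq (continuous_entry _ _) continuous_const)

/-- A right invariant measure on `Lg`, viewed on `G`. -/
lemma exists_block_measure : ∃ m : Measure G, SFinite m ∧ m (Lg : Set G)ᶜ = 0 ∧
    (∀ C : Set G, IsCompact C → m C < ∞) ∧ (∀ O : Set G, IsOpen O → (1 : G) ∈ O → m O ≠ 0) ∧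
    ∀ p ∈ Lg, ∀ S : Set G, MeasurableSet S → m ((fun h => h * p) ⁻¹' S) = m S := by
  have : LocallyCompactSpace Lg := isClosed_Lg.isClosedEmbedding_subtypeVal.locallyCompactSpace
  let μ : Measure Lg := (haar : Measure Lg).inv
  have hv : Measurable (Subtype.val : Lg → G) := measurable_subtype_coe
  have hμ : ∀ S : Set Lg, μ S = (haar : Measure Lg) S⁻¹ := fun S => Measure.inv_apply _ S
  have hsf : SFinite μ := by
    have : SecondCountableTopology Lg := TopologicalSpace.Subtype.secondCountableTopology _
    have : SigmaCompactSpace Lg := sigmaCompactSpace_of_locallyCompact_secondCountable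
    have : SigmaFinite (haar : Measure Lg) := inferInstance
    exact inferInstanceAs (SFinite (Measure.map _ (haar : Measure Lg)))
  refine ⟨μ.map Subtype.val, inferInstance, ?_, ?_, ?_, ?_⟩
  · rw [Measure.map_apply hv isClosed_Lg.measurableSet.compl]
    have : (Subtype.val : Lg → G) ⁻¹' (Lg : Set G)ᶜ = ∅ := by ext g; simp
    rw [this, measure_empty]
  · intro C hC
    rw [Measure.map_apply hv hC.isClosed.measurableSet, hμ]
    have : IsCompact ((Subtype.val : Lg → G) ⁻¹' C) :=
      isClosed_Lg.isClosedEmbedding_subtypeVal.isCompact_preimage hC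
    exact this.inv.measure_lt_top
  · intro O hO h1
    rw [Measure.map_apply hv hO.measurableSet, hμ]
    exact ((hO.preimage continuous_subtype_val).inv.measure_pos _ ⟨1, by simpa using h1⟩).ne'
  · intro p hp S hS
    rw [Measure.map_apply hv hS, Measure.map_apply hv (measurable_mul_const p hS)]
    have e : (Subtype.val : Lg → G) ⁻¹' ((fun h => h * p) ⁻¹' S) =
        (fun h : Lg => h * ⟨p, hp⟩) ⁻¹' (Subtype.val ⁻¹' S) := by ext g; simp
    rw [e, measure_preimage_mul_right]

lemma mInv_of_mem_Lg {ν : Measure X} (hu : ∀ s, MInv ν (u s)) (hA : ∀ t, MInv ν (gSL t))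
    (hd : ∀ t, MInv ν (dd t)) (h31 : ∀ c, MInv ν (e31 c)) {h : G} (hL : h ∈ Lg) (h0 : 0 < h 0 0)
    (h1 : 0 < h 1 1) : MInv ν h := by
  obtain ⟨a1, a2, a3, a4⟩ := hL
  have hdet := G_det h
  simp only [a1, a2, a3, a4, mul_zero, zero_mul, add_zero, sub_zero] at hdet
  have e : h = e31 (h 2 0 / h 0 0) * (dd (Real.log (h 0 0) + 2 * Real.log (h 1 1)) *
      gSL (-Real.log (h 1 1))) * u (h 0 2 / h 0 0) := by
    have x0 : exp (Real.log (h 0 0)) = h 0 0 := Real.exp_log h0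
    have x1 : exp (Real.log (h 1 1)) = h 1 1 := Real.exp_log h1
    have hT : ∀ i j, (dd (Real.log (h 0 0) + 2 * Real.log (h 1 1)) * gSL (-Real.log (h 1 1))) i j =
        Matrix.diagonal ![h 0 0, h 1 1, (h 0 0 * h 1 1)⁻¹] i j := by
      intro i j
      have x2 : (h 0 0 * h 1 1)⁻¹ = exp (-(Real.log (h 0 0) + Real.log (h 1 1))) := by
        rw [Real.exp_neg, exp_add, x0, x1]
      rw [x2]
      simp only [G_mul_apply, gSL_eq, dd, dT_apply]
      fin_cases i <;> fin_cases j <;> simp [← exp_add]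
      · conv_rhs => rw [← x0]
        congr 1; ring
      · exact x1
      · ring
    generalize dd (Real.log (h 0 0) + 2 * Real.log (h 1 1)) * gSL (-Real.log (h 1 1)) = T at hT
    refine G_ext fun i j => ?_
    simp only [G_mul_apply, hT]
    fin_cases i <;> fin_cases j <;> simp [e31, u, a1, a2, a3, a4]
    · field_simp
    · field_simp
    · field_simp; linear_combination hdet
  rw [e]
  exact ((h31 _).mul ((hd _).mul (hA _))).mul (hu _)

lemma exists_block_decomp {g : G} (hg : 0 < g 0 0 * g 2 2 - g 0 2 * g 2 0) : ∃ p z : G,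
    g = p * z ∧ p ∈ Lg ∧ z 0 0 = 1 ∧ z 0 2 = 0 ∧ z 2 0 = 0 ∧ z 2 2 = 1 ∧ p 0 0 = g 0 0 ∧
      p 0 2 = g 0 2 ∧ p 2 0 = g 2 0 ∧ p 2 2 = g 2 2 ∧
      p 1 1 = (g 0 0 * g 2 2 - g 0 2 * g 2 0)⁻¹ := by
  let p : G := ⟨!![g 0 0, 0, g 0 2; 0, (g 0 0 * g 2 2 - g 0 2 * g 2 0)⁻¹, 0; g 2 0, 0, g 2 2], by
    rw [det_fin_three]
    simp
    field_simp⟩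
  have hp : p ∈ Lg := ⟨rfl, rfl, rfl, rfl⟩
  have e : ∀ i j, g i j = (p * (p⁻¹ * g)) i j := fun i j => by rw [mul_inv_cancel_left]
  have e00 := e 0 0
  have e02 := e 0 2
  have e20 := e 2 0
  have e22 := e 2 2
  rw [G_mul_apply] at e00 e02 e20 e22
  have p0 : p 0 0 = g 0 0 := rfl
  have p1 : p 0 1 = 0 := rfl
  have p2 : p 0 2 = g 0 2 := rfl
  have p3 : p 2 0 = g 2 0 := rfl
  have p4 : p 2 1 = 0 := rfl
  have p5 : p 2 2 = g 2 2 := rfl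
  rw [p0, p1, p2] at e00 e02
  rw [p3, p4, p5] at e20 e22
  refine ⟨p, p⁻¹ * g, by rw [mul_inv_cancel_left], hp, ?_, ?_, ?_, ?_, rfl, rfl, rfl, rfl, rfl⟩
  · refine mul_left_cancel₀ hg.ne' ?_; linear_combination g 0 2 * e20 - g 2 2 * e00
  · refine mul_left_cancel₀ hg.ne' ?_; linear_combination g 0 2 * e22 - g 2 2 * e02
  · refine mul_left_cancel₀ hg.ne' ?_; linear_combination g 2 0 * e00 - g 0 0 * e20
  · refine mul_left_cancel₀ hg.ne' ?_; linear_combination g 2 0 * e02 - g 0 0 * e22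

lemma e31_mem_Lg (c : ℝ) : e31 c ∈ Lg := by refine ⟨?_, ?_, ?_, ?_⟩ <;> simp [e31]

lemma block_ne_zero {h : G} (hL : h ∈ Lg) : h 0 0 * h 2 2 - h 0 2 * h 2 0 ≠ 0 := by
  obtain ⟨a1, a2, a3, a4⟩ := hL
  have hdet := G_det h
  simp only [a1, a2, a3, a4, mul_zero, zero_mul, add_zero, sub_zero] at hdet
  intro h0
  have : (1 : ℝ) = 0 := by linear_combination h 1 1 * h0 - hdet
  exact one_ne_zero this

/-- The entry `(2,0)` of a conjugate of a transversal element vanishes. -/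
lemma conj_transversal {h z : G} (hL : h ∈ Lg) (z00 : z 0 0 = 1) (z02 : z 0 2 = 0)
    (z20 : z 2 0 = 0) (z22 : z 2 2 = 1) : (h * z * h⁻¹) 2 0 = 0 := by
  set g := h * z * h⁻¹
  have e : ∀ i j, (g * h) i j = (h * z) i j := fun i j => by simp [g]
  have e20 := e 2 0
  have e22 := e 2 2
  have hne := block_ne_zero hL
  obtain ⟨a1, a2, a3, a4⟩ := hL
  simp only [G_mul_apply, a1, a2, a3, a4, z00, z02, z20, z22] at e20 e22
  refine mul_left_cancel₀ hne ?_
  linear_combination h 2 2 * e20 - h 2 0 * e22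

lemma transversal_eq_one {h z : G} (hL : h ∈ Lg) (z00 : z 0 0 = 1) (z02 : z 0 2 = 0)
    (z20 : z 2 0 = 0) (z22 : z 2 2 = 1) (h1 : (h * z * h⁻¹) 2 1 = 0) (h2 : (h * z * h⁻¹) 1 0 = 0)
    (h3 : (e31 1 * h * z * (e31 1 * h)⁻¹) 2 1 = 0)
    (h4 : (e31 1 * h * z * (e31 1 * h)⁻¹) 1 0 = 0) : z ∈ Lg := by
  have key1 : ∀ k ∈ Lg, (k * z * k⁻¹) 2 1 = 0 → k 2 0 * z 0 1 + k 2 2 * z 2 1 = 0 := by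
    intro k hk h0
    have h20 := conj_transversal hk z00 z02 z20 z22
    have e : ((k * z * k⁻¹) * k) 2 1 = (k * z) 2 1 := by simp
    obtain ⟨a1, a2, a3, a4⟩ := hk
    rw [G_mul_apply, G_mul_apply k z, h0, h20, a1, a2] at e
    linarith
  have key2 : ∀ k ∈ Lg, (k * z * k⁻¹) 1 0 = 0 → z 1 0 * k⁻¹ 0 0 + z 1 2 * k⁻¹ 2 0 = 0 := by
    intro k hk h0
    have h20 := conj_transversal hk z00 z02 z20 z22
    have e : (k⁻¹ * (k * z * k⁻¹)) 1 0 = (z * k⁻¹) 1 0 := by simp [mul_assoc]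
    obtain ⟨a1, a2, a3, a4⟩ := inv_mem hk
    rw [G_mul_apply, G_mul_apply z, h0, h20, a3, a4] at e
    linarith
  have hL' := mul_mem (e31_mem_Lg 1) hL
  have r1 := key1 h hL h1
  have r2 := key1 _ hL' h3
  have r3 := key2 h hL h2
  have r4 := key2 _ hL' h4
  have f1 : (e31 1 * h) 2 0 = h 0 0 + h 2 0 := by rw [G_mul_apply]; simp [e31]
  have f2 : (e31 1 * h) 2 2 = h 0 2 + h 2 2 := by rw [G_mul_apply]; simp [e31]
  have ei : (e31 1 * h)⁻¹ = h⁻¹ * e31 (-1) := by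
    rw [_root_.mul_inv_rev]; congr 1
    rw [inv_eq_iff_mul_eq_one, ← e31_add]; simp [e31_zero]
  have f3 : (e31 1 * h)⁻¹ 0 0 = h⁻¹ 0 0 - h⁻¹ 0 2 := by rw [ei, G_mul_apply]; simp [e31]; ring
  have f4 : (e31 1 * h)⁻¹ 2 0 = h⁻¹ 2 0 - h⁻¹ 2 2 := by rw [ei, G_mul_apply]; simp [e31]; ring
  rw [f1, f2] at r2
  rw [f3, f4] at r4
  have n1 := block_ne_zero hL
  have n2 := block_ne_zero (inv_mem hL)
  refine ⟨?_, ?_, ?_, ?_⟩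
  · refine mul_left_cancel₀ n1 ?_; linear_combination h 2 2 * (r2 - r1) - h 0 2 * r1
  · refine mul_left_cancel₀ n1 ?_; linear_combination h 0 0 * r1 - h 2 0 * (r2 - r1)
  · refine mul_left_cancel₀ n2 ?_; linear_combination h⁻¹ 2 2 * r3 - h⁻¹ 2 0 * (r3 - r4)
  · refine mul_left_cancel₀ n2 ?_; linear_combination h⁻¹ 0 0 * (r3 - r4) - h⁻¹ 0 2 * r3

lemma isCompact_closedBox (r : ℝ) : IsCompact {g : G | ∀ i j, |g i j - (1 : M₃) i j| ≤ r} := by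
  refine (isCompact_bounded_G (r + 1)).of_isClosed_subset ?_ fun g hg i j => ?_
  · have : {g : G | ∀ i j, |g i j - (1 : M₃) i j| ≤ r} =
        ⋂ i, ⋂ j, {g : G | |g i j - (1 : M₃) i j| ≤ r} := by ext; simp
    rw [this]
    exact isClosed_iInter fun i => isClosed_iInter fun j =>
      isClosed_le ((continuous_entry i j).sub continuous_const).abs continuous_const
  · have h1 := hg i j
    have h2 : |(1 : M₃) i j| ≤ 1 := by rw [Matrix.one_apply]; split_ifs <;> simp
    have := abs_sub_abs_le_abs_sub (g i j) ((1 : M₃) i j)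
    linarith

lemma eventually_conj_mem {C O : Set G} (hC : IsCompact C) (hO : O ∈ 𝓝 (1 : G)) :
    ∀ᶠ z : G in 𝓝 1, ∀ h ∈ C, h * z * h⁻¹ ∈ O := by
  refine hC.eventually_forall_of_forall_eventually fun h _ => ?_
  have hc : Continuous (fun p : G × G => p.2 * p.1 * p.2⁻¹) := by fun_prop
  have := hc.tendsto (1, h)
  simp only [mul_one, mul_inv_cancel] at this
  exact this.eventually hO

lemma block_decomp_tendsto {g : ℕ → G} (hg : Tendsto g atTop (𝓝 1)) :
    ∀ᶠ n in atTop, 0 < g n 0 0 * g n 2 2 - g n 0 2 * g n 2 0 := by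
  have h := fun i j => tendsto_entry hg i j
  have := ((h 0 0).mul (h 2 2)).sub ((h 0 2).mul (h 2 0))
  simp at this
  exact this.eventually (lt_mem_nhds one_pos)

/-- On a set of positive measure, small displacements lie in the block subgroup. -/
lemma exists_plaque_set (hu : ∀ s, MInv ν (u s))
    (hA : ∀ t, MInv ν (gSL t)) (hd : ∀ t, MInv ν (dd t)) (h31 : ∀ c, MInv ν (e31 c))
    (h12 : ν (Om e12) = 0) (h23 : ν (Om e23) = 0) (hdd : ν (Om dd)ᶜ = 0) :
    ∃ S : Set X, ν S ≠ 0 ∧ ∃ V ∈ 𝓝 (1 : G), ∀ x ∈ S, ∀ g ∈ V, g • x ∈ S → g ∈ Lg := by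
  obtain ⟨m, hsf, hmL, hmC, hmO, hmR⟩ := exists_block_measure
  let W := {g : G | ∀ i j, |g i j - (1 : M₃) i j| ≤ 1 / 2}
  have hWc : IsCompact W := isCompact_closedBox _
  have hWm : MeasurableSet W := hWc.isClosed.measurableSet
  obtain ⟨W₁, hW₁o, hW₁1, hW₁⟩ := exists_open_div_subset (nbox_mem_nhds (ε := 1 / 2) (by norm_num))
  have hWW : ∀ p ∈ W₁, ∀ q ∈ W₁, p * q⁻¹ ∈ W := fun p hp q hq i j => (hW₁ p hp q hq i j).le
  have hW₁W : W₁ ⊆ W := fun p hp => by simpa using hWW p hp 1 hW₁1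
  have hWfin : m W ≠ ∞ := (hmC W hWc).ne
  have hW₁fin : m W₁ ≠ ∞ := ne_top_of_le_ne_top hWfin (measure_mono hW₁W)
  have hW₁pos : m W₁ ≠ 0 := hmO _ hW₁o hW₁1
  obtain ⟨c, hc0, hcfin, hc4⟩ : ∃ c : ℝ≥0∞, c ≠ 0 ∧ c ≠ ∞ ∧ 2 * c < m W₁ := by
    refine ⟨m W₁ / 4, by simp [hW₁pos], (div_lt_top hW₁fin (by simp)).ne, ?_⟩
    have e : 2 * (m W₁ / 4) = m W₁ / 2 := by
      rw [← mul_div_assoc, mul_comm, ENNReal.div_eq_div_iff (by simp) (by simp) (by simp) (by simp)]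
      ring
    rw [e]; exact ENNReal.half_lt_self hW₁pos hW₁fin
  have hWpos : m W ≠ 0 := fun h => hW₁pos (measure_mono_null hW₁W h)
  obtain ⟨ε₀, hε₀, hε₀c⟩ : ∃ ε₀ : ℝ≥0∞, ε₀ ≠ 0 ∧ m W * (ε₀ + ε₀) < c := by
    refine ⟨c / m W / 4, by simp [hc0, hWfin], ?_⟩
    have hq : c / m W ≠ ∞ := (div_lt_top hcfin hWpos).ne
    have hq0 : c / m W ≠ 0 := by simp [hc0, hWfin]
    have h1 : c / m W / 4 + c / m W / 4 < c / m W := by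
      have : c / m W / 4 + c / m W / 4 = c / m W / 2 := by
        rw [← two_mul, ← mul_div_assoc, mul_comm, ENNReal.div_eq_div_iff (by simp) (by simp)
          (by simp) (by simp)]
        ring
      rw [this]; exact ENNReal.half_lt_self hq0 hq
    calc _ < m W * (c / m W) := (ENNReal.mul_lt_mul_iff_right hWpos hWfin).2 h1
      _ = c := ENNReal.mul_div_cancel hWpos hWfin
  obtain ⟨K, K', hG, hK'E, hle⟩ := exists_goodPair hu hA h12 h23 (measurableSet_Om continuous_dd) hε₀
  have hOm1 : ν (Om dd) = 1 := (prob_compl_eq_zero_iff (measurableSet_Om continuous_dd)).1 hdd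
  have hKm : MeasurableSet K := hG.isCompact.isClosed.measurableSet
  have hKc : ν Kᶜ ≤ ε₀ := by
    rw [hOm1] at hle
    rw [prob_compl_eq_one_sub hKm]
    exact tsub_le_iff_left.2 hle
  obtain ⟨O, hO, hcone⟩ := exists_cone hG (hG.sub.trans hK'E) one_pos
  let J := K ∩ (fun x => e31 1 • x) ⁻¹' K
  have hJm : MeasurableSet J := hKm.inter (measurable_smulX _ hKm)
  have hJc : ν Jᶜ ≤ ε₀ + ε₀ := by
    rw [Set.compl_inter]
    refine (measure_union_le _ _).trans (add_le_add hKc ?_)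
    rw [← Set.preimage_compl, (h31 1).preimage hKm.compl]
    exact hKc
  let T : Set (X × G) := {p | p.2 ∈ W ∧ p.2 • p.1 ∈ Jᶜ}
  have hT : MeasurableSet T := (measurable_snd hWm).inter
    ((continuous_snd.smul continuous_fst).measurable hJm.compl)
  let ψ : X → ℝ≥0∞ := fun x => m {h | h ∈ W ∧ h • x ∈ Jᶜ}
  have hψ : Measurable ψ := measurable_measure_prodMk_left hT
  have hItg : ∫⁻ x, ψ x ∂ν ≤ m W * (ε₀ + ε₀) := by
    have e : ∫⁻ x, ψ x ∂ν = (ν.prod m) T := (Measure.prod_apply hT).symm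
    rw [e, Measure.prod_apply_symm hT]
    have hae : ∀ᵐ h ∂m, h ∈ Lg := mem_ae_iff.2 hmL
    calc ∫⁻ h, ν ((fun x => (x, h)) ⁻¹' T) ∂m ≤ ∫⁻ h, W.indicator (fun _ => ε₀ + ε₀) h ∂m := by
          refine lintegral_mono_ae ?_
          filter_upwards [hae] with h hL
          by_cases hW : h ∈ W
          · rw [indicator_of_mem hW]
            have h00 := abs_le.1 (hW 0 0)
            have h11 := abs_le.1 (hW 1 1)
            simp only [one_apply_eq] at h00 h11
            have hi := mInv_of_mem_Lg hu hA hd h31 hL (by linarith [h00.1]) (by linarith [h11.1])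
            refine le_trans ?_ ((hi.preimage hJm.compl).le.trans hJc)
            exact measure_mono fun x hx => hx.2
          · rw [Set.indicator_of_notMem hW]
            refine le_of_eq (measure_mono_null (t := ∅) (fun x hx => hW hx.1) measure_empty)
      _ = m W * (ε₀ + ε₀) := by rw [lintegral_indicator_const hWm, mul_comm]
  let S : Set X := {x | ψ x < c}
  refine ⟨S, fun h0 => ?_, ?_⟩
  · have h1 := mul_meas_ge_le_lintegral (μ := ν) hψ c
    have h2 : ν {x | c ≤ ψ x} = 1 := by
      have : {x | c ≤ ψ x} = Sᶜ := by ext x; simp [S]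
      rw [this, prob_compl_eq_one_iff (measurableSet_lt hψ measurable_const)]
      exact h0
    rw [h2, mul_one] at h1
    exact absurd (h1.trans hItg) (not_le.2 hε₀c)
  · by_contra! hcon
    have hseq := fun n : ℕ => hcon (nbox (1 / ((n : ℝ) + 1))) (nbox_mem_nhds (by positivity))
    choose x hxS g hg hgx hgL using hseq
    have hg1 : Tendsto g atTop (𝓝 1) := by
      rw [tendsto_G_iff]
      intro i j
      rw [tendsto_iff_norm_sub_tendsto_zero]
      exact squeeze_zero (fun n => norm_nonneg _) (fun n => (hg n i j).le)
        tendsto_one_div_add_atTop_nhds_zero_nat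
    have hpos := block_decomp_tendsto hg1
    have hdec : ∀ n, ∃ p z : G, 0 < g n 0 0 * g n 2 2 - g n 0 2 * g n 2 0 →
        (g n = p * z ∧ p ∈ Lg ∧ z 0 0 = 1 ∧ z 0 2 = 0 ∧ z 2 0 = 0 ∧ z 2 2 = 1 ∧ p 0 0 = g n 0 0 ∧
          p 0 2 = g n 0 2 ∧ p 2 0 = g n 2 0 ∧ p 2 2 = g n 2 2 ∧
          p 1 1 = (g n 0 0 * g n 2 2 - g n 0 2 * g n 2 0)⁻¹) := by
      intro n
      by_cases h : 0 < g n 0 0 * g n 2 2 - g n 0 2 * g n 2 0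
      · obtain ⟨p, z, hpz⟩ := exists_block_decomp h
        exact ⟨p, z, fun _ => hpz⟩
      · exact ⟨1, 1, fun h' => absurd h' h⟩
    choose p z hpz using hdec
    have hp1 : Tendsto p atTop (𝓝 1) := by
      have h := fun i j => tendsto_entry hg1 i j
      have h11 := (((h 0 0).mul (h 2 2)).sub ((h 0 2).mul (h 2 0))).inv₀ (by simp)
      rw [tendsto_G_iff]
      intro i j
      fin_cases i <;> fin_cases j
      · exact (h 0 0).congr' (hpos.mono fun n hn => ((hpz n hn).2.2.2.2.2.2.1).symm)
      · exact tendsto_const_nhds.congr' (hpos.mono fun n hn => ((hpz n hn).2.1.1).symm)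
      · exact (h 0 2).congr' (hpos.mono fun n hn => ((hpz n hn).2.2.2.2.2.2.2.1).symm)
      · exact tendsto_const_nhds.congr' (hpos.mono fun n hn => ((hpz n hn).2.1.2.2.1).symm)
      · have h11' := h11.congr' (hpos.mono fun n hn => ((hpz n hn).2.2.2.2.2.2.2.2.2.2).symm)
        simpa using h11'
      · exact tendsto_const_nhds.congr' (hpos.mono fun n hn => ((hpz n hn).2.1.2.2.2).symm)
      · exact (h 2 0).congr' (hpos.mono fun n hn => ((hpz n hn).2.2.2.2.2.2.2.2.1).symm)
      · exact tendsto_const_nhds.congr' (hpos.mono fun n hn => ((hpz n hn).2.1.2.1).symm)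
      · exact (h 2 2).congr' (hpos.mono fun n hn => ((hpz n hn).2.2.2.2.2.2.2.2.2.1).symm)
    have hz1 : Tendsto z atTop (𝓝 1) := by
      have h1 : Tendsto (fun n => (p n)⁻¹ * g n) atTop (𝓝 (1⁻¹ * 1)) := hp1.inv.mul hg1
      rw [inv_one, mul_one] at h1
      exact h1.congr' (hpos.mono fun n hn => by rw [(hpz n hn).1, inv_mul_cancel_left])
    have hC' : IsCompact ((fun h => e31 1 * h) '' W) := hWc.image (continuous_const_mul _)
    obtain ⟨n, hn, hnp, hnz1, hnz2⟩ := (hpos.and ((hp1.eventually (hW₁o.mem_nhds hW₁1)).and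
      ((hz1.eventually (eventually_conj_mem hWc hO)).and
        (hz1.eventually (eventually_conj_mem hC' hO))))).exists
    obtain ⟨hgpz, hpL, z00, z02, z20, z22, -⟩ := hpz n hn
    have hb1 : m {h | h ∈ W ∧ h • x n ∈ Jᶜ} < c := hxS n
    have hmeas : MeasurableSet {h : G | h ∈ W ∧ h • g n • x n ∈ Jᶜ} :=
      hWm.inter ((continuous_id.smul continuous_const).measurable hJm.compl)
    have hb2 : m {h | h ∈ W₁ ∧ h • z n • x n ∈ Jᶜ} < c := by
      refine lt_of_le_of_lt ?_ (hgx n)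
      change _ ≤ m {h | h ∈ W ∧ h • g n • x n ∈ Jᶜ}
      rw [← hmR _ (inv_mem hpL) _ hmeas]
      refine measure_mono fun h hh => ⟨hWW _ hh.1 _ hnp, ?_⟩
      have e : (h * (p n)⁻¹) • g n • x n = h • z n • x n := by
        rw [hgpz, smul_smul, smul_smul, ← mul_assoc, inv_mul_cancel_right]
      rw [e]; exact hh.2
    obtain ⟨h, hW, hL, hx1, hx2⟩ : ∃ h ∈ W₁, h ∈ Lg ∧ h • x n ∈ J ∧ h • z n • x n ∈ J := by
      by_contra! hno
      have hsub : W₁ ⊆ (Lg : Set G)ᶜ ∪ ({h | h ∈ W ∧ h • x n ∈ Jᶜ} ∪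
          {h | h ∈ W₁ ∧ h • z n • x n ∈ Jᶜ}) := by
        intro h hh
        by_cases hL : h ∈ Lg
        · right
          by_cases hJ : h • x n ∈ J
          · exact Or.inr ⟨hh, hno h hh hL hJ⟩
          · exact Or.inl ⟨hW₁W hh, hJ⟩
        · exact Or.inl hL
      have := (measure_mono (μ := m) hsub).trans ((measure_union_le _ _).trans
        (add_le_add hmL.le ((measure_union_le _ _).trans (add_le_add hb1.le hb2.le))))
      rw [zero_add, ← two_mul] at this
      exact absurd this (not_le.2 hc4)
    have hg20 := conj_transversal hL z00 z02 z20 z22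
    have hc1 := hcone _ hx1.1 _ (hnz1 h (hW₁W hW)) (by
      rw [smul_smul, inv_mul_cancel_right, mul_smul]; exact hx2.1)
    have hL' := mul_mem (e31_mem_Lg 1) hL
    have hg20' := conj_transversal hL' z00 z02 z20 z22
    have hc2 := hcone _ hx1.2 _ (hnz2 _ ⟨h, hW₁W hW, rfl⟩) (by
      rw [smul_smul, smul_smul]
      have e : (e31 1 * h * z n * (e31 1 * h)⁻¹ * (e31 1 * h)) • x n = e31 1 • h • z n • x n := by
        rw [inv_mul_cancel_right, mul_smul, mul_smul]
      rw [mul_assoc (e31 1 * h * z n * (e31 1 * h)⁻¹) (e31 1) h, e]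
      exact hx2.2)
    rw [hg20, abs_zero, mul_zero] at hc1
    simp only [hg20', abs_zero, mul_zero] at hc2
    have b1 := abs_nonneg ((h * z n * h⁻¹) 2 1)
    have b2 := abs_nonneg ((h * z n * h⁻¹) 1 0)
    have b3 := abs_nonneg ((e31 1 * h * z n * (e31 1 * h)⁻¹) 2 1)
    have b4 := abs_nonneg ((e31 1 * h * z n * (e31 1 * h)⁻¹) 1 0)
    have hzL : z n ∈ Lg := transversal_eq_one hL z00 z02 z20 z22 (abs_eq_zero.1 (by linarith))
      (abs_eq_zero.1 (by linarith)) (abs_eq_zero.1 (by linarith)) (abs_eq_zero.1 (by linarith))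
    refine hgL n ?_
    rw [hgpz]
    exact mul_mem hpL hzL

/-! ### Lattice vectors -/

/-- Nonzero vectors of the lattice attached to a point of `X`. -/
def Lam (x : X) : Set (ℝ³) := {v | ∃ g : G, g • x₀ = x ∧ ∃ z : Fin 3 → ℤ, z ≠ 0 ∧
  v = (g : M₃) *ᵥ fun i => (z i : ℝ)}

lemma Gamma_mulVec {γ : G} (hγ : γ ∈ Gamma) {z : Fin 3 → ℤ} (hz : z ≠ 0) : ∃ z' : Fin 3 → ℤ,
    z' ≠ 0 ∧ ((γ : M₃) *ᵥ fun i => (z i : ℝ)) = fun i => (z' i : ℝ) := by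
  obtain ⟨N, rfl⟩ := hγ
  refine ⟨(N : Matrix (Fin 3) (Fin 3) ℤ) *ᵥ z, fun h => hz ?_, ?_⟩
  · have := congrArg (fun v => ((N⁻¹ : SpecialLinearGroup (Fin 3) ℤ) : Matrix (Fin 3) (Fin 3) ℤ) *ᵥ v) h
    simp only [mulVec_mulVec, ← Matrix.SpecialLinearGroup.coe_mul, inv_mul_cancel,
      Matrix.SpecialLinearGroup.coe_one, one_mulVec, mulVec_zero] at this
    exact this
  · ext i
    simp [mulVec, dotProduct]

lemma mem_Lam_iff (g : G) (v : ℝ³) : v ∈ Lam (g • x₀) ↔ ∃ z : Fin 3 → ℤ, z ≠ 0 ∧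
    v = (g : M₃) *ᵥ fun i => (z i : ℝ) := by
  refine ⟨?_, fun ⟨z, hz, hv⟩ => ⟨g, rfl, z, hz, hv⟩⟩
  rintro ⟨h, hh, z, hz, rfl⟩
  have hγ := (smul_x₀_eq_iff g h).1 hh.symm
  obtain ⟨z', hz', e⟩ := Gamma_mulVec hγ hz
  refine ⟨z', hz', ?_⟩
  rw [← e, mulVec_mulVec, ← coe_G_mul, mul_inv_cancel_left]

lemma Lam_smul (g : G) {x : X} {v : ℝ³} (hv : v ∈ Lam x) : (g : M₃) *ᵥ v ∈ Lam (g • x) := by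
  obtain ⟨h, rfl, z, hz, rfl⟩ := hv
  refine ⟨g * h, by rw [mul_smul], z, hz, ?_⟩
  rw [mulVec_mulVec, coe_G_mul]

/-- A compact set is the image of a bounded set of matrices with bounded inverses. -/
lemma exists_bounded_rep {K : Set X} (hK : IsCompact K) : ∃ R > 0, ∀ x ∈ K, ∃ g : G,
    g • x₀ = x ∧ (∀ i j, |g i j| ≤ R) ∧ ∀ i j, |g⁻¹ i j| ≤ R := by
  let B : ℕ → Set G := fun n => {g | ∀ i j, |g i j| < n ∧ |g⁻¹ i j| < n}
  have hBo : ∀ n, IsOpen (B n) := by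
    intro n
    have : B n = ⋂ i, ⋂ j, ({g : G | |g i j| < n} ∩ {g : G | |g⁻¹ i j| < n}) := by ext g; simp [B]
    rw [this]
    refine isOpen_iInter_of_finite fun i => isOpen_iInter_of_finite fun j => ?_
    exact (isOpen_lt (continuous_entry i j).abs continuous_const).inter
      (isOpen_lt ((continuous_entry i j).comp continuous_inv).abs continuous_const)
  have hmono : Monotone B := fun m n hmn g hg i j => by
    have : (m : ℝ) ≤ n := by exact_mod_cast hmn
    exact ⟨(hg i j).1.trans_le this, (hg i j).2.trans_le this⟩
  obtain ⟨n, hn⟩ := hK.elim_directed_cover (fun n => (fun g : G => g • x₀) '' B n)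
    (fun n => isOpenMap_smul_pt x₀ _ (hBo n)) (fun x _ => by
      obtain ⟨g, rfl⟩ := exists_smul_x₀ x
      obtain ⟨n, hn⟩ := exists_nat_gt (∑ i, ∑ j, (|g i j| + |g⁻¹ i j|))
      refine Set.mem_iUnion.2 ⟨n, g, fun i j => ?_, rfl⟩
      have h1 : |g i j| + |g⁻¹ i j| ≤ ∑ i, ∑ j, (|g i j| + |g⁻¹ i j|) :=
        (Finset.single_le_sum (f := fun j => |g i j| + |g⁻¹ i j|) (fun j _ => by positivity)
          (Finset.mem_univ j)).trans
        (Finset.single_le_sum (f := fun i => ∑ j, (|g i j| + |g⁻¹ i j|))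
          (fun i _ => Finset.sum_nonneg fun j _ => by positivity) (Finset.mem_univ i))
      have := abs_nonneg (g i j)
      have := abs_nonneg (g⁻¹ i j)
      constructor <;> linarith)
    (directed_of_isDirected_le fun m n hmn => Set.image_mono (hmono hmn))
  refine ⟨n + 1, by positivity, fun x hx => ?_⟩
  obtain ⟨g, hg, hgx⟩ := hn hx
  exact ⟨g, hgx, fun i j => by linarith [(hg i j).1], fun i j => by linarith [(hg i j).2]⟩

lemma exists_abs_ge_one {z : Fin 3 → ℤ} (hz : z ≠ 0) : ∃ i, (1 : ℝ) ≤ |(z i : ℝ)| := by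
  obtain ⟨i, hi⟩ := Function.ne_iff.1 hz
  exact ⟨i, by exact_mod_cast Int.one_le_abs hi⟩

lemma abs_mulVec_le {A : M₃} {R r : ℝ} (hA : ∀ i j, |A i j| ≤ R)
    {v : ℝ³} (hv : ∀ i, |v i| ≤ r) (i : Fin 3) : |(A *ᵥ v) i| ≤ 3 * R * r := by
  have hR : 0 ≤ R := (abs_nonneg _).trans (hA 0 0)
  rw [mulVec, dotProduct]
  refine (Finset.abs_sum_le_sum_abs _ _).trans ?_
  calc ∑ j, |A i j * v j| ≤ ∑ _j : Fin 3, R * r := Finset.sum_le_sum fun j _ => by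
        rw [abs_mul]; exact mul_le_mul (hA i j) (hv j) (abs_nonneg _) hR
    _ = 3 * R * r := by simp; ring

lemma exists_lower_bound {K : Set X} (hK : IsCompact K) : ∃ ε > 0, ∀ x ∈ K, ∀ v ∈ Lam x,
    ∃ i, ε ≤ |v i| := by
  obtain ⟨R, hR, hrep⟩ := exists_bounded_rep hK
  refine ⟨1 / (6 * R), by positivity, fun x hx v hv => ?_⟩
  obtain ⟨g, rfl, -, hg⟩ := hrep x hx
  obtain ⟨z, hz, rfl⟩ := (mem_Lam_iff g v).1 hv
  obtain ⟨i, hi⟩ := exists_abs_ge_one hz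
  by_contra! hcon
  have h1 := abs_mulVec_le (A := (g⁻¹ : G)) hg (fun j => (hcon j).le) i
  rw [mulVec_mulVec, ← coe_G_mul, inv_mul_cancel, coe_G_one, one_mulVec] at h1
  have : 3 * R * (1 / (6 * R)) = 1 / 2 := by field_simp; norm_num
  linarith

/-- A stabilizer element of the block group with large trace fixes a lattice vector on the axis. -/
lemma exists_axis_vector {x : X} {c : G} (hc : c • x = x) (hL : c ∈ Lg) (h11 : c 1 1 = 1)
    (htr : c 0 0 + c 2 2 ≠ 2) : ∃ v ∈ Lam x, v 0 = 0 ∧ v 2 = 0 := by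
  obtain ⟨g, rfl⟩ := exists_smul_x₀ x
  have hγ : g⁻¹ * (c * g) ∈ Gamma := (smul_x₀_eq_iff _ _).1 (by rw [mul_smul, hc])
  obtain ⟨N, hN⟩ := hγ
  obtain ⟨a1, a2, a3, a4⟩ := hL
  have hdet := G_det c
  simp only [a1, a2, a3, a4, h11, mul_zero, zero_mul, add_zero, sub_zero, mul_one] at hdet
  have hNr : (N : Matrix (Fin 3) (Fin 3) ℤ).map (Int.castRingHom ℝ) =
      ((g⁻¹ * (c * g) : G) : M₃) := by
    rw [← hN]; rfl
  have hd0 : ((c : M₃) - 1).det = 0 := by rw [det_fin_three]; simp [a1, a2, a3, a4, h11]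
  have hdN : ((N : Matrix (Fin 3) (Fin 3) ℤ) - 1).det = 0 := by
    have h1 : (Int.castRingHom ℝ) ((N : Matrix (Fin 3) (Fin 3) ℤ) - 1).det = 0 := by
      rw [RingHom.map_det, map_sub, map_one, RingHom.mapMatrix_apply, hNr]
      have e : ((g⁻¹ * (c * g) : G) : M₃) - 1 = ((g⁻¹ : G) : Matrix _ _ ℝ) *
          ((c : M₃) - 1) * (g : M₃) := by
        rw [mul_sub, sub_mul, mul_one, ← coe_G_mul g⁻¹ g, inv_mul_cancel, coe_G_one, coe_G_mul,
          coe_G_mul, mul_assoc]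
      rw [e, det_mul, det_mul, hd0, mul_zero, zero_mul]
    simpa using h1
  obtain ⟨z, hz, hNz⟩ := exists_mulVec_eq_zero_iff.2 hdN
  let zr : ℝ³ := fun i => (z i : ℝ)
  have hfix : ((g⁻¹ * (c * g) : G) : M₃) *ᵥ zr = zr := by
    rw [sub_mulVec, one_mulVec, sub_eq_zero] at hNz
    rw [← hNr]
    ext i
    have := congrArg (fun v => ((v i : ℤ) : ℝ)) hNz
    simpa [mulVec, dotProduct, zr] using this
  let w := (g : M₃) *ᵥ zr
  have hw : (c : M₃) *ᵥ w = w := by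
    have := congrArg (fun v => (g : M₃) *ᵥ v) hfix
    simp only [mulVec_mulVec, ← coe_G_mul, mul_inv_cancel_left] at this
    rw [coe_G_mul, ← mulVec_mulVec] at this
    exact this
  refine ⟨w, (mem_Lam_iff g w).2 ⟨z, hz, rfl⟩, ?_⟩
  have e0 := congrFun hw 0
  have e2 := congrFun hw 2
  simp only [mulVec, dotProduct, Fin.sum_univ_three, a1, a2] at e0 e2
  have hne : 2 - (c 0 0 + c 2 2) ≠ 0 := sub_ne_zero.2 (Ne.symm htr)
  constructor
  · refine mul_left_cancel₀ hne ?_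
    linear_combination (c 2 2 - 1) * e0 - c 0 2 * e2 - w 0 * hdet
  · refine mul_left_cancel₀ hne ?_
    linear_combination (c 0 0 - 1) * e2 - c 2 0 * e0 - w 2 * hdet

/-! ### No measure is invariant under the block group and carried by transversal pairs -/

/-- The part of the block-group orbit of `x` of size `r`. -/
def plaque (r : ℝ) (x : X) : Set X := (fun l : G => l • x) ''
  ((Lg : Set G) ∩ {g : G | ∀ i j, |g i j - (1 : M₃) i j| ≤ r})

lemma isCompact_plaque (r : ℝ) (x : X) : IsCompact (plaque r x) :=
  ((isCompact_closedBox r).inter_left isClosed_Lg).image (continuous_id.smul continuous_const)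

lemma exists_plaque_pos {ν : Measure X} {S : Set X} (hS : ν S ≠ 0) {V : Set G}
    (hV : V ∈ 𝓝 (1 : G)) (h : ∀ x ∈ S, ∀ g ∈ V, g • x ∈ S → g ∈ Lg) :
    ∃ x, ∀ r > 0, ν (plaque r x) ≠ 0 := by
  obtain ⟨x, hx, hpos⟩ := exists_mem_forall_mem_nhdsWithin_pos_measure hS
  refine ⟨x, fun r hr h0 => ?_⟩
  have hN : (fun g : G => g • x) '' (V ∩ nbox r) ∈ 𝓝 x :=
    smul_pt_mem_nhds (inter_mem hV (nbox_mem_nhds hr)) x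
  refine (hpos _ (inter_mem self_mem_nhdsWithin (mem_nhdsWithin_of_mem_nhds hN))).ne' ?_
  refine measure_mono_null ?_ h0
  rintro _ ⟨hyS, g, ⟨hgV, hgr⟩, rfl⟩
  exact ⟨g, ⟨h x hx g hgV hyS, fun i j => (hgr i j).le⟩, rfl⟩

lemma exists_plaque_return {x : X} {r : ℝ} (hr : ν (plaque r x) ≠ 0) {a : G} (ha : MInv ν a) :
    ∃ y ∈ plaque r x, ∃ᶠ n in atTop, a ^ n • y ∈ plaque r x := by
  by_contra! hcon
  refine hr (measure_eq_zero_iff_ae_notMem.2 ?_)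
  filter_upwards [ha.recurrence (isCompact_plaque r x).isClosed.measurableSet] with y hy hyP
  exact hy hyP (hcon y hyP)

/-- The rank one limits of `exp (-n) • dd n` and `exp (-n) • dd (-n)`. -/
lemma tendsto_exp_smul_dd {n : ℕ → ℕ} (hn : Tendsto n atTop atTop) :
    Tendsto (fun j => exp (-(n j : ℝ)) • (dd (n j) : M₃)) atTop (𝓝 (Matrix.diagonal ![1, 0, 0])) ∧
    Tendsto (fun j => exp (-(n j : ℝ)) • (dd (-(n j)) : M₃)) atTop
      (𝓝 (Matrix.diagonal ![0, 0, 1])) := by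
  have h0 : Tendsto (fun j => exp (-(n j : ℝ))) atTop (𝓝 0) :=
    tendsto_exp_neg_atTop_nhds_zero.comp (tendsto_natCast_atTop_atTop.comp hn)
  have h1 : Tendsto (fun j => exp (-(n j : ℝ)) * exp (-(n j : ℝ))) atTop (𝓝 0) := by
    simpa using h0.mul h0
  have e : ∀ j, exp (-(n j : ℝ)) * exp (n j) = 1 := fun j => by rw [← exp_add]; simp
  constructor <;> refine tendsto_pi_nhds.2 fun i => tendsto_pi_nhds.2 fun k => ?_ <;>
    simp only [Matrix.smul_apply, dd, dT_apply, smul_eq_mul] <;>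
    fin_cases i <;> fin_cases k <;> simp [e, h0, h1]

lemma tendsto_coe_G {ι : Type*} {l : Filter ι} {f : ι → G} {g : G} (h : Tendsto f l (𝓝 g)) :
    Tendsto (fun i => (f i : M₃)) l (𝓝 (g : M₃)) :=
  (isClosedEmbedding_coe_G.continuous.tendsto g).comp h

lemma tendsto_one_of_closedBox {l : ℕ → G} (h : ∀ n i j,
    |l n i j - (1 : M₃) i j| ≤ 1 / ((n : ℝ) + 1)) :
    Tendsto l atTop (𝓝 1) := by
  rw [tendsto_G_iff]
  intro i j
  rw [tendsto_iff_norm_sub_tendsto_zero]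
  exact squeeze_zero (fun n => norm_nonneg _) (fun n => h n i j)
    tendsto_one_div_add_atTop_nhds_zero_nat

lemma Lg_mul_apply {g h : G} (hg : g ∈ Lg) : (g * h) 1 1 = g 1 1 * h 1 1 := by
  obtain ⟨a1, a2, a3, a4⟩ := hg
  rw [G_mul_apply, a3, a4]; ring

lemma exists_return_seq {x : X} (hx : ∀ r > 0, ν (plaque r x) ≠ 0) {a : G} (ha : MInv ν a) :
    ∃ (n : ℕ → ℕ) (l l' : ℕ → G), Tendsto n atTop atTop ∧ Tendsto l atTop (𝓝 1) ∧
      Tendsto l' atTop (𝓝 1) ∧ (∀ j, l j ∈ Lg) ∧ (∀ j, l' j ∈ Lg) ∧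
      ∀ j, ((l' j)⁻¹ * a ^ n j * l j) • x = x := by
  have hstep : ∀ j : ℕ, ∃ n l l', j ≤ n ∧ l ∈ Lg ∧ l' ∈ Lg ∧
      (∀ i k, |l i k - (1 : M₃) i k| ≤ 1 / ((j : ℝ) + 1)) ∧
      (∀ i k, |l' i k - (1 : M₃) i k| ≤ 1 / ((j : ℝ) + 1)) ∧
      (l'⁻¹ * a ^ n * l) • x = x := by
    intro j
    obtain ⟨y, ⟨l, ⟨hl, hlb⟩, rfl⟩, hfr⟩ := exists_plaque_return (hx (1 / ((j : ℝ) + 1))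
      (by positivity)) ha
    obtain ⟨n, hn, l', ⟨hl', hlb'⟩, e⟩ := (frequently_atTop.1 hfr) j
    refine ⟨n, l, l', hn, hl, hl', hlb, hlb', ?_⟩
    simp only at e
    rw [mul_smul, mul_smul, ← e, inv_smul_smul]
  choose n l l' hn hl hl' hlb hlb' e using hstep
  exact ⟨n, l, l', tendsto_atTop_mono hn tendsto_id, tendsto_one_of_closedBox hlb,
    tendsto_one_of_closedBox hlb', hl, hl', e⟩

lemma dd_mem_Lg (t : ℝ) : dd t ∈ Lg := by refine ⟨?_, ?_, ?_, ?_⟩ <;> simp [dd, dT_apply]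

lemma u_mem_Lg (s : ℝ) : u s ∈ Lg := by refine ⟨?_, ?_, ?_, ?_⟩ <;> simp [u]

lemma exists_hyperbolic_stab (hu : ∀ s, MInv ν (u s))
    (hd : ∀ t, MInv ν (dd t)) (h31 : ∀ c, MInv ν (e31 c)) {x : X}
    (hx : ∀ r > 0, ν (plaque r x) ≠ 0) :
    ∃ c ∈ Lg, c • x = x ∧ c 1 1 = 1 ∧ c 0 0 + c 2 2 ≠ 2 := by
  let k : G := u 1 * e31 1
  let k' : G := e31 (-1) * u (-1)
  have hkk' : k⁻¹ = k' := by
    rw [inv_eq_iff_mul_eq_one]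
    simp only [k, k']
    rw [mul_assoc, ← mul_assoc (e31 1), ← e31_add, add_neg_cancel, e31_zero, one_mul, ← u_add,
      add_neg_cancel, u_zero]
  have hkL : k ∈ Lg := mul_mem (u_mem_Lg 1) (e31_mem_Lg 1)
  have hk : MInv ν k := (hu 1).mul (h31 1)
  obtain ⟨n, l, l', hn, hl, hl', hlL, hlL', hs⟩ := exists_return_seq hx (hd 1)
  obtain ⟨m, q, q', hm, hq, hq', hqL, hqL', hs'⟩ :=
    exists_return_seq hx ((hk.mul (hd 1)).mul hk.inv)
  simp only [dd_pow, mul_one, conj_pow] at hs hs'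
  let δ : ℕ → G := fun j => (l' j)⁻¹ * dd (n j) * l j
  let δ' : ℕ → G := fun j => (q' j)⁻¹ * (k * dd (m j) * k⁻¹) * q j
  let c : ℕ → G := fun j => δ j * δ' j * (δ j)⁻¹ * (δ' j)⁻¹
  have hδL : ∀ j, δ j ∈ Lg := fun j => mul_mem (mul_mem (inv_mem (hlL' j)) (dd_mem_Lg _)) (hlL j)
  have hδL' : ∀ j, δ' j ∈ Lg := fun j => mul_mem (mul_mem (inv_mem (hqL' j))
    (mul_mem (mul_mem hkL (dd_mem_Lg _)) (inv_mem hkL))) (hqL j)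
  have hcx : ∀ j, c j • x = x := by
    intro j
    have h1 : (δ j)⁻¹ • x = x := inv_smul_eq_iff.2 (hs j).symm
    have h2 : (δ' j)⁻¹ • x = x := inv_smul_eq_iff.2 (hs' j).symm
    simp only [c, mul_smul]
    rw [h2, h1]
    erw [hs' j, hs j]
  have hcL : ∀ j, c j ∈ Lg := fun j =>
    mul_mem (mul_mem (mul_mem (hδL j) (hδL' j)) (inv_mem (hδL j))) (inv_mem (hδL' j))
  have hc11 : ∀ j, c j 1 1 = 1 := by
    intro j
    have i1 : δ j 1 1 * (δ j)⁻¹ 1 1 = 1 := by rw [← Lg_mul_apply (hδL j), mul_inv_cancel]; simp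
    have i2 : δ' j 1 1 * (δ' j)⁻¹ 1 1 = 1 := by rw [← Lg_mul_apply (hδL' j), mul_inv_cancel]; simp
    simp only [c]
    rw [Lg_mul_apply (mul_mem (mul_mem (hδL j) (hδL' j)) (inv_mem (hδL j))),
      Lg_mul_apply (mul_mem (hδL j) (hδL' j)), Lg_mul_apply (hδL j)]
    linear_combination (δ' j 1 1 * (δ' j)⁻¹ 1 1) * i1 + i2
  obtain ⟨t1, t2⟩ := tendsto_exp_smul_dd hn
  obtain ⟨t3, t4⟩ := tendsto_exp_smul_dd hm
  have r1 : Tendsto (fun j => exp (-(n j : ℝ)) • (δ j : M₃)) atTop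
      (𝓝 (Matrix.diagonal ![1, 0, 0])) := by
    have := ((tendsto_coe_G hl'.inv).mul t1).mul (tendsto_coe_G hl)
    simp only [inv_one, coe_G_one, one_mul, mul_one] at this
    exact this.congr fun j => by simp [δ]
  have r2 : Tendsto (fun j => exp (-(n j : ℝ)) • ((δ j)⁻¹ : G).1) atTop
      (𝓝 (Matrix.diagonal ![0, 0, 1])) := by
    have := ((tendsto_coe_G hl.inv).mul t2).mul (tendsto_coe_G hl')
    simp only [inv_one, coe_G_one, one_mul, mul_one] at this
    refine this.congr fun j => ?_
    have e : (δ j)⁻¹ = (l j)⁻¹ * dd (-(n j)) * l' j := by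
      simp only [δ, _root_.mul_inv_rev, inv_inv, dd, dT_inv, mul_assoc]
    rw [e]; simp
  have r3 : Tendsto (fun j => exp (-(m j : ℝ)) • (δ' j : M₃)) atTop
      (𝓝 (k.1 * Matrix.diagonal ![1, 0, 0] * k'.1)) := by
    have := ((tendsto_coe_G hq'.inv).mul ((t3.const_mul k.1).mul_const k'.1)).mul (tendsto_coe_G hq)
    simp only [inv_one, coe_G_one, one_mul, mul_one] at this
    exact this.congr fun j => by simp only [δ', hkk']; simp
  have r4 : Tendsto (fun j => exp (-(m j : ℝ)) • ((δ' j)⁻¹ : G).1) atTop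
      (𝓝 (k.1 * Matrix.diagonal ![0, 0, 1] * k'.1)) := by
    have := ((tendsto_coe_G hq.inv).mul ((t4.const_mul k.1).mul_const k'.1)).mul (tendsto_coe_G hq')
    simp only [inv_one, coe_G_one, one_mul, mul_one] at this
    refine this.congr fun j => ?_
    have e : (δ' j)⁻¹ = (q j)⁻¹ * (k * dd (-(m j)) * k') * q' j := by
      rw [← hkk']
      simp only [δ', _root_.mul_inv_rev, inv_inv, dd, dT_inv, mul_assoc]
    rw [e]; simp
  have r5 := ((r1.mul r3).mul r2).mul r4
  set Lim : M₃ := Matrix.diagonal ![1, 0, 0] *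
    (k.1 * Matrix.diagonal ![1, 0, 0] * k'.1) * Matrix.diagonal ![0, 0, 1] *
      (k.1 * Matrix.diagonal ![0, 0, 1] * k'.1) with hLim
  have r6 : ∀ i, Tendsto (fun j => exp (-(n j : ℝ)) * exp (-(m j : ℝ)) *
      exp (-(n j : ℝ)) * exp (-(m j : ℝ)) * c j i i) atTop
      (𝓝 (Lim i i)) := by
    intro i
    refine ((tendsto_pi_nhds.1 (tendsto_pi_nhds.1 r5 i)) i).congr fun j => ?_
    simp only [c, coe_G_mul, smul_mul_assoc, mul_smul_comm, smul_smul,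
      Matrix.smul_apply, smul_eq_mul]
    ring
  have s0 : Tendsto (fun j => exp (-(n j : ℝ))) atTop (𝓝 0) :=
    tendsto_exp_neg_atTop_nhds_zero.comp (tendsto_natCast_atTop_atTop.comp hn)
  have s1 : Tendsto (fun j => exp (-(m j : ℝ))) atTop (𝓝 0) :=
    tendsto_exp_neg_atTop_nhds_zero.comp (tendsto_natCast_atTop_atTop.comp hm)
  have s2 := (((s0.mul s1).mul s0).mul s1).mul_const 2
  have s3 := (r6 0).add (r6 2)
  have hval : Lim 0 0 + Lim 2 2 = 2 := by
    have hk1 : k.1 = !![2, 0, 1; 0, 1, 0; 1, 0, 1] := by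
      ext i j
      simp only [k]
      rw [G_mul_apply]
      fin_cases i <;> fin_cases j <;> simp [u, e31]; norm_num
    have hk2 : k'.1 = !![1, 0, -1; 0, 1, 0; -1, 0, 2] := by
      ext i j
      simp only [k']
      rw [G_mul_apply]
      fin_cases i <;> fin_cases j <;> simp [u, e31]; norm_num
    have d1 : (Matrix.diagonal ![1, 0, 0] : M₃) = !![1, 0, 0; 0, 0, 0; 0, 0, 0] := by
      ext i j; fin_cases i <;> fin_cases j <;> simp
    have d2 : (Matrix.diagonal ![0, 0, 1] : M₃) = !![0, 0, 0; 0, 0, 0; 0, 0, 1] := by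
      ext i j; fin_cases i <;> fin_cases j <;> simp
    rw [hLim, hk1, hk2, d1, d2]
    simp [vecHead, vecTail]
  rw [hval] at s3
  have hne : ∃ j, c j 0 0 + c j 2 2 ≠ 2 := by
    by_contra! hcon
    have s4 := s3.congr (f₂ := fun j => exp (-(n j : ℝ)) * exp (-(m j : ℝ)) *
      exp (-(n j : ℝ)) * exp (-(m j : ℝ)) * 2) fun j => by rw [← mul_add, hcon j]
    have := tendsto_nhds_unique s4 s2
    norm_num at this
  obtain ⟨j, hj⟩ := hne
  exact ⟨c j, hcL j, hcx j, hc11 j, hj⟩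

lemma false_of_transversal (hu : ∀ s, MInv ν (u s))
    (hA : ∀ t, MInv ν (gSL t)) (h12 : ν (Om e12) = 0) (h23 : ν (Om e23) = 0) : False := by
  obtain ⟨ν', hprob, hu, hA, hd, h12, h23, hdd⟩ := exists_dd_inv hu hA h12 h23
  have h31 := mInv_e31 hu hA hd h12 h23 hdd
  obtain ⟨S, hS, V, hV, hSV⟩ := exists_plaque_set hu hA hd h31 h12 h23 hdd
  obtain ⟨x, hx⟩ := exists_plaque_pos hS hV hSV
  obtain ⟨c, hcL, hcx, hc11, htr⟩ := exists_hyperbolic_stab hu hd h31 hx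
  obtain ⟨v, hv, v0, v2⟩ := exists_axis_vector hcx hcL hc11 htr
  obtain ⟨ε, hε, hlow⟩ := exists_lower_bound (isCompact_plaque 1 x)
  obtain ⟨y, ⟨l, ⟨hl, -⟩, rfl⟩, hfr⟩ := exists_plaque_return (hx 1 one_pos) (hA 1)
  obtain ⟨a1, a2, a3, a4⟩ := hl
  have hlim : Tendsto (fun n : ℕ => exp (-(n : ℝ)) * |l 1 1 * v 1|) atTop (𝓝 0) := by
    have := (tendsto_exp_neg_atTop_nhds_zero.comp
      (tendsto_natCast_atTop_atTop (R := ℝ))).mul_const |l 1 1 * v 1|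
    simpa using this
  obtain ⟨n, hn, hn2⟩ := (hfr.and_eventually (hlim.eventually (gt_mem_nhds hε))).exists
  rw [gSL_pow, mul_one] at hn
  obtain ⟨i, hi⟩ := hlow _ hn _ (Lam_smul (gSL n) (Lam_smul l hv))
  have e : ∀ i, ((gSL n : M₃) *ᵥ ((l : M₃) *ᵥ v)) i =
      if i = 1 then exp (-(n : ℝ)) * (l 1 1 * v 1) else 0 := by
    intro i
    simp only [mulVec, dotProduct, Fin.sum_univ_three, gSL_eq, dT_apply, v0, v2, a1, a2, a3, a4]
    fin_cases i <;> simp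
  rw [e] at hi
  split_ifs at hi with h1
  · rw [abs_mul, abs_of_pos (exp_pos _)] at hi
    linarith
  · simp at hi; linarith

/-! ### Mahler's compactness criterion -/

/-- Squared Euclidean norm. -/
def qf (v : ℝ³) : ℝ := v 0 ^ 2 + v 1 ^ 2 + v 2 ^ 2

/-- Inner product. -/
def ip (v w : ℝ³) : ℝ := v 0 * w 0 + v 1 * w 1 + v 2 * w 2

/-- Cross product. -/
def cr (v w : ℝ³) : ℝ³ := ![v 1 * w 2 - v 2 * w 1, v 2 * w 0 - v 0 * w 2, v 0 * w 1 - v 1 * w 0]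

lemma qf_cr (v w : ℝ³) : qf (cr v w) = qf v * qf w - ip v w ^ 2 := by simp [qf, cr, ip]; ring

lemma ip_add_smul (v w w' : ℝ³) (c : ℝ) : ip v (w + c • w') = ip v w + c * ip v w' := by
  simp [ip]; ring

lemma cr_add_smul (v w w' : ℝ³) (c : ℝ) : cr v (w + c • w') = cr v w + c • cr v w' := by
  ext i; fin_cases i <;> simp [cr] <;> ring

lemma cr_self (v : ℝ³) : cr v v = 0 := by ext i; fin_cases i <;> simp [cr] <;> ring

lemma sq_le_qf (v : ℝ³) (i : Fin 3) : v i ^ 2 ≤ qf v := by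
  unfold qf
  fin_cases i <;> simp <;> nlinarith [sq_nonneg (v 0), sq_nonneg (v 1), sq_nonneg (v 2)]

/-- Columns of a matrix. -/
def gcol (g : G) (j : Fin 3) : ℝ³ := fun i => g i j

lemma exists_near_min {ι : Type*} [Nonempty ι] (f : ι → ℝ) {δ : ℝ} (hδ : 0 < δ)
    (hf : ∀ i, δ ≤ f i) : ∃ i, ∀ j, f i ≤ 11 / 10 * f j := by
  have hbd : BddBelow (Set.range f) := ⟨δ, by rintro _ ⟨i, rfl⟩; exact hf i⟩
  have hinf : 0 < ⨅ i, f i := hδ.trans_le (le_ciInf hf)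
  obtain ⟨i, hi⟩ := exists_lt_of_ciInf_lt (show ⨅ i, f i < 11 / 10 * ⨅ i, f i by linarith)
  exact ⟨i, fun j => hi.le.trans (by linarith [ciInf_le hbd j])⟩

/-- An integral matrix of determinant one, as an element of `Γ`. -/
lemma mem_Gamma_of_int {g : G} {N : Matrix (Fin 3) (Fin 3) ℤ} (h : ∀ i j, g i j = N i j) :
    g ∈ Gamma := by
  have e : N.map (Int.castRingHom ℝ) = (g : M₃) := by ext i j; simp [h]
  have hd : N.det = 1 := by
    have : (Int.castRingHom ℝ) N.det = 1 := by rw [RingHom.map_det, RingHom.mapMatrix_apply, e, g.2]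
    rw [eq_intCast] at this
    exact_mod_cast this
  exact ⟨⟨N, hd⟩, G_ext fun i j => by rw [h]; rfl⟩

/-- An integral upper triangular unipotent matrix. -/
def ui (a b c : ℤ) : G := ⟨!![1, a, c; 0, 1, b; 0, 0, 1], by simp [det_fin_three]⟩

/-- Exchange of the first two columns. -/
def sw01 : G := ⟨!![0, -1, 0; 1, 0, 0; 0, 0, 1], by simp [det_fin_three]⟩

/-- Exchange of the last two columns. -/
def sw12 : G := ⟨!![1, 0, 0; 0, 0, -1; 0, 1, 0], by simp [det_fin_three]⟩

lemma ui_mem (a b c : ℤ) : ui a b c ∈ Gamma :=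
  mem_Gamma_of_int (N := !![1, a, c; 0, 1, b; 0, 0, 1]) fun i j => by
    fin_cases i <;> fin_cases j <;> simp [ui]

lemma sw01_mem : sw01 ∈ Gamma :=
  mem_Gamma_of_int (N := !![0, -1, 0; 1, 0, 0; 0, 0, 1]) fun i j => by
    fin_cases i <;> fin_cases j <;> simp [sw01]

lemma sw12_mem : sw12 ∈ Gamma :=
  mem_Gamma_of_int (N := !![1, 0, 0; 0, 0, -1; 0, 1, 0]) fun i j => by
    fin_cases i <;> fin_cases j <;> simp [sw12]

lemma smul_x₀_mul {g γ : G} (h : γ ∈ Gamma) : (g * γ) • x₀ = g • x₀ :=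
  ((smul_x₀_eq_iff _ _).2 (by rwa [inv_mul_cancel_left])).symm

lemma gcol_ui (g : G) (a b c : ℤ) : gcol (g * ui a b c) 0 = gcol g 0 ∧
    gcol (g * ui a b c) 1 = gcol g 1 + (a : ℝ) • gcol g 0 ∧
    gcol (g * ui a b c) 2 = gcol g 2 + (b : ℝ) • gcol g 1 + (c : ℝ) • gcol g 0 := by
  refine ⟨?_, ?_, ?_⟩ <;> ext i <;> simp only [gcol, G_mul_apply, Pi.add_apply, Pi.smul_apply, smul_eq_mul] <;> simp [ui] <;> ring

lemma gcol_sw (g : G) : gcol (g * sw01) 0 = gcol g 1 ∧ gcol (g * sw12) 0 = gcol g 0 ∧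
    gcol (g * sw12) 1 = gcol g 2 := by
  refine ⟨?_, ?_, ?_⟩ <;> ext i <;> simp only [gcol, G_mul_apply] <;> simp [sw01, sw12]

lemma gcol_mem_Lam (g : G) : gcol g 0 ∈ Lam (g • x₀) := by
  refine (mem_Lam_iff g _).2 ⟨![1, 0, 0], fun h => by simpa using congrFun h 0, ?_⟩
  ext i
  simp [gcol, mulVec, dotProduct, Fin.sum_univ_three]

lemma exists_cr_lower_bound (x : X) : ∃ δ > 0, ∀ g : G, g • x₀ = x →
    δ ≤ qf (cr (gcol g 0) (gcol g 1)) := by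
  obtain ⟨h, rfl⟩ := exists_smul_x₀ x
  obtain ⟨R, hR0, hR⟩ : ∃ R > 0, ∀ i j, |h i j| ≤ R := by
    obtain ⟨R, hR, hr⟩ := exists_bounded_rep (K := {h • x₀}) isCompact_singleton
    refine ⟨1 + ∑ i, ∑ j, |h i j|, by positivity, fun i j => ?_⟩
    have := (Finset.single_le_sum (f := fun j => |h i j|) (fun j _ => by positivity)
          (Finset.mem_univ j)).trans
        (Finset.single_le_sum (f := fun i => ∑ j, |h i j|)
          (fun i _ => Finset.sum_nonneg fun j _ => by positivity) (Finset.mem_univ i))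
    linarith
  refine ⟨(1 / (6 * R)) ^ 2, by positivity, fun g hg => ?_⟩
  obtain ⟨N, hN⟩ := (smul_x₀_eq_iff g h).1 hg
  have hN' : ∀ i j, ((N i j : ℤ) : ℝ) = (g⁻¹ * h) i j := fun i j => by rw [← hN]; simp
  have hrow : ∀ j, g⁻¹ 2 j = cr (gcol g 0) (gcol g 1) j := by
    intro j
    rw [G_inv_apply, adjugate_fin_three]
    fin_cases j <;> simp [cr, gcol] <;> ring
  by_contra! hcon
  have hsm : ∀ j, |g⁻¹ 2 j| ≤ 1 / (6 * R) := by
    intro j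
    rw [hrow]
    exact abs_le_of_sq_le_sq ((sq_le_qf _ j).trans hcon.le) (by positivity)
  have hzero : ∀ j, N 2 j = 0 := by
    intro j
    have h1 : |((N 2 j : ℤ) : ℝ)| < 1 := by
      rw [hN', G_mul_apply]
      refine (abs_add_three _ _ _).trans_lt ?_
      simp only [abs_mul]
      have hb : ∀ k, |g⁻¹ 2 k| * |h k j| ≤ 1 / (6 * R) * R := fun k =>
        mul_le_mul (hsm k) (hR k j) (abs_nonneg _) (by positivity)
      have e : 1 / (6 * R) * R = 1 / 6 := by field_simp
      linarith [hb 0, hb 1, hb 2]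
    exact Int.abs_lt_one_iff.1 (by exact_mod_cast h1)
  have := N.2
  rw [det_fin_three] at this
  simp [hzero] at this

lemma abs_add_round_le (x : ℝ) : |x + ((-round x : ℤ) : ℝ)| ≤ 1 / 2 := by
  push_cast
  rw [← sub_eq_add_neg]
  exact abs_sub_round x

/-- A reduced basis of a lattice without short vectors. -/
lemma exists_reduced {ε : ℝ} (hε : 0 < ε) {x : X} (hx : ∀ v ∈ Lam x, ε ^ 2 ≤ qf v) :
    ∃ g : G, g • x₀ = x ∧ ε ^ 2 ≤ qf (gcol g 0) ∧ qf (gcol g 0) ≤ 11 / 10 * qf (gcol g 1) ∧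
      |ip (gcol g 0) (gcol g 1)| ≤ 1 / 2 * qf (gcol g 0) ∧
      |ip (gcol g 0) (gcol g 2)| ≤ 1 / 2 * qf (gcol g 0) ∧
      qf (cr (gcol g 0) (gcol g 1)) ≤ 11 / 10 * qf (cr (gcol g 0) (gcol g 2)) ∧
      |ip (cr (gcol g 0) (gcol g 1)) (cr (gcol g 0) (gcol g 2))| ≤ 1 / 2 * qf (cr (gcol g 0) (gcol g 1)) := by
  have hq : ∀ g : G, g • x₀ = x → ε ^ 2 ≤ qf (gcol g 0) := fun g hg => hx _ (hg ▸ gcol_mem_Lam g)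
  obtain ⟨h, rfl⟩ := exists_smul_x₀ x
  have : Nonempty {g : G // g • x₀ = h • x₀} := ⟨⟨h, rfl⟩⟩
  obtain ⟨⟨g₁, hg₁⟩, hmin₁⟩ := exists_near_min (fun g : {g : G // g • x₀ = h • x₀} => qf (gcol g.1 0))
    (δ := ε ^ 2) (by positivity) fun g => hq g.1 g.2
  have : Nonempty {g : G // g • x₀ = h • x₀ ∧ gcol g 0 = gcol g₁ 0} := ⟨⟨g₁, hg₁, rfl⟩⟩
  obtain ⟨δ, hδ, hδ'⟩ := exists_cr_lower_bound (h • x₀)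
  obtain ⟨⟨g₂, hg₂, hc₂⟩, hmin₂⟩ := exists_near_min
    (fun g : {g : G // g • x₀ = h • x₀ ∧ gcol g 0 = gcol g₁ 0} => qf (cr (gcol g.1 0) (gcol g.1 1)))
    hδ fun g => hδ' g.1 g.2.1
  set b₁ := gcol g₂ 0 with hb₁
  have hA : 0 < qf b₁ := lt_of_lt_of_le (by positivity) (hq g₂ hg₂)
  set N := cr b₁ (gcol g₂ 1) with hN
  have hNpos : 0 < qf N := hδ.trans_le (hδ' g₂ hg₂)
  let a : ℤ := -round (ip b₁ (gcol g₂ 1) / qf b₁)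
  set b₂ := gcol g₂ 1 + (a : ℝ) • b₁ with hb₂
  let b : ℤ := -round (ip N (cr b₁ (gcol g₂ 2)) / qf N)
  let c : ℤ := -round (ip b₁ (gcol g₂ 2 + (b : ℝ) • b₂) / qf b₁)
  set g := g₂ * ui a 0 0 * ui 0 b c with hg
  have hgx : g • x₀ = h • x₀ := by
    rw [hg, smul_x₀_mul (ui_mem _ _ _), smul_x₀_mul (ui_mem _ _ _), hg₂]
  obtain ⟨p0, p1, p2⟩ := gcol_ui g₂ a 0 0
  obtain ⟨q0, q1, q2⟩ := gcol_ui (g₂ * ui a 0 0) 0 b c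
  have c0 : gcol g 0 = b₁ := by rw [hg, q0, p0]
  have c1 : gcol g 1 = b₂ := by rw [hg, q1, p1]; simp only [Int.cast_zero, zero_smul, add_zero]; rfl
  have c2 : gcol g 2 = gcol g₂ 2 + (b : ℝ) • b₂ + (c : ℝ) • b₁ := by
    rw [hg, q2, p0, p1, p2]; simp only [Int.cast_zero, zero_smul, add_zero]; rfl
  have hcrN : cr b₁ b₂ = N := by rw [hb₂, cr_add_smul, cr_self, smul_zero, add_zero]
  have hipself : ∀ v, ip v v = qf v := fun v => by simp [ip, qf]; ring
  have hround : ∀ {v w : ℝ³} {k : ℤ}, 0 < qf v → k = -round (ip v w / qf v) →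
      |ip v (w + (k : ℝ) • v)| ≤ 1 / 2 * qf v := by
    intro v w k hv hk
    have h1 := abs_add_round_le (ip v w / qf v)
    rw [← hk] at h1
    rw [ip_add_smul, hipself]
    have e : ip v w + (k : ℝ) * qf v = (ip v w / qf v + k) * qf v := by field_simp
    rw [e, abs_mul, abs_of_pos hv]
    gcongr
  refine ⟨g, hgx, ?_, ?_, ?_, ?_, ?_, ?_⟩
  · exact hq g hgx
  · have h1 := hmin₁ ⟨g * sw01, by rw [smul_x₀_mul sw01_mem, hgx]⟩
    simp only [(gcol_sw g).1] at h1
    rw [c0, hc₂]; exact h1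
  · rw [c0, c1]; exact hround hA rfl
  · rw [c0, c2]; exact hround hA rfl
  · have h1 := hmin₂ ⟨g * sw12, by rw [smul_x₀_mul sw12_mem, hgx], by rw [(gcol_sw g).2.1, c0, hc₂]⟩
    simp only [(gcol_sw g).2.1, (gcol_sw g).2.2] at h1
    rw [c1]
    rw [c0] at h1 ⊢
    rw [hcrN]; exact h1
  · rw [c0, c1, c2, hcrN, cr_add_smul, cr_self, smul_zero, add_zero, cr_add_smul, hcrN]
    exact hround hNpos rfl

lemma cr_cr_gcol (g : G) : cr (cr (gcol g 0) (gcol g 1)) (cr (gcol g 0) (gcol g 2)) = gcol g 0 := by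
  have hdet := G_det g
  ext i
  fin_cases i <;> simp [cr, gcol]
  · linear_combination g 0 0 * hdet
  · linear_combination g 1 0 * hdet
  · linear_combination g 2 0 * hdet

set_option maxHeartbeats 1000000 in
lemma reduced_bounds {ε A B C D F Q M H : ℝ} (hε : 0 < ε) (h1 : ε ^ 2 ≤ A) (h2 : A ≤ 11 / 10 * D)
    (h3 : |B| ≤ 1 / 2 * A) (h4 : |C| ≤ 1 / 2 * A) (h5 : Q ≤ 11 / 10 * M) (h6 : |H| ≤ 1 / 2 * Q)
    (l1 : Q = A * D - B ^ 2) (l2 : M = A * F - C ^ 2) (l3 : A = Q * M - H ^ 2) :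
    A ≤ 2 ∧ D ≤ 4 / ε ^ 2 ∧ F ≤ (4 / ε ^ 2 + 1) / ε ^ 2 := by
  have hε2 : 0 < ε ^ 2 := by positivity
  have hA : 0 < A := hε2.trans_le h1
  have hB : B ^ 2 ≤ A ^ 2 / 4 := by have := sq_le_sq' (abs_le.1 h3).1 (abs_le.1 h3).2; nlinarith
  have hC : C ^ 2 ≤ A ^ 2 / 4 := by have := sq_le_sq' (abs_le.1 h4).1 (abs_le.1 h4).2; nlinarith
  have hQA : 13 / 20 * A ^ 2 ≤ Q := by
    have : A * (A * (10 / 11)) ≤ A * D := by gcongr; linarith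
    nlinarith
  have hQ : 0 < Q := lt_of_lt_of_le (by positivity) hQA
  have hH : H ^ 2 ≤ Q ^ 2 / 4 := by have := sq_le_sq' (abs_le.1 h6).1 (abs_le.1 h6).2; nlinarith
  have hAQ : 13 / 20 * Q ^ 2 ≤ A := by
    have : Q * (Q * (10 / 11)) ≤ Q * M := by gcongr; linarith
    nlinarith
  have hA2 : A ≤ 2 := by
    by_contra! hlt
    have a1 : 13 / 20 * (A * 2) ≤ Q := by nlinarith
    have a2 : (13 / 10 * A) ^ 2 ≤ Q ^ 2 := by refine pow_le_pow_left₀ (by positivity) ?_ 2; linarith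
    nlinarith
  have hQ2 : Q ≤ 2 := by
    by_contra! hlt
    have : 2 ^ 2 ≤ Q ^ 2 := pow_le_pow_left₀ (by norm_num) hlt.le 2
    linarith
  have hA4 : A ^ 2 ≤ 2 ^ 2 := pow_le_pow_left₀ hA.le hA2 2
  have hD : A * D ≤ 4 := by linarith
  have hM : A * M ≤ 4 := by
    have e1 : Q * M = A + H ^ 2 := by linarith
    have e2 : Q * M ≤ A + Q ^ 2 / 4 := by linarith
    have e3 : A * A ≤ Q * 2 := by linarith [sq A]
    have e4 : Q * (A * M) ≤ Q * 4 := by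
      have a1 : A * (Q * M) ≤ A * (A + Q ^ 2 / 4) := mul_le_mul_of_nonneg_left e2 hA.le
      have a2 : A * Q ≤ 2 * 2 := mul_le_mul hA2 hQ2 hQ.le (by norm_num)
      have a3 : Q * (A * Q) ≤ Q * (2 * 2) := mul_le_mul_of_nonneg_left a2 hQ.le
      linarith
    exact le_of_mul_le_mul_left e4 hQ
  have hinv : ∀ {y z : ℝ}, 0 ≤ z → A * y ≤ z → y ≤ z / ε ^ 2 := by
    intro y z hz h
    rw [le_div_iff₀ hε2]
    rcases le_or_gt y 0 with hy | hy
    · exact (mul_nonpos_of_nonpos_of_nonneg hy hε2.le).trans hz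
    · exact ((mul_le_mul_of_nonneg_left h1 hy.le).trans_eq (mul_comm _ _)).trans h
  have hM' : M ≤ 4 / ε ^ 2 := hinv (by norm_num) hM
  have hD' : D ≤ 4 / ε ^ 2 := hinv (by norm_num) hD
  have hF' : F ≤ (4 / ε ^ 2 + 1) / ε ^ 2 := hinv (by positivity) (by linarith)
  exact ⟨hA2, hD', hF'⟩

lemma exists_compact_of_no_short {ε : ℝ} (hε : 0 < ε) : ∃ C : Set X, IsCompact C ∧
    ∀ x, (∀ v ∈ Lam x, ∃ i, ε ≤ |v i|) → x ∈ C := by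
  let R : ℝ := 2 + (4 + 8 / ε ^ 2) / ε ^ 2
  refine ⟨(fun g : G => g • x₀) '' {g : G | ∀ i j, |g i j| ≤ R},
    (isCompact_bounded_G R).image (by fun_prop), fun x hx => ?_⟩
  have hx' : ∀ v ∈ Lam x, ε ^ 2 ≤ qf v := by
    intro v hv
    obtain ⟨i, hi⟩ := hx v hv
    refine le_trans ?_ (sq_le_qf v i)
    rw [← sq_abs (v i)]
    exact pow_le_pow_left₀ hε.le hi 2
  obtain ⟨g, hgx, h1, h2, h3, h4, h5, h6⟩ := exists_reduced hε hx'
  have l1 := qf_cr (gcol g 0) (gcol g 1)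
  have l2 := qf_cr (gcol g 0) (gcol g 2)
  have l3 := qf_cr (cr (gcol g 0) (gcol g 1)) (cr (gcol g 0) (gcol g 2))
  rw [cr_cr_gcol] at l3
  have hbound : ∀ j, qf (gcol g j) ≤ R := by
    set A := qf (gcol g 0)
    set D := qf (gcol g 1)
    set F := qf (gcol g 2)
    set Q := qf (cr (gcol g 0) (gcol g 1))
    set M := qf (cr (gcol g 0) (gcol g 2))
    set B := ip (gcol g 0) (gcol g 1)
    set C := ip (gcol g 0) (gcol g 2)
    set H := ip (cr (gcol g 0) (gcol g 1)) (cr (gcol g 0) (gcol g 2))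
    obtain ⟨hA2, hD', hF'⟩ := reduced_bounds hε h1 h2 h3 h4 h5 h6 l1 l2 l3
    have p1 : 0 < 1 / ε ^ 2 := by positivity
    have p2 : 4 / ε ^ 2 = 4 * (1 / ε ^ 2) := by ring
    have p3 : 8 / ε ^ 2 = 8 * (1 / ε ^ 2) := by ring
    have p4 : (4 / ε ^ 2 + 1) / ε ^ 2 = 4 * (1 / ε ^ 2) * (1 / ε ^ 2) + 1 / ε ^ 2 := by ring
    have p5 : (4 + 8 / ε ^ 2) / ε ^ 2 = 4 * (1 / ε ^ 2) + 8 * (1 / ε ^ 2) * (1 / ε ^ 2) := by ring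
    have hR : R = 2 + (4 * (1 / ε ^ 2) + 8 * (1 / ε ^ 2) * (1 / ε ^ 2)) := by simp only [R, p5]
    have p6 : 0 < (1 / ε ^ 2) * (1 / ε ^ 2) := by positivity
    intro j
    fin_cases j
    · change A ≤ R; linarith
    · change D ≤ R; linarith
    · change F ≤ R; linarith
  refine ⟨g, fun i j => ?_, hgx⟩
  have hR1 : 1 ≤ R := by
    have : 0 ≤ (4 + 8 / ε ^ 2) / ε ^ 2 := by positivity
    simp only [R]; linarith
  refine abs_le_of_sq_le_sq (((sq_le_qf (gcol g j) i).trans (hbound j)).trans ?_) (by linarith)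
  nlinarith

/-! ### Nondivergence of unipotent orbits -/

/-- Sup norm of `u s *ᵥ v`. -/
def Fn (v : ℝ³) (s : ℝ) : ℝ := max |v 0 + s * v 2| (max |v 1| |v 2|)

lemma Fn_nonneg (v : ℝ³) (s : ℝ) : 0 ≤ Fn v s := (abs_nonneg _).trans (le_max_left _ _)

lemma Fn_smul (r : ℝ) (v : ℝ³) (s : ℝ) : Fn (r • v) s = |r| * Fn v s := by
  unfold Fn
  rw [mul_max_of_nonneg _ _ (abs_nonneg r), mul_max_of_nonneg _ _ (abs_nonneg r), ← abs_mul,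
    ← abs_mul, ← abs_mul]
  simp only [Pi.smul_apply, smul_eq_mul]
  ring_nf

lemma continuous_Fn (v : ℝ³) : Continuous (Fn v) := by unfold Fn; fun_prop

lemma Fn_lt {v : ℝ³} {s r : ℝ} : Fn v s < r ↔ |v 0 + s * v 2| < r ∧ |v 1| < r ∧ |v 2| < r := by
  simp [Fn, max_lt_iff]

lemma Fn_le {v : ℝ³} {s r : ℝ} : Fn v s ≤ r ↔ |v 0 + s * v 2| ≤ r ∧ |v 1| ≤ r ∧ |v 2| ≤ r := by
  simp [Fn, max_le_iff]

lemma Fn_enlarge {v : ℝ³} {c r ρ : ℝ} (hr : 0 < r)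
    (h : ∀ s ∈ Icc (c - r) (c + r), Fn v s ≤ ρ) {s : ℝ}
    (hs : s ∈ Icc (c - 5 * r) (c + 5 * r)) : Fn v s ≤ 5 * ρ := by
  have h1 := Fn_le.1 (h (c - r) ⟨le_rfl, by linarith⟩)
  have h2 := Fn_le.1 (h (c + r) ⟨by linarith, le_rfl⟩)
  have hρ : 0 ≤ ρ := (abs_nonneg _).trans h1.2.1
  refine Fn_le.2 ⟨?_, h1.2.1.trans (by linarith), h1.2.2.trans (by linarith)⟩
  have a1 := abs_le.1 h1.1
  have a2 := abs_le.1 h2.1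
  obtain ⟨b1, b2⟩ := hs
  rw [abs_le]
  constructor <;> rcases le_total 0 (v 2) with hv | hv <;> nlinarith

lemma volume_Fn_lt {v : ℝ³} {α β δ M : ℝ} (hαβ : α ≤ β) (hδ : 0 < δ) (hM : 0 < M)
    (h : ∃ s ∈ Icc α β, M ≤ Fn v s) :
    volume {s | s ∈ Icc α β ∧ Fn v s < δ} ≤ ofReal (4 * (δ / M) * (β - α)) := by
  have hL : 0 ≤ β - α := by linarith
  rcases le_or_gt M (2 * δ) with hd | hd
  · refine (measure_mono fun s hs => hs.1).trans ?_
    rw [volume_Icc]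
    refine ofReal_le_ofReal ?_
    have : 1 ≤ 4 * (δ / M) := by rw [← mul_div_assoc, le_div_iff₀ hM]; linarith
    nlinarith
  rcases Set.eq_empty_or_nonempty {s | s ∈ Icc α β ∧ Fn v s < δ} with he | ⟨s₀, hs₀, hF₀⟩
  · rw [he]; simp
  obtain ⟨s₁, hs₁, hF₁⟩ := h
  obtain ⟨a0, a1, a2⟩ := Fn_lt.1 hF₀
  have hbig : M ≤ |v 0 + s₁ * v 2| := by
    by_contra! hcon
    exact absurd hF₁ (not_le.2 (Fn_lt.2 ⟨hcon, by linarith, by linarith⟩))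
  have hb : M / 2 ≤ |v 2| * (β - α) := by
    have e : |v 2 * (s₁ - s₀)| ≥ |v 0 + s₁ * v 2| - |v 0 + s₀ * v 2| := by
      have := abs_sub_abs_le_abs_sub (v 0 + s₁ * v 2) (v 0 + s₀ * v 2)
      rwa [show v 0 + s₁ * v 2 - (v 0 + s₀ * v 2) = v 2 * (s₁ - s₀) by ring] at this
    rw [abs_mul] at e
    have : |s₁ - s₀| ≤ β - α := abs_le.2 ⟨by linarith [hs₁.1, hs₀.2], by linarith [hs₁.2, hs₀.1]⟩
    nlinarith [abs_nonneg (v 2)]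
  have hv : 0 < |v 2| := by
    rcases (abs_nonneg (v 2)).eq_or_lt with h0 | h0
    · rw [← h0] at hb; linarith
    · exact h0
  have hsub : {s | s ∈ Icc α β ∧ Fn v s < δ} ⊆ Metric.ball (-(v 0) / v 2) (δ / |v 2|) := by
    rintro s ⟨-, hs⟩
    have hs := (Fn_lt.1 hs).1
    rw [Metric.mem_ball, dist_eq, lt_div_iff₀ hv, ← abs_mul]
    have hv0 : v 2 ≠ 0 := abs_pos.1 hv
    rwa [show (s - -(v 0) / v 2) * v 2 = v 0 + s * v 2 by field_simp; ring]
  refine (measure_mono hsub).trans ?_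
  rw [Real.volume_ball]
  refine ofReal_le_ofReal ?_
  rw [← mul_div_assoc, div_le_iff₀ hv]
  have : δ = δ / M * M := by field_simp
  have : 0 < δ / M := by positivity
  nlinarith

lemma exists_maximal_interval {S : Set (ℝ³)} {α β ρ s : ℝ} (hαβ : α < β)
    (hs : s ∈ Icc α β) (hfin : {v ∈ S | Fn v s < ρ}.Finite)
    (hreach : ∀ v ∈ S, ∃ s ∈ Icc α β, ρ ≤ Fn v s) (hne : ∃ v ∈ S, Fn v s < ρ) :
    ∃ c r : ℝ, 0 < r ∧ s ∈ Icc (c - r) (c + r) ∧ Icc (c - r) (c + r) ⊆ Icc α β ∧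
      (∃ p ∈ S, ∀ x ∈ Icc (c - r) (c + r), Fn p x ≤ ρ) ∧
      ∀ q ∈ S, ∃ x ∈ Icc (c - r) (c + r), ρ ≤ Fn q x := by
  let Z : (ℝ³) → Set ℝ := fun v => Icc α β ∩ {x | ρ ≤ Fn v x}
  have hZc : ∀ v, IsCompact (Z v) := fun v =>
    isCompact_Icc.inter_right (isClosed_le continuous_const (continuous_Fn v))
  have hZn : ∀ v ∈ S, (Z v).Nonempty := fun v hv => by
    obtain ⟨x, hx, h⟩ := hreach v hv; exact ⟨x, hx, h⟩
  obtain ⟨p, ⟨hpS, hps⟩, hmax⟩ := hfin.exists_maximalFor (fun v => Metric.infDist s (Z v)) _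
    (by obtain ⟨v, hv, h⟩ := hne; exact ⟨v, hv, h⟩)
  set R := Metric.infDist s (Z p) with hR
  have hRpos : 0 < R := by
    refine ((hZc p).isClosed.notMem_iff_infDist_pos (hZn p hpS)).1 fun h => ?_
    exact absurd h.2 (not_le.2 hps)
  have hlt : ∀ x ∈ Icc α β, |x - s| < R → Fn p x < ρ := by
    intro x hx hd
    by_contra! hcon
    have := Metric.infDist_le_dist_of_mem (x := s) (show x ∈ Z p from ⟨hx, hcon⟩)
    rw [dist_comm, dist_eq] at this
    linarith
  have hle : ∀ x ∈ Icc α β, |x - s| ≤ R → Fn p x ≤ ρ := by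
    intro x hx hd
    have hc : Tendsto (fun n : ℕ => Fn p (x + 1 / ((n : ℝ) + 1) * (s - x))) atTop (𝓝 (Fn p x)) := by
      have h1 := (tendsto_one_div_add_atTop_nhds_zero_nat (𝕜 := ℝ)).mul_const (s - x)
      have h2 := h1.const_add x
      rw [zero_mul, add_zero] at h2
      exact ((continuous_Fn p).tendsto x).comp h2
    refine le_of_tendsto' hc fun n => (hlt _ ?_ ?_).le
    · have h0 : 0 < 1 / ((n : ℝ) + 1) := by positivity
      have h1 : 1 / ((n : ℝ) + 1) ≤ 1 := by rw [div_le_one (by positivity)]; simp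
      constructor <;> nlinarith [hx.1, hx.2, hs.1, hs.2]
    · have h0 : 0 < 1 / ((n : ℝ) + 1) := by positivity
      have h1 : 1 / ((n : ℝ) + 1) ≤ 1 := by rw [div_le_one (by positivity)]; simp
      rw [show x + 1 / ((n : ℝ) + 1) * (s - x) - s = (1 - 1 / ((n : ℝ) + 1)) * (x - s) by ring,
        abs_mul, abs_of_nonneg (by linarith)]
      nlinarith [abs_nonneg (x - s)]
  have hJ : ∀ x, x ∈ Icc (max α (s - R)) (min β (s + R)) ↔ x ∈ Icc α β ∧ |x - s| ≤ R := by
    intro x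
    rw [Set.mem_Icc, max_le_iff, le_min_iff, abs_le, Set.mem_Icc]
    constructor
    · rintro ⟨⟨h1, h2⟩, h3, h4⟩; exact ⟨⟨h1, h3⟩, by linarith, by linarith⟩
    · rintro ⟨⟨h1, h3⟩, h2, h4⟩; exact ⟨⟨h1, by linarith⟩, h3, by linarith⟩
  have hAB : max α (s - R) < min β (s + R) := by
    rw [max_lt_iff, lt_min_iff, lt_min_iff]
    exact ⟨⟨hαβ, by linarith [hs.1]⟩, by linarith [hs.2], by linarith⟩
  set A := max α (s - R)
  set B := min β (s + R)
  refine ⟨(A + B) / 2, (B - A) / 2, by linarith, ?_⟩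
  rw [show (A + B) / 2 - (B - A) / 2 = A by ring, show (A + B) / 2 + (B - A) / 2 = B by ring]
  refine ⟨(hJ s).2 ⟨hs, by simpa using hRpos.le⟩, fun x hx => ((hJ x).1 hx).1,
    ⟨p, hpS, fun x hx => hle x ((hJ x).1 hx).1 ((hJ x).1 hx).2⟩, fun q hq => ?_⟩
  by_cases hqs : Fn q s < ρ
  · obtain ⟨x, hx, hd⟩ := (hZc q).exists_infDist_eq_dist (hZn q hq) s
    refine ⟨x, (hJ x).2 ⟨hx.1, ?_⟩, hx.2⟩
    have h1 : Metric.infDist s (Z q) ≤ R := by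
      rcases le_total R (Metric.infDist s (Z q)) with h | h
      · exact hmax ⟨hq, hqs⟩ h
      · exact h
    rwa [hd, dist_comm, dist_eq] at h1
  · exact ⟨s, (hJ s).2 ⟨hs, by simpa using hRpos.le⟩, not_lt.1 hqs⟩

/-- Vitali covering by intervals that are maximal for the family `S`. -/
lemma volume_le_of_maximal {S : Set (ℝ³)} {α β ρ κ : ℝ} (hαβ : α < β) (hκ : 0 ≤ κ)
    (hfin : ∀ s, {v ∈ S | Fn v s < ρ}.Finite)
    (hreach : ∀ v ∈ S, ∃ s ∈ Icc α β, ρ ≤ Fn v s) {B : Set ℝ} (hBI : B ⊆ Icc α β)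
    (hB : ∀ s ∈ B, ∃ v ∈ S, Fn v s < ρ)
    (hloc : ∀ c r : ℝ, 0 < r → ∀ p ∈ S, (∀ x ∈ Icc (c - r) (c + r), Fn p x ≤ ρ) →
      (∀ q ∈ S, ∃ x ∈ Icc (c - r) (c + r), ρ ≤ Fn q x) →
      volume (B ∩ Icc (c - 5 * r) (c + 5 * r)) ≤ ofReal (κ * (2 * r))) :
    volume B ≤ ofReal (κ * (β - α)) := by
  have hch : ∀ s : B, ∃ c r : ℝ, 0 < r ∧ (s : ℝ) ∈ Icc (c - r) (c + r) ∧
      Icc (c - r) (c + r) ⊆ Icc α β ∧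
      (∃ p ∈ S, ∀ x ∈ Icc (c - r) (c + r), Fn p x ≤ ρ) ∧
      ∀ q ∈ S, ∃ x ∈ Icc (c - r) (c + r), ρ ≤ Fn q x := fun s =>
    exists_maximal_interval hαβ (hBI s.2) (hfin s) hreach (hB s s.2)
  choose c r hr hs hI hp hq using hch
  obtain ⟨U, -, hdisj, hcov⟩ := Vitali.exists_disjoint_subfamily_covering_enlargement_closedBall
    (univ : Set B) c r (β - α) (fun s _ => by
      have h1 := (hI s ⟨le_rfl, by linarith [hr s]⟩).1
      have h2 := (hI s ⟨by linarith [hr s], le_rfl⟩).2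
      linarith [hr s]) 5 (by norm_num)
  have hcount : U.Countable := hdisj.countable_of_nonempty_interior fun s _ => by
    rw [closedBall_eq_Icc, interior_Icc]
    exact ⟨c s, by linarith [hr s], by linarith [hr s]⟩
  have hsub : B ⊆ ⋃ b ∈ U, B ∩ Icc (c b - 5 * r b) (c b + 5 * r b) := by
    intro s hsB
    obtain ⟨b, hb, hsubset⟩ := hcov ⟨s, hsB⟩ (Set.mem_univ _)
    rw [closedBall_eq_Icc, closedBall_eq_Icc] at hsubset
    exact Set.mem_biUnion hb ⟨hsB, hsubset (hs ⟨s, hsB⟩)⟩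
  have hvol : ∀ b, volume (B ∩ Icc (c b - 5 * r b) (c b + 5 * r b)) ≤
      ofReal κ * volume (Metric.closedBall (c b) (r b)) := by
    intro b
    obtain ⟨p, hpS, hpl⟩ := hp b
    refine (hloc (c b) (r b) (hr b) p hpS hpl (hq b)).trans_eq ?_
    rw [Real.volume_closedBall, ofReal_mul hκ]
  calc volume B ≤ volume (⋃ b ∈ U, B ∩ Icc (c b - 5 * r b) (c b + 5 * r b)) := measure_mono hsub
    _ ≤ ∑' b : U, volume (B ∩ Icc (c b - 5 * r b) (c b + 5 * r b)) := measure_biUnion_le _ hcount _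
    _ ≤ ∑' b : U, ofReal κ * volume (Metric.closedBall (c b) (r b)) :=
        ENNReal.tsum_le_tsum fun b => hvol b
    _ = ofReal κ * volume (⋃ b ∈ U, Metric.closedBall (c b) (r b)) := by
        rw [ENNReal.tsum_mul_left, measure_biUnion hcount hdisj fun b _ => measurableSet_closedBall]
    _ ≤ ofReal κ * volume (Icc α β) := by
        gcongr
        refine Set.iUnion₂_subset fun b _ => ?_
        rw [closedBall_eq_Icc]
        exact hI b
    _ = ofReal (κ * (β - α)) := by rw [volume_Icc, ofReal_mul hκ]

lemma one_le_abs_of_reach {J : Set ℝ} {p : ℝ³} {ρ r : ℝ} (hρ : 0 < ρ)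
    (hp : ∀ x ∈ J, Fn p x ≤ ρ) (hr : ∃ x ∈ J, ρ ≤ Fn (r • p) x) : 1 ≤ |r| := by
  obtain ⟨x, hx, h⟩ := hr
  rw [Fn_smul] at h
  by_contra! hcon
  have := hp x hx
  nlinarith [abs_nonneg r]

lemma planar_bound {S : Set (ℝ³)} {p : ℝ³} {α β ρ δ ε : ℝ} (hαβ : α < β)
    (hρ : 0 < ρ) (hδ : 0 < δ) (hδρ : δ ≤ ρ) (hε : 10 * ρ * δ < ε)
    (hfin : ∀ s, {v ∈ S | Fn v s < ρ}.Finite)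
    (hreach : ∀ v ∈ S, ∃ s ∈ Icc α β, ρ ≤ Fn v s)
    (hpar : ∀ w ∈ S, ∀ w' ∈ S, (∃ r : ℝ, w' = r • w) ∨ ∀ s, Fn p s ≤ 2 * Fn w s * Fn w' s) :
    volume {s | s ∈ Icc α β ∧ ε ≤ Fn p s ∧ ∃ w ∈ S, Fn w s < δ} ≤
      ofReal (20 * (δ / ρ) * (β - α)) := by
  refine volume_le_of_maximal hαβ (by positivity) hfin hreach (fun s hs => hs.1)
    (fun s ⟨_, _, w, hw, h⟩ => ⟨w, hw, h.trans_le hδρ⟩) fun c r hr w hw hwle hq => ?_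
  obtain ⟨x, hx, hxρ⟩ := hq w hw
  have hv := volume_Fn_lt (v := w) (α := c - 5 * r) (β := c + 5 * r) (by linarith) hδ hρ
    ⟨x, ⟨by linarith [hx.1], by linarith [hx.2]⟩, hxρ⟩
  refine (measure_mono ?_).trans (hv.trans_eq (by ring_nf))
  rintro s ⟨⟨-, hps, w', hw', hlt⟩, hs⟩
  refine ⟨hs, ?_⟩
  have h5 := Fn_enlarge hr hwle hs
  rcases hpar w hw w' hw' with ⟨k, rfl⟩ | h
  · have hk := one_le_abs_of_reach hρ hwle (hq _ hw')
    rw [Fn_smul] at hlt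
    nlinarith [Fn_nonneg w s]
  · exfalso
    have h1 := h s
    have h2 : 2 * Fn w s * Fn w' s ≤ 2 * (5 * ρ) * δ :=
      mul_le_mul (by linarith) hlt.le (Fn_nonneg _ _) (by positivity)
    linarith

/-! ### The dual lattice -/

/-- The twisted cross product, which commutes with `u s`. -/
def tc (v w : ℝ³) : ℝ³ := ![v 0 * w 1 - v 1 * w 0, v 2 * w 0 - v 0 * w 2, v 2 * w 1 - v 1 * w 2]

/-- The sign change relating a lattice to its double dual. -/
def s2 (v : ℝ³) : ℝ³ := ![-v 0, v 1, -v 2]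

/-- The invariant pairing. -/
def pr (w v : ℝ³) : ℝ := -w 2 * v 0 + w 1 * v 1 + w 0 * v 2

/-- The dual automorphism, normalised to fix `u s`. -/
def th (g : G) : G := ⟨!![g⁻¹ 2 2, g⁻¹ 1 2, -g⁻¹ 0 2; g⁻¹ 2 1, g⁻¹ 1 1, -g⁻¹ 0 1;
  -g⁻¹ 2 0, -g⁻¹ 1 0, g⁻¹ 0 0], by
    have := G_det g⁻¹
    rw [det_fin_three]
    simp
    linear_combination this⟩

lemma th_mulVec (g : G) (v : ℝ³) : (th g : M₃) *ᵥ v =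
    ![g⁻¹ 2 2 * v 0 + g⁻¹ 1 2 * v 1 - g⁻¹ 0 2 * v 2, g⁻¹ 2 1 * v 0 + g⁻¹ 1 1 * v 1 - g⁻¹ 0 1 * v 2,
      -(g⁻¹ 2 0 * v 0) - g⁻¹ 1 0 * v 1 + g⁻¹ 0 0 * v 2] := by
  ext i
  fin_cases i <;> simp [th, mulVec, dotProduct, Fin.sum_univ_three] <;> ring

lemma G_mulVec (g : G) (v : ℝ³) (i : Fin 3) : ((g : M₃) *ᵥ v) i =
    g i 0 * v 0 + g i 1 * v 1 + g i 2 * v 2 := by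
  simp [mulVec, dotProduct, Fin.sum_univ_three]

lemma tc_mulVec (g : G) (v w : ℝ³) : tc ((g : M₃) *ᵥ v) ((g : M₃) *ᵥ w) =
      (th g : M₃) *ᵥ tc v w := by
  rw [th_mulVec]
  simp only [G_inv_apply, adjugate_fin_three]
  ext i
  fin_cases i <;> simp [tc, G_mulVec] <;> ring

lemma s2_tc_th (g : G) (v w : ℝ³) : s2 (tc ((th g : M₃) *ᵥ v) ((th g : M₃) *ᵥ w)) =
      (g : M₃) *ᵥ s2 (tc v w) := by
  have hg : ∀ i j, g i j = adjugate ((g⁻¹ : G) : M₃) i j := fun i j => by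
    rw [← G_inv_apply, inv_inv]
  ext i
  rw [G_mulVec, hg, hg, hg, th_mulVec, th_mulVec, adjugate_fin_three]
  fin_cases i <;> simp [tc, s2] <;> ring

lemma pr_mulVec (g : G) (v w : ℝ³) : pr ((th g : M₃) *ᵥ w) ((g : M₃) *ᵥ v) = pr w v := by
  have hd := G_det g
  rw [th_mulVec]
  simp only [G_inv_apply, adjugate_fin_three]
  simp [pr, G_mulVec]
  linear_combination (-w 2 * v 0 + w 1 * v 1 + w 0 * v 2) * hd

lemma tc_mem {g : G} {v w : ℝ³} (hv : v ∈ Lam (g • x₀)) (hw : w ∈ Lam (g • x₀))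
    (h0 : tc v w ≠ 0) : tc v w ∈ Lam (th g • x₀) := by
  obtain ⟨z, -, rfl⟩ := (mem_Lam_iff _ _).1 hv
  obtain ⟨z', -, rfl⟩ := (mem_Lam_iff _ _).1 hw
  rw [tc_mulVec] at h0 ⊢
  have e : tc (fun i => (z i : ℝ)) (fun i => (z' i : ℝ)) = fun i => ((![z 0 * z' 1 - z 1 * z' 0,
      z 2 * z' 0 - z 0 * z' 2, z 2 * z' 1 - z 1 * z' 2] i : ℤ) : ℝ) := by
    ext i; fin_cases i <;> simp [tc]
  rw [e] at h0 ⊢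
  refine (mem_Lam_iff _ _).2 ⟨_, fun h => h0 ?_, rfl⟩
  rw [h]
  ext i
  simp [mulVec, dotProduct]

lemma s2_tc_mem {g : G} {v w : ℝ³} (hv : v ∈ Lam (th g • x₀)) (hw : w ∈ Lam (th g • x₀))
    (h0 : s2 (tc v w) ≠ 0) : s2 (tc v w) ∈ Lam (g • x₀) := by
  obtain ⟨z, -, rfl⟩ := (mem_Lam_iff _ _).1 hv
  obtain ⟨z', -, rfl⟩ := (mem_Lam_iff _ _).1 hw
  rw [s2_tc_th] at h0 ⊢
  have e : s2 (tc (fun i => (z i : ℝ)) (fun i => (z' i : ℝ))) = fun i =>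
      ((![-(z 0 * z' 1 - z 1 * z' 0), z 2 * z' 0 - z 0 * z' 2,
        -(z 2 * z' 1 - z 1 * z' 2)] i : ℤ) : ℝ) := by
    ext i; fin_cases i <;> simp [tc, s2]
  rw [e] at h0 ⊢
  refine (mem_Lam_iff _ _).2 ⟨_, fun h => h0 ?_, rfl⟩
  rw [h]
  ext i
  simp [mulVec, dotProduct]

lemma pr_int {g : G} {v w : ℝ³} (hv : v ∈ Lam (g • x₀)) (hw : w ∈ Lam (th g • x₀)) :
    ∃ k : ℤ, pr w v = k := by
  obtain ⟨z, -, rfl⟩ := (mem_Lam_iff _ _).1 hv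
  obtain ⟨z', -, rfl⟩ := (mem_Lam_iff _ _).1 hw
  rw [pr_mulVec]
  exact ⟨-z' 2 * z 0 + z' 1 * z 1 + z' 0 * z 2, by simp [pr]⟩

lemma Lam_ne_zero {x : X} {v : ℝ³} (hv : v ∈ Lam x) : v ≠ 0 := by
  rintro rfl
  obtain ⟨ε, hε, h⟩ := exists_lower_bound (K := {x}) isCompact_singleton
  obtain ⟨i, hi⟩ := h x rfl 0 hv
  simp at hi
  linarith

lemma parallel_of_tc {v w : ℝ³} (hv : v ≠ 0) (h : tc v w = 0) : ∃ r : ℝ, w = r • v := by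
  have h0 := congrFun h 0
  have h1 := congrFun h 1
  have h2 := congrFun h 2
  simp [tc] at h0 h1 h2
  obtain ⟨i, hi⟩ := Function.ne_iff.1 hv
  refine ⟨w i / v i, ?_⟩
  ext j
  simp only [Pi.zero_apply] at hi
  rw [Pi.smul_apply, smul_eq_mul, div_mul_eq_mul_div, eq_div_iff hi]
  fin_cases i <;> fin_cases j <;> simp <;> linarith

lemma Fn_tc (v w : ℝ³) (s : ℝ) : Fn (tc v w) s ≤ 2 * Fn v s * Fn w s := by
  obtain ⟨a0, a1, a2⟩ := Fn_le.1 (le_refl (Fn v s))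
  obtain ⟨b0, b1, b2⟩ := Fn_le.1 (le_refl (Fn w s))
  have key : ∀ {x y x' y' : ℝ}, |x| ≤ Fn v s → |x'| ≤ Fn w s → |y| ≤ Fn v s → |y'| ≤ Fn w s →
      |x * x' - y * y'| ≤ 2 * Fn v s * Fn w s := by
    intro x y x' y' h1 h2 h3 h4
    have e1 := mul_le_mul h1 h2 (abs_nonneg _) (Fn_nonneg v s)
    have e2 := mul_le_mul h3 h4 (abs_nonneg _) (Fn_nonneg v s)
    have := abs_sub (x * x') (y * y')
    rw [abs_mul, abs_mul] at this
    linarith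
  refine Fn_le.2 ⟨?_, ?_, ?_⟩
  · have := key a0 b1 a1 b0
    rwa [show (v 0 + s * v 2) * w 1 - v 1 * (w 0 + s * w 2) = tc v w 0 + s * tc v w 2 by
      simp [tc]; ring] at this
  · have := key a2 b0 a0 b2
    rwa [show v 2 * (w 0 + s * w 2) - (v 0 + s * v 2) * w 2 = tc v w 1 by simp [tc]; ring] at this
  · have := key a2 b1 a1 b2
    rwa [show v 2 * w 1 - v 1 * w 2 = tc v w 2 by simp [tc]] at this

lemma Fn_s2 (v : ℝ³) (s : ℝ) : Fn (s2 v) s = Fn v s := by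
  simp only [Fn, s2, cons_val_zero, cons_val_one, cons_val, abs_neg]
  rw [← abs_neg, show -(-v 0 + s * -v 2) = v 0 + s * v 2 by ring]

lemma abs_pr_le (w v : ℝ³) (s : ℝ) : |pr w v| ≤ 3 * Fn w s * Fn v s := by
  obtain ⟨a0, a1, a2⟩ := Fn_le.1 (le_refl (Fn w s))
  obtain ⟨b0, b1, b2⟩ := Fn_le.1 (le_refl (Fn v s))
  have e : pr w v = -w 2 * (v 0 + s * v 2) + w 1 * v 1 + (w 0 + s * w 2) * v 2 := by simp [pr]; ring
  rw [e]
  refine (abs_add_three _ _ _).trans ?_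
  rw [abs_mul, abs_mul, abs_mul, abs_neg]
  have e0 := mul_le_mul a2 b0 (abs_nonneg _) (Fn_nonneg w s)
  have e1 := mul_le_mul a1 b1 (abs_nonneg _) (Fn_nonneg w s)
  have e2 := mul_le_mul a0 b2 (abs_nonneg _) (Fn_nonneg w s)
  linarith

lemma finite_Lam (x : X) (R : ℝ) : {v ∈ Lam x | ∀ i, |v i| ≤ R}.Finite := by
  obtain ⟨R', hR', hrep⟩ := exists_bounded_rep (K := {x}) isCompact_singleton
  obtain ⟨g, rfl, -, hg⟩ := hrep x rfl
  obtain ⟨N, hN⟩ := exists_nat_gt (3 * R' * R)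
  refine ((Set.finite_Icc (fun _ : Fin 3 => (-(N : ℤ))) (fun _ => (N : ℤ))).image fun z =>
    (g : M₃) *ᵥ fun i => (z i : ℝ)).subset ?_
  rintro v ⟨hv, hR⟩
  obtain ⟨z, hz, rfl⟩ := (mem_Lam_iff g v).1 hv
  have hb : ∀ i, |(z i : ℝ)| ≤ N := fun i => by
    have h1 := abs_mulVec_le (A := (g⁻¹ : G)) hg hR i
    rw [mulVec_mulVec, ← coe_G_mul, inv_mul_cancel, coe_G_one, one_mulVec] at h1
    linarith
  refine ⟨z, ⟨fun i => ?_, fun i => ?_⟩, rfl⟩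
  · have := (abs_le.1 (hb i)).1; exact_mod_cast this
  · have := (abs_le.1 (hb i)).2; exact_mod_cast this

lemma finite_Fn_lt (x : X) (s ρ : ℝ) : {v ∈ Lam x | Fn v s < ρ}.Finite := by
  refine (finite_Lam x (ρ + |s| * ρ)).subset ?_
  rintro v ⟨hv, h⟩
  obtain ⟨a0, a1, a2⟩ := Fn_lt.1 h
  have hρ : 0 ≤ |s| * ρ := mul_nonneg (abs_nonneg s) ((abs_nonneg _).trans a1.le)
  refine ⟨hv, fun i => ?_⟩
  fin_cases i
  · have h1 : |v 0| ≤ |v 0 + s * v 2| + |s * v 2| := by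
      have := abs_sub (v 0 + s * v 2) (s * v 2)
      rwa [add_sub_cancel_right] at this
    rw [abs_mul] at h1
    have := mul_le_mul_of_nonneg_left a2.le (abs_nonneg s)
    simp only [Fin.zero_eta]
    linarith
  · simp only [Fin.mk_one]; linarith
  · simp only [Fin.reduceFinMk]; linarith

/-- Nondivergence: if no vector of the lattice or its dual stays small, few times are bad. -/
lemma nondivergence (g : G) {α β ρ ε : ℝ} (hαβ : α < β) (hρ : 0 < ρ) (hρ' : ρ < 1 / 10)
    (hε : 0 < ε) (hερ : ε ≤ ρ) (h1 : ∀ v ∈ Lam (g • x₀), ∃ s ∈ Icc α β, ρ ≤ Fn v s)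
    (h2 : ∀ w ∈ Lam (th g • x₀), ∃ s ∈ Icc α β, ρ ≤ Fn w s) :
    volume {s | s ∈ Icc α β ∧ ∃ v ∈ Lam (g • x₀), Fn v s < ε} ≤
      ofReal (1020 * (ε / ρ) * (β - α)) := by
  have hερ' : ε ≤ ε / ρ := by rw [le_div_iff₀ hρ]; nlinarith
  have hq : 0 < ε / ρ := by positivity
  refine volume_le_of_maximal (S := Lam (g • x₀) ∪ Lam (th g • x₀)) (ρ := ρ) hαβ (by positivity)
    (fun s => ?_) (fun v hv => hv.elim (h1 v) (h2 v)) (fun s hs => hs.1)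
    (fun s ⟨_, v, hv, h⟩ => ⟨v, Or.inl hv, h.trans_le hερ⟩) fun c r hr p hp hpl hreach => ?_
  · refine ((finite_Fn_lt (g • x₀) s ρ).union (finite_Fn_lt (th g • x₀) s ρ)).subset ?_
    rintro v ⟨hv | hv, h⟩
    · exact Or.inl ⟨hv, h⟩
    · exact Or.inr ⟨hv, h⟩
  have hJ : Icc (c - r) (c + r) ⊆ Icc (c - 5 * r) (c + 5 * r) :=
    Set.Icc_subset_Icc (by linarith) (by linarith)
  have hreach5 : ∀ q ∈ Lam (g • x₀) ∪ Lam (th g • x₀),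
      ∃ x ∈ Icc (c - 5 * r) (c + 5 * r), ρ ≤ Fn q x := fun q hq => by
    obtain ⟨x, hx, h⟩ := hreach q hq; exact ⟨x, hJ hx, h⟩
  have hsmall := volume_Fn_lt (v := p) (by linarith) hε hρ (hreach5 p hp)
  have hge : ∀ {q : ℝ³} {k : ℝ}, k • p = q → q ∈ Lam (g • x₀) ∪ Lam (th g • x₀) →
      ∀ s, Fn p s ≤ Fn q s := by
    rintro _ k rfl hq s
    rw [Fn_smul]
    nlinarith [one_le_abs_of_reach hρ hpl (hreach _ hq), Fn_nonneg p s]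
  rcases hp with hp | hp
  · have hplane := planar_bound (S := {w ∈ Lam (th g • x₀) | pr w p = 0}) (p := p)
      (α := c - 5 * r) (β := c + 5 * r) (ρ := ρ) (δ := 10 * ρ * ε) (ε := ε) (by linarith) hρ
      (by positivity) (by nlinarith) (by
        have : ρ * ρ < 1 / 100 := by nlinarith
        nlinarith)
      (fun s => (finite_Fn_lt (th g • x₀) s ρ).subset fun w hw => ⟨hw.1.1, hw.2⟩)
      (fun w hw => hreach5 w (Or.inr hw.1)) (fun w hw w' hw' => ?_)
    · refine (measure_mono (t := {s | s ∈ Icc (c - 5 * r) (c + 5 * r) ∧ Fn p s < ε} ∪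
        {s | s ∈ Icc (c - 5 * r) (c + 5 * r) ∧ ε ≤ Fn p s ∧
          ∃ w ∈ {w ∈ Lam (th g • x₀) | pr w p = 0}, Fn w s < 10 * ρ * ε}) ?_).trans
        ((measure_union_le _ _).trans ((add_le_add hsmall hplane).trans ?_))
      · rintro s ⟨⟨-, v, hv, hlt⟩, hs⟩
        rcases lt_or_ge (Fn p s) ε with h | h
        · exact Or.inl ⟨hs, h⟩
        refine Or.inr ⟨hs, h, tc p v, ?_, ?_⟩
        · by_cases h0 : tc p v = 0
          · exfalso
            obtain ⟨k, hk⟩ := parallel_of_tc (Lam_ne_zero hp) h0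
            have := hge hk.symm (Or.inl hv) s
            linarith
          · exact ⟨tc_mem hp hv h0, by simp [pr, tc]; ring⟩
        · have a1 := Fn_tc p v s
          have a2 := Fn_enlarge hr hpl hs
          have a3 : 2 * Fn p s * Fn v s < 2 * (5 * ρ) * ε := by
            have b1 : 2 * Fn p s * Fn v s ≤ 2 * (5 * ρ) * Fn v s :=
              mul_le_mul_of_nonneg_right (by linarith) (Fn_nonneg _ _)
            exact b1.trans_lt (mul_lt_mul_of_pos_left hlt (by positivity))
          linarith
      · have e : 10 * ρ * ε / ρ = 10 * ε := by field_simp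
        rw [e, ← ofReal_add (by nlinarith) (by nlinarith)]
        refine ofReal_le_ofReal ?_
        nlinarith
    · by_cases h0 : tc w w' = 0
      · exact Or.inl (parallel_of_tc (Lam_ne_zero hw.1) h0)
      · right
        intro s
        have hs2 : s2 (tc w w') ≠ 0 := by
          intro h
          refine h0 ?_
          ext i
          have := congrFun h i
          fin_cases i <;> simpa [s2] using this
        have hmem := s2_tc_mem hw.1 hw'.1 hs2
        have hz : tc p (s2 (tc w w')) = 0 := by
          have p1 := hw.2
          have p2 := hw'.2
          simp only [pr] at p1 p2
          ext i
          fin_cases i <;> simp [tc, s2]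
          · linear_combination w 0 * p2 - w' 0 * p1
          · linear_combination w 1 * p2 - w' 1 * p1
          · linear_combination w 2 * p2 - w' 2 * p1
        obtain ⟨k, hk⟩ := parallel_of_tc (Lam_ne_zero hp) hz
        have := hge hk.symm (Or.inl hmem) s
        rw [Fn_s2] at this
        exact this.trans (Fn_tc w w' s)
  · have hplane := planar_bound (S := {v ∈ Lam (g • x₀) | pr p v = 0}) (p := p)
      (α := c - 5 * r) (β := c + 5 * r) (ρ := ρ) (δ := ε) (ε := ε) (by linarith) hρ hε hερ
      (by nlinarith)
      (fun s => (finite_Fn_lt (g • x₀) s ρ).subset fun w hw => ⟨hw.1.1, hw.2⟩)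
      (fun w hw => hreach5 w (Or.inl hw.1)) (fun w hw w' hw' => ?_)
    · refine (measure_mono (t := {s | s ∈ Icc (c - 5 * r) (c + 5 * r) ∧ Fn p s < ε} ∪
        {s | s ∈ Icc (c - 5 * r) (c + 5 * r) ∧ ε ≤ Fn p s ∧
          ∃ w ∈ {v ∈ Lam (g • x₀) | pr p v = 0}, Fn w s < ε}) ?_).trans
        ((measure_union_le _ _).trans ((add_le_add hsmall hplane).trans ?_))
      · rintro s ⟨⟨-, v, hv, hlt⟩, hs⟩
        rcases lt_or_ge (Fn p s) ε with h | h
        · exact Or.inl ⟨hs, h⟩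
        refine Or.inr ⟨hs, h, v, ⟨hv, ?_⟩, hlt⟩
        obtain ⟨k, hk⟩ := pr_int hv hp
        have a1 := abs_pr_le p v s
        have a2 := Fn_enlarge hr hpl hs
        have a3 : 3 * Fn p s * Fn v s ≤ 3 * (5 * ρ) * ε :=
          mul_le_mul (by linarith) hlt.le (Fn_nonneg _ _) (by positivity)
        have a4 : |(k : ℝ)| < 1 := by rw [← hk]; nlinarith
        have a5 : k = 0 := Int.abs_lt_one_iff.1 (by exact_mod_cast a4)
        rw [hk, a5, Int.cast_zero]
      · rw [← ofReal_add (by nlinarith) (by nlinarith)]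
        refine ofReal_le_ofReal ?_
        nlinarith
    · by_cases h0 : tc w w' = 0
      · exact Or.inl (parallel_of_tc (Lam_ne_zero hw.1) h0)
      · right
        intro s
        have hz : tc p (tc w w') = 0 := by
          have p1 := hw.2
          have p2 := hw'.2
          simp only [pr] at p1 p2
          ext i
          fin_cases i <;> simp [tc]
          · linear_combination w' 0 * p1 - w 0 * p2
          · linear_combination w 1 * p2 - w' 1 * p1
          · linear_combination w' 2 * p1 - w 2 * p2
        obtain ⟨k, hk⟩ := parallel_of_tc (Lam_ne_zero hp) hz
        exact (hge hk.symm (Or.inr (tc_mem hw.1 hw'.1 h0)) s).trans (Fn_tc w w' s)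

/-! ### Uniform tightness of invariant measures -/

lemma th_mul (g h : G) : th (g * h) = th g * th h := by
  refine G_ext fun i j => ?_
  rw [G_mul_apply]
  fin_cases i <;> fin_cases j <;> simp only [th, _root_.mul_inv_rev, G_mul_apply] <;> simp <;> ring

lemma th_mem_Gamma {γ : G} (h : γ ∈ Gamma) : th γ ∈ Gamma := by
  obtain ⟨N, hN⟩ := inv_mem h
  have e : ∀ i j, γ⁻¹ i j = ((N i j : ℤ) : ℝ) := fun i j => by rw [← hN]; rfl
  refine mem_Gamma_of_int (N := !![N 2 2, N 1 2, -N 0 2; N 2 1, N 1 1, -N 0 1;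
    -N 2 0, -N 1 0, N 0 0]) fun i j => ?_
  fin_cases i <;> fin_cases j <;> simp only [th, e] <;> simp

lemma th_smul_eq {g h : G} (e : g • x₀ = h • x₀) : th g • x₀ = th h • x₀ := by
  have := smul_x₀_mul (g := th g) (th_mem_Gamma ((smul_x₀_eq_iff g h).1 e))
  rwa [← th_mul, mul_inv_cancel_left, eq_comm] at this

lemma exists_dual_lower_bound {K : Set X} (hK : IsCompact K) : ∃ ε > 0, ∀ g : G, g • x₀ ∈ K →
    ∀ w ∈ Lam (th g • x₀), ∃ i, ε ≤ |w i| := by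
  obtain ⟨R, hR, hrep⟩ := exists_bounded_rep hK
  obtain ⟨ε, hε, h⟩ := exists_lower_bound (K := (fun g : G => g • x₀) '' {g : G | ∀ i j, |g i j| ≤ R})
    ((isCompact_bounded_G R).image (by fun_prop))
  refine ⟨ε, hε, fun g hg => ?_⟩
  obtain ⟨g', hg', -, hb⟩ := hrep _ hg
  rw [← th_smul_eq hg']
  refine h _ ⟨th g', fun i j => ?_, rfl⟩
  fin_cases i <;> fin_cases j <;> simpa [th] using hb _ _

lemma gSL_mulVec (t : ℝ) (v : ℝ³) : (gSL t : M₃) *ᵥ v =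
    ![exp (2 * t) * v 0, exp (-t) * v 1, exp (-t) * v 2] := by
  ext i
  fin_cases i <;> simp [gSL, mulVec_diagonal]

lemma th_gSL_mulVec (t : ℝ) (w : ℝ³) : (th (gSL t) : M₃) *ᵥ w =
    ![exp t * w 0, exp t * w 1, exp (-2 * t) * w 2] := by
  rw [th_mulVec, gSL_inv]
  ext i
  fin_cases i <;> simp [gSL]

lemma u_mulVec (s : ℝ) (v : ℝ³) : (u s : M₃) *ᵥ v = ![v 0 + s * v 2, v 1, v 2] := by
  ext i
  fin_cases i <;> simp [u, mulVec, dotProduct, Fin.sum_univ_three]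

lemma exists_compact_of_Fn {ε : ℝ} (hε : 0 < ε) : ∃ C : Set X, IsCompact C ∧
    ∀ x s, (∀ v ∈ Lam x, ε ≤ Fn v s) → u s • x ∈ C := by
  obtain ⟨C, hC, h⟩ := exists_compact_of_no_short hε
  refine ⟨C, hC, fun x s hx => h _ fun v hv => ?_⟩
  have h1 := Lam_smul (u s)⁻¹ hv
  rw [inv_smul_smul, u_inv, u_mulVec] at h1
  by_contra! hcon
  refine absurd (hx _ h1) (not_le.2 (Fn_lt.2 ?_))
  simpa using ⟨hcon 0, hcon 1, hcon 2⟩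

lemma ae_frequently_compact {ν : Measure X} [IsFiniteMeasure ν] {h : G} (hi : MInv ν h) :
    ∀ᵐ x ∂ν, ∃ K : Set X, IsCompact K ∧ ∃ᶠ n : ℕ in atTop, h ^ n • x ∈ K := by
  filter_upwards [ae_all_iff.2 fun n => hi.recurrence
    (isCompact_compactCovering X n).isClosed.measurableSet] with x hx
  obtain ⟨n, hn⟩ := exists_mem_compactCovering x
  exact ⟨_, isCompact_compactCovering X n, hx n hn⟩

lemma false_of_frequently_le {ε C : ℝ} (hε : 0 < ε)
    (h : ∃ᶠ n : ℕ in atTop, ε ≤ exp (-n) * C) : False := by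
  have h1 : Tendsto (fun n : ℕ => exp (-n) * C) atTop (𝓝 (0 * C)) :=
    ((tendsto_exp_neg_atTop_nhds_zero).comp tendsto_natCast_atTop_atTop).mul_const C
  rw [zero_mul] at h1
  obtain ⟨n, hn, hlt⟩ := (h.and_eventually (h1.eventually_lt_const hε)).exists
  linarith

lemma dual_third_ne_zero {g : G} (hrec : ∃ K : Set X, IsCompact K ∧
    ∃ᶠ n : ℕ in atTop, gSL (-1) ^ n • g • x₀ ∈ K) {w : ℝ³} (hw : w ∈ Lam (th g • x₀)) :
    w 2 ≠ 0 := by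
  intro h0
  obtain ⟨K, hK, hf⟩ := hrec
  obtain ⟨ε, hε, hlow⟩ := exists_dual_lower_bound hK
  refine false_of_frequently_le hε (C := |w 0| + |w 1|) (hf.mono fun n hn => ?_)
  rw [gSL_pow, ← mul_smul] at hn
  have h1 := Lam_smul (th (gSL (n * -1))) hw
  rw [← mul_smul, ← th_mul] at h1
  obtain ⟨i, hi⟩ := hlow _ hn _ h1
  refine hi.trans ?_
  rw [th_gSL_mulVec]
  have e : exp (n * -1) = exp (-n) := by ring_nf
  have p := exp_pos (-(n : ℝ))
  fin_cases i <;> simp [h0, abs_mul] <;> nlinarith [abs_nonneg (w 0), abs_nonneg (w 1)]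

/-- Lattices with a short vector fixed by `u s`. -/
def FixS (ρ : ℝ) : Set X := {x | ∃ v ∈ Lam x, v 2 = 0 ∧ ∀ i, |v i| ≤ ρ}

lemma measurableSet_FixS (ρ : ℝ) : MeasurableSet (FixS ρ) := by
  have : FixS ρ = ⋃ (z : {z : Fin 3 → ℤ // z ≠ 0}) (N : ℕ), (fun g : G => g • x₀) ''
      ({g : G | ∀ i j, |g i j| ≤ N} ∩ {g : G | ((g : M₃) *ᵥ fun i => (z.1 i : ℝ)) 2 = 0 ∧
          ∀ i, |((g : M₃) *ᵥ fun i => (z.1 i : ℝ)) i| ≤ ρ}) := by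
    ext x
    simp only [Set.mem_iUnion, Set.mem_image]
    constructor
    · rintro ⟨v, hv, h2, hb⟩
      obtain ⟨R, -, hR⟩ := exists_bounded_rep (K := {x}) isCompact_singleton
      obtain ⟨g, rfl, hg, -⟩ := hR x rfl
      obtain ⟨z, hz, rfl⟩ := (mem_Lam_iff g v).1 hv
      obtain ⟨N, hN⟩ := exists_nat_ge R
      exact ⟨⟨z, hz⟩, N, g, ⟨fun i j => (hg i j).trans hN, h2, hb⟩, rfl⟩
    · rintro ⟨z, N, g, ⟨-, h2, hb⟩, rfl⟩
      exact ⟨_, (mem_Lam_iff g _).2 ⟨z.1, z.2, rfl⟩, h2, hb⟩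
  rw [this]
  refine MeasurableSet.iUnion fun z => MeasurableSet.iUnion fun N => ?_
  refine (((isCompact_bounded_G N).inter_right ?_).image (by fun_prop)).isClosed.measurableSet
  have hc : ∀ i, Continuous fun g : G =>
      ((g : M₃) *ᵥ fun i => (z.1 i : ℝ)) i := fun i => by
    simp only [G_mulVec]
    exact (((continuous_entry i 0).mul_const _).add ((continuous_entry i 1).mul_const _)).add
      ((continuous_entry i 2).mul_const _)
  refine (isClosed_eq (hc 2) continuous_const).inter ?_
  have e : {g : G | ∀ i, |((g : M₃) *ᵥ fun i => (z.1 i : ℝ)) i| ≤ ρ} =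
      ⋂ i, {g : G | |((g : M₃) *ᵥ fun i => (z.1 i : ℝ)) i| ≤ ρ} := by
    ext g; simp
  change IsClosed {g : G | ∀ i, _}
  rw [e]
  exact isClosed_iInter fun i => isClosed_le (hc i).abs continuous_const

lemma ae_notMem_FixS {ν : Measure X} [IsFiniteMeasure ν] (hA : ∀ t, MInv ν (gSL t)) (ρ : ℝ) :
    ∀ᵐ x ∂ν, x ∉ FixS ρ := by
  filter_upwards [(hA 1).recurrence (measurableSet_FixS ρ), ae_frequently_compact (hA 1),
    ae_frequently_compact (hA (-1))] with x hE hf hb hx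
  have hE := hE hx
  obtain ⟨g, rfl⟩ := exists_smul_x₀ x
  obtain ⟨v, hv, hv2, hvρ⟩ := hx
  have hpar : ∀ w ∈ Lam (g • x₀), w 2 = 0 → ∃ r : ℝ, w = r • v := by
    intro w hw hw2
    refine parallel_of_tc (Lam_ne_zero hv) (by_contra fun h0 => ?_)
    exact dual_third_ne_zero hb (tc_mem hv hw h0) (by simp [tc, hv2, hw2])
  have hv0 : v 0 ≠ 0 := by
    intro h0
    obtain ⟨K, hK, hfr⟩ := hf
    obtain ⟨ε, hε, hlow⟩ := exists_lower_bound hK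
    refine false_of_frequently_le hε (C := |v 1|) (hfr.mono fun n hn => ?_)
    rw [gSL_pow] at hn
    obtain ⟨i, hi⟩ := hlow _ hn _ (Lam_smul _ hv)
    rw [gSL_mulVec] at hi
    refine hi.trans ?_
    have p := exp_pos (-(n : ℝ))
    fin_cases i <;> simp [h0, hv2, abs_mul] <;> positivity
  obtain ⟨ε, hε, hlow⟩ := exists_lower_bound (K := {g • x₀}) isCompact_singleton
  refine false_of_frequently_le hε (C := ρ * ρ / |v 0|) (hE.mono fun n hn => ?_)
  rw [gSL_pow, mul_one] at hn
  obtain ⟨w, hw, hw2, hwρ⟩ := hn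
  have h1 := Lam_smul (gSL n)⁻¹ hw
  rw [inv_smul_smul, gSL_inv, gSL_mulVec] at h1
  obtain ⟨r, hr⟩ := hpar _ h1 (by simp [hw2])
  obtain ⟨i, hi⟩ := hlow _ rfl _ h1
  rw [hr] at hi
  have h0 := congrFun hr 0
  simp only [cons_val_zero, Pi.smul_apply, smul_eq_mul] at h0 hi
  have hρ : 0 ≤ ρ := (abs_nonneg _).trans (hvρ 0)
  have hrb : |r| ≤ exp (-n) * ρ / |v 0| := by
    rw [le_div_iff₀ (abs_pos.2 hv0), ← abs_mul, ← h0, abs_mul, abs_of_pos (exp_pos _)]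
    refine mul_le_mul (Real.exp_le_exp.2 ?_) (hwρ 0) (abs_nonneg _) (exp_pos _).le
    have : (0 : ℝ) ≤ n := by positivity
    linarith
  rw [abs_mul] at hi
  calc ε ≤ |r| * |v i| := hi
    _ ≤ (exp (-n) * ρ / |v 0|) * ρ := mul_le_mul hrb (hvρ i) (abs_nonneg _) (by positivity)
    _ = _ := by ring

lemma exists_reach {x : X} {ρ : ℝ} (h : ∀ v ∈ Lam x, v 2 = 0 → ¬ ∀ i, |v i| ≤ ρ) :
    ∃ S₀ : ℝ, ∀ S, S₀ ≤ S → ∀ v ∈ Lam x, ∃ s ∈ Icc 0 S, ρ ≤ Fn v s := by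
  have hex : ∀ v ∈ Lam x, ∃ s, 0 ≤ s ∧ ρ ≤ Fn v s := by
    intro v hv
    by_cases h2 : v 2 = 0
    · have := h v hv h2
      push Not at this
      obtain ⟨i, hi⟩ := this
      refine ⟨0, le_rfl, hi.le.trans ?_⟩
      have := Fn_le.1 (le_refl (Fn v 0))
      rw [zero_mul, add_zero] at this
      fin_cases i
      exacts [this.1, this.2.1, this.2.2]
    · rcases lt_or_ge ρ 0 with hρ | hρ
      · exact ⟨0, le_rfl, hρ.le.trans (Fn_nonneg _ _)⟩
      refine ⟨(ρ + |v 0|) / |v 2|, by positivity, le_trans ?_ (le_max_left _ _)⟩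
      have e : |(ρ + |v 0|) / |v 2| * v 2| = ρ + |v 0| := by
        have : 0 < |v 2| := abs_pos.2 h2
        rw [abs_mul, abs_of_nonneg (by positivity), div_mul_cancel₀ _ this.ne']
      have := abs_sub_abs_le_abs_sub ((ρ + |v 0|) / |v 2| * v 2) (-v 0)
      rw [e, abs_neg, sub_neg_eq_add, add_comm (_ * _) (v 0)] at this
      linarith
  choose! f hf0 hf using hex
  obtain ⟨S₀, hS₀⟩ := ((finite_Fn_lt x 0 ρ).image f).bddAbove
  refine ⟨max S₀ 0, fun S hS v hv => ?_⟩
  by_cases hlt : Fn v 0 < ρ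
  · exact ⟨f v, ⟨hf0 v hv, (hS₀ ⟨v, ⟨hv, hlt⟩, rfl⟩).trans ((le_max_left _ _).trans hS)⟩, hf v hv⟩
  · exact ⟨0, ⟨le_rfl, (le_max_right _ _).trans hS⟩, not_lt.1 hlt⟩

lemma le_integral_of_bad {f : ℝ → ℝ} (hf : Continuous f) (h0 : ∀ r, 0 ≤ f r) (h1 : ∀ r, f r ≤ 1)
    {α β κ : ℝ} (hαβ : α ≤ β) (hκ : 0 ≤ κ) {B : Set ℝ} (hB : volume B ≤ ofReal κ)
    (hgood : ∀ r ∈ Icc α β, r ∉ B → f r = 1) : β - α - κ ≤ ∫ r in α..β, f r := by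
  have hsub : (∫ r in α..β, (1 - f r)) ≤ κ := by
    rw [integral_of_le hαβ, setIntegral_eq_of_subset_of_forall_sdiff_eq_zero
      (f := fun r => 1 - f r) (s := Set.Ioc α β ∩ {r | f r ≠ 1}) measurableSet_Ioc Set.inter_subset_left (fun r hr => by
        have : f r = 1 := by_contra fun h => hr.2 ⟨hr.1, h⟩
        simp only [this, sub_self])]
    have hv : volume (Set.Ioc α β ∩ {r | f r ≠ 1}) ≤ ofReal κ :=
      (measure_mono fun r hr => by_contra fun hrB =>
        hr.2 (hgood r (Set.Ioc_subset_Icc_self hr.1) hrB)).trans hB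
    have h2 := norm_setIntegral_le_of_norm_le_const (f := fun r => 1 - f r) (C := 1)
      (hv.trans_lt ofReal_lt_top) (fun r _ => by
        rw [norm_eq_abs, abs_le]; constructor <;> linarith [h0 r, h1 r])
    refine (le_abs_self _).trans (h2.trans ?_)
    rw [one_mul]
    exact toReal_le_of_le_ofReal hκ hv
  rw [intervalIntegral.integral_sub (by simp) (hf.intervalIntegrable _ _)] at hsub
  simp at hsub
  linarith

/-- A cutoff function equal to one on a given compact set. -/
lemma exists_cutoff {C : Set X} (hC : IsCompact C) : ∃ f : C(X, ℝ), HasCompactSupport f ∧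
    (∀ x ∈ C, f x = 1) ∧ (∀ x, 0 ≤ f x) ∧ ∀ x, f x ≤ 1 := by
  obtain ⟨f, h1, -, hc, h01⟩ := exists_continuous_one_zero_of_isCompact hC isClosed_empty
    (Set.disjoint_empty C)
  exact ⟨f, hc, h1, fun x => (h01 x).1, fun x => (h01 x).2⟩

lemma real_compl_tsupport_le {f : C(X, ℝ)}
    (hf : HasCompactSupport f) (hfle : ∀ x, f x ≤ 1) {η : ℝ} (h1 : 1 - η ≤ ∫ x, f x ∂ν) :
    ν.real (tsupport f)ᶜ ≤ η := by
  have h2 : ∫ x, f x ∂ν ≤ ν.real (tsupport f) := by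
    rw [← integral_indicator_one (isClosed_tsupport f).measurableSet]
    refine integral_mono (f.continuous.integrable_of_hasCompactSupport hf)
      ((integrable_const (1 : ℝ)).indicator (isClosed_tsupport f).measurableSet) fun x => ?_
    by_cases hx : x ∈ tsupport f
    · simpa [hx] using hfle x
    · simp [hx, image_eq_zero_of_notMem_tsupport hx]
  rw [probReal_compl_eq_one_sub (isClosed_tsupport f).measurableSet]
  linarith

lemma exists_uniform_compact {η : ℝ} (hη : 0 < η) : ∃ C : Set X, IsCompact C ∧
    ∀ (ν : Measure X) [IsProbabilityMeasure ν], (∀ t, MInv ν (gSL t)) → (∀ s, MInv ν (u s)) →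
      ν.real Cᶜ ≤ η := by
  obtain ⟨ε, hε, hε1, hε2⟩ : ∃ ε : ℝ, 0 < ε ∧ ε ≤ 1 / 20 ∧ 20400 * ε ≤ η :=
    ⟨min (1 / 20) (η / 20400), by positivity, min_le_left _ _, by
      have := min_le_right (1 / 20) (η / 20400); linarith⟩
  obtain ⟨C₀, hC₀, hgood⟩ := exists_compact_of_Fn hε
  obtain ⟨f, hf, hf1, hf0, hfle⟩ := exists_cutoff hC₀
  refine ⟨tsupport f, hf, fun ν _ hA hu => ?_⟩
  have habs : ∀ x, |f x| ≤ 1 := fun x => abs_le.2 ⟨by linarith [hf0 x], hfle x⟩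
  have hae : ∀ᵐ x ∂ν, 1 - η ≤ Lm f x := by
    filter_upwards [ae_notMem_FixS hA (1 / 20), ae_frequently_compact (hA (-1)), ae_mem_Gen hu]
      with x hx hb hG
    obtain ⟨g, rfl⟩ := exists_smul_x₀ x
    obtain ⟨S₁, hS₁⟩ := exists_reach (x := g • x₀) (ρ := 1 / 20) fun v hv h2 h => hx ⟨v, hv, h2, h⟩
    obtain ⟨S₂, hS₂⟩ := exists_reach (x := th g • x₀) (ρ := 1 / 20)
      fun v hv h2 => absurd h2 (dual_third_ne_zero hb hv)
    refine ge_of_tendsto (tendsto_avg hG hf) ?_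
    filter_upwards [eventually_ge_atTop S₁, eventually_ge_atTop S₂, eventually_gt_atTop 0]
      with S h1 h2 hS
    have hnd := nondivergence g hS (ρ := 1 / 20) (by norm_num) (by norm_num) hε hε1 (hS₁ S h1)
      (hS₂ S h2)
    have := le_integral_of_bad (f := fun r => f (u r • g • x₀))
      (f.continuous.comp (by have := continuous_u; fun_prop)) (fun r => hf0 _) (fun r => hfle _)
      hS.le (by positivity) hnd (fun r hr hbad => hf1 _ (hgood _ _ fun v hv => by
        by_contra hlt
        exact hbad ⟨hr, v, hv, not_le.1 hlt⟩))
    unfold avg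
    rw [inv_mul_eq_div, le_div_iff₀ hS]
    refine le_trans ?_ this
    nlinarith
  have hItg : Integrable (Lm f) ν := Integrable.of_bound (measurable_Lm f).aestronglyMeasurable 1 (by
    filter_upwards [ae_mem_Gen hu] with x hx using abs_Lm_le hx hf habs)
  have h1 : 1 - η ≤ ∫ x, f x ∂ν := by
    rw [← integral_Lm hu hf]
    have := integral_mono_ae (integrable_const (1 - η)) hItg hae
    simpa using this
  exact real_compl_tsupport_le hf hfle h1

/-! ### Classification of invariant measures -/

lemma MInv.map_conj {ν : Measure X} {b h : G} (hi : MInv ν (b⁻¹ * h * b)) :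
    MInv (Measure.map (fun x => b • x) ν) h := by
  unfold MInv at hi ⊢
  rw [Measure.map_map (measurable_smulX h) (measurable_smulX b)]
  conv_rhs => rw [← hi, Measure.map_map (measurable_smulX b) (measurable_smulX _)]
  congr 1
  ext x
  simp [← mul_smul, mul_assoc]

lemma MInv.cond {ν : Measure X} {h : G} (hi : MInv ν h) {D : Set X} (hD : MeasurableSet D)
    (hinv : ∀ x, h • x ∈ D ↔ x ∈ D) : MInv (ProbabilityTheory.cond ν D) h := by
  unfold MInv ProbabilityTheory.cond
  rw [Measure.map_smul]
  have := Measure.restrict_map (μ := ν) (measurable_smulX h) hD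
  rw [hi, show (fun x : X => h • x) ⁻¹' D = D from Set.ext hinv] at this
  rw [← this]

lemma tight_ap (hA : ∀ t, MInv ν (gSL t)) (hu : ∀ s, MInv ν (u s)) (η : ℝ) (hη : 0 < η) :
    ∃ C : Set X, IsCompact C ∧ ∀ k : ℕ, ν.real {x | (ap k)⁻¹ • x ∉ C} ≤ η := by
  obtain ⟨C, hC, h⟩ := exists_uniform_compact hη
  refine ⟨C, hC, fun k => ?_⟩
  have : IsProbabilityMeasure (Measure.map (fun x => (ap k)⁻¹ • x) ν) :=
    Measure.isProbabilityMeasure_map (measurable_smulX _).aemeasurable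
  have h1 := h (Measure.map (fun x => (ap k)⁻¹ • x) ν) (fun t => MInv.map_conj (by
      rw [inv_inv, gSL_eq]
      unfold ap
      rw [dT_comm, mul_inv_cancel_right, ← gSL_eq]
      exact hA t))
    (fun s => MInv.map_conj (by
      rw [inv_inv, ap_u, mul_inv_cancel_right]
      exact hu _))
  rwa [measureReal_def, Measure.map_apply (measurable_smulX _) hC.isClosed.measurableSet.compl] at h1

lemma cond_eq_haar (hA : ∀ t, MInv ν (gSL t)) (hu : ∀ s, MInv ν (u s))
    {D : Set X} (hD : MeasurableSet D) (hDA : ∀ t x, gSL t • x ∈ D ↔ x ∈ D)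
    (hDu : ∀ s x, u s • x ∈ D ↔ x ∈ D) (hsub : D ⊆ Om e12 ∨ D ⊆ Om e23) (h0 : ν D ≠ 0) :
    ProbabilityTheory.cond ν D = μ := by
  have hp := ProbabilityTheory.cond_isProbabilityMeasure (μ := ν) h0
  have hA' : ∀ t, MInv (ProbabilityTheory.cond ν D) (gSL t) := fun t => (hA t).cond hD (hDA t)
  have hu' : ∀ s, MInv (ProbabilityTheory.cond ν D) (u s) := fun s => (hu s).cond hD (hDu s)
  have hae : ∀ᵐ x ∂(ProbabilityTheory.cond ν D), x ∈ D := ae_cond_mem hD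
  rcases hsub with hs | hs
  · exact eq_of_inv_e12 hA' hu' fun p => mInv_of_ae_inv hu' (by
      filter_upwards [hae] with x hx using (hs hx).2 p)
  · exact eq_of_inv_e23 hu' (fun p => mInv_of_ae_inv hu' (by
      filter_upwards [hae] with x hx using (hs hx).2 p)) (tight_ap hA' hu')

lemma cond_of_full {D : Set X} (hD : MeasurableSet D)
    (h : ν Dᶜ = 0) : ProbabilityTheory.cond ν D = ν := by
  unfold ProbabilityTheory.cond
  rw [Measure.restrict_eq_self_of_ae_mem (show ∀ᵐ x ∂ν, x ∈ D from h),
    (prob_compl_eq_zero_iff hD).1 h, inv_one, one_smul]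

/-- An invariant probability measure is the homogeneous one. -/
lemma eq_haar_of_inv (hA : ∀ t, MInv ν (gSL t)) (hu : ∀ s, MInv ν (u s)) : ν = μ := by
  have m12 : MeasurableSet (Om e12) := measurableSet_Om continuous_e12
  have m23 : MeasurableSet (Om e23) := measurableSet_Om continuous_e23
  have h3 : ν (Om e12 ∪ Om e23)ᶜ = 0 := by
    by_contra h0
    have hm := (m12.union m23).compl
    have hp := ProbabilityTheory.cond_isProbabilityMeasure (μ := ν) h0
    have hae := ae_cond_mem (μ := ν) hm
    refine false_of_transversal (ν := ProbabilityTheory.cond ν (Om e12 ∪ Om e23)ᶜ)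
      (fun s => (hu s).cond hm fun x => ?_) (fun t => (hA t).cond hm fun x => ?_) ?_ ?_
    · simp [Om_u_iff]
    · simp [Om_e12_gSL_iff, Om_e23_gSL_iff]
    · exact measure_eq_zero_iff_ae_notMem.2 (hae.mono fun x h hx => h (Or.inl hx))
    · exact measure_eq_zero_iff_ae_notMem.2 (hae.mono fun x h hx => h (Or.inr hx))
  have c1 : ν (Om e12) ≠ 0 → ProbabilityTheory.cond ν (Om e12) = μ := fun h =>
    cond_eq_haar hA hu m12 (fun t x => Om_e12_gSL_iff t) (fun s x => Om_u_iff s) (Or.inl le_rfl) h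
  have c2 : ν (Om e23 \ Om e12) ≠ 0 → ProbabilityTheory.cond ν (Om e23 \ Om e12) = μ := fun h =>
    cond_eq_haar hA hu (m23.diff m12) (fun t x => by simp [Om_e12_gSL_iff, Om_e23_gSL_iff])
      (fun s x => by simp [Om_u_iff]) (Or.inr Set.sdiff_subset) h
  by_cases h1 : ν (Om e12) = 0
  · have hfull : ν (Om e23 \ Om e12)ᶜ = 0 := by
      refine measure_mono_null (t := Om e12 ∪ (Om e12 ∪ Om e23)ᶜ) ?_ (measure_union_null h1 h3)
      intro x hx
      by_cases hx1 : x ∈ Om e12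
      · exact Or.inl hx1
      · exact Or.inr fun h => h.elim hx1 fun h2 => hx ⟨h2, hx1⟩
    have hne : ν (Om e23 \ Om e12) ≠ 0 := fun h0 => by
      have := (prob_compl_eq_zero_iff (μ := ν) (m23.diff m12)).1 hfull
      simp [h0] at this
    rw [← c2 hne, cond_of_full (m23.diff m12) hfull]
  · have h2 : ν (Om e23 \ Om e12) = 0 := by
      by_contra h2
      have e : ∀ᵐ x ∂μ, x ∈ Om e12 := by rw [← c1 h1]; exact ae_cond_mem m12
      have e' : ∀ᵐ x ∂μ, x ∈ Om e23 \ Om e12 := by rw [← c2 h2]; exact ae_cond_mem (m23.diff m12)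
      obtain ⟨x, hx, hx'⟩ := (e.and e').exists
      exact hx'.2 hx
    have hfull : ν (Om e12)ᶜ = 0 := by
      refine measure_mono_null (t := (Om e23 \ Om e12) ∪ (Om e12 ∪ Om e23)ᶜ) ?_
        (measure_union_null h2 h3)
      intro x hx
      by_cases hx2 : x ∈ Om e23
      · exact Or.inl ⟨hx2, hx⟩
      · exact Or.inr fun h => h.elim hx hx2
    rw [← c1 h1, cond_of_full m12 hfull]

/-! ### Windows of times without short vectors -/

/-- Vectors that are short along the whole expanded segment at time `t`. -/
def BadV (σ t : ℝ) (v : ℝ³) : Prop :=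
  |v 0| ≤ σ * exp (-2 * t) ∧ |v 2| ≤ σ * exp (-2 * t) ∧ |v 1| ≤ σ * exp t

lemma BadV.abs_tc_le {σ t t' : ℝ} {v v' : ℝ³} (hσ : 0 ≤ σ) (ht : 0 ≤ t) (ht' : 0 ≤ t')
    (h1 : t' ≤ 2 * t) (h2 : t ≤ 2 * t') (h : BadV σ t v) (h' : BadV σ t' v') (i : Fin 3) :
    |tc v v' i| ≤ 2 * σ ^ 2 := by
  obtain ⟨a0, a2, a1⟩ := h
  obtain ⟨b0, b2, b1⟩ := h'
  have key : ∀ {x y p q : ℝ}, |x| ≤ σ * exp p → |y| ≤ σ * exp q → p + q ≤ 0 →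
      |x * y| ≤ σ ^ 2 := by
    intro x y p q hx hy hpq
    rw [abs_mul]
    calc |x| * |y| ≤ (σ * exp p) * (σ * exp q) :=
          mul_le_mul hx hy (abs_nonneg _) (by positivity)
      _ = σ ^ 2 * exp (p + q) := by rw [exp_add]; ring
      _ ≤ σ ^ 2 * 1 := by gcongr; exact exp_le_one_iff.2 hpq
      _ = σ ^ 2 := mul_one _
  have sub : ∀ {x y : ℝ}, |x| ≤ σ ^ 2 → |y| ≤ σ ^ 2 → |x - y| ≤ 2 * σ ^ 2 := fun hx hy =>
    (abs_sub _ _).trans (by linarith)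
  fin_cases i
  · exact sub (key a0 b1 (by linarith)) (key a1 b0 (by linarith))
  · exact sub (key a2 b0 (by linarith)) (key a0 b2 (by linarith))
  · exact sub (key a2 b1 (by linarith)) (key a1 b2 (by linarith))

lemma exists_of_mem_Lam_smul {h : G} {x : X} {v' : ℝ³} (hv' : v' ∈ Lam (h • x)) :
    ∃ v ∈ Lam x, v' = (h : M₃) *ᵥ v := by
  have hv := Lam_smul h⁻¹ hv'
  rw [inv_smul_smul] at hv
  refine ⟨_, hv, ?_⟩
  rw [mulVec_mulVec, ← coe_G_mul, mul_inv_cancel, coe_G_one, one_mulVec]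

lemma exists_good_window {g₀ : G} (hax : ∀ v ∈ Lam (g₀ • x₀), ¬ (v 0 = 0 ∧ v 2 = 0)) :
    ∃ σ > 0, ∀ N : ℕ, ∃ T : ℝ, N ≤ T ∧ ∀ t ∈ Icc T (T + (N + 1)), ∀ v ∈ Lam (g₀ • x₀),
      ¬ BadV σ t v := by
  obtain ⟨ε, hε, hdual⟩ := exists_dual_lower_bound (K := {g₀ • x₀}) isCompact_singleton
  obtain ⟨ε', hε', hlow⟩ := exists_lower_bound (K := {g₀ • x₀}) isCompact_singleton
  obtain ⟨σ, hσ, hσ1, hσε⟩ : ∃ σ : ℝ, 0 < σ ∧ σ ≤ 1 ∧ σ ≤ ε / 4 :=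
    ⟨min 1 (ε / 4), by positivity, min_le_left _ _, min_le_right _ _⟩
  refine ⟨σ, hσ, ?_⟩
  by_contra! hcon
  obtain ⟨N, hN⟩ := hcon
  have hch : ∀ k : ℕ, ∃ t : ℝ, ∃ v ∈ Lam (g₀ • x₀), 2 * N + 2 + k ≤ t ∧ t ≤ 3 * N + 3 + k ∧
      BadV σ t v := by
    intro k
    obtain ⟨t, ht, v, hv, hb⟩ := hN (2 * N + 2 + k) (by
      have : (0 : ℝ) ≤ N := by positivity
      have : (0 : ℝ) ≤ k := by positivity
      linarith)
    exact ⟨t, v, hv, ht.1, by linarith [ht.2], hb⟩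
  choose t v hv ht1 ht2 hbad using hch
  have hN0 : (0 : ℝ) ≤ N := by positivity
  have hk0 : ∀ k : ℕ, (0 : ℝ) ≤ k := fun k => by positivity
  have hpar : ∀ k, ∃ r : ℝ, v k = r • v 0 := by
    intro k
    induction k with
    | zero => exact ⟨1, by simp⟩
    | succ k ih =>
      obtain ⟨r, hr⟩ := ih
      obtain ⟨r', hr'⟩ : ∃ r' : ℝ, v (k + 1) = r' • v k := by
        refine parallel_of_tc (Lam_ne_zero (hv k)) (by_contra fun h0 => ?_)
        obtain ⟨i, hi⟩ := hdual g₀ rfl _ (tc_mem (hv k) (hv (k + 1)) h0)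
        have a1 := ht1 k
        have a2 := ht2 k
        have a3 := ht1 (k + 1)
        have a4 := ht2 (k + 1)
        push_cast at a3 a4
        have := (hbad k).abs_tc_le hσ.le (by linarith [hk0 k]) (by linarith [hk0 k])
          (by linarith [hk0 k]) (by linarith [hk0 k]) (hbad (k + 1)) i
        nlinarith
      exact ⟨r' * r, by rw [hr', hr, smul_smul]⟩
  have hzero : ∀ j, (∀ k, |v k j| ≤ σ * exp (-2 * t k)) → v 0 j = 0 := by
    intro j hj
    by_contra hne
    have hpos : 0 < |v 0 j| := abs_pos.2 hne
    refine false_of_frequently_le (ε := ε' * |v 0 j|) (by positivity)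
      (C := (|v 0 0| + |v 0 1| + |v 0 2|) * σ) (Eventually.of_forall fun k => ?_).frequently
    obtain ⟨r, hr⟩ := hpar k
    obtain ⟨i, hi⟩ := hlow _ rfl _ (hv k)
    have hjk := hj k
    rw [hr, Pi.smul_apply, smul_eq_mul, abs_mul] at hi hjk
    have hM : |v 0 i| ≤ |v 0 0| + |v 0 1| + |v 0 2| := by
      have := abs_nonneg (v 0 0)
      have := abs_nonneg (v 0 1)
      have := abs_nonneg (v 0 2)
      fin_cases i <;> simp <;> linarith
    have hexp : exp (-2 * t k) ≤ exp (-k) := Real.exp_le_exp.2 (by linarith [ht1 k, hk0 k])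
    calc ε' * |v 0 j| ≤ (|r| * |v 0 i|) * |v 0 j| := by gcongr
      _ = |v 0 i| * (|r| * |v 0 j|) := by ring
      _ ≤ (|v 0 0| + |v 0 1| + |v 0 2|) * (σ * exp (-k)) :=
          mul_le_mul hM (hjk.trans (by gcongr)) (by positivity) (by positivity)
      _ = _ := by ring
  exact hax _ (hv 0) ⟨hzero 0 fun k => (hbad k).1, hzero 2 fun k => (hbad k).2.1⟩

lemma linear_bound {s₁ s₂ : ℝ} (h : s₁ < s₂) : ∃ c : ℝ, 1 ≤ c ∧ ∀ p q δ : ℝ,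
    |p + s₁ * q| ≤ δ → |p + s₂ * q| ≤ δ → |p| ≤ c * δ ∧ |q| ≤ c * δ := by
  have hL : 0 < s₂ - s₁ := by linarith
  refine ⟨1 + 2 * (1 + |s₁|) / (s₂ - s₁), le_add_of_nonneg_right (by positivity),
    fun p q δ h1 h2 => ?_⟩
  have hδ : 0 ≤ δ := (abs_nonneg _).trans h1
  have hq : |q| ≤ 2 * δ / (s₂ - s₁) := by
    rw [le_div_iff₀ hL, ← abs_of_pos hL, ← abs_mul,
      show q * (s₂ - s₁) = (p + s₂ * q) - (p + s₁ * q) by ring]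
    exact (abs_sub _ _).trans (by linarith)
  have e : (1 + 2 * (1 + |s₁|) / (s₂ - s₁)) * δ =
      δ + 2 * δ / (s₂ - s₁) + |s₁| * (2 * δ / (s₂ - s₁)) := by ring
  have hp : |p| ≤ δ + |s₁| * |q| := by
    have := abs_sub (p + s₁ * q) (s₁ * q)
    rw [add_sub_cancel_right, abs_mul] at this
    linarith
  have := mul_le_mul_of_nonneg_left hq (abs_nonneg s₁)
  have : 0 ≤ |s₁| * (2 * δ / (s₂ - s₁)) := by positivity
  have : 0 ≤ 2 * δ / (s₂ - s₁) := by positivity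
  rw [e]
  constructor <;> linarith

lemma reach_of_not_bad (g₀ : G) {s₁ s₂ σ : ℝ} (hs : s₁ < s₂) (hσ : 0 < σ) :
    ∃ ρ : ℝ, 0 < ρ ∧ ρ < 1 / 10 ∧ ∀ t, 0 ≤ t → (∀ v ∈ Lam (g₀ • x₀), ¬ BadV σ t v) →
      (∀ v ∈ Lam ((gSL t * g₀) • x₀), ∃ s ∈ Icc (exp (3 * t) * s₁) (exp (3 * t) * s₂), ρ ≤ Fn v s) ∧
      ∀ w ∈ Lam (th (gSL t * g₀) • x₀),
        ∃ s ∈ Icc (exp (3 * t) * s₁) (exp (3 * t) * s₂), ρ ≤ Fn w s := by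
  obtain ⟨ε, hε, hdual⟩ := exists_dual_lower_bound (K := {g₀ • x₀}) isCompact_singleton
  obtain ⟨c, hc1, hc⟩ := linear_bound hs
  have hc0 : 0 < c := by linarith
  obtain ⟨ρ, hρ, hρ1, hρσ, hρε⟩ : ∃ ρ : ℝ, 0 < ρ ∧ ρ < 1 / 10 ∧ c * ρ ≤ σ ∧ c * ρ < ε := by
    refine ⟨min (1 / 20) (min (σ / c) (ε / (2 * c))), by positivity,
      (min_le_left _ _).trans_lt (by norm_num), ?_, ?_⟩
    · calc c * _ ≤ c * (σ / c) := by gcongr; exact (min_le_right _ _).trans (min_le_left _ _)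
        _ = σ := by field_simp
    · calc c * _ ≤ c * (ε / (2 * c)) := by
            gcongr; exact (min_le_right _ _).trans (min_le_right _ _)
        _ = ε / 2 := by field_simp
        _ < ε := by linarith
  refine ⟨ρ, hρ, hρ1, fun t ht hgood => ?_⟩
  have hmem : ∀ s ∈ Icc s₁ s₂, exp (3 * t) * s ∈
      Icc (exp (3 * t) * s₁) (exp (3 * t) * s₂) := fun s hs =>
    ⟨by gcongr; exact hs.1, by gcongr; exact hs.2⟩
  have hm1 := hmem s₁ ⟨le_rfl, hs.le⟩
  have hm2 := hmem s₂ ⟨hs.le, le_rfl⟩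
  have hρc : ρ ≤ c * ρ := by nlinarith
  have hmulle : ∀ {x y p : ℝ}, exp p * x ≤ y → x ≤ y * exp (-p) := fun {x y p} h => by
    rw [Real.exp_neg, ← div_eq_mul_inv, le_div_iff₀ (exp_pos p)]; linarith
  constructor
  · intro v' hv'
    by_contra! hcon
    rw [mul_smul] at hv'
    obtain ⟨v, hv, rfl⟩ := exists_of_mem_Lam_smul hv'
    rw [gSL_mulVec] at hcon
    have hlin : ∀ s, exp (3 * t) * s ∈ Icc (exp (3 * t) * s₁) (exp (3 * t) * s₂) →
        |v 0 + s * v 2| ≤ ρ * exp (-(2 * t)) := fun s hs => by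
      have := (Fn_lt.1 (hcon _ hs)).1
      simp only [cons_val_zero, cons_val] at this
      refine hmulle ?_
      rw [← abs_of_pos (exp_pos (2 * t)), ← abs_mul]
      refine le_of_eq_of_le ?_ this.le
      rw [show exp (3 * t) = exp (2 * t) * exp t by rw [← exp_add]; ring_nf, Real.exp_neg]
      congr 1
      field_simp
    obtain ⟨b0, b2⟩ := hc _ _ _ (hlin s₁ hm1) (hlin s₂ hm2)
    have b1 := (Fn_lt.1 (hcon _ hm1)).2.1
    simp only [cons_val_one, cons_val_zero, abs_mul, abs_exp] at b1
    have b1' := hmulle b1.le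
    rw [neg_neg] at b1'
    have hx := exp_pos (-(2 * t))
    refine hgood v hv ⟨?_, ?_, ?_⟩
    · rw [neg_mul]; nlinarith
    · rw [neg_mul]; nlinarith
    · nlinarith [exp_pos t]
  · intro w' hw'
    by_contra! hcon
    rw [th_mul, mul_smul] at hw'
    obtain ⟨w, hw, rfl⟩ := exists_of_mem_Lam_smul hw'
    rw [th_gSL_mulVec] at hcon
    have h1t : exp (-t) ≤ 1 := exp_le_one_iff.2 (by linarith)
    have hlin : ∀ s, exp (3 * t) * s ∈ Icc (exp (3 * t) * s₁) (exp (3 * t) * s₂) →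
        |w 0 + s * w 2| ≤ ρ := fun s hs => by
      have := (Fn_lt.1 (hcon _ hs)).1
      simp only [cons_val_zero, cons_val] at this
      refine (hmulle (p := t) (y := ρ) ?_).trans (by nlinarith)
      rw [← abs_of_pos (exp_pos t), ← abs_mul]
      refine le_of_eq_of_le ?_ this.le
      rw [show exp (3 * t) = exp t * exp (2 * t) by rw [← exp_add]; ring_nf, neg_mul, Real.exp_neg]
      congr 1
      field_simp
    obtain ⟨b0, b2⟩ := hc _ _ _ (hlin s₁ hm1) (hlin s₂ hm2)
    have b1 := (Fn_lt.1 (hcon _ hm1)).2.1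
    simp only [cons_val_one, cons_val_zero, abs_mul, abs_exp] at b1
    have b1' := hmulle b1.le
    obtain ⟨i, hi⟩ := hdual g₀ rfl w hw
    fin_cases i
    · exact absurd hi (not_le.2 (b0.trans_lt hρε))
    · have : |w 1| ≤ ρ := b1'.trans (by nlinarith)
      exact absurd hi (not_le.2 (by simp only [Fin.mk_one]; linarith))
    · exact absurd hi (not_le.2 (b2.trans_lt hρε))

/-! ### Averages along expanding segments -/

/-- Uniform distribution on an interval. -/
def unifI (α β : ℝ) : Measure ℝ := ProbabilityTheory.cond volume (Icc α β)

lemma isProb_unifI {α β : ℝ} (h : α < β) : IsProbabilityMeasure (unifI α β) :=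
  ProbabilityTheory.cond_isProbabilityMeasure_of_finite (by simpa using h) (by simp)

lemma ae_unifI (α β : ℝ) : ∀ᵐ r ∂unifI α β, r ∈ Icc α β := ae_cond_mem measurableSet_Icc

lemma integral_unifI {α β : ℝ} (h : α < β) (f : ℝ → ℝ) :
    ∫ r, f r ∂unifI α β = (β - α)⁻¹ * ∫ r in α..β, f r := by
  unfold unifI ProbabilityTheory.cond
  rw [integral_smul_measure, volume_Icc, toReal_inv,
    toReal_ofReal (by linarith), integral_Icc_eq_integral_Ioc,
    integral_of_le h.le, smul_eq_mul]

lemma abs_shift_le {f : ℝ → ℝ} (hf : Continuous f) {M : ℝ} (hM : ∀ r, |f r| ≤ M) {α β : ℝ}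
    (h : α < β) (δ : ℝ) :
    |(∫ r, f (r + δ) ∂unifI α β) - ∫ r, f r ∂unifI α β| ≤ 2 * M * |δ| / (β - α) := by
  have hi : ∀ a b, IntervalIntegrable f volume a b := fun a b => hf.intervalIntegrable a b
  rw [integral_unifI h, integral_unifI h, ← mul_sub, integral_comp_add_right,
    intervalIntegral.integral_interval_sub_interval_comm (hi _ _) (hi _ _) (hi _ _), abs_mul,
    abs_of_pos (inv_pos.2 (by linarith)), inv_mul_eq_div]
  have hb : ∀ a b, |∫ r in a..b, f r| ≤ M * |b - a| := fun a b => by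
    rw [← norm_eq_abs]
    exact intervalIntegral.norm_integral_le_of_norm_le_const fun r _ => hM r
  have h1 := hb (α + δ) α
  have h2 := hb (β + δ) β
  rw [show α - (α + δ) = -δ by ring, abs_neg] at h1
  rw [show β - (β + δ) = -δ by ring, abs_neg] at h2
  have : 0 < β - α := by linarith
  gcongr
  exact (abs_sub _ _).trans (by linarith)

/-- Average of `f` over the translated segment. -/
def seg (y : X) (s₁ s₂ : ℝ) (f : X → ℝ) (t : ℝ) : ℝ := ∫ s, f (gSL t • u s • y) ∂unifI s₁ s₂

lemma continuous_orb (y : X) : Continuous fun p : ℝ × ℝ => gSL p.1 • u p.2 • y := by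
  have := continuous_gSL
  have := continuous_u
  fun_prop

section

variable {y : X} {s₁ s₂ : ℝ} {f : X → ℝ} {M : ℝ}

lemma gSL_u_smul (t r s : ℝ) (y : X) :
    u r • gSL t • u s • y = gSL t • u (s + exp (-3 * t) * r) • y := by
  simp only [← mul_smul]
  rw [gSL_u, gSL_u, ← mul_assoc, ← u_add, mul_add, ← mul_assoc (exp _), ← exp_add]
  congr 3
  ring_nf
  simp

lemma continuous_seg (hs : s₁ < s₂) (hf : Continuous f) : Continuous (seg y s₁ s₂ f) := by
  have e : seg y s₁ s₂ f = fun t => (s₂ - s₁)⁻¹ * ∫ s in s₁..s₂, f (gSL t • u s • y) := by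
    ext t; exact integral_unifI hs _
  rw [e]
  exact continuous_const.mul (intervalIntegral.continuous_parametric_intervalIntegral_of_continuous'
    (f := fun t s => f (gSL t • u s • y)) (hf.comp (continuous_orb y)) _ _)

lemma integrable_seg (hs : s₁ < s₂) (hf : Continuous f) (hM : ∀ x, |f x| ≤ M) (t : ℝ) :
    Integrable (fun s => f (gSL t • u s • y)) (unifI s₁ s₂) := by
  have := isProb_unifI hs
  exact Integrable.of_bound (hf.comp ((continuous_orb y).comp
    (Continuous.prodMk_right t))).aestronglyMeasurable M (ae_of_all _ fun s => hM _)

lemma abs_seg_le (hs : s₁ < s₂) (hM : ∀ x, |f x| ≤ M) (t : ℝ) : |seg y s₁ s₂ f t| ≤ M := by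
  have := isProb_unifI hs
  have := norm_integral_le_of_norm_le_const (μ := unifI s₁ s₂) (f := fun s => f (gSL t • u s • y))
    (ae_of_all _ fun s => hM _)
  simp only [probReal_univ, mul_one] at this
  exact this

lemma abs_seg_u_sub_le (hs : s₁ < s₂) (hf : Continuous f) (hM : ∀ x, |f x| ≤ M) (r t : ℝ) :
    |seg y s₁ s₂ (fun x => f (u r • x)) t - seg y s₁ s₂ f t| ≤
      2 * M * |exp (-3 * t) * r| / (s₂ - s₁) := by
  have hc : Continuous fun s => f (gSL t • u s • y) := by
    have := continuous_u
    fun_prop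
  have h := abs_shift_le hc (M := M) (fun s => hM (gSL t • u s • y)) hs (exp (-3 * t) * r)
  have e : seg y s₁ s₂ (fun x => f (u r • x)) t =
      ∫ s, f (gSL t • u (s + exp (-3 * t) * r) • y) ∂unifI s₁ s₂ :=
    integral_congr_ae (ae_of_all _ fun s => congrArg f (gSL_u_smul t r s y))
  rw [e]
  exact h

lemma abs_seg_avg_sub_le (hs : s₁ < s₂) (f : C(X, ℝ)) (hM : ∀ x, |f x| ≤ M) {S : ℝ} (hS : 0 < S)
    (t : ℝ) : |seg y s₁ s₂ (avg S f) t - seg y s₁ s₂ f t| ≤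
      2 * M * (exp (-3 * t) * S) / (s₂ - s₁) := by
  have := isProb_unifI hs
  have := isProb_unifI hS
  have hM0 : 0 ≤ M := (abs_nonneg _).trans (hM y)
  have havg : ∀ x, avg S f x = ∫ r, f (u r • x) ∂unifI 0 S := fun x => by
    rw [integral_unifI hS, sub_zero]; rfl
  have hcont : Continuous fun p : ℝ × ℝ => f (u p.2 • gSL t • u p.1 • y) := by
    have := continuous_u
    have := f.continuous
    fun_prop
  have e : seg y s₁ s₂ (avg S f) t = ∫ r, seg y s₁ s₂ (fun x => f (u r • x)) t ∂unifI 0 S := by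
    unfold seg
    simp only [havg]
    exact integral_integral_swap (f := fun s r => f (u r • gSL t • u s • y))
      (Integrable.of_bound hcont.aestronglyMeasurable M (ae_of_all _ fun p => hM _))
  have hItg : Integrable (fun r => seg y s₁ s₂ (fun x => f (u r • x)) t) (unifI 0 S) := by
    have := (Integrable.of_bound (μ := (unifI 0 S).prod (unifI s₁ s₂))
      (f := fun p : ℝ × ℝ => f (u p.1 • gSL t • u p.2 • y))
      (hcont.comp continuous_swap).aestronglyMeasurable M (ae_of_all _ fun p => hM _))
    exact this.integral_prod_left
  have e2 : seg y s₁ s₂ (avg S f) t - seg y s₁ s₂ f t =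
      ∫ r, (seg y s₁ s₂ (fun x => f (u r • x)) t - seg y s₁ s₂ f t) ∂unifI 0 S := by
    rw [integral_sub hItg (integrable_const _), e]; simp
  have hbound : ∀ᵐ r ∂unifI 0 S, ‖seg y s₁ s₂ (fun x => f (u r • x)) t - seg y s₁ s₂ f t‖ ≤
      2 * M * (exp (-3 * t) * S) / (s₂ - s₁) := by
    filter_upwards [ae_unifI 0 S] with r hr
    refine (abs_seg_u_sub_le hs f.continuous hM r t).trans ?_
    have : 0 < s₂ - s₁ := by linarith
    rw [abs_mul, abs_exp, abs_of_nonneg hr.1]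
    gcongr
    exact hr.2
  rw [e2]
  simpa using norm_integral_le_of_norm_le_const hbound

/-- Distribution of `gSL t • u s • y` for `t` and `s` uniform in intervals. -/
def tavg (y : X) (s₁ s₂ T T' : ℝ) : Measure X :=
  Measure.map (fun p : ℝ × ℝ => gSL p.1 • u p.2 • y) ((unifI T T').prod (unifI s₁ s₂))

lemma isProb_tavg (hs : s₁ < s₂) {T T' : ℝ} (hT : T < T') :
    IsProbabilityMeasure (tavg y s₁ s₂ T T') := by
  have := isProb_unifI hs
  have := isProb_unifI hT
  exact Measure.isProbabilityMeasure_map (continuous_orb y).aemeasurable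

lemma integral_tavg (hs : s₁ < s₂) {T T' : ℝ} (hT : T < T') (hf : Continuous f)
    (hM : ∀ x, |f x| ≤ M) :
    ∫ x, f x ∂tavg y s₁ s₂ T T' = ∫ t, seg y s₁ s₂ f t ∂unifI T T' := by
  have := isProb_unifI hs
  have := isProb_unifI hT
  unfold tavg
  rw [integral_map (continuous_orb y).aemeasurable hf.aestronglyMeasurable]
  exact integral_prod (fun p : ℝ × ℝ => f (gSL p.1 • u p.2 • y)) (Integrable.of_bound
    (hf.comp (continuous_orb y)).aestronglyMeasurable M (ae_of_all _ fun p => hM _))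

end

lemma le_integral_unifI {f : ℝ → ℝ} (hf : Continuous f) {M c α β : ℝ} (hM : ∀ r, |f r| ≤ M)
    (h : α < β) (hc : ∀ r ∈ Icc α β, c ≤ f r) : c ≤ ∫ r, f r ∂unifI α β := by
  have := isProb_unifI h
  have h1 := integral_mono_ae (μ := unifI α β) (integrable_const c)
    (Integrable.of_bound hf.aestronglyMeasurable M (ae_of_all _ hM))
    ((ae_unifI α β).mono fun r hr => hc r hr)
  simpa using h1

lemma exists_compact_windows {g₀ : G} (hax : ∀ v ∈ Lam (g₀ • x₀), ¬ (v 0 = 0 ∧ v 2 = 0))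
    {s₁ s₂ : ℝ} (hs : s₁ < s₂) : ∃ T : ℕ → ℝ, (∀ N, N ≤ T N) ∧ ∀ η > 0, ∃ f : C(X, ℝ),
      HasCompactSupport f ∧ (∀ x, 0 ≤ f x) ∧ (∀ x, f x ≤ 1) ∧
        ∀ N, ∀ t ∈ Icc (T N) (T N + (N + 1)), 1 - η ≤ seg (g₀ • x₀) s₁ s₂ f t := by
  obtain ⟨σ, hσ, hw⟩ := exists_good_window hax
  choose T hT hgood using hw
  obtain ⟨ρ, hρ, hρ1, hreach⟩ := reach_of_not_bad g₀ hs hσ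
  refine ⟨T, hT, fun η hη => ?_⟩
  obtain ⟨ε, hε, hε1, hε2⟩ : ∃ ε : ℝ, 0 < ε ∧ ε ≤ ρ ∧ 1020 * (ε / ρ) ≤ η := by
    refine ⟨min ρ (η * ρ / 1020), by positivity, min_le_left _ _, ?_⟩
    rw [← mul_div_assoc, div_le_iff₀ hρ]
    linarith [min_le_right ρ (η * ρ / 1020)]
  obtain ⟨C₀, hC₀, hCgood⟩ := exists_compact_of_Fn hε
  obtain ⟨f, hf, hf1, hf0, hfle⟩ := exists_cutoff hC₀
  refine ⟨f, hf, hf0, hfle, fun N t ht => ?_⟩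
  have ht0 : 0 ≤ t := le_trans (by have := hT N; have : (0 : ℝ) ≤ N := by positivity
                                   linarith) ht.1
  obtain ⟨r1, r2⟩ := hreach t ht0 (hgood N t ht)
  have he := exp_pos (3 * t)
  have hlt : exp (3 * t) * s₁ < exp (3 * t) * s₂ := by gcongr
  have hL : 0 < s₂ - s₁ := by linarith
  have hnd := nondivergence (gSL t * g₀) hlt hρ hρ1 hε hε1 r1 r2
  have h1 := le_integral_of_bad (f := fun r => f (u r • (gSL t * g₀) • x₀))
    (f.continuous.comp (by have := continuous_u; fun_prop)) (fun r => hf0 _) (fun r => hfle _)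
    hlt.le (by rw [← mul_sub]; positivity) hnd (fun r hr hbad => hf1 _ (hCgood _ _ fun v hv => by
      by_contra hlt
      exact hbad ⟨hr, v, hv, not_le.1 hlt⟩))
  have e : ∀ s, f (gSL t • u s • g₀ • x₀) = f (u (exp (3 * t) * s) • (gSL t * g₀) • x₀) :=
    fun s => by rw [← mul_smul, gSL_u, mul_smul, mul_smul]
  unfold seg
  rw [integral_unifI hs]
  simp only [e]
  rw [intervalIntegral.integral_comp_mul_left (fun r => f (u r • (gSL t * g₀) • x₀)) he.ne',
    smul_eq_mul, ← mul_assoc, ← mul_inv, inv_mul_eq_div, le_div_iff₀ (by positivity)]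
  refine le_trans ?_ h1
  rw [← mul_sub]
  nlinarith [mul_pos hL he]

lemma tendsto_zero_of_le_exp {a : ℕ → ℝ} {C : ℝ}
    (h : ∀ N : ℕ, |a N| ≤ C * (1 / ((N : ℝ) + 1))) : Tendsto a atTop (𝓝 0) := by
  have h1 := (tendsto_one_div_add_atTop_nhds_zero_nat (𝕜 := ℝ)).const_mul C
  rw [mul_zero] at h1
  exact squeeze_zero_norm h h1

lemma exp_le_one_div {N : ℕ} {t : ℝ} (h : N ≤ t) : exp (-3 * t) ≤ 1 / ((N : ℝ) + 1) := by
  have h0 : (0 : ℝ) ≤ N := by positivity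
  rw [le_div_iff₀ (by positivity), neg_mul, Real.exp_neg, inv_mul_le_iff₀ (exp_pos _), mul_one]
  linarith [Real.add_one_le_exp (3 * t)]

/-- Weak limits of the time averages are the homogeneous measure. -/
lemma exists_ultrafilter
    {g₀ : G} (hax : ∀ v ∈ Lam (g₀ • x₀), ¬ (v 0 = 0 ∧ v 2 = 0)) {s₁ s₂ : ℝ} (hs : s₁ < s₂) :
    ∃ T : ℕ → ℝ, (∀ N, N ≤ T N) ∧ ∃ U : Ultrafilter ℕ, (U : Filter ℕ) ≤ atTop ∧
      ∀ f : BoundedContinuousFunction X ℝ, Tendsto (fun N : ℕ =>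
        ∫ t, seg (g₀ • x₀) s₁ s₂ f t ∂unifI (T N) (T N + (N + 1))) U (𝓝 (∫ x, f x ∂μ)) := by
  obtain ⟨T, hT, hcomp⟩ := exists_compact_windows hax hs
  refine ⟨T, hT, ?_⟩
  have hTT : ∀ N : ℕ, T N < T N + (N + 1) := fun N => lt_add_of_pos_right _ (by positivity)
  have hprob : ∀ N : ℕ, IsProbabilityMeasure (tavg (g₀ • x₀) s₁ s₂ (T N) (T N + (N + 1))) :=
    fun N => isProb_tavg hs (hTT N)
  let P : ℕ → ProbabilityMeasure X := fun N => ⟨tavg (g₀ • x₀) s₁ s₂ (T N) (T N + (N + 1)), hprob N⟩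
  have htight : IsTightMeasureSet {x : Measure X | ∃ ν ∈ Set.range P, (ν : Measure X) = x} := by
    rw [isTightMeasureSet_iff_exists_isCompact_measure_compl_le]
    intro ε hε
    obtain ⟨η, hη, hηε⟩ : ∃ η : ℝ, 0 < η ∧ ofReal η ≤ ε := by
      rcases eq_or_ne ε ∞ with rfl | hne
      · exact ⟨1, one_pos, le_top⟩
      · exact ⟨ε.toReal, toReal_pos hε.ne' hne, (ofReal_toReal hne).le⟩
    obtain ⟨f, hf, hf0, hf1, hseg⟩ := hcomp η hη
    refine ⟨tsupport f, hf, ?_⟩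
    rintro _ ⟨_, ⟨N, rfl⟩, rfl⟩
    have habs : ∀ x, |f x| ≤ 1 := fun x => abs_le.2 ⟨by linarith [hf0 x], hf1 x⟩
    have := real_compl_tsupport_le (ν := tavg (g₀ • x₀) s₁ s₂ (T N) (T N + (N + 1))) hf hf1 (by
      rw [integral_tavg hs (hTT N) f.continuous habs]
      exact le_integral_unifI (continuous_seg hs f.continuous) (abs_seg_le hs habs) (hTT N) (hseg N))
    refine le_trans ?_ hηε
    change tavg (g₀ • x₀) s₁ s₂ (T N) (T N + (N + 1)) _ ≤ _
    rw [← ofReal_toReal (measure_ne_top (tavg (g₀ • x₀) s₁ s₂ (T N) (T N + (N + 1))) _)]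
    exact ofReal_le_ofReal this
  obtain ⟨ν, -, hν⟩ := (isCompact_closure_of_isTightMeasureSet htight).exists_mapClusterPt
    (f := atTop) (u := P) (le_principal_iff.2 (Eventually.of_forall (f := atTop) fun N =>
      subset_closure ⟨N, rfl⟩))
  obtain ⟨U, hU, hlim⟩ := mapClusterPt_iff_ultrafilter.1 hν
  rw [ProbabilityMeasure.tendsto_iff_forall_integral_tendsto] at hlim
  have hlim' : ∀ f : BoundedContinuousFunction X ℝ, Tendsto (fun N : ℕ =>
      ∫ t, seg (g₀ • x₀) s₁ s₂ f t ∂unifI (T N) (T N + (N + 1))) U (𝓝 (∫ x, f x ∂(ν : Measure X))) := by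
    intro f
    refine (hlim f).congr fun N => ?_
    exact integral_tavg hs (hTT N) f.continuous (fun x => f.norm_coe_le_norm x)
  have hinv : ∀ {h : G}, (∀ f : C(X, ℝ), HasCompactSupport f → ∀ M, (∀ x, |f x| ≤ M) → ∃ C : ℝ, ∀ N : ℕ,
      |(∫ t, seg (g₀ • x₀) s₁ s₂ (fun x => f (h • x)) t ∂unifI (T N) (T N + (N + 1))) -
        ∫ t, seg (g₀ • x₀) s₁ s₂ f t ∂unifI (T N) (T N + (N + 1))| ≤ C * (1 / ((N : ℝ) + 1))) →
      MInv (ν : Measure X) h := by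
    intro h hC
    refine MInv.of_integral fun f hf => ?_
    obtain ⟨M, -, hM⟩ := exists_bound hf
    obtain ⟨C, hC⟩ := hC f hf M hM
    have l1 := hlim' (BoundedContinuousFunction.ofNormedAddCommGroup (fun x => f (h • x))
      (tr h f).continuous M fun x => hM _)
    have l2 := hlim' (BoundedContinuousFunction.ofNormedAddCommGroup f f.continuous M hM)
    have l3 := (tendsto_zero_of_le_exp hC).mono_left hU
    exact sub_eq_zero.1 (tendsto_nhds_unique (l1.sub l2) l3)
  have hA : ∀ r, MInv (ν : Measure X) (gSL r) := by
    refine fun r => hinv fun f hf M hM => ⟨2 * M * |r|, fun N => ?_⟩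
    have e : seg (g₀ • x₀) s₁ s₂ (fun x => f (gSL r • x)) =
        fun t => seg (g₀ • x₀) s₁ s₂ f (t + r) := by
      ext t
      simp only [seg, ← mul_smul (gSL r), ← gSL_add, add_comm t r]
    rw [e]
    refine (abs_shift_le (continuous_seg hs f.continuous) (abs_seg_le hs hM) (hTT N) r).trans_eq ?_
    rw [add_sub_cancel_left, mul_one_div]
  have hu : ∀ r, MInv (ν : Measure X) (u r) := by
    refine fun r => hinv fun f hf M hM => ⟨2 * M * |r| / (s₂ - s₁), fun N => ?_⟩
    have := isProb_unifI (hTT N)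
    have hM0 : 0 ≤ M := (abs_nonneg _).trans (hM x₀)
    have hL : 0 < s₂ - s₁ := by linarith
    have hi : ∀ f' : C(X, ℝ), (∀ x, |f' x| ≤ M) → Integrable (seg (g₀ • x₀) s₁ s₂ f')
        (unifI (T N) (T N + (N + 1))) := fun f' hM' =>
      Integrable.of_bound (continuous_seg hs f'.continuous).aestronglyMeasurable M
        (ae_of_all _ (abs_seg_le hs hM'))
    change |(∫ t, seg (g₀ • x₀) s₁ s₂ (tr (u r) f) t ∂_) - _| ≤ _
    rw [← integral_sub (hi (tr (u r) f) fun x => hM _) (hi f hM), ← norm_eq_abs]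
    have hb : ∀ᵐ t ∂unifI (T N) (T N + (N + 1)), ‖seg (g₀ • x₀) s₁ s₂ (tr (u r) f) t -
        seg (g₀ • x₀) s₁ s₂ f t‖ ≤ 2 * M * |r| / (s₂ - s₁) * (1 / ((N : ℝ) + 1)) := by
      filter_upwards [ae_unifI (T N) (T N + (N + 1))] with t ht
      refine (abs_seg_u_sub_le hs f.continuous hM r t).trans ?_
      rw [abs_mul, abs_exp]
      calc 2 * M * (exp (-3 * t) * |r|) / (s₂ - s₁)
          = 2 * M * |r| / (s₂ - s₁) * exp (-3 * t) := by ring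
        _ ≤ _ := by gcongr; exact exp_le_one_div ((hT N).trans ht.1)
    simpa using norm_integral_le_of_norm_le_const hb
  have hνμ : (ν : Measure X) = μ := eq_haar_of_inv hA hu
  exact ⟨U, hU, fun f => hνμ ▸ hlim' f⟩

/-! ### Equidistribution along a sequence of times -/

lemma ae_Lm_eq (hu : ∀ s, MInv μ (u s)) {f : C(X, ℝ)} (hf : HasCompactSupport f) :
    ∀ᵐ x ∂μ, Lm f x = ∫ x, f x ∂μ := by
  obtain ⟨M, hM0, hM⟩ := exists_bound hf
  have hG := ae_mem_Gen hu
  have e : Gen.indicator (Lm f) =ᵐ[μ] Lm f := by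
    filter_upwards [hG] with x hx using indicator_of_mem hx _
  obtain ⟨c, hc⟩ := ae_const_of_u_inv (μ := μ) (f := Gen.indicator (Lm f))
    ((measurable_Lm f).indicator measurableSet_Gen) (M := M) (fun x => by
      by_cases hx : x ∈ Gen
      · rw [indicator_of_mem hx]; exact abs_Lm_le hx hf hM
      · rw [Set.indicator_of_notMem hx, abs_zero]; exact hM0.le) (fun s => by
      filter_upwards [hG] with x hx
      rw [indicator_of_mem hx, indicator_of_mem ((nrm_u s).mem_Gen hx), Lm_u hx hf])
  have hc' := e.symm.trans hc
  have h1 := integral_Lm hu hf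
  rw [integral_congr_ae hc'] at h1
  simp only [integral_const, probReal_univ, one_smul] at h1
  rw [← h1]
  exact hc'

lemma tendsto_integral_abs_avg (hu : ∀ s, MInv μ (u s)) {f : C(X, ℝ)} (hf : HasCompactSupport f) :
    Tendsto (fun n : ℕ => ∫ x, |avg n f x - ∫ x, f x ∂μ| ∂μ) atTop (𝓝 0) := by
  obtain ⟨M, hM0, hM⟩ := exists_bound hf
  have := tendsto_integral_of_dominated_convergence (μ := μ)
    (F := fun (n : ℕ) x => |avg n f x - ∫ x, f x ∂μ|) (f := fun _ => 0)
    (fun _ => M + |∫ x, f x ∂μ|)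
    (fun n => ((continuous_avg n f).sub continuous_const).abs.aestronglyMeasurable)
    (integrable_const _) (fun n => ae_of_all _ fun x => by
      rw [norm_eq_abs, abs_abs]
      exact (abs_sub _ _).trans (by linarith [abs_avg_le hM n x])) (by
      filter_upwards [ae_mem_Gen hu, ae_Lm_eq hu hf] with x hx hL
      have h1 := ((tendsto_avg hx hf).comp tendsto_natCast_atTop_atTop).sub_const (∫ x, f x ∂μ)
      rw [hL, sub_self] at h1
      simpa using h1.abs)
  simpa using this

lemma exists_time
    (hu : ∀ s, MInv μ (u s)) {g₀ : G} (hax : ∀ v ∈ Lam (g₀ • x₀), ¬ (v 0 = 0 ∧ v 2 = 0))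
    {s₁ s₂ : ℝ} (hs : s₁ < s₂) (i : ℕ) {δ : ℝ} (hδ : 0 < δ) (t₀ : ℝ) :
    ∃ t, t₀ ≤ t ∧ ∀ k ∈ Finset.range i,
      |seg (g₀ • x₀) s₁ s₂ (tst k) t - ∫ x, tst k x ∂μ| < δ := by
  obtain ⟨T, hT, U, hU, hlim⟩ := exists_ultrafilter (μ := μ) hax hs
  choose M hM0 hM using fun k => exists_bound (hasCompactSupport_tst k)
  have hS := (tendsto_finsetSum (Finset.range i) fun k _ =>
    tendsto_integral_abs_avg (μ := μ) hu (hasCompactSupport_tst k))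
  simp only [Finset.sum_const_zero] at hS
  obtain ⟨n, hn, hn0⟩ := ((hS.eventually_lt_const (half_pos hδ)).and (eventually_gt_atTop 0)).exists
  have hn0' : (0 : ℝ) < n := by exact_mod_cast hn0
  let Φ : X → ℝ := fun x => ∑ k ∈ Finset.range i, |avg n (tst k) x - ∫ x, tst k x ∂μ|
  have hΦk : ∀ k x, |avg n (tst k) x - ∫ x, tst k x ∂μ| ≤ M k + |∫ x, tst k x ∂μ| := fun k x =>
    (abs_sub _ _).trans (by linarith [abs_avg_le (hM k) n x])
  have hΦc : Continuous Φ := continuous_finsetSum _ fun k _ =>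
    ((continuous_avg n (tst k)).sub continuous_const).abs
  have hΦb : ∀ x, |Φ x| ≤ ∑ k ∈ Finset.range i, (M k + |∫ x, tst k x ∂μ|) := fun x => by
    rw [abs_of_nonneg (Finset.sum_nonneg fun k _ => abs_nonneg _)]
    exact Finset.sum_le_sum fun k _ => hΦk k x
  have hΦμ : ∫ x, Φ x ∂μ < δ / 2 := by
    rw [integral_finsetSum _ fun k _ => ?_]
    · exact hn
    · exact Integrable.of_bound ((continuous_avg n (tst k)).sub
        continuous_const).abs.aestronglyMeasurable _ (ae_of_all _ fun x => by
          rw [norm_eq_abs, abs_abs]; exact hΦk k x)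
  have hL : 0 < s₂ - s₁ := by linarith
  have herr : ∀ᶠ t : ℝ in atTop, ∀ k ∈ Finset.range i,
      2 * M k * (exp (-3 * t) * n) / (s₂ - s₁) < δ / 2 := by
    rw [eventually_all_finset]
    intro k _
    have h1 : Tendsto (fun t : ℝ => exp (-3 * t)) atTop (𝓝 0) :=
      Real.tendsto_exp_atBot.comp (tendsto_id.const_mul_atTop_of_neg (by norm_num))
    have h2 := (((h1.mul_const (n : ℝ)).const_mul (2 * M k)).div_const (s₂ - s₁))
    rw [zero_mul, mul_zero, zero_div] at h2
    exact h2.eventually_lt_const (half_pos hδ)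
  obtain ⟨t₁, ht₁⟩ := eventually_atTop.1 herr
  have hl := hlim (BoundedContinuousFunction.ofNormedAddCommGroup Φ hΦc _ hΦb)
  have hat : Tendsto (fun N : ℕ => (N : ℝ)) U atTop := tendsto_natCast_atTop_atTop.mono_left hU
  obtain ⟨N, hNΦ, hN0, hN1⟩ := ((hl.eventually_lt_const hΦμ).and
    ((hat.eventually_ge_atTop t₀).and (hat.eventually_ge_atTop t₁))).exists
  have hTT : T N < T N + (N + 1) := lt_add_of_pos_right _ (by positivity)
  obtain ⟨t, ht, hlt⟩ : ∃ t ∈ Icc (T N) (T N + (N + 1)), seg (g₀ • x₀) s₁ s₂ Φ t < δ / 2 := by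
    by_contra! hcon
    exact absurd (le_integral_unifI (continuous_seg hs hΦc) (abs_seg_le hs hΦb) hTT hcon)
      (not_le.2 hNΦ)
  refine ⟨t, (hN0.trans (hT N)).trans ht.1, fun k hk => ?_⟩
  have := isProb_unifI hs
  have h1 := abs_seg_avg_sub_le (y := g₀ • x₀) hs (tst k) (hM k) hn0' t
  have h2 := ht₁ t ((hN1.trans (hT N)).trans ht.1) k hk
  have h3 : |seg (g₀ • x₀) s₁ s₂ (avg n (tst k)) t - ∫ x, tst k x ∂μ| ≤ seg (g₀ • x₀) s₁ s₂ Φ t := by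
    have hi := integrable_seg (y := g₀ • x₀) hs (continuous_avg n (tst k)) (abs_avg_le (hM k) n) t
    have e : seg (g₀ • x₀) s₁ s₂ (avg n (tst k)) t - ∫ x, tst k x ∂μ =
        ∫ s, (avg n (tst k) (gSL t • u s • g₀ • x₀) - ∫ x, tst k x ∂μ) ∂unifI s₁ s₂ := by
      rw [integral_sub hi (integrable_const _)]; simp [seg]
    rw [e]
    refine (abs_integral_le_integral_abs).trans (integral_mono (hi.sub (integrable_const _)).abs
      (integrable_seg hs hΦc hΦb t) fun s => ?_)
    exact Finset.single_le_sum (f := fun k => |avg n (tst k) (gSL t • u s • g₀ • x₀) -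
      ∫ x, tst k x ∂μ|) (fun k _ => abs_nonneg _) hk
  calc _ = |(seg (g₀ • x₀) s₁ s₂ (avg n (tst k)) t - ∫ x, tst k x ∂μ) -
        (seg (g₀ • x₀) s₁ s₂ (avg n (tst k)) t - seg (g₀ • x₀) s₁ s₂ (tst k) t)| := by ring_nf
    _ ≤ _ := abs_sub _ _
    _ < δ := by linarith

lemma exists_times
    (hu : ∀ s, MInv μ (u s)) {g₀ : G} (hax : ∀ v ∈ Lam (g₀ • x₀), ¬ (v 0 = 0 ∧ v 2 = 0))
    {s₁ s₂ : ℝ} (hs : s₁ < s₂) : ∃ t : ℕ → ℝ, Tendsto t atTop atTop ∧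
      ∀ f : C(X, ℝ), HasCompactSupport f →
        Tendsto (fun i => seg (g₀ • x₀) s₁ s₂ f (t i)) atTop (𝓝 (∫ x, f x ∂μ)) := by
  have := isProb_unifI hs
  choose t ht hk using fun i : ℕ => exists_time (μ := μ) hu hax hs i
    (δ := 1 / ((i : ℝ) + 1)) (by positivity) i
  refine ⟨t, tendsto_atTop_mono ht tendsto_natCast_atTop_atTop, fun f hf => ?_⟩
  rw [Metric.tendsto_atTop]
  intro ε hε
  obtain ⟨k, hkf⟩ := tst_dense hf (ε := ε / 4) (by positivity)
  obtain ⟨M, -, hM⟩ := exists_bound hf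
  obtain ⟨M', -, hM'⟩ := exists_bound (hasCompactSupport_tst k)
  obtain ⟨n, hn⟩ := exists_nat_one_div_lt (show 0 < ε / 4 by positivity)
  refine ⟨max n (k + 1), fun i hi => ?_⟩
  have h1 := hk i k (Finset.mem_range.2 (by have := le_max_right n (k + 1); omega))
  have h2 : 1 / ((i : ℝ) + 1) ≤ 1 / ((n : ℝ) + 1) := by
    have : (n : ℝ) ≤ i := by exact_mod_cast (le_max_left _ _).trans hi
    gcongr
  have h3 : |seg (g₀ • x₀) s₁ s₂ f (t i) - seg (g₀ • x₀) s₁ s₂ (tst k) (t i)| ≤ ε / 4 := by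
    unfold seg
    rw [← integral_sub (integrable_seg hs f.continuous hM _)
      (integrable_seg hs (tst k).continuous hM' _), ← norm_eq_abs]
    simpa using norm_integral_le_of_norm_le_const (μ := unifI s₁ s₂) (C := ε / 4)
      (f := fun s => f (gSL (t i) • u s • g₀ • x₀) - tst k (gSL (t i) • u s • g₀ • x₀))
      (ae_of_all _ fun s => hkf _)
  have h4 : |(∫ x, f x ∂μ) - ∫ x, tst k x ∂μ| ≤ ε / 4 := by
    rw [← integral_sub (f.continuous.integrable_of_hasCompactSupport hf)
      ((tst k).continuous.integrable_of_hasCompactSupport (hasCompactSupport_tst k)),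
      ← norm_eq_abs]
    simpa using norm_integral_le_of_norm_le_const (μ := μ) (C := ε / 4)
      (f := fun x => f x - tst k x) (ae_of_all _ hkf)
  rw [dist_eq]
  have a1 := abs_lt.1 h1
  have a3 := abs_le.1 h3
  have a4 := abs_le.1 h4
  rw [abs_lt]
  constructor <;> linarith [a1.1, a1.2, a3.1, a3.2, a4.1, a4.2]

/-! ### The segment `φ_{a,b}` -/

/-- Conjugates `φ_{a,b}` into the group `u`. -/
def kap (a : ℝ) : G := ⟨!![1, 0, 0; 0, 0, -1; 0, 1, a], by simp [det_fin_three]⟩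

/-- Base point of the conjugated segment. -/
def bp (a b : ℝ) : G := e12 (-b) * kap a

lemma kap_mul_phiSL (a b s : ℝ) : kap a * phiSL a b s = u s * bp a b := by
  refine G_ext fun i j => ?_
  unfold bp
  fin_cases i <;> fin_cases j <;> simp only [G_mul_apply] <;> (simp [kap, phiSL, u, e12]; try ring)

lemma kap_gSL (a t : ℝ) : kap a * gSL t = gSL t * kap a := by
  refine G_ext fun i j => ?_
  fin_cases i <;> fin_cases j <;> simp only [G_mul_apply] <;> simp [kap, gSL] <;> ring

lemma gSL_phiSL (a b s t : ℝ) :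
    gSL t • phiSL a b s • x₀ = (kap a)⁻¹ • gSL t • u s • bp a b • x₀ := by
  rw [eq_inv_smul_iff]
  simp only [← mul_smul]
  rw [← mul_assoc, kap_gSL, mul_assoc, kap_mul_phiSL]

lemma axis_iff (a b : ℝ) : (∃ v ∈ Lam (bp a b • x₀), v 0 = 0 ∧ v 2 = 0) ↔
    ∃ p q : ℚ, a = (p : ℝ) ∧ b = (q : ℝ) := by
  have hmul : ∀ z : Fin 3 → ℤ, ((bp a b : G) : M₃) *ᵥ (fun i => (z i : ℝ)) =
      ![z 0 + b * z 2, -z 2, z 1 + a * z 2] := by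
    intro z
    ext i
    rw [G_mulVec]
    fin_cases i <;> simp only [bp, G_mul_apply] <;> simp [kap, e12]
  constructor
  · rintro ⟨v, hv, h0, h2⟩
    obtain ⟨z, hz, rfl⟩ := (mem_Lam_iff _ _).1 hv
    rw [hmul] at h0 h2
    simp only [cons_val_zero, cons_val] at h0 h2
    have hz2 : z 2 ≠ 0 := by
      intro h
      simp only [h, Int.cast_zero, mul_zero, add_zero, Int.cast_eq_zero] at h0 h2
      refine hz ?_
      ext i
      fin_cases i
      exacts [h0, h2, h]
    have hz2' : (z 2 : ℝ) ≠ 0 := by exact_mod_cast hz2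
    refine ⟨-z 1 / z 2, -z 0 / z 2, ?_, ?_⟩
    · push_cast; rw [eq_div_iff hz2']; linarith
    · push_cast; rw [eq_div_iff hz2']; linarith
  · rintro ⟨p, q, rfl, rfl⟩
    refine ⟨_, (mem_Lam_iff _ _).2 ⟨![-(q.num * p.den), -(p.num * q.den), p.den * q.den],
      fun h => ?_, rfl⟩, ?_, ?_⟩
    · have := congrFun h 2
      simp at this
    · rw [hmul]
      have hq : (q : ℝ) * q.den = q.num := by exact_mod_cast Rat.mul_den_eq_num q
      simp
      linear_combination (p.den : ℝ) * hq
    · rw [hmul]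
      have hp : (p : ℝ) * p.den = p.num := by exact_mod_cast Rat.mul_den_eq_num p
      simp
      linear_combination (q.den : ℝ) * hp

lemma integral_gtLambda (a b s₁ s₂ t : ℝ) (f : C(X, ℝ)) :
    ∫ x, f x ∂gtLambda a b s₁ s₂ t = seg (bp a b • x₀) s₁ s₂ (tr (kap a)⁻¹ f) t := by
  have hphi : Continuous fun s => phiSL a b s • x₀ := by
    have : (fun s => phiSL a b s • x₀) = fun s => (kap a)⁻¹ • u s • bp a b • x₀ := by
      ext s
      rw [eq_inv_smul_iff, ← mul_smul, ← mul_smul, kap_mul_phiSL]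
    rw [this]
    have := continuous_u
    fun_prop
  unfold gtLambda lambdaAB
  rw [integral_map (measurable_smulX _).aemeasurable f.continuous.aestronglyMeasurable,
    integral_map (f := fun x => f (gSL t • x)) hphi.aemeasurable (tr (gSL t) f).continuous.aestronglyMeasurable]
  exact integral_congr_ae (ae_of_all _ fun s => congrArg f (gSL_phiSL a b s t))

/-- In the rational case the whole segment leaves every compact set. -/
lemma escape {a b : ℝ} (h : ∃ p q : ℚ, a = (p : ℝ) ∧ b = (q : ℝ)) {K : Set X} (hK : IsCompact K) :
    ∃ T : ℝ, ∀ t, T ≤ t → ∀ s, gSL t • phiSL a b s • x₀ ∉ K := by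
  obtain ⟨v, hv, h0, h2⟩ := (axis_iff a b).2 h
  obtain ⟨ε, hε, hlow⟩ := exists_lower_bound (K := (fun x => kap a • x) '' K)
    (hK.image (continuous_const_smul _))
  have h1 : Tendsto (fun t : ℝ => exp (-t) * |v 1|) atTop (𝓝 (0 * |v 1|)) :=
    tendsto_exp_neg_atTop_nhds_zero.mul_const _
  rw [zero_mul] at h1
  obtain ⟨T, hT⟩ := eventually_atTop.1 (h1.eventually_lt_const hε)
  refine ⟨T, fun t ht s hmem => ?_⟩
  rw [gSL_phiSL] at hmem
  obtain ⟨i, hi⟩ := hlow _ ⟨_, hmem, smul_inv_smul _ _⟩ _ (Lam_smul (gSL t) (Lam_smul (u s) hv))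
  have hlt := hT t ht
  rw [gSL_mulVec, u_mulVec] at hi
  fin_cases i <;> simp [h0, h2, abs_mul] at hi <;> linarith

lemma exists_test_pos
    {B : Set X} (hB : IsOpen B) (hne : B.Nonempty) : ∃ f : C(X, ℝ), HasCompactSupport f ∧
      (∀ x, 0 ≤ f x) ∧ (∀ x, f x ≤ 1) ∧ (∀ x ∉ B, f x = 0) ∧ 0 < ∫ x, f x ∂μ := by
  obtain ⟨x, hx⟩ := hne
  obtain ⟨f, h1, h0, hc, h01⟩ := exists_continuous_one_zero_of_isCompact (isCompact_singleton (x := x))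
    hB.isClosed_compl (Set.disjoint_singleton_left.2 fun h => h hx)
  refine ⟨f, hc, fun y => (h01 y).1, fun y => (h01 y).2, fun y hy => h0 hy, ?_⟩
  rw [integral_pos_iff_support_of_nonneg (fun y => (h01 y).1)
    (f.continuous.integrable_of_hasCompactSupport hc)]
  exact isOpen_pos_measure f.continuous.isOpen_support ⟨x, by simp [h1 rfl]⟩

lemma exists_times_gtLambda
    (hinv : ∀ g : G, MInv μ g) {a b : ℝ} (h : ¬ ∃ p q : ℚ, a = (p : ℝ) ∧ b = (q : ℝ)) {s₁ s₂ : ℝ}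
    (hs : s₁ < s₂) : ∃ t : ℕ → ℝ, Tendsto t atTop atTop ∧ ∀ f : C(X, ℝ), HasCompactSupport f →
      Tendsto (fun i => ∫ x, f x ∂(gtLambda a b s₁ s₂ (t i))) atTop (𝓝 (∫ x, f x ∂μ)) := by
  rw [← axis_iff] at h
  push Not at h
  obtain ⟨t, ht, hlim⟩ := exists_times (μ := μ) (fun s => hinv _) (fun v hv ⟨h0, h2⟩ => h v hv h0 h2) hs
  refine ⟨t, ht, fun f hf => ?_⟩
  have h1 := hlim _ (hasCompactSupport_tr hf (kap a)⁻¹)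
  simp only [integral_gtLambda]
  rwa [show ∫ x, tr (kap a)⁻¹ f x ∂μ = ∫ x, f x ∂μ from (hinv (kap a)⁻¹).integral f] at h1

lemma ae_dense (hinv : ∀ g : G, MInv μ g) {a b : ℝ} (h : ¬ ∃ p q : ℚ, a = (p : ℝ) ∧ b = (q : ℝ)) :
    ∀ᵐ s, Dense {y : X | ∃ t : ℝ, 0 ≤ t ∧ y = gSL t • phiSL a b s • x₀} := by
  have hB := TopologicalSpace.isBasis_countableBasis X
  simp only [hB.dense_iff]
  rw [ae_ball_iff (TopologicalSpace.countable_countableBasis X)]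
  intro B hBm
  have hBo := hB.isOpen hBm
  by_cases hne : B.Nonempty
  swap
  · exact ae_of_all _ fun s h => absurd h hne
  let D : Set ℝ := {s | ∀ t, 0 ≤ t → gSL t • phiSL a b s • x₀ ∉ B}
  suffices hD : volume D = 0 by
    filter_upwards [measure_eq_zero_iff_ae_notMem.1 hD] with s hs _
    simp only [D, Set.mem_ofPred_eq] at hs
    push Not at hs
    obtain ⟨t, ht, hm⟩ := hs
    exact ⟨_, hm, t, ht, rfl⟩
  have hDm : MeasurableSet D := by
    have : D = ⋂ (t : ℝ) (_ : 0 ≤ t), {s | gSL t • phiSL a b s • x₀ ∈ Bᶜ} := by ext s; simp [D]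
    rw [this]
    refine (isClosed_iInter fun t => isClosed_iInter fun _ => hBo.isClosed_compl.preimage ?_).measurableSet
    simp only [gSL_phiSL]
    have := continuous_u
    fun_prop
  by_contra h0
  obtain ⟨f, hf, hf0, hf1, hfB, hpos⟩ := exists_test_pos (μ := μ) hBo hne
  have hnb : (ae (volume.restrict D)).NeBot := ae_neBot.2 (by rwa [Ne, Measure.restrict_eq_zero])
  obtain ⟨x, hx⟩ := (Besicovitch.ae_tendsto_measure_inter_div volume D).exists
  obtain ⟨c, hc⟩ : ∃ c, c = ∫ x, f x ∂μ := ⟨_, rfl⟩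
  rw [← hc] at hpos
  obtain ⟨r, hr, hr0⟩ := ((hx.eventually_const_lt (show ofReal (1 - c / 2) < 1 by
    rw [← ofReal_one, ofReal_lt_ofReal_iff one_pos]; linarith)).and self_mem_nhdsWithin).exists
  have hr0 : 0 < r := hr0
  have hJ : x - r < x + r := by linarith
  have hprob := isProb_unifI hJ
  have hDr : 1 - c / 2 ≤ (unifI (x - r) (x + r)).real D := by
    rw [measureReal_def, unifI, ProbabilityTheory.cond_apply measurableSet_Icc, Set.inter_comm,
      mul_comm, ← div_eq_mul_inv, ← closedBall_eq_Icc]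
    refine (ofReal_le_iff_le_toReal (ne_of_lt ?_)).1 hr.le
    refine (div_le_of_le_mul ?_ : _ ≤ (1 : ℝ≥0∞)).trans_lt one_lt_top
    rw [one_mul]
    exact measure_mono Set.inter_subset_right
  obtain ⟨t, ht, hlim⟩ := exists_times_gtLambda hinv h hJ
  have hlt := (hlim f hf).eventually_const_lt (show c / 2 < ∫ x, f x ∂μ by rw [← hc]; linarith)
  obtain ⟨i, hi, hti⟩ := (hlt.and (ht.eventually_ge_atTop 0)).exists
  refine absurd hi (not_lt.2 ?_)
  rw [integral_gtLambda]
  have h2 : seg (bp a b • x₀) (x - r) (x + r) (tr (kap a)⁻¹ f) (t i) ≤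
      (unifI (x - r) (x + r)).real Dᶜ := by
    rw [← integral_indicator_one hDm.compl]
    refine integral_mono (integrable_seg hJ (tr (kap a)⁻¹ f).continuous (M := 1) (fun y =>
      abs_le.2 ⟨neg_one_lt_zero.le.trans (hf0 ((kap a)⁻¹ • y)), hf1 ((kap a)⁻¹ • y)⟩) _)
      ((integrable_const (1 : ℝ)).indicator hDm.compl) fun s => ?_
    change f ((kap a)⁻¹ • gSL (t i) • u s • bp a b • x₀) ≤ _
    rw [← gSL_phiSL]
    by_cases hs : s ∈ D
    · simp [hs, hfB _ (hs (t i) hti)]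
    · simpa [hs] using hf1 _
  rw [probReal_compl_eq_one_sub hDm] at h2
  linarith

lemma not_dense_of_rational
    (hinv : ∀ g : G, MInv μ g) {a b : ℝ} (h : ∃ p q : ℚ, a = (p : ℝ) ∧ b = (q : ℝ)) (s : ℝ) :
    ¬ Dense {y : X | ∃ t : ℝ, 0 ≤ t ∧ y = gSL t • phiSL a b s • x₀} := by
  intro hd
  obtain ⟨K, hK, hKx⟩ := exists_compact_mem_nhds x₀
  obtain ⟨T, hT⟩ := escape h hK
  have hsub : interior K ⊆ (fun t => gSL t • phiSL a b s • x₀) '' Icc 0 T := by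
    have hcl : IsClosed ((fun t => gSL t • phiSL a b s • x₀) '' Icc 0 T) :=
      (isCompact_Icc.image (by have := continuous_gSL; fun_prop)).isClosed
    refine (hd.open_subset_closure_inter isOpen_interior).trans (closure_minimal ?_ hcl)
    rintro _ ⟨hy, t, ht, rfl⟩
    refine ⟨t, ⟨ht, ?_⟩, rfl⟩
    by_contra hlt
    exact hT t (not_le.1 hlt).le s (interior_subset hy)
  have hpos := isOpen_pos_measure (μ := μ) isOpen_interior ⟨x₀, mem_interior_iff_mem_nhds.2 hKx⟩
  obtain ⟨x, hx, hrec⟩ := ((frequently_ae_mem_iff.2 hpos.ne').and_eventually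
    ((hinv (gSL 1)).recurrence isOpen_interior.measurableSet)).exists
  obtain ⟨n, hn, hnT⟩ := ((hrec hx).and_eventually
    ((tendsto_natCast_atTop_atTop (R := ℝ)).eventually_ge_atTop T)).exists
  obtain ⟨t, ht, rfl⟩ := hsub hx
  rw [gSL_pow, ← mul_smul, ← gSL_add] at hn
  exact hT _ (by linarith [ht.1]) s (interior_subset hn)

lemma not_tendsto_of_rational
    {a b : ℝ} (h : ∃ p q : ℚ, a = (p : ℝ) ∧ b = (q : ℝ)) (s₁ s₂ : ℝ) {t : ℕ → ℝ}
    (ht : Tendsto t atTop atTop) (hlim : ∀ f : C(X, ℝ), HasCompactSupport f →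
      Tendsto (fun i => ∫ x, f x ∂(gtLambda a b s₁ s₂ (t i))) atTop (𝓝 (∫ x, f x ∂μ))) : False := by
  obtain ⟨f, hf, -, -, -, hpos⟩ := exists_test_pos (μ := μ) isOpen_univ ⟨x₀, trivial⟩
  obtain ⟨T, hT⟩ := escape h hf
  obtain ⟨i, hi, hti⟩ := (((hlim f hf).eventually_const_lt hpos).and (ht.eventually_ge_atTop T)).exists
  refine absurd hi (not_lt.2 (le_of_eq ?_))
  rw [integral_gtLambda]
  refine integral_eq_zero_of_ae (ae_of_all _ fun s => ?_)
  change f ((kap a)⁻¹ • gSL (t i) • u s • bp a b • x₀) = 0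
  rw [← gSL_phiSL]
  exact image_eq_zero_of_notMem_tsupport (hT _ hti s)

end

theorem equidistribution_along_sequence_tfae (a b s₁ s₂ : ℝ) (h : s₁ < s₂)
    (μX : Measure X) [IsProbabilityMeasure μX]
    (hinv : ∀ g : G, Measure.map (fun x => g • x) μX = μX) :
    List.TFAE
      [ (∃ t : ℕ → ℝ, Tendsto t atTop atTop ∧
          ∀ f : C(X, ℝ), HasCompactSupport f →
            Tendsto (fun i => ∫ x, f x ∂(gtLambda a b s₁ s₂ (t i))) atTop
              (𝓝 (∫ x, f x ∂μX))),
        (∀ᵐ s ∂(volume.restrict (Set.Icc s₁ s₂)),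
          Dense {y : X | ∃ t : ℝ, 0 ≤ t ∧ y = gSL t • phiSL a b s • x₀}),
        ¬ (∃ p q : ℚ, a = (p : ℝ) ∧ b = (q : ℝ)) ] := by
  have : SMulInvariantMeasure G X μX := ⟨fun g s hs => by
    rw [← Measure.map_apply (measurable_smulX g) hs, hinv g]⟩
  tfae_have 1 → 3 := fun ⟨t, ht, hlim⟩ hrat => not_tendsto_of_rational hrat s₁ s₂ ht hlim
  tfae_have 3 → 1 := fun hrat => exists_times_gtLambda hinv hrat h
  tfae_have 2 → 3 := fun hd hrat => by
    have : (ae (volume.restrict (Set.Icc s₁ s₂))).NeBot := ae_neBot.2 (by simpa using h)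
    obtain ⟨s, hs⟩ := hd.exists
    exact not_dense_of_rational hinv hrat s hs
  tfae_have 3 → 2 := fun hrat => ae_restrict_of_ae (ae_dense hinv hrat)
  tfae_finish
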